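/- Let D ⊊ ℂ be a domain and let ρ : D → [-∞,∞) be a subharmonic function that is bounded from below. Then the Hartogs domain G_{D,ρ} is an L²_h-domain of holomorphy if and only if limsup_{D ∋ z → z₀} ρ(z) = ∞ for every point z₀ ∈ S(D). -/

import Mathlib

open MeasureTheory Filter Metric Set

/-- `elog x` is `log x` with value `-∞` for `x ≤ 0`, as an extended real. -/
noncomputable def elog (x : ℝ) : EReal := if x ≤ 0 then ⊥ else ((Real.log x : ℝ) : EReal)

/-- The sub-mean value inequality over circles of closed discs contained in `Ω`, phrased via
continuous real-valued majorants of the (extended-real-valued) function on the circle. -/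
def SubmeanOn (u : ℂ → EReal) (Ω : Set ℂ) : Prop :=
  ∀ c : ℂ, ∀ r : ℝ, 0 < r → Metric.closedBall c r ⊆ Ω →
    ∀ φ : ℝ → ℝ, Continuous φ →
      (∀ θ : ℝ, u (c + r * Complex.exp (θ * Complex.I)) ≤ ((φ θ : ℝ) : EReal)) →
      u c ≤ (((2 * Real.pi)⁻¹ * ∫ θ in (0:ℝ)..(2 * Real.pi), φ θ : ℝ) : EReal)

/-- `u : Ω → [-∞, ∞)` is subharmonic on the open set `Ω ⊆ ℂ`: upper semicontinuous,
nowhere `+∞`, not identically `-∞` on any connected component, sub-mean value inequality. -/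
def SubharmonicOn (u : ℂ → EReal) (Ω : Set ℂ) : Prop :=
  IsOpen Ω ∧ UpperSemicontinuousOn u Ω ∧
  (∀ z ∈ Ω, u z ≠ ⊤) ∧
  (∀ z ∈ Ω, ∃ w ∈ connectedComponentIn Ω z, u w ≠ ⊥) ∧
  SubmeanOn u Ω

/-- A set `E ⊆ ℂ` is polar if some subharmonic function on an open set containing `E`
equals `-∞` on `E`. -/
def PolarSet (E : Set ℂ) : Prop :=
  ∃ Ω : Set ℂ, E ⊆ Ω ∧ ∃ u : ℂ → EReal, SubharmonicOn u Ω ∧ ∀ z ∈ E, u z = ⊥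

/-- The space of square-integrable holomorphic functions on `D`. -/
def L2h {E : Type*} [NormedAddCommGroup E] [NormedSpace ℂ E] [MeasureSpace E]
    (D : Set E) : Set (E → ℂ) :=
  {f | DifferentiableOn ℂ f D ∧ IntegrableOn (fun z => ‖f z‖ ^ 2) D volume}

/-- `D` is an `L²ₕ`-domain of holomorphy. -/
def IsL2hDomainOfHolomorphy {E : Type*} [NormedAddCommGroup E] [NormedSpace ℂ E]
    [MeasureSpace E] (D : Set E) : Prop :=
  ¬ ∃ D₀ D₁ : Set E, IsOpen D₀ ∧ IsConnected D₀ ∧ IsOpen D₁ ∧ IsConnected D₁ ∧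
      D₀ ⊆ D₁ ∩ D ∧ ¬ (D₁ ⊆ D) ∧
      ∀ f ∈ L2h D, ∃ g : E → ℂ, DifferentiableOn ℂ g D₁ ∧ Set.EqOn g f D₀

/-- The Hartogs domain `G_{D,ρ} = {(z₁,z₂) : z₁ ∈ D, |z₂| < e^{-ρ(z₁)}}`. -/
def hartogs (D : Set ℂ) (ρ : ℂ → EReal) : Set (ℂ × ℂ) :=
  {p | p.1 ∈ D ∧ elog ‖p.2‖ < - ρ p.1}

/-- `S(D)`: boundary points near which the complement of `D` is polar. -/
def polarS (D : Set ℂ) : Set ℂ :=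
  {z ∈ frontier D | ∃ U : Set ℂ, IsOpen U ∧ z ∈ U ∧ PolarSet (U \ D)}

/-- `fj` is the family of coefficients of a Hartogs expansion of `f` on `G_{D,ρ}`. -/
def HartogsExpansion (D : Set ℂ) (ρ : ℂ → EReal) (f : ℂ × ℂ → ℂ) (fj : ℕ → ℂ → ℂ) : Prop :=
  (∀ j, DifferentiableOn ℂ (fj j) D) ∧
  ∀ p ∈ hartogs D ρ, HasSum (fun j => fj j p.1 * p.2 ^ j) (f p)

/-- `ρ_f(z) = limsup_j (1/j) log |f_j(z)|` for coefficients `fj`. -/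
noncomputable def coeffGrowth (fj : ℕ → ℂ → ℂ) (z : ℂ) : EReal :=
  Filter.limsup (fun (j : ℕ) => ((((j : ℝ)⁻¹ : ℝ)) : EReal) * elog ‖fj j z‖) Filter.atTop

/-- The upper semicontinuous regularization `g*`. -/
noncomputable def uscReg (g : ℂ → EReal) (z : ℂ) : EReal := Filter.limsup g (nhds z)

/-- `ρ̃ = sup_{f ∈ L²ₕ(G_{D,ρ})} (ρ_f)*`. -/
noncomputable def rhoTilde (D : Set ℂ) (ρ : ℂ → EReal) (z : ℂ) : EReal :=
  ⨆ fj ∈ {fj : ℕ → ℂ → ℂ | ∃ f ∈ L2h (hartogs D ρ), HartogsExpansion D ρ f fj},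
    uscReg (coeffGrowth fj) z

/-- `D̂ = D ∪ {z ∈ S(D) : limsup_{D ∋ w → z} ρ(w) < ∞}`. -/
def DHat (D : Set ℂ) (ρ : ℂ → EReal) : Set ℂ :=
  D ∪ {z ∈ polarS D | Filter.limsup ρ (nhdsWithin z D) < ⊤}

open Classical in
/-- `ρ̂`, extending `ρ` to `D̂` by boundary limsups. -/
noncomputable def rhoHat (D : Set ℂ) (ρ : ℂ → EReal) (z : ℂ) : EReal :=
  if z ∈ D then ρ z else Filter.limsup ρ (nhdsWithin z D)

/-- `u` is plurisubharmonic on an open `Ω ⊆ ℂⁿ`. -/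
def PlurisubharmonicOn {n : ℕ} (u : (Fin n → ℂ) → EReal) (Ω : Set (Fin n → ℂ)) : Prop :=
  IsOpen Ω ∧ UpperSemicontinuousOn u Ω ∧
  (∀ z ∈ Ω, u z ≠ ⊤) ∧
  (∀ z ∈ Ω, ∃ w ∈ connectedComponentIn Ω z, u w ≠ ⊥) ∧
  ∀ a b : Fin n → ℂ, SubmeanOn (fun lam => u (a + lam • b)) {lam : ℂ | a + lam • b ∈ Ω}

/-- A set `E ⊆ ℂⁿ` is pluripolar. -/
def PluripolarSet {n : ℕ} (E : Set (Fin n → ℂ)) : Prop :=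
  ∃ Ω : Set (Fin n → ℂ), E ⊆ Ω ∧
    ∃ u : (Fin n → ℂ) → EReal, PlurisubharmonicOn u Ω ∧ ∀ z ∈ E, u z = ⊥

/-- `D ⊆ ℂⁿ` is pseudoconvex: it admits a plurisubharmonic exhaustion function. -/
def IsPseudoconvex {n : ℕ} (D : Set (Fin n → ℂ)) : Prop :=
  ∃ u : (Fin n → ℂ) → EReal, PlurisubharmonicOn u D ∧
    ∀ c : ℝ, IsCompact {z | z ∈ D ∧ u z ≤ (c : EReal)}

/-- `L²ₕ(D)` is infinite dimensional: arbitrarily many elements that are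
linearly independent as functions on `D`. -/
def L2hInfiniteDim {E : Type*} [NormedAddCommGroup E] [NormedSpace ℂ E] [MeasureSpace E]
    (D : Set E) : Prop :=
  ∀ N : ℕ, ∃ fs : Fin N → E → ℂ, (∀ i, fs i ∈ L2h D) ∧
    ∀ c : Fin N → ℂ, (∀ z ∈ D, ∑ i, c i * fs i z = 0) → c = 0

/-- Real-valued subharmonic functions that are bounded on compact sets. -/
structure RSub (φ : ℂ → ℝ) (D : Set ℂ) : Prop where
  usc : UpperSemicontinuousOn φ D
  bdd : ∀ K ⊆ D, IsCompact K → ∃ B, ∀ z ∈ K, |φ z| ≤ B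
  submean : ∀ c R, 0 < R → closedBall c R ⊆ D → φ c ≤ Real.circleAverage φ c R

theorem circleIntegrable_of_usc {f : ℂ → ℝ} {c : ℂ} {R B : ℝ} (hR : 0 ≤ R)
    (hf : UpperSemicontinuousOn f (sphere c R)) (hB : ∀ z ∈ sphere c R, |f z| ≤ B) :
    CircleIntegrable f c R := by
  have hm : ∀ θ, circleMap c R θ ∈ sphere c R := fun θ => circleMap_mem_sphere c hR θ
  have h1 : UpperSemicontinuous (fun θ => f (circleMap c R θ)) := by
    rw [← upperSemicontinuousOn_univ_iff]
    exact hf.comp (g := circleMap c R) (continuous_circleMap c R).continuousOn (fun θ _ => hm θ)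
  have h2 : Measurable (fun θ => f (circleMap c R θ)) := h1.measurable
  rw [circleIntegrable_def, intervalIntegrable_iff]
  refine Measure.integrableOn_of_bounded (M := B) (by simp [ENNReal.mul_eq_top]) h2.aestronglyMeasurable ?_
  filter_upwards with θ using hB _ (hm θ)

theorem RSub.circleIntegrable {φ : ℂ → ℝ} {D : Set ℂ} (h : RSub φ D) {c : ℂ} {R : ℝ}
    (hR : 0 ≤ R) (hs : sphere c R ⊆ D) : CircleIntegrable φ c R := by
  obtain ⟨B, hB⟩ := h.bdd _ hs (isCompact_sphere c R)
  exact circleIntegrable_of_usc hR (h.usc.mono hs) hB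

theorem RSub.add {φ ψ : ℂ → ℝ} {D : Set ℂ} (h : RSub φ D) (h' : RSub ψ D) :
    RSub (fun z => φ z + ψ z) D := by
  refine ⟨h.usc.add h'.usc, fun K hK hc => ?_, fun c R hR hs => ?_⟩
  · obtain ⟨B, hB⟩ := h.bdd K hK hc
    obtain ⟨B', hB'⟩ := h'.bdd K hK hc
    exact ⟨B + B', fun z hz => (abs_add_le _ _).trans (add_le_add (hB z hz) (hB' z hz))⟩
  · have hs' := sphere_subset_closedBall.trans hs
    have := Real.circleAverage_fun_add (h.circleIntegrable hR.le hs') (h'.circleIntegrable hR.le hs')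
    rw [this]
    exact add_le_add (h.submean c R hR hs) (h'.submean c R hR hs)

theorem RSub.const_mul {φ : ℂ → ℝ} {D : Set ℂ} (h : RSub φ D) {k : ℝ} (hk : 0 ≤ k) :
    RSub (fun z => k * φ z) D := by
  refine ⟨?_, fun K hK hc => ?_, fun c R hR hs => ?_⟩
  · exact (continuous_const_mul k).comp_upperSemicontinuousOn h.usc
      (fun a b hab => mul_le_mul_of_nonneg_left hab hk)
  · obtain ⟨B, hB⟩ := h.bdd K hK hc
    exact ⟨k * B, fun z hz => by
      rw [abs_mul, abs_of_nonneg hk]; exact mul_le_mul_of_nonneg_left (hB z hz) hk⟩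
  · have := Real.circleAverage_fun_smul (f := φ) (c := c) (R := R) (a := k)
    simp only [smul_eq_mul] at this
    rw [this]
    exact mul_le_mul_of_nonneg_left (h.submean c R hR hs) hk

theorem RSub.add_const {φ : ℂ → ℝ} {D : Set ℂ} (h : RSub φ D) (k : ℝ) :
    RSub (fun z => φ z + k) D := by
  refine h.add ⟨continuousOn_const.upperSemicontinuousOn, fun K _ _ => ⟨|k|, fun _ _ => le_rfl⟩,
    fun c R _ _ => (Real.circleAverage_const k c R).ge⟩

/-- Continuous majorants decreasing to an upper semicontinuous function. -/
theorem exists_continuous_approx {X : Type*} [PseudoMetricSpace X] {S : Set X} {f : X → ℝ} {B : ℝ}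
    (hf : UpperSemicontinuousOn f S) (hB : ∀ x ∈ S, |f x| ≤ B) :
    ∃ φ : ℕ → X → ℝ, (∀ n, Continuous (φ n)) ∧ (∀ n, ∀ x ∈ S, f x ≤ φ n x ∧ φ n x ≤ B) ∧
      ∀ x ∈ S, Tendsto (fun n => φ n x) atTop (nhds (f x)) := by
  rcases S.eq_empty_or_nonempty with rfl | hne
  · exact ⟨fun _ _ => 0, fun _ => continuous_const, by simp, by simp⟩
  have : Nonempty S := hne.to_subtype
  have bd : ∀ (n : ℕ) (x : X), BddAbove (range fun y : S => f y - n * dist x y) := by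
    refine fun n x => ⟨B, ?_⟩
    rintro _ ⟨y, rfl⟩
    have h1 := (abs_le.1 (hB y y.2)).2
    have h2 : 0 ≤ (n : ℝ) * dist x y := by positivity
    simp only; linarith
  have upper : ∀ (n : ℕ) (x : X), (⨆ y : S, (f y - n * dist x y)) ≤ B := by
    refine fun n x => ciSup_le fun y => ?_
    have h1 := (abs_le.1 (hB y y.2)).2
    have h2 : 0 ≤ (n : ℝ) * dist x y := by positivity
    linarith
  have lower : ∀ (n : ℕ), ∀ x ∈ S, f x ≤ ⨆ y : S, (f y - n * dist x y) := by
    intro n x hx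
    have := le_ciSup (bd n x) ⟨x, hx⟩
    simpa using this
  refine ⟨fun n x => ⨆ y : S, (f y - n * dist x y), fun n => ?_, fun n x hx => ⟨lower n x hx, upper n x⟩,
    fun x hx => ?_⟩
  · refine (LipschitzWith.of_le_add_mul (n : NNReal) fun x x' => ?_).continuous
    refine ciSup_le fun y => ?_
    have h1 := le_ciSup (bd n x') y
    have h2 : (n : ℝ) * dist x' y ≤ n * (dist x x' + dist x y) := by
      refine mul_le_mul_of_nonneg_left ?_ (by positivity)
      have := dist_triangle x' x y
      rwa [dist_comm x' x] at this
    simp only [NNReal.coe_natCast]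
    linarith
  · rw [tendsto_order]
    refine ⟨fun a ha => Eventually.of_forall fun n => ha.trans_le (lower n x hx), fun a ha => ?_⟩
    obtain ⟨b, hb1, hb2⟩ := exists_between ha
    have h1 := hf x hx b hb1
    obtain ⟨δ, hδ, h1⟩ := Metric.mem_nhdsWithin_iff.1 h1
    obtain ⟨N, hN⟩ := exists_nat_gt (2 * B / δ)
    filter_upwards [eventually_ge_atTop N] with n hn
    refine lt_of_le_of_lt (ciSup_le fun y => ?_) hb2
    by_cases hy : dist (y : X) x < δ
    · have := h1 ⟨mem_ball.2 hy, y.2⟩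
      simp only [mem_ofPred_eq] at this
      have h2 : 0 ≤ (n : ℝ) * dist x y := by positivity
      linarith
    · push Not at hy
      rw [dist_comm] at hy
      have h3 : 2 * B < n * δ := by
        rw [div_lt_iff₀ hδ] at hN
        have : (N : ℝ) ≤ n := by exact_mod_cast hn
        nlinarith
      have h4 : (n : ℝ) * δ ≤ n * dist x y := mul_le_mul_of_nonneg_left hy (by positivity)
      have h5 := (abs_le.1 (hB y y.2)).2
      have h6 := (abs_le.1 (hB x hx)).1
      linarith

theorem le_circleAverage_of_majorants {f : ℂ → ℝ} {c : ℂ} {R B a : ℝ} (hR : 0 ≤ R)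
    (hf : UpperSemicontinuousOn f (sphere c R)) (hB : ∀ z ∈ sphere c R, |f z| ≤ B)
    (h : ∀ φ : ℂ → ℝ, Continuous φ → (∀ z ∈ sphere c R, f z ≤ φ z) → a ≤ Real.circleAverage φ c R) :
    a ≤ Real.circleAverage f c R := by
  obtain ⟨φ, hc, hle, ht⟩ := exists_continuous_approx hf hB
  have hm : ∀ θ, circleMap c R θ ∈ sphere c R := fun θ => circleMap_mem_sphere c hR θ
  refine le_of_tendsto_of_tendsto' tendsto_const_nhds (b := atTop)
    (g := fun n => Real.circleAverage (φ n) c R) ?_ fun n => h _ (hc n) fun z hz => (hle n z hz).1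
  simp only [Real.circleAverage_def]
  refine Tendsto.const_smul ?_ _
  refine intervalIntegral.tendsto_integral_filter_of_dominated_convergence (fun _ => B) ?_ ?_ ?_ ?_
  · exact Eventually.of_forall fun n =>
      ((hc n).comp (continuous_circleMap c R)).aestronglyMeasurable
  · refine Eventually.of_forall fun n => Eventually.of_forall fun θ _ => ?_
    have h1 := hle n _ (hm θ)
    have h2 := abs_le.1 (hB _ (hm θ))
    rw [Real.norm_eq_abs, abs_le]
    constructor <;> linarith
  · simp
  · exact Eventually.of_forall fun θ _ => ht _ (hm θ)

theorem circleAverage_re {h : ℂ → ℂ} (hh : Differentiable ℂ h) (c : ℂ) (R : ℝ) :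
    Real.circleAverage (fun z => (h z).re) c R = (h c).re :=
  InnerProductSpace.HarmonicOnNhd.circleAverage_eq (f := fun z => (h z).re)
    fun z _ => AnalyticAt.harmonicAt_re (hh.analyticAt z)

theorem exists_re_fourier (g : C(AddCircle (2 * Real.pi), ℂ))
    (hg : g ∈ Submodule.span ℂ (range (@fourier (2 * Real.pi)))) :
    ∃ p q : Polynomial ℂ, ∀ θ : ℝ, g θ = p.eval (Complex.exp (θ * Complex.I)) +
      (starRingEnd ℂ) (q.eval (Complex.exp (θ * Complex.I))) := by
  induction hg using Submodule.span_induction with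
  | mem x hx =>
    obtain ⟨n, rfl⟩ := hx
    have key : ∀ θ : ℝ, fourier n (θ : AddCircle (2 * Real.pi)) =
        (Complex.exp (θ * Complex.I)) ^ n := by
      intro θ
      rw [fourier_coe_apply, ← Complex.exp_int_mul]
      congr 1
      have : (Real.pi : ℂ) ≠ 0 := by exact_mod_cast Real.pi_ne_zero
      push_cast
      field_simp
    rcases n.eq_nat_or_neg with ⟨k, rfl | rfl⟩
    · exact ⟨Polynomial.X ^ k, 0, fun θ => by rw [key]; simp⟩
    · refine ⟨0, Polynomial.X ^ k, fun θ => ?_⟩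
      rw [key]
      have : (starRingEnd ℂ) (Complex.exp (θ * Complex.I)) = (Complex.exp (θ * Complex.I))⁻¹ := by
        rw [← Complex.exp_conj, ← Complex.exp_neg]
        simp
      simp [this]
  | zero => exact ⟨0, 0, by simp⟩
  | add x y _ _ hx hy =>
    obtain ⟨p, q, h⟩ := hx
    obtain ⟨p', q', h'⟩ := hy
    refine ⟨p + p', q + q', fun θ => ?_⟩
    simp only [ContinuousMap.add_apply, h, h', Polynomial.eval_add, map_add]
    ring
  | smul a x _ hx =>
    obtain ⟨p, q, h⟩ := hx
    refine ⟨Polynomial.C a * p, Polynomial.C ((starRingEnd ℂ) a) * q, fun θ => ?_⟩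
    simp only [ContinuousMap.smul_apply, h, smul_eq_mul, Polynomial.eval_mul, Polynomial.eval_C,
      map_mul, Complex.conj_conj]
    ring

/-- Continuous functions on a circle are uniform limits of real parts of entire functions. -/
theorem exists_entire_re_approx {φ : ℂ → ℝ} (hφ : Continuous φ) (c : ℂ) {R ε : ℝ} (hR : 0 < R)
    (hε : 0 < ε) :
    ∃ h : ℂ → ℂ, Differentiable ℂ h ∧ ∀ z ∈ sphere c R, |φ z - (h z).re| < ε := by
  have : Fact (0 < 2 * Real.pi) := ⟨Real.two_pi_pos⟩
  have per : Function.Periodic (fun θ : ℝ => (φ (circleMap c R θ) : ℂ)) (2 * Real.pi) := fun θ => by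
    simp only [periodic_circleMap c R θ]
  have hF : Continuous (per.lift : AddCircle (2 * Real.pi) → ℂ) := by
    refine continuous_quot_lift _ ?_
    exact Complex.continuous_ofReal.comp (hφ.comp (continuous_circleMap c R))
  set F : C(AddCircle (2 * Real.pi), ℂ) := ⟨per.lift, hF⟩ with hFdef
  have hmem : F ∈ (Submodule.span ℂ (range (@fourier (2 * Real.pi)))).topologicalClosure := by
    rw [span_fourier_closure_eq_top]; trivial
  obtain ⟨g, hg, hd⟩ := Metric.mem_closure_iff.1 hmem ε hε
  obtain ⟨p, q, hpq⟩ := exists_re_fourier g hg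
  refine ⟨fun z => (p + q).eval ((z - c) / R), ?_, fun z hz => ?_⟩
  · exact (p + q).differentiable.comp ((differentiable_id.sub_const c).div_const _)
  · have hR' : (R : ℂ) ≠ 0 := by exact_mod_cast hR.ne'
    obtain ⟨θ, rfl⟩ : ∃ θ, circleMap c R θ = z := by
      have : z ∈ range (circleMap c R) := by rw [range_circleMap, abs_of_pos hR]; exact hz
      exact this
    have h1 : dist (F θ) (g θ) < ε := (ContinuousMap.dist_apply_le_dist _).trans_lt hd
    have h2 : F θ = (φ (circleMap c R θ) : ℂ) := rfl
    have h3 : (circleMap c R θ - c) / R = Complex.exp (θ * Complex.I) := by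
      simp [circleMap, hR']
    beta_reduce
    rw [h3]
    rw [h2, hpq, dist_eq_norm] at h1
    refine lt_of_le_of_lt ?_ h1
    refine le_trans (le_of_eq ?_) (Complex.abs_re_le_norm _)
    simp

theorem le_circleAverage_of_local {f : ℂ → ℝ} {c : ℂ} {R B : ℝ} (hR : 0 < R)
    (hf : UpperSemicontinuousOn f (closedBall c R)) (hB : ∀ z ∈ closedBall c R, |f z| ≤ B)
    (hloc : ∀ m ∈ ball c R, ∃ r₀ > 0, ∀ r, 0 < r → r < r₀ → f m ≤ Real.circleAverage f m r) :
    f c ≤ Real.circleAverage f c R := by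
  refine le_circleAverage_of_majorants hR.le (hf.mono sphere_subset_closedBall)
    (fun z hz => hB z (sphere_subset_closedBall hz)) fun φ hφ hle => ?_
  refine le_of_forall_pos_le_add fun ε hε => ?_
  obtain ⟨h, hd, hh⟩ := exists_entire_re_approx hφ c hR (half_pos hε)
  have havg : (h c).re ≤ Real.circleAverage φ c R + ε / 2 := by
    rw [← circleAverage_re hd c R]
    have e : Real.circleAverage (fun z => φ z + ε / 2) c R = Real.circleAverage φ c R + ε / 2 := by
      rw [Real.circleAverage_fun_add (hφ.continuousOn.circleIntegrable hR.le)
        (circleIntegrable_const _ _ _), Real.circleAverage_const]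
    rw [← e]
    refine Real.circleAverage_mono ?_ ?_ fun z hz => ?_
    · exact ((Complex.continuous_re.comp hd.continuous).continuousOn).circleIntegrable hR.le
    · exact ((hφ.add continuous_const).continuousOn).circleIntegrable hR.le
    · rw [abs_of_pos hR] at hz
      have := (abs_lt.1 (hh z hz)).1
      linarith
  suffices f c ≤ (h c).re + ε / 2 by linarith
  by_contra! hcon
  obtain ⟨η, hη, hηR⟩ : ∃ η > 0, η * R ^ 2 < f c - ((h c).re + ε / 2) := by
    refine ⟨(f c - ((h c).re + ε / 2)) / (2 * R ^ 2), div_pos (by linarith) (by positivity), ?_⟩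
    field_simp
    linarith
  have hcont : Continuous fun z : ℂ => -(h z).re + η * ‖z - c‖ ^ 2 := by
    have := hd.continuous
    fun_prop
  obtain ⟨m, hm, hmax⟩ := UpperSemicontinuousOn.exists_isMaxOn (nonempty_closedBall.2 hR.le)
    (isCompact_closedBall c R) (hf.add hcont.continuousOn.upperSemicontinuousOn)
  rw [isMaxOn_iff] at hmax
  have h0 := hmax c (mem_closedBall_self hR.le)
  simp only [sub_self, norm_zero] at h0
  rcases eq_or_lt_of_le (mem_closedBall.1 hm) with hms | hmb
  · have h1 := hle m (mem_sphere.2 hms)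
    have h2 := (abs_lt.1 (hh m (mem_sphere.2 hms))).2
    rw [dist_eq_norm] at hms
    rw [hms] at h0
    linarith
  · obtain ⟨r₀, hr₀, hr⟩ := hloc m (mem_ball.2 hmb)
    obtain ⟨r, hr1, hr2⟩ := exists_between (lt_min hr₀ (sub_pos.2 hmb))
    have hrsub : closedBall m r ⊆ closedBall c R := by
      refine closedBall_subset_closedBall' ?_
      have := hr2.trans_le (min_le_right _ _)
      linarith
    have h1 := hr r hr1 (hr2.trans_le (min_le_left _ _))
    set q : ℂ → ℂ := fun z => ((f m - (h m).re + η * ‖m - c‖ ^ 2 : ℝ) : ℂ) + h z -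
      η * (‖m - c‖ ^ 2 + r ^ 2 + 2 * ((z - m) * (starRingEnd ℂ) (m - c))) with hq
    have hqd : Differentiable ℂ q := by
      rw [hq]; fun_prop
    have h2 : Real.circleAverage f m r ≤ Real.circleAverage (fun z => (q z).re) m r := by
      refine Real.circleAverage_mono ?_ ?_ fun z hz => ?_
      · exact circleIntegrable_of_usc hr1.le (hf.mono (sphere_subset_closedBall.trans hrsub))
          (fun z hz => hB z (hrsub (sphere_subset_closedBall hz)))
      · exact ((Complex.continuous_re.comp hqd.continuous).continuousOn).circleIntegrable hr1.le
      · rw [abs_of_pos hr1] at hz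
        have h3 := hmax z (hrsub (sphere_subset_closedBall hz))
        have h4 : ‖z - c‖ ^ 2 = ‖m - c‖ ^ 2 + r ^ 2 +
            2 * ((z - m) * (starRingEnd ℂ) (m - c)).re := by
          have h5 : ‖z - m‖ = r := by rw [← dist_eq_norm]; exact hz
          rw [← h5, Complex.sq_norm, Complex.sq_norm, Complex.sq_norm]
          simp [Complex.normSq_apply]
          ring
        rw [h4] at h3
        have h6 : (q z).re = (f m - (h m).re + η * ‖m - c‖ ^ 2) + (h z).re -
          η * (‖m - c‖ ^ 2 + r ^ 2 + 2 * ((z - m) * (starRingEnd ℂ) (m - c)).re) := by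
          simp only [hq, Complex.sub_re, Complex.add_re, Complex.ofReal_re, Complex.re_ofReal_mul]
          norm_cast
          simp
        rw [h6]
        linarith
    rw [circleAverage_re hqd] at h2
    have h7 : (q m).re = f m - η * r ^ 2 := by
      simp only [hq, Complex.sub_re, Complex.add_re, Complex.ofReal_re, Complex.re_ofReal_mul,
        sub_self, zero_mul, mul_zero]
      norm_cast
      ring
    have : 0 < η * r ^ 2 := by positivity
    linarith

theorem RSub.of_local {f : ℂ → ℝ} {D : Set ℂ} (hf : UpperSemicontinuousOn f D)
    (hb : ∀ K ⊆ D, IsCompact K → ∃ B, ∀ z ∈ K, |f z| ≤ B)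
    (hloc : ∀ m ∈ D, ∃ r₀ > 0, ∀ r, 0 < r → r < r₀ → f m ≤ Real.circleAverage f m r) :
    RSub f D := by
  refine ⟨hf, hb, fun c R hR hs => ?_⟩
  obtain ⟨B, hB⟩ := hb _ hs (isCompact_closedBall c R)
  exact le_circleAverage_of_local hR (hf.mono hs) hB
    fun m hm => hloc m (hs (ball_subset_closedBall hm))

theorem coe_toReal_of_subharmonicOn {ρ : ℂ → EReal} {D : Set ℂ} (hρ : SubharmonicOn ρ D) {M : ℝ}
    (hM : ∀ z ∈ D, (M : EReal) ≤ ρ z) {z : ℂ} (hz : z ∈ D) : ((ρ z).toReal : EReal) = ρ z :=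
  EReal.coe_toReal (hρ.2.2.1 z hz) (fun h => by have := hM z hz; rw [h] at this; simp at this)

theorem RSub.of_subharmonicOn {ρ : ℂ → EReal} {D : Set ℂ} (hρ : SubharmonicOn ρ D) {M : ℝ}
    (hM : ∀ z ∈ D, (M : EReal) ≤ ρ z) : RSub (fun z => (ρ z).toReal) D := by
  have hcoe := fun z hz => coe_toReal_of_subharmonicOn hρ hM (z := z) hz
  have usc : UpperSemicontinuousOn (fun z => (ρ z).toReal) D := by
    intro x hx b hb
    have h1 : ρ x < (b : EReal) := by rw [← hcoe x hx]; exact_mod_cast hb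
    filter_upwards [hρ.2.1 x hx b h1, self_mem_nhdsWithin] with z hz hzD
    rw [← hcoe z hzD] at hz
    exact_mod_cast hz
  have low : ∀ z ∈ D, M ≤ (ρ z).toReal := fun z hz => by
    have := hM z hz
    rw [← hcoe z hz] at this
    exact_mod_cast this
  have bdd : ∀ K ⊆ D, IsCompact K → ∃ B, ∀ z ∈ K, |(ρ z).toReal| ≤ B := by
    intro K hK hc
    obtain ⟨B, hB⟩ := UpperSemicontinuousOn.bddAbove_of_isCompact hc (usc.mono hK)
    refine ⟨|M| + |B|, fun z hz => abs_le.2 ⟨?_, ?_⟩⟩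
    · have := low z (hK hz)
      have := neg_abs_le M
      have := abs_nonneg B
      linarith
    · have := hB ⟨z, hz, rfl⟩
      have := le_abs_self B
      have := abs_nonneg M
      simp only at *
      linarith
  refine ⟨usc, bdd, fun c R hR hs => ?_⟩
  obtain ⟨B, hB⟩ := bdd _ hs (isCompact_closedBall c R)
  have hs' := (sphere_subset_closedBall (x := c) (ε := R)).trans hs
  refine le_circleAverage_of_majorants hR.le (usc.mono hs')
    (fun z hz => hB z (sphere_subset_closedBall hz)) fun φ hφ hle => ?_
  have h := hρ.2.2.2.2 c R hR hs (fun θ => φ (circleMap c R θ))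
    (hφ.comp (continuous_circleMap c R)) fun θ => by
      have hm := circleMap_mem_sphere c hR.le θ
      have h1 := hle _ hm
      have h2 := hcoe _ (hs' hm)
      rw [circleMap] at *
      rw [← h2]
      exact_mod_cast h1
  rw [← hcoe c (hs (mem_closedBall_self hR.le))] at h
  rw [Real.circleAverage_def, smul_eq_mul]
  exact_mod_cast h

theorem integrable_prod_rotate {E : Type*} [NormedAddCommGroup E] [NormedSpace ℝ E] {G : ℂ → E}
    (hG : Integrable G) :
    Integrable (fun p : ℝ × ℂ => G (Complex.exp (p.1 * Complex.I) * p.2))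
      ((volume.restrict (Ioc 0 (2 * Real.pi))).prod volume) := by
  have h1 : Integrable (fun p : ℝ × ℂ => G p.2)
      ((volume.restrict (Ioc 0 (2 * Real.pi))).prod volume) := hG.comp_snd _
  have h2 : MeasurePreserving (fun p : ℝ × ℂ => (p.1, Complex.exp (p.1 * Complex.I) * p.2))
      ((volume.restrict (Ioc 0 (2 * Real.pi))).prod volume)
      ((volume.restrict (Ioc 0 (2 * Real.pi))).prod volume) := by
    refine (MeasurePreserving.id (volume.restrict (Ioc 0 (2 * Real.pi)))).skew_product
      (g := fun (θ : ℝ) (z : ℂ) => Complex.exp (θ * Complex.I) * z)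
      ?_ (Eventually.of_forall fun θ => ?_)
    · exact Continuous.measurable (by fun_prop)
    · have := (rotation (Circle.exp θ)).measurePreserving
      have e : ⇑(rotation (Circle.exp θ)) = fun z => Complex.exp (θ * Complex.I) * z := by
        ext z; simp [rotation_apply]
      rw [← e]
      exact this.map_eq
  exact h2.integrable_comp_of_integrable h1

theorem circleAverage_zero_norm {E : Type*} [NormedAddCommGroup E] [NormedSpace ℝ E] (G : ℂ → E)
    (s : ℂ) : Real.circleAverage G 0 ‖s‖ =
      (2 * Real.pi)⁻¹ • ∫ θ in Ioc 0 (2 * Real.pi), G (Complex.exp (θ * Complex.I) * s) := by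
  rw [Real.circleAverage_eq_integral_add s.arg,
    intervalIntegral.integral_of_le Real.two_pi_pos.le]
  congr 2
  ext θ
  congr 1
  rw [circleMap, zero_add]
  conv_rhs => rw [← Complex.norm_mul_exp_arg_mul_I s]
  push_cast
  rw [add_mul, Complex.exp_add]
  ring

/-- Integration in polar coordinates through circle averages. -/
theorem integral_eq_integral_circleAverage {E : Type*} [NormedAddCommGroup E] [NormedSpace ℝ E]
    [CompleteSpace E] {G : ℂ → E} (hG : Integrable G) :
    ∫ s, G s = ∫ s : ℂ, Real.circleAverage G 0 ‖s‖ := by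
  have h := integrable_prod_rotate hG
  simp_rw [circleAverage_zero_norm]
  rw [integral_smul, ← integral_integral_swap (f := fun θ s => G (Complex.exp ((θ:ℝ) * Complex.I) * s)) h]
  have : ∀ θ : ℝ, ∫ s, G (Complex.exp (θ * Complex.I) * s) = ∫ s, G s := fun θ => by
    have := (rotation (Circle.exp θ)).measurePreserving.integral_comp
      (rotation (Circle.exp θ)).toHomeomorph.measurableEmbedding G
    simpa [rotation_apply, Circle.coe_exp] using this
  simp_rw [this]
  simp [smul_smul]
  rw [max_eq_left Real.two_pi_pos.le, ← mul_inv_rev, inv_mul_cancel₀ Real.two_pi_pos.ne', one_smul]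

theorem integrable_circleAverage {E : Type*} [NormedAddCommGroup E] [NormedSpace ℝ E]
    [CompleteSpace E] {G : ℂ → E} (hG : Integrable G) :
    Integrable fun s : ℂ => Real.circleAverage G 0 ‖s‖ := by
  rw [show (fun s : ℂ => Real.circleAverage G 0 ‖s‖) = _ from funext (circleAverage_zero_norm G)]
  exact (integrable_prod_rotate hG).integral_prod_right.smul _

theorem integral_radial_smul {E : Type*} [NormedAddCommGroup E] [NormedSpace ℝ E]
    [CompleteSpace E] {k : ℂ → ℝ} {F : ℂ → E} (hk : ∀ s t, ‖s‖ = ‖t‖ → k s = k t)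
    (hG : Integrable fun s => k s • F s) :
    Integrable (fun s => k s • Real.circleAverage F 0 ‖s‖) ∧
    ∫ s, k s • F s = ∫ s, k s • Real.circleAverage F 0 ‖s‖ := by
  have : ∀ s, Real.circleAverage (fun s => k s • F s) 0 ‖s‖ =
      k s • Real.circleAverage F 0 ‖s‖ := by
    intro s
    rw [← Real.circleAverage_fun_smul]
    refine Real.circleAverage_congr_sphere fun t ht => ?_
    simp only [abs_norm, mem_sphere_zero_iff_norm] at ht
    simp only [hk _ _ ht]
  simp_rw [← this]
  exact ⟨integrable_circleAverage hG, integral_eq_integral_circleAverage hG⟩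

/-- A twice differentiable function with the sub-mean value property has nonnegative Laplacian. -/
theorem laplacian_nonneg_of_submean {f : ℂ → ℝ} {z : ℂ} {R : ℝ} (hR : 0 < R) (hf : ContDiff ℝ 2 f)
    (h : ∀ r, 0 < r → r < R → f z ≤ Real.circleAverage f z r) :
    0 ≤ fderiv ℝ (fderiv ℝ f) z 1 1 + fderiv ℝ (fderiv ℝ f) z Complex.I Complex.I := by
  have hd : Differentiable ℝ f := hf.differentiable (by norm_num)
  have hd1 : ContDiff ℝ 1 (fderiv ℝ f) := hf.fderiv_right (by norm_num)
  have hd2 : Differentiable ℝ (fderiv ℝ f) := hd1.differentiable (by norm_num)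
  set L := fderiv ℝ f z with hL
  set Q := fderiv ℝ (fderiv ℝ f) z with hQ
  have hsymm : ∀ v w, Q v w = Q w v := fun v w =>
    second_derivative_symmetric (fun y => (hd y).hasFDerivAt) (hd2 z).hasFDerivAt v w
  refine le_of_forall_pos_le_add fun ε hε => ?_
  have ht : ∃ δ > 0, ∀ v, ‖v‖ < δ → f (z + v) ≤ f z + L v + Q v v / 2 + ε / 4 * ‖v‖ ^ 2 := by
    have h1 := (hasFDerivAt_iff_isLittleO_nhds_zero.1 (hd2 z).hasFDerivAt).def
      (show 0 < ε / 4 by positivity)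
    obtain ⟨δ, hδ, h2⟩ := Metric.eventually_nhds_iff_ball.1 h1
    refine ⟨δ, hδ, fun v hv => ?_⟩
    have h3 : ∀ u, HasFDerivAt (fun v => f (z + v) - L v - Q v v / 2) (fderiv ℝ f (z + u) - L - Q u) u := by
      intro u
      have a1 : HasFDerivAt (fun v => f (z + v)) (fderiv ℝ f (z + u)) u := by
        exact (hd (z + u)).hasFDerivAt.comp u ((hasFDerivAt_id u).const_add z)
      have a2 : HasFDerivAt (fun v => Q v v) ((Q u).comp (ContinuousLinearMap.id ℝ ℂ) + Q.flip u) u := by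
        have := Q.hasFDerivAt (x := u) |>.clm_apply (hasFDerivAt_id u)
        simpa using this
      have := (a1.sub L.hasFDerivAt).sub (a2.mul_const (1/2 : ℝ))
      refine HasFDerivAt.congr_fderiv (this.congr_of_eventuallyEq ?_) ?_
      · exact Eventually.of_forall fun y => by simp; ring
      · refine ContinuousLinearMap.ext fun w => ?_
        simp [hsymm w u]
        ring
    have h4 := (convex_closedBall (0:ℂ) ‖v‖).norm_image_sub_le_of_norm_hasFDerivWithin_le
      (f := fun v => f (z + v) - L v - Q v v / 2) (C := ε / 4 * ‖v‖)
      (fun u _ => (h3 u).hasFDerivWithinAt) (fun u hu => ?_) (x := 0) (y := v) ?_ ?_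
    · simp only [add_zero, map_zero, zero_div, sub_zero] at h4
      have := (le_abs_self _).trans h4
      nlinarith
    · have hu' : ‖u‖ ≤ ‖v‖ := by
        simpa using hu
      have := h2 u (by simpa using hu'.trans_lt hv)
      exact this.trans (mul_le_mul_of_nonneg_left hu' (by positivity))
    · simp
    · simp
  obtain ⟨δ, hδ, ht⟩ := ht
  obtain ⟨r, hr0, hr⟩ := exists_between (lt_min hδ hR)
  have hrδ := hr.trans_le (min_le_left _ _)
  have hrR := hr.trans_le (min_le_right _ _)
  set A := Q 1 1
  set C := Q Complex.I Complex.I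
  set B := Q 1 Complex.I with hB
  have hLv : ∀ v : ℂ, L v = ((L 1 - L Complex.I * Complex.I) * v).re := by
    intro v
    have : v = v.re • (1:ℂ) + v.im • Complex.I := by simp
    conv_lhs => rw [this, map_add, map_smul, map_smul]
    simp; ring
  have hQv : ∀ v : ℂ, Q v v = (A + C) / 2 * ‖v‖ ^ 2 +
      (((A - C) / 2 - B * Complex.I : ℂ) * v ^ 2).re := by
    intro v
    have : v = v.re • (1:ℂ) + v.im • Complex.I := by simp
    have e : Q v v = v.re ^ 2 * A + v.im ^ 2 * C + 2 * v.re * v.im * B := by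
      conv_lhs => rw [this]
      simp only [map_add, map_smul, add_apply, smul_apply,
        smul_eq_mul, hsymm Complex.I 1]
      ring
    rw [e, Complex.sq_norm, Complex.normSq_apply]
    have : ((A - C) / 2 - B * Complex.I : ℂ) = ⟨(A - C) / 2, - B⟩ := by
      apply Complex.ext <;> simp
    rw [this, pow_two v, Complex.mul_re, Complex.mul_re, Complex.mul_im]
    ring
  set q : ℂ → ℂ := fun y => ((f z + (A + C) / 4 * r ^ 2 + ε / 4 * r ^ 2 : ℝ) : ℂ) +
    (L 1 - L Complex.I * Complex.I) * (y - z) + ((A - C) / 2 - B * Complex.I) / 2 * (y - z) ^ 2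
  have hq : Differentiable ℂ q := by fun_prop
  have h2 : Real.circleAverage f z r ≤ Real.circleAverage (fun z => (q z).re) z r := by
    refine Real.circleAverage_mono ?_ ?_ fun y hy => ?_
    · exact hd.continuous.continuousOn.circleIntegrable hr0.le
    · exact ((Complex.continuous_re.comp hq.continuous).continuousOn).circleIntegrable hr0.le
    · rw [abs_of_pos hr0, mem_sphere_iff_norm] at hy
      have h3 := ht (y - z) (by rwa [hy])
      rw [hLv, hQv, hy] at h3
      have h4 : (q y).re = f z + (A + C) / 4 * r ^ 2 + ε / 4 * r ^ 2 +
        ((L 1 - L Complex.I * Complex.I) * (y - z)).re +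
        (((A - C) / 2 - B * Complex.I : ℂ) * (y - z) ^ 2).re / 2 := by
        simp only [q, Complex.add_re, Complex.ofReal_re]
        congr 1
        rw [div_mul_eq_mul_div, Complex.div_ofNat_re]
      rw [h4]
      rw [add_sub_cancel] at h3
      linarith
  have h3 := (h r hr0 hrR).trans h2
  rw [circleAverage_re hq] at h3
  have h4 : (q z).re = f z + (A + C) / 4 * r ^ 2 + ε / 4 * r ^ 2 := by
    simp only [q, sub_self, mul_zero, add_zero, Complex.ofReal_re, zero_pow two_ne_zero]
  rw [h4] at h3
  have : 0 < r ^ 2 := by positivity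
  have h5 : 0 ≤ ((A + C) + ε) * r ^ 2 := by linarith
  exact nonneg_of_mul_nonneg_left h5 this

noncomputable def molBase (z : ℂ) : ℝ := Real.smoothTransition (1 - ‖z‖ ^ 2)

/-- A smooth radial mollifier supported in the ball of radius `δ`. -/
noncomputable def mol (δ : ℝ) (z : ℂ) : ℝ :=
  (∫ t : ℂ, molBase (δ⁻¹ • t))⁻¹ * molBase (δ⁻¹ • z)

theorem molBase_contDiff {n : ℕ∞} : ContDiff ℝ n molBase :=
  Real.smoothTransition.contDiff.comp (contDiff_const.sub (contDiff_norm_sq ℝ))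

theorem molBase_eq_zero {z : ℂ} (h : 1 ≤ ‖z‖) : molBase z = 0 :=
  Real.smoothTransition.zero_of_nonpos (by nlinarith)

theorem molBase_smul_eq_zero {δ : ℝ} (hδ : 0 < δ) {z : ℂ} (h : δ ≤ ‖z‖) :
    molBase (δ⁻¹ • z) = 0 := by
  apply molBase_eq_zero
  rw [norm_smul, norm_inv, Real.norm_of_nonneg hδ.le, inv_mul_eq_div, one_le_div hδ]
  exact h

theorem molBase_smul_hasCompactSupport {δ : ℝ} (hδ : 0 < δ) :
    HasCompactSupport fun z => molBase (δ⁻¹ • z) := by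
  refine HasCompactSupport.intro (isCompact_closedBall (0 : ℂ) δ) fun z hz => ?_
  rw [mem_closedBall_zero_iff, not_le] at hz
  exact molBase_smul_eq_zero hδ hz.le

theorem molBase_smul_contDiff (δ : ℝ) {n : ℕ∞} : ContDiff ℝ n fun z => molBase (δ⁻¹ • z) :=
  molBase_contDiff.comp (contDiff_const_smul _)

theorem molBase_integral_pos {δ : ℝ} (hδ : 0 < δ) : 0 < ∫ t : ℂ, molBase (δ⁻¹ • t) := by
  refine Continuous.integral_pos_of_hasCompactSupport_nonneg_nonzero (x := 0)
    (molBase_smul_contDiff δ (n := 0)).continuous (molBase_smul_hasCompactSupport hδ)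
    (fun z => Real.smoothTransition.nonneg _) ?_
  simp [molBase]

theorem mol_contDiff (δ : ℝ) {n : ℕ∞} : ContDiff ℝ n (mol δ) :=
  contDiff_const.mul (molBase_smul_contDiff δ)

theorem mol_continuous (δ : ℝ) : Continuous (mol δ) := (mol_contDiff δ (n := 0)).continuous

theorem mol_nonneg (δ : ℝ) (z : ℂ) : 0 ≤ mol δ z :=
  mul_nonneg (inv_nonneg.2 (integral_nonneg fun _ => Real.smoothTransition.nonneg _))
    (Real.smoothTransition.nonneg _)

theorem mol_eq_zero {δ : ℝ} (hδ : 0 < δ) {z : ℂ} (h : δ ≤ ‖z‖) : mol δ z = 0 := by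
  rw [mol, molBase_smul_eq_zero hδ h, mul_zero]

theorem mol_hasCompactSupport {δ : ℝ} (hδ : 0 < δ) : HasCompactSupport (mol δ) :=
  (molBase_smul_hasCompactSupport hδ).mul_left

theorem mol_radial (δ : ℝ) (s t : ℂ) (h : ‖s‖ = ‖t‖) : mol δ s = mol δ t := by
  simp only [mol, molBase, norm_smul, h]

theorem mol_integral {δ : ℝ} (hδ : 0 < δ) : ∫ z, mol δ z = 1 := by
  simp only [mol]
  rw [integral_const_mul, inv_mul_cancel₀ (molBase_integral_pos hδ).ne']

theorem mol_integrable {δ : ℝ} (hδ : 0 < δ) : Integrable (mol δ) :=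
  (mol_continuous δ).integrable_of_hasCompactSupport (mol_hasCompactSupport hδ)

/-- Mollification. -/
noncomputable def mollify {E : Type*} [NormedAddCommGroup E] [NormedSpace ℝ E] (δ : ℝ) (f : ℂ → E)
    (z : ℂ) : E := ∫ s, mol δ s • f (z - s)

theorem mollify_eq_conv {E : Type*} [NormedAddCommGroup E] [NormedSpace ℝ E] (δ : ℝ)
    (f : ℂ → E) : mollify δ f =
      convolution (mol δ) f (ContinuousLinearMap.lsmul ℝ ℝ) volume := by
  ext z; rfl

theorem mollify_contDiff {E : Type*} [NormedAddCommGroup E] [NormedSpace ℝ E] [CompleteSpace E]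
    {δ : ℝ} (hδ : 0 < δ) {f : ℂ → E} (hf : LocallyIntegrable f) {n : ℕ∞} :
    ContDiff ℝ n (mollify δ f) := by
  rw [mollify_eq_conv]
  exact HasCompactSupport.contDiff_convolution_left _ (mol_hasCompactSupport hδ) (mol_contDiff δ) hf

theorem mollify_integrable {E : Type*} [NormedAddCommGroup E] [NormedSpace ℝ E]
    {δ : ℝ} (hδ : 0 < δ) {f : ℂ → E} (hf : LocallyIntegrable f) (z : ℂ) :
    Integrable fun s => mol δ s • f (z - s) :=
  (mol_hasCompactSupport hδ).convolutionExists_left (ContinuousLinearMap.lsmul ℝ ℝ)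
    (mol_continuous δ) hf z

theorem mollify_le {δ : ℝ} (hδ : 0 < δ) {f : ℂ → ℝ} (hf : LocallyIntegrable f) {z : ℂ} {C : ℝ}
    (h : ∀ s, ‖s‖ < δ → f (z - s) ≤ C) : mollify δ f z ≤ C := by
  have : ∫ s, mol δ s • C = C := by
    rw [integral_smul_const, mol_integral hδ, one_smul]
  rw [← this]
  refine integral_mono (mollify_integrable hδ hf z) ((mol_integrable hδ).smul_const C) fun s => ?_
  by_cases hs : ‖s‖ < δ
  · exact mul_le_mul_of_nonneg_left (h s hs) (mol_nonneg δ s)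
  · simp [mol_eq_zero hδ (not_lt.1 hs)]

theorem le_mollify {δ : ℝ} (hδ : 0 < δ) {f : ℂ → ℝ} (hf : LocallyIntegrable f) {z : ℂ} {C : ℝ}
    (h : ∀ s, ‖s‖ < δ → C ≤ f (z - s)) : C ≤ mollify δ f z := by
  have := mollify_le hδ hf.neg (z := z) (C := -C) fun s hs => neg_le_neg (h s hs)
  simp only [mollify, Pi.neg_apply, smul_neg, integral_neg] at this
  simpa [mollify] using this

theorem circleAverage_sub_left {E : Type*} [NormedAddCommGroup E] [NormedSpace ℝ E] (f : ℂ → E)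
    (z : ℂ) (R : ℝ) : Real.circleAverage (fun s => f (z - s)) 0 R = Real.circleAverage f z R := by
  rw [← Real.circleAverage_neg_radius (c := z), Real.circleAverage_def, Real.circleAverage_def]
  congr 2; ext θ; congr 1; simp [circleMap]; ring

theorem circleAverage_sub_right {E : Type*} [NormedAddCommGroup E] [NormedSpace ℝ E] (f : ℂ → E)
    (s c : ℂ) (R : ℝ) :
    Real.circleAverage (fun z => f (z - s)) c R = Real.circleAverage f (c - s) R := by
  rw [Real.circleAverage_def, Real.circleAverage_def]
  congr 2; ext θ; congr 1; simp [circleMap]; ring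

/-- Mollification through circle averages. -/
theorem mollify_eq_circleAverage {E : Type*} [NormedAddCommGroup E] [NormedSpace ℝ E]
    [CompleteSpace E] {δ : ℝ} (hδ : 0 < δ) {f : ℂ → E} (hf : LocallyIntegrable f) (z : ℂ) :
    Integrable (fun s => mol δ s • Real.circleAverage f z ‖s‖) ∧
    mollify δ f z = ∫ s, mol δ s • Real.circleAverage f z ‖s‖ := by
  have h := integral_radial_smul (mol_radial δ) (mollify_integrable hδ hf z)
  have e : ∀ s : ℂ, Real.circleAverage (fun s => f (z - s)) 0 ‖s‖ = Real.circleAverage f z ‖s‖ :=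
    fun s => circleAverage_sub_left f z _
  simp_rw [e] at h
  exact h

theorem le_mollify_of_submean {δ : ℝ} (hδ : 0 < δ) {f : ℂ → ℝ} (hf : LocallyIntegrable f) {z : ℂ}
    (h : ∀ r, 0 < r → r < δ → f z ≤ Real.circleAverage f z r) : f z ≤ mollify δ f z := by
  obtain ⟨h1, h2⟩ := mollify_eq_circleAverage hδ hf z
  rw [h2]
  have : ∫ s, mol δ s • f z = f z := by
    rw [integral_smul_const, mol_integral hδ, one_smul]
  conv_lhs => rw [← this]
  refine integral_mono ((mol_integrable hδ).smul_const _) h1 fun s => ?_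
  by_cases hs : ‖s‖ < δ
  · refine mul_le_mul_of_nonneg_left ?_ (mol_nonneg δ s)
    rcases eq_or_lt_of_le (norm_nonneg s) with h0 | h0
    · rw [← h0, Real.circleAverage_zero]
    · exact h _ h0 hs
  · simp [mol_eq_zero hδ (not_lt.1 hs)]

/-- Mollification reproduces functions with the mean value property. -/
theorem mollify_eq_of_mean {E : Type*} [NormedAddCommGroup E] [NormedSpace ℝ E]
    [CompleteSpace E] {δ : ℝ} (hδ : 0 < δ) {f : ℂ → E} (hf : LocallyIntegrable f) {z : ℂ}
    (h : ∀ r, 0 < r → r < δ → Real.circleAverage f z r = f z) : mollify δ f z = f z := by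
  obtain ⟨h1, h2⟩ := mollify_eq_circleAverage hδ hf z
  rw [h2]
  have : ∫ s, mol δ s • f z = f z := by
    rw [integral_smul_const, mol_integral hδ, one_smul]
  conv_rhs => rw [← this]
  refine integral_congr_ae (Eventually.of_forall fun s => ?_)
  by_cases hs : ‖s‖ < δ
  · simp only
    rcases eq_or_lt_of_le (norm_nonneg s) with h0 | h0
    · rw [← h0, Real.circleAverage_zero]
    · rw [h _ h0 hs]
  · simp [mol_eq_zero hδ (not_lt.1 hs)]

theorem circleAverage_mollify {δ : ℝ} (hδ : 0 < δ) {f : ℂ → ℝ} {B : ℝ} (hm : Measurable f)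
    (hB : ∀ z, |f z| ≤ B) (z : ℂ) (R : ℝ) :
    Integrable (fun s => mol δ s • Real.circleAverage f (z - s) R) ∧
    Real.circleAverage (mollify δ f) z R = ∫ s, mol δ s • Real.circleAverage f (z - s) R := by
  have key : Integrable (fun p : ℝ × ℂ => mol δ p.2 • f (circleMap z R p.1 - p.2))
      ((volume.restrict (Ioc 0 (2 * Real.pi))).prod volume) := by
    have h1 : Integrable (fun p : ℝ × ℂ => mol δ p.2)
      ((volume.restrict (Ioc 0 (2 * Real.pi))).prod volume) := (mol_integrable hδ).comp_snd _
    have h2 : Measurable (fun p : ℝ × ℂ => f (circleMap z R p.1 - p.2)) :=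
      hm.comp (Continuous.measurable (by fun_prop))
    have := h1.bdd_mul (c := B) h2.aestronglyMeasurable (Eventually.of_forall fun p => hB _)
    simpa [mul_comm] using this
  have e : ∀ s, mol δ s • Real.circleAverage f (z - s) R =
      (2 * Real.pi)⁻¹ * ∫ θ in Ioc 0 (2 * Real.pi), mol δ s • f (circleMap z R θ - s) := by
    intro s
    rw [← circleAverage_sub_right, Real.circleAverage_def,
      intervalIntegral.integral_of_le Real.two_pi_pos.le, integral_smul]
    simp only [smul_eq_mul]; ring
  simp_rw [e]
  refine ⟨key.integral_prod_right.const_mul _, ?_⟩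
  rw [integral_const_mul, ← integral_integral_swap (f := fun θ s => mol δ s • f (circleMap z R θ - s)) key]
  rw [Real.circleAverage_def, intervalIntegral.integral_of_le Real.two_pi_pos.le]
  rfl

theorem measurable_indicator_of_usc {φ : ℂ → ℝ} {K : Set ℂ} (hK : MeasurableSet K)
    (h : UpperSemicontinuousOn φ K) : Measurable (K.indicator φ) := by
  classical
  have h1 : Measurable (fun x : K => φ x) := by
    refine UpperSemicontinuous.measurable ?_
    rw [← upperSemicontinuousOn_univ_iff]
    exact h.comp (g := ((↑) : K → ℂ)) continuous_subtype_val.continuousOn (fun x _ => x.2)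
  refine measurable_of_restrict_of_restrict_compl hK ?_ ?_
  · convert h1 using 1
    ext x
    simp
  · convert measurable_const (a := (0 : ℝ)) using 1
    ext x
    have : (x : ℂ) ∉ K := x.2
    simp [this]

theorem exists_thickening {D K : Set ℂ} (hD : IsOpen D) (hK : IsCompact K) (hKD : K ⊆ D) :
    ∃ δ > 0, ∃ K₁, IsCompact K₁ ∧ K₁ ⊆ D ∧ ∀ z ∈ K, ∀ s : ℂ, ‖s‖ ≤ δ → z - s ∈ K₁ := by
  obtain ⟨δ, hδ, h⟩ := hK.exists_cthickening_subset_open hD hKD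
  refine ⟨δ, hδ, _, hK.cthickening, h, fun z hz s hs => ?_⟩
  refine mem_cthickening_of_dist_le _ z δ K hz ?_
  simpa [dist_eq_norm] using hs

/-- Smooth subharmonic approximation near a compact set. -/
theorem RSub.exists_smooth_approx {φ : ℂ → ℝ} {D K : Set ℂ} (hD : IsOpen D) (h : RSub φ D)
    (hK : IsCompact K) (hKD : K ⊆ D) :
    ∃ (F : ℕ → ℂ → ℝ) (B : ℝ), (∀ n, ContDiff ℝ 2 (F n)) ∧ (∀ n, ∀ z ∈ K, |F n z| ≤ B) ∧
      (∀ z ∈ K, Tendsto (fun n => F n z) atTop (nhds (φ z))) ∧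
      ∀ n, ∀ z ∈ K, 0 ≤ fderiv ℝ (fderiv ℝ (F n)) z 1 1 +
        fderiv ℝ (fderiv ℝ (F n)) z Complex.I Complex.I := by
  obtain ⟨δ, hδ, K₁, hK₁, hK₁D, hsub⟩ := exists_thickening hD hK hKD
  obtain ⟨B, hB⟩ := h.bdd K₁ hK₁D hK₁
  set f := K₁.indicator φ with hf
  have fm : Measurable f := measurable_indicator_of_usc hK₁.measurableSet (h.usc.mono hK₁D)
  have fB : ∀ z, |f z| ≤ |B| := by
    intro z
    by_cases hz : z ∈ K₁
    · rw [hf, indicator_of_mem hz]; exact (hB z hz).trans (le_abs_self B)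
    · rw [hf, indicator_of_notMem hz]; simp
  have feq : ∀ z ∈ K₁, f z = φ z := fun z hz => indicator_of_mem hz _
  have fl : LocallyIntegrable f := by
    have : IntegrableOn f K₁ :=
      Measure.integrableOn_of_bounded (M := |B|) hK₁.measure_lt_top.ne fm.aestronglyMeasurable
        (Eventually.of_forall fB)
    rw [integrableOn_iff_integrable_of_support_subset support_indicator_subset] at this
    exact this.locallyIntegrable
  set d : ℕ → ℝ := fun n => δ / 2 / (n + 1) with hd
  have hd0 : ∀ n, 0 < d n := fun n => by positivity
  have hd1 : ∀ n, d n ≤ δ / 2 := fun n => div_le_self (by positivity) (by simp)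
  have hdt : Tendsto d atTop (nhds 0) := by
    have := (tendsto_one_div_add_atTop_nhds_zero_nat (𝕜 := ℝ)).const_mul (δ / 2)
    rw [mul_zero] at this
    exact this.congr fun n => by rw [hd]; ring
  have avg : ∀ z r, 0 < r → (∀ s : ℂ, ‖s‖ ≤ r → z - s ∈ K₁) →
      f z ≤ Real.circleAverage f z r := by
    intro z r hr hs
    have hz : z ∈ K₁ := by simpa using hs 0 (by simpa using hr.le)
    have hc : closedBall z r ⊆ K₁ := fun y hy => by
      have := hs (z - y) (by rwa [mem_closedBall, dist_comm, dist_eq_norm] at hy)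
      simpa using this
    rw [feq z hz, Real.circleAverage_congr_sphere (f₂ := φ)]
    · exact h.submean z r hr (hc.trans hK₁D)
    · intro y hy
      rw [abs_of_pos hr] at hy
      exact feq y (hc (sphere_subset_closedBall hy))
  refine ⟨fun n => mollify (d n) f, |B|, fun n => mollify_contDiff (hd0 n) fl (n := 2),
    fun n z hz => abs_le.2 ⟨?_, ?_⟩, fun z hz => ?_, fun n z hz => ?_⟩
  · exact le_mollify (hd0 n) fl fun s _ => (abs_le.1 (fB _)).1
  · exact mollify_le (hd0 n) fl fun s _ => (abs_le.1 (fB _)).2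
  · rw [tendsto_order]
    have hzK : z ∈ K₁ := by simpa using hsub z hz 0 (by simpa using hδ.le)
    refine ⟨fun a ha => Eventually.of_forall fun n => ha.trans_le ?_, fun a ha => ?_⟩
    · rw [← feq z hzK]
      refine le_mollify_of_submean (hd0 n) fl fun r hr hrd => avg z r hr fun s hs => hsub z hz s ?_
      linarith [hd1 n]
    · obtain ⟨b, hb1, hb2⟩ := exists_between ha
      have h1 := h.usc z (hKD hz) b hb1
      obtain ⟨ε, hε, h1⟩ := Metric.mem_nhdsWithin_iff.1 h1
      filter_upwards [hdt.eventually (gt_mem_nhds hε)] with n hn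
      refine lt_of_le_of_lt (mollify_le (hd0 n) fl fun s hs => ?_) hb2
      have hm := hsub z hz s (by linarith [hd1 n])
      rw [feq _ hm]
      have : z - s ∈ ball z ε ∩ D := ⟨by simpa [dist_eq_norm] using hs.trans hn, hK₁D hm⟩
      exact (h1 this).le
  · refine laplacian_nonneg_of_submean (half_pos hδ) (mollify_contDiff (hd0 n) fl (n := 2))
      fun r hr hrd => ?_
    obtain ⟨h1, h2⟩ := circleAverage_mollify (hd0 n) fm fB z r
    rw [h2]
    refine integral_mono (mollify_integrable (hd0 n) fl z) h1 fun s => ?_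
    by_cases hs : ‖s‖ < d n
    · refine mul_le_mul_of_nonneg_left (avg _ r hr fun t ht => ?_) (mol_nonneg _ s)
      rw [sub_sub]
      refine hsub z hz _ ((norm_add_le _ _).trans ?_)
      linarith [hd1 n]
    · simp [mol_eq_zero (hd0 n) (not_lt.1 hs)]

/-- The real-linear map `v ↦ a v + b v̄`. -/
noncomputable def wirt (a b : ℂ) : ℂ →L[ℝ] ℂ :=
  a • ContinuousLinearMap.id ℝ ℂ + b • (Complex.conjCLE : ℂ →L[ℝ] ℂ)

theorem wirt_apply (a b v : ℂ) : wirt a b v = a * v + b * starRingEnd ℂ v := by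
  simp [wirt]

/-- `f` is real differentiable at `p` with Wirtinger derivatives `a = ∂f`, `b = ∂̄f`. -/
def HasW (f : ℂ → ℂ) (a b p : ℂ) : Prop := HasFDerivAt (𝕜 := ℝ) f (wirt a b) p

/-- The Wirtinger derivative `∂/∂z`. -/
noncomputable def dz (f : ℂ → ℂ) (p : ℂ) : ℂ :=
  (1 / 2) * (fderiv ℝ f p 1 - Complex.I * fderiv ℝ f p Complex.I)

/-- The Wirtinger derivative `∂/∂z̄`. -/
noncomputable def db (f : ℂ → ℂ) (p : ℂ) : ℂ :=
  (1 / 2) * (fderiv ℝ f p 1 + Complex.I * fderiv ℝ f p Complex.I)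

theorem wirt_ext {L : ℂ →L[ℝ] ℂ} {a b : ℂ} (h1 : L 1 = a + b)
    (h2 : L Complex.I = a * Complex.I - b * Complex.I) : L = wirt a b := by
  ext v
  rw [wirt_apply]
  conv_lhs => rw [← Complex.re_add_im v]
  have e : ((v.re : ℂ) + v.im * Complex.I) = v.re • (1 : ℂ) + v.im • Complex.I := by
    simp [Complex.real_smul]
  rw [e, map_add, map_smul, map_smul, h1, h2]
  conv_rhs => rw [← Complex.re_add_im v]
  simp only [Complex.real_smul, map_add, map_mul, Complex.conj_ofReal, Complex.conj_I]
  ring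

theorem DifferentiableAt.hasW {f : ℂ → ℂ} {p : ℂ} (h : DifferentiableAt ℝ f p) :
    HasW f (dz f p) (db f p) p := by
  unfold HasW
  rw [← wirt_ext (L := fderiv ℝ f p)]
  · exact h.hasFDerivAt
  · unfold dz db; ring
  · unfold dz db; ring_nf; simp only [Complex.I_sq]; ring

namespace HasW
variable {f g : ℂ → ℂ} {a b a' b' p : ℂ}

theorem fderiv_eq (h : HasW f a b p) : fderiv ℝ f p = wirt a b := HasFDerivAt.fderiv h

theorem dz_eq (h : HasW f a b p) : dz f p = a := by
  unfold dz
  rw [h.fderiv_eq, wirt_apply, wirt_apply]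
  simp only [map_one, Complex.conj_I]
  ring_nf; simp only [Complex.I_sq]; ring

theorem db_eq (h : HasW f a b p) : db f p = b := by
  unfold db
  rw [h.fderiv_eq, wirt_apply, wirt_apply]
  simp only [map_one, Complex.conj_I]
  ring_nf; simp only [Complex.I_sq]; ring

theorem congr_coeff (h : HasW f a b p) (ha : a = a') (hb : b = b') : HasW f a' b' p := by
  subst ha hb; exact h

theorem const (c p : ℂ) : HasW (fun _ => c) 0 0 p := by
  unfold HasW
  refine (hasFDerivAt_const c p).congr_fderiv ?_
  ext v; simp [wirt_apply]

theorem id (p : ℂ) : HasW (fun z => z) 1 0 p := by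
  unfold HasW
  refine (hasFDerivAt_id (𝕜 := ℝ) p).congr_fderiv ?_
  ext v; simp [wirt_apply]

theorem add (hf : HasW f a b p) (hg : HasW g a' b' p) :
    HasW (fun z => f z + g z) (a + a') (b + b') p := by
  unfold HasW at *
  refine (HasFDerivAt.add hf hg).congr_fderiv ?_
  ext v; simp [wirt_apply]; ring

theorem sub (hf : HasW f a b p) (hg : HasW g a' b' p) :
    HasW (fun z => f z - g z) (a - a') (b - b') p := by
  unfold HasW at *
  refine (HasFDerivAt.sub hf hg).congr_fderiv ?_
  ext v; simp [wirt_apply]; ring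

theorem neg (hf : HasW f a b p) : HasW (fun z => -f z) (-a) (-b) p := by
  unfold HasW at *
  refine (HasFDerivAt.neg hf).congr_fderiv ?_
  ext v; simp [wirt_apply]; ring

theorem mul (hf : HasW f a b p) (hg : HasW g a' b' p) :
    HasW (fun z => f z * g z) (a * g p + f p * a') (b * g p + f p * b') p := by
  unfold HasW at *
  refine (HasFDerivAt.mul hf hg).congr_fderiv ?_
  ext v; simp [wirt_apply]; ring

theorem conj (hf : HasW f a b p) :
    HasW (fun z => starRingEnd ℂ (f z)) (starRingEnd ℂ b) (starRingEnd ℂ a) p := by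
  unfold HasW at *
  refine ((Complex.conjCLE : ℂ →L[ℝ] ℂ).hasFDerivAt.comp p hf).congr_fderiv ?_
  ext v; simp [wirt_apply]; ring

theorem comp_hol {k : ℂ → ℂ} {k' : ℂ} (hk : HasDerivAt k k' (f p)) (hf : HasW f a b p) :
    HasW (fun z => k (f z)) (k' * a) (k' * b) p := by
  unfold HasW at *
  refine ((hk.hasFDerivAt.restrictScalars ℝ).comp p hf).congr_fderiv ?_
  ext v; simp [wirt_apply]; ring

theorem exp (hf : HasW f a b p) :
    HasW (fun z => Complex.exp (f z)) (Complex.exp (f p) * a) (Complex.exp (f p) * b) p :=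
  comp_hol (Complex.hasDerivAt_exp _) hf

theorem of_hasDerivAt {k' : ℂ} (h : HasDerivAt f k' p) : HasW f k' 0 p := by
  have := comp_hol (f := fun z => z) h (HasW.id p)
  exact this.congr_coeff (by simp) (by simp)

theorem comp_real {x : ℂ → ℝ} {k : ℝ → ℝ} {k' : ℝ} (hk : HasDerivAt k k' (x p))
    (hx : HasW (fun z => (x z : ℂ)) a b p) :
    HasW (fun z => (k (x z) : ℂ)) (k' * a) (k' * b) p := by
  unfold HasW at *
  have hx' : HasFDerivAt x ((Complex.reCLM).comp (wirt a b)) p := by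
    have := (Complex.reCLM.hasFDerivAt).comp p hx
    exact this
  have him : ∀ v, (wirt a b v).im = 0 := by
    intro v
    have h1 := (Complex.imCLM.hasFDerivAt).comp p hx
    have h2 : HasFDerivAt (Complex.imCLM ∘ fun z => (x z : ℂ)) (0 : ℂ →L[ℝ] ℝ) p := by
      have : (Complex.imCLM ∘ fun z => (x z : ℂ)) = fun _ => 0 := by ext z; simp
      rw [this]; exact hasFDerivAt_const _ _
    have := congrArg (fun L => L v) (h1.unique h2)
    simpa using this
  refine (Complex.ofRealCLM.hasFDerivAt.comp p (hk.comp_hasFDerivAt p hx')).congr_fderiv ?_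
  ext v
  have e : ((wirt a b v).re : ℂ) = wirt a b v := by
    apply Complex.ext <;> simp [him v]
  simp only [ContinuousLinearMap.comp_apply, smul_apply, smul_eq_mul,
    Complex.ofRealCLM_apply, Complex.reCLM_apply, Complex.ofReal_mul, e]
  simp only [wirt_apply]; ring

theorem congr_of_eventuallyEq (h : HasW f a b p) (e : g =ᶠ[nhds p] f) : HasW g a b p :=
  HasFDerivAt.congr_of_eventuallyEq h e

theorem hasDerivAt (h : HasW f a 0 p) : HasDerivAt f a p := by
  rw [hasDerivAt_iff_hasFDerivAt]
  refine hasFDerivAt_of_restrictScalars ℝ h ?_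
  ext v; simp [wirt_apply]; ring

end HasW

theorem ContDiff.dz {f : ℂ → ℂ} (h : ContDiff ℝ 2 f) : ContDiff ℝ 1 (dz f) := by
  have h1 := h.fderiv_right (m := 1) (by norm_num)
  unfold _root_.dz
  fun_prop

theorem ContDiff.db {f : ℂ → ℂ} (h : ContDiff ℝ 2 f) : ContDiff ℝ 1 (db f) := by
  have h1 := h.fderiv_right (m := 1) (by norm_num)
  unfold _root_.db
  fun_prop

theorem ContDiff.continuous_dz {f : ℂ → ℂ} (h : ContDiff ℝ 1 f) : Continuous (_root_.dz f) := by
  have h1 := h.continuous_fderiv (by norm_num)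
  unfold _root_.dz
  fun_prop

theorem ContDiff.continuous_db {f : ℂ → ℂ} (h : ContDiff ℝ 1 f) : Continuous (_root_.db f) := by
  have h1 := h.continuous_fderiv (by norm_num)
  unfold _root_.db
  fun_prop

theorem tsupport_db_subset (f : ℂ → ℂ) : tsupport (db f) ⊆ tsupport f := by
  refine closure_minimal (fun x hx => ?_) (isClosed_tsupport f)
  by_contra h
  have : fderiv ℝ f x = 0 := by
    by_contra h'
    exact h (support_fderiv_subset ℝ h')
  exact hx (by simp [db, this])

theorem tsupport_dz_subset (f : ℂ → ℂ) : tsupport (dz f) ⊆ tsupport f := by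
  refine closure_minimal (fun x hx => ?_) (isClosed_tsupport f)
  by_contra h
  have : fderiv ℝ f x = 0 := by
    by_contra h'
    exact h (support_fderiv_subset ℝ h')
  exact hx (by simp [dz, this])

theorem HasCompactSupport.db {f : ℂ → ℂ} (h : HasCompactSupport f) :
    HasCompactSupport (db f) :=
  h.mono' (subset_closure.trans (tsupport_db_subset f))

theorem HasCompactSupport.dz {f : ℂ → ℂ} (h : HasCompactSupport f) :
    HasCompactSupport (dz f) :=
  h.mono' (subset_closure.trans (tsupport_dz_subset f))

theorem integral_fderiv_eq_zero {f : ℂ → ℂ} (hf : ContDiff ℝ 1 f) (hc : HasCompactSupport f)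
    (v : ℂ) : ∫ z, fderiv ℝ f z v = 0 := by
  have h1 := hf.continuous_fderiv (by norm_num)
  have hi : Integrable (fun z => fderiv ℝ f z v) := by
    refine Continuous.integrable_of_hasCompactSupport (by fun_prop) ?_
    exact (hc.fderiv ℝ).comp_left (g := fun L : ℂ →L[ℝ] ℂ => L v) rfl
  have := integral_bilinear_fderiv_right_eq_neg_left_of_integrable (μ := volume)
    (B := ContinuousLinearMap.mul ℝ ℂ) (f := fun _ => (1 : ℂ)) (g := f) (v := v)
    (by simp) (by simpa using hi)
    (by simpa using hf.continuous.integrable_of_hasCompactSupport hc) (by fun_prop)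
    (fun x _ => hf.differentiable (by norm_num) x)
  simpa using this

theorem integrable_fderiv_apply {f : ℂ → ℂ} (hf : ContDiff ℝ 1 f) (hc : HasCompactSupport f)
    (v : ℂ) : Integrable fun z => fderiv ℝ f z v := by
  have h1 := hf.continuous_fderiv (by norm_num)
  refine Continuous.integrable_of_hasCompactSupport (by fun_prop) ?_
  exact (hc.fderiv ℝ).comp_left (g := fun L : ℂ →L[ℝ] ℂ => L v) rfl

theorem integral_db_eq_zero {f : ℂ → ℂ} (hf : ContDiff ℝ 1 f) (hc : HasCompactSupport f) :
    ∫ z, db f z = 0 := by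
  unfold db
  rw [integral_const_mul, integral_add (integrable_fderiv_apply hf hc _)
    ((integrable_fderiv_apply hf hc _).const_mul _), integral_const_mul,
    integral_fderiv_eq_zero hf hc, integral_fderiv_eq_zero hf hc]
  simp

theorem integral_dz_eq_zero {f : ℂ → ℂ} (hf : ContDiff ℝ 1 f) (hc : HasCompactSupport f) :
    ∫ z, dz f z = 0 := by
  unfold dz
  rw [integral_const_mul, integral_sub (integrable_fderiv_apply hf hc _)
    ((integrable_fderiv_apply hf hc _).const_mul _), integral_const_mul,
    integral_fderiv_eq_zero hf hc, integral_fderiv_eq_zero hf hc]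
  simp

theorem fderiv_dz_apply {f : ℂ → ℂ} (h : ContDiff ℝ 2 f) (p v : ℂ) :
    fderiv ℝ (dz f) p v = (1 / 2) * (fderiv ℝ (fderiv ℝ f) p v 1 -
      Complex.I * fderiv ℝ (fderiv ℝ f) p v Complex.I) := by
  have h1 : DifferentiableAt ℝ (fderiv ℝ f) p :=
    (h.fderiv_right (m := 1) (by norm_num)).differentiable (by norm_num) p
  have h2 : ∀ u : ℂ, HasFDerivAt (fun z => fderiv ℝ f z u)
      ((ContinuousLinearMap.apply ℝ ℂ u).comp (fderiv ℝ (fderiv ℝ f) p)) p := fun u =>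
    (ContinuousLinearMap.apply ℝ ℂ u).hasFDerivAt.comp p h1.hasFDerivAt
  have h3 := ((h2 1).sub ((h2 Complex.I).const_mul Complex.I)).const_mul (1 / 2 : ℂ)
  have : dz f = fun z => (1 / 2 : ℂ) * (fderiv ℝ f z 1 - Complex.I * fderiv ℝ f z Complex.I) := rfl
  rw [this]
  erw [HasFDerivAt.fderiv h3]
  simp

theorem fderiv_db_apply {f : ℂ → ℂ} (h : ContDiff ℝ 2 f) (p v : ℂ) :
    fderiv ℝ (db f) p v = (1 / 2) * (fderiv ℝ (fderiv ℝ f) p v 1 +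
      Complex.I * fderiv ℝ (fderiv ℝ f) p v Complex.I) := by
  have h1 : DifferentiableAt ℝ (fderiv ℝ f) p :=
    (h.fderiv_right (m := 1) (by norm_num)).differentiable (by norm_num) p
  have h2 : ∀ u : ℂ, HasFDerivAt (fun z => fderiv ℝ f z u)
      ((ContinuousLinearMap.apply ℝ ℂ u).comp (fderiv ℝ (fderiv ℝ f) p)) p := fun u =>
    (ContinuousLinearMap.apply ℝ ℂ u).hasFDerivAt.comp p h1.hasFDerivAt
  have h3 := ((h2 1).add ((h2 Complex.I).const_mul Complex.I)).const_mul (1 / 2 : ℂ)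
  have : db f = fun z => (1 / 2 : ℂ) * (fderiv ℝ f z 1 + Complex.I * fderiv ℝ f z Complex.I) := rfl
  rw [this]
  erw [HasFDerivAt.fderiv h3]
  simp [mul_add]

theorem db_dz_comm {f : ℂ → ℂ} (h : ContDiff ℝ 2 f) (p : ℂ) : db (dz f) p = dz (db f) p := by
  have hs : fderiv ℝ (fderiv ℝ f) p 1 Complex.I = fderiv ℝ (fderiv ℝ f) p Complex.I 1 :=
    (h.contDiffAt.isSymmSndFDerivAt (by simp)) 1 Complex.I
  conv_lhs => rw [db, fderiv_dz_apply h, fderiv_dz_apply h]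
  conv_rhs => rw [dz, fderiv_db_apply h, fderiv_db_apply h]
  rw [hs]; ring

theorem dz_db_eq {f : ℂ → ℂ} (h : ContDiff ℝ 2 f) (p : ℂ) :
    dz (db f) p = (1 / 4) * (fderiv ℝ (fderiv ℝ f) p 1 1 +
      fderiv ℝ (fderiv ℝ f) p Complex.I Complex.I) := by
  have hs : fderiv ℝ (fderiv ℝ f) p 1 Complex.I = fderiv ℝ (fderiv ℝ f) p Complex.I 1 :=
    (h.contDiffAt.isSymmSndFDerivAt (by simp)) 1 Complex.I
  rw [dz, fderiv_db_apply h, fderiv_db_apply h, hs]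
  ring_nf; simp only [Complex.I_sq]; ring

theorem fderiv_fderiv_ofReal {F : ℂ → ℝ} (h : ContDiff ℝ 2 F) (p u v : ℂ) :
    fderiv ℝ (fderiv ℝ (fun z => (F z : ℂ))) p u v = (fderiv ℝ (fderiv ℝ F) p u v : ℂ) := by
  have h0 : fderiv ℝ (fun z => (F z : ℂ)) = fun z => Complex.ofRealCLM.comp (fderiv ℝ F z) := by
    ext1 z
    exact (Complex.ofRealCLM.hasFDerivAt.comp z
      (h.differentiable (by norm_num) z).hasFDerivAt).fderiv
  have h1 : DifferentiableAt ℝ (fderiv ℝ F) p :=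
    (h.fderiv_right (m := 1) (by norm_num)).differentiable (by norm_num) p
  have h2 := (((ContinuousLinearMap.compL ℝ ℂ ℝ ℂ) Complex.ofRealCLM).hasFDerivAt.comp p
    h1.hasFDerivAt)
  rw [h0]
  have h3 : (fun z => Complex.ofRealCLM.comp (fderiv ℝ F z)) =
    ((ContinuousLinearMap.compL ℝ ℂ ℝ ℂ) Complex.ofRealCLM) ∘ fderiv ℝ F := rfl
  rw [h3, h2.fderiv]
  rfl

theorem dz_db_ofReal {F : ℂ → ℝ} (h : ContDiff ℝ 2 F) (p : ℂ) :
    dz (db (fun z => (F z : ℂ))) p = (((1 / 4) * (fderiv ℝ (fderiv ℝ F) p 1 1 +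
      fderiv ℝ (fderiv ℝ F) p Complex.I Complex.I) : ℝ) : ℂ) := by
  have h' : ContDiff ℝ 2 (fun z => (F z : ℂ)) := Complex.ofRealCLM.contDiff.comp h
  rw [dz_db_eq h', fderiv_fderiv_ofReal h,
    fderiv_fderiv_ofReal h]
  push_cast; ring

theorem db_conj {f : ℂ → ℂ} {p : ℂ} (h : DifferentiableAt ℝ f p) :
    db (fun z => starRingEnd ℂ (f z)) p = starRingEnd ℂ (dz f p) := h.hasW.conj.db_eq

theorem db_ofReal {f : ℂ → ℝ} {p : ℂ} (h : DifferentiableAt ℝ (fun z => (f z : ℂ)) p) :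
    db (fun z => (f z : ℂ)) p = starRingEnd ℂ (dz (fun z => (f z : ℂ)) p) := by
  rw [← db_conj h]; simp

theorem ContDiff.ofReal {f : ℂ → ℝ} {n : WithTop ℕ∞} (h : ContDiff ℝ n f) :
    ContDiff ℝ n (fun z => (f z : ℂ)) := Complex.ofRealCLM.contDiff.comp h

theorem ContDiff.conj {f : ℂ → ℂ} {n : WithTop ℕ∞} (h : ContDiff ℝ n f) :
    ContDiff ℝ n (fun z => starRingEnd ℂ (f z)) :=
  (Complex.conjCLE : ℂ →L[ℝ] ℂ).contDiff.comp h

/-- The pointwise form of the twisted Bochner–Kodaira identity. -/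
theorem twisted_identity {φ w : ℂ → ℝ} {α : ℂ → ℂ} (hφ : ContDiff ℝ 2 φ) (hw : ContDiff ℝ 2 w)
    (hα : ContDiff ℝ 2 α) :
    ∃ X Y : ℂ → ℂ, ContDiff ℝ 1 X ∧ ContDiff ℝ 1 Y ∧
      (∀ p, α p = 0 → X p = 0) ∧ (∀ p, α p = 0 → Y p = 0) ∧
      ∀ p, (dz X p + db Y p).re ≤ (w p * ‖db α p‖ ^ 2 +
          2 * ‖dz (fun z => (w z : ℂ)) p‖ * ‖db α p‖ * ‖α p‖) * Real.exp (φ p) -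
        ((w p * (dz (db fun z => (φ z : ℂ)) p).re - (dz (db fun z => (w z : ℂ)) p).re) *
          Real.exp (φ p) * ‖α p‖ ^ 2) - w p * Real.exp (φ p) * ‖dz α p + dz (fun z => (φ z : ℂ)) p * α p‖ ^ 2 := by
  set W : ℂ → ℂ := fun z => (w z : ℂ) with hW
  set Φ : ℂ → ℂ := fun z => (φ z : ℂ) with hΦ
  have cW : ContDiff ℝ 2 W := hw.ofReal
  have cΦ : ContDiff ℝ 2 Φ := hφ.ofReal
  have c1W := cW.of_le (m := 1) (by norm_num)
  have c1Φ := cΦ.of_le (m := 1) (by norm_num)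
  have c1α := hα.of_le (m := 1) (by norm_num)
  have cE : ContDiff ℝ 1 (fun z => Complex.exp (Φ z)) := c1Φ.cexp
  refine ⟨fun z => W z * Complex.exp (Φ z) * db α z * starRingEnd ℂ (α z) +
    db W z * Complex.exp (Φ z) * α z * starRingEnd ℂ (α z),
    fun z => -(W z * Complex.exp (Φ z) * starRingEnd ℂ (α z) * (dz α z + dz Φ z * α z)),
    ?_, ?_, ?_, ?_, ?_⟩
  · exact (((c1W.mul cE).mul hα.db).mul c1α.conj).add
      (((cW.db.mul cE).mul c1α).mul c1α.conj)
  · exact (((c1W.mul cE).mul c1α.conj).mul (hα.dz.add (cΦ.dz.mul c1α))).neg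
  · intro p hp; simp [hp]
  · intro p hp; simp [hp]
  intro p
  have d1 : ∀ {f : ℂ → ℂ}, ContDiff ℝ 1 f → HasW f (dz f p) (db f p) p := fun h =>
    (h.differentiable (by norm_num) p).hasW
  have hE := (d1 c1Φ).exp
  have hX := ((((d1 c1W).mul hE).mul (d1 hα.db)).mul (d1 c1α).conj).add
      ((((d1 cW.db).mul hE).mul (d1 c1α)).mul (d1 c1α).conj)
  have hY := ((((d1 c1W).mul hE).mul (d1 c1α).conj).mul
    ((d1 hα.dz).add ((d1 cΦ.dz).mul (d1 c1α)))).neg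
  rw [hX.dz_eq, hY.db_eq]
  have e1 : db W p = starRingEnd ℂ (dz W p) := db_ofReal (c1W.differentiable (by norm_num) p)
  have e2 : db Φ p = starRingEnd ℂ (dz Φ p) := db_ofReal (c1Φ.differentiable (by norm_num) p)
  rw [db_dz_comm hα, db_dz_comm cΦ, e1, e2]
  have r1 : dz (db Φ) p = ((dz (db Φ) p).re : ℂ) := by
    rw [dz_db_ofReal hφ, Complex.ofReal_re]
  have r2 : dz (db W) p = ((dz (db W) p).re : ℂ) := by
    rw [dz_db_ofReal hw, Complex.ofReal_re]
  generalize (dz (db Φ) p).re = L at *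
  generalize (dz (db W) p).re = M at *
  rw [r1, r2]
  generalize dz (db α) p = αzb
  have e3 : Complex.exp (Φ p) = (Real.exp (φ p) : ℂ) := by simp [hΦ]
  rw [e3]
  have hEpos := Real.exp_pos (φ p)
  generalize Real.exp (φ p) = E at *
  have e4 : W p = (w p : ℂ) := rfl
  rw [e4]
  generalize dz W p = wz
  generalize dz Φ p = φz
  generalize db α p = b
  generalize dz α p = a
  generalize α p = x
  generalize w p = v
  have key : (wz * E * b * starRingEnd ℂ x).re ≤ ‖wz‖ * ‖b‖ * ‖x‖ * E := by
    refine (Complex.re_le_norm _).trans ?_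
    simp only [norm_mul, Complex.norm_real, RCLike.norm_conj, Real.norm_eq_abs, abs_of_pos hEpos]
    apply le_of_eq; ring
  have hn : ∀ y : ℂ, ‖y‖ ^ 2 = y.re ^ 2 + y.im ^ 2 := fun y => by
    rw [Complex.sq_norm, Complex.normSq_apply]; ring
  have : (v * ‖b‖ ^ 2 + 2 * ‖wz‖ * ‖b‖ * ‖x‖) * E = v * ‖b‖ ^ 2 * E + 2 * (‖wz‖ * ‖b‖ * ‖x‖ * E) := by
    ring
  rw [this, hn, hn, hn]
  refine le_trans (le_of_eq ?_) (sub_le_sub_right (sub_le_sub_right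
    (add_le_add_right (mul_le_mul_of_nonneg_left key (by norm_num)) _) _) _)
  simp only [Complex.add_re, Complex.neg_re, Complex.mul_re, Complex.mul_im, Complex.add_im,
    Complex.conj_re, Complex.conj_im, Complex.ofReal_re, Complex.ofReal_im]
  ring

theorem integral_nonneg_of_divergence {X Y : ℂ → ℂ} {A : ℂ → ℝ} (hX : ContDiff ℝ 1 X)
    (hY : ContDiff ℝ 1 Y) (cX : HasCompactSupport X) (cY : HasCompactSupport Y)
    (hA : Integrable A) (h : ∀ p, (dz X p + db Y p).re ≤ A p) : 0 ≤ ∫ p, A p := by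
  have iX : Integrable (dz X) := hX.continuous_dz.integrable_of_hasCompactSupport cX.dz
  have iY : Integrable (db Y) := hY.continuous_db.integrable_of_hasCompactSupport cY.db
  have h0 : ∫ p, (dz X p + db Y p).re = 0 := by
    have := integral_re (𝕜 := ℂ) (iX.add iY)
    simp only [Pi.add_apply, RCLike.re_to_complex] at this
    rw [this, integral_add iX iY, integral_dz_eq_zero hX cX, integral_db_eq_zero hY cY]
    simp
  rw [← h0]
  exact integral_mono (iX.add iY).re hA h

/-- The basic twisted `L²` inequality. -/
theorem twisted_inequality {φ w k m : ℂ → ℝ} {α : ℂ → ℂ} (hφ : ContDiff ℝ 2 φ)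
    (hw : ContDiff ℝ 2 w) (hα : ContDiff ℝ 2 α) (hc : HasCompactSupport α)
    (hw0 : ∀ z, 0 ≤ w z) (hk : Continuous k) (hm : Continuous m)
    (hle : ∀ z ∈ tsupport α, ∀ s t : ℝ, 0 ≤ s → 0 ≤ t → 2 * ‖dz (fun z => (w z : ℂ)) z‖ * s * t + k z * t ^ 2 ≤
      (w z * (dz (db fun z => (φ z : ℂ)) z).re - (dz (db fun z => (w z : ℂ)) z).re) * t ^ 2 +
        m z * s ^ 2) :
    ∫ z, k z * ‖α z‖ ^ 2 * Real.exp (φ z) ≤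
      ∫ z, (w z + m z) * ‖db α z‖ ^ 2 * Real.exp (φ z) := by
  obtain ⟨X, Y, hX, hY, X0, Y0, h⟩ := twisted_identity hφ hw hα
  have c1α := hα.continuous
  have c2 : Continuous (db α) := hα.db.continuous
  have cφ := hφ.continuous
  have cw := hw.continuous
  have i1 : Integrable fun z => k z * ‖α z‖ ^ 2 * Real.exp (φ z) := by
    refine Continuous.integrable_of_hasCompactSupport (by fun_prop) (hc.mono fun z hz => ?_)
    contrapose! hz
    simp only [Function.mem_support, not_not] at hz ⊢
    simp [hz]
  have i2 : Integrable fun z => (w z + m z) * ‖db α z‖ ^ 2 * Real.exp (φ z) := by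
    refine Continuous.integrable_of_hasCompactSupport (by fun_prop) (hc.db.mono fun z hz => ?_)
    contrapose! hz
    simp only [Function.mem_support, not_not] at hz ⊢
    simp [hz]
  have cs : ∀ {Z : ℂ → ℂ}, (∀ p, α p = 0 → Z p = 0) → HasCompactSupport Z := fun {Z} hZ =>
    hc.mono fun z hz => by
      contrapose! hz
      simp only [Function.mem_support, not_not] at hz ⊢
      exact hZ z hz
  have := integral_nonneg_of_divergence hX hY (cs X0) (cs Y0) (i2.sub i1) fun p => ?_
  · rw [integral_sub' i2 i1] at this
    linarith
  · by_cases hp : p ∈ tsupport α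
    · refine (h p).trans ?_
      have h1 := hle p hp ‖db α p‖ ‖α p‖ (norm_nonneg _) (norm_nonneg _)
      have h2 := mul_le_mul_of_nonneg_right h1 (Real.exp_pos (φ p)).le
      have h3 : 0 ≤ w p * Real.exp (φ p) *
          ‖dz α p + dz (fun z => (φ z : ℂ)) p * α p‖ ^ 2 :=
        mul_nonneg (mul_nonneg (hw0 p) (Real.exp_pos _).le) (sq_nonneg _)
      simp only [Pi.sub_apply]
      nlinarith [h2, h3]
    · have h1 : X =ᶠ[nhds p] fun _ => 0 := by
        filter_upwards [(isClosed_tsupport α).isOpen_compl.mem_nhds hp] with z hz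
        exact X0 z (image_eq_zero_of_notMem_tsupport hz)
      have h2 : Y =ᶠ[nhds p] fun _ => 0 := by
        filter_upwards [(isClosed_tsupport α).isOpen_compl.mem_nhds hp] with z hz
        exact Y0 z (image_eq_zero_of_notMem_tsupport hz)
      rw [((HasW.const 0 p).congr_of_eventuallyEq h1).dz_eq,
        ((HasW.const 0 p).congr_of_eventuallyEq h2).db_eq]
      have h3 : α p = 0 := image_eq_zero_of_notMem_tsupport hp
      have h4 : db α p = 0 := image_eq_zero_of_notMem_tsupport fun h => hp (tsupport_db_subset α h)
      simp [h3, h4]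

theorem hasW_normSq (a p : ℂ) :
    HasW (fun z => ((‖z - a‖ ^ 2 : ℝ) : ℂ)) (starRingEnd ℂ (p - a)) (p - a) p := by
  have h := (HasW.id p).sub (HasW.const a p)
  have h2 := h.mul h.conj
  have e : (fun z : ℂ => (z - a) * starRingEnd ℂ (z - a)) = fun z => ((‖z - a‖ ^ 2 : ℝ) : ℂ) := by
    ext z; rw [Complex.mul_conj, Complex.normSq_eq_norm_sq]
  rw [e] at h2
  exact h2.congr_coeff (by simp) (by simp)

theorem dz_radial {k : ℝ → ℝ} {k' : ℝ} {a p : ℂ} (hk : HasDerivAt k k' (‖p - a‖ ^ 2)) :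
    dz (fun z => (k (‖z - a‖ ^ 2) : ℂ)) p = k' * starRingEnd ℂ (p - a) :=
  (HasW.comp_real hk (hasW_normSq a p)).dz_eq

theorem dz_db_radial {k k1 : ℝ → ℝ} {k2 : ℝ} {a p : ℂ}
    (hk : ∀ x, 0 ≤ x → HasDerivAt k (k1 x) x) (hk1 : HasDerivAt k1 k2 (‖p - a‖ ^ 2)) :
    dz (db (fun z => (k (‖z - a‖ ^ 2) : ℂ))) p = ((k1 (‖p - a‖ ^ 2) + ‖p - a‖ ^ 2 * k2 : ℝ) : ℂ) := by
  have e : db (fun z => (k (‖z - a‖ ^ 2) : ℂ)) = fun z => (k1 (‖z - a‖ ^ 2) : ℂ) * (z - a) := by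
    ext z
    exact (HasW.comp_real (hk _ (sq_nonneg _)) (hasW_normSq a z)).db_eq
  have h := (HasW.comp_real hk1 (hasW_normSq a p)).mul ((HasW.id p).sub (HasW.const a p))
  rw [e, h.dz_eq]
  have : starRingEnd ℂ (p - a) * (p - a) = ((‖p - a‖ ^ 2 : ℝ) : ℂ) := by
    rw [mul_comm, Complex.mul_conj, Complex.normSq_eq_norm_sq]
  rw [mul_assoc, this]
  push_cast; ring

theorem dz_db_add {f g : ℂ → ℂ} (hf : ContDiff ℝ 2 f) (hg : ContDiff ℝ 2 g) (p : ℂ) :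
    dz (db fun z => f z + g z) p = dz (db f) p + dz (db g) p := by
  have e : (db fun z => f z + g z) = fun z => db f z + db g z := by
    ext z
    exact ((hf.differentiable (by norm_num) z).hasW.add
      (hg.differentiable (by norm_num) z).hasW).db_eq
  rw [e]
  exact ((hf.db.differentiable (by norm_num) p).hasW.add
      (hg.db.differentiable (by norm_num) p).hasW).dz_eq

theorem two_mul_le_of_sq_le {A κ m s t : ℝ} (hκ : 0 ≤ κ) (hm : 0 ≤ m) (h : A ^ 2 ≤ κ * m) :
    2 * A * s * t ≤ κ * t ^ 2 + m * s ^ 2 := by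
  refine le_of_abs_le (abs_le_of_sq_le_sq ?_ (by positivity))
  have h1 : (A ^ 2) * (s * t) ^ 2 ≤ κ * m * (s * t) ^ 2 :=
    mul_le_mul_of_nonneg_right h (sq_nonneg _)
  nlinarith [sq_nonneg (κ * t ^ 2 - m * s ^ 2)]

theorem weight_bound {S x c w L : ℝ} (hS : 0 < S) (hc : 0 < c) (hc1 : c ≤ 1)
    (hSx : S ^ 2 = x + c) (hw : 2 ≤ w) (hL : 0 ≤ L) :
    c / S ^ 4 + 2 / (S * (1 + S) ^ 2) ≤
      w * (L + (4 / (S * (1 + S)) + x * (-(2 * (1 + 2 * S)) / (S ^ 3 * (1 + S) ^ 2)))) -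
      (((1 / (x + (1 + c))) - 1 / (x + c)) +
        x * (-1 / (x + (1 + c)) ^ 2 - -1 / (x + c) ^ 2)) := by
  have hxS : x = S ^ 2 - c := by linarith
  have e1 : ((1 / (x + (1 + c))) - 1 / (x + c)) +
        x * (-1 / (x + (1 + c)) ^ 2 - -1 / (x + c) ^ 2) = (1 + c) / (1 + S ^ 2) ^ 2 - c / S ^ 4 := by
    have : x + (1 + c) = 1 + S ^ 2 := by linarith
    rw [this, ← hSx, hxS]
    field_simp
    ring
  have e2 : 2 / (S * (1 + S) ^ 2) ≤
      4 / (S * (1 + S)) + x * (-(2 * (1 + 2 * S)) / (S ^ 3 * (1 + S) ^ 2)) := by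
    have h1 : x * (-(2 * (1 + 2 * S)) / (S ^ 3 * (1 + S) ^ 2)) ≥
        S ^ 2 * (-(2 * (1 + 2 * S)) / (S ^ 3 * (1 + S) ^ 2)) := by
      have : -(2 * (1 + 2 * S)) / (S ^ 3 * (1 + S) ^ 2) ≤ 0 :=
        div_nonpos_of_nonpos_of_nonneg (by linarith) (by positivity)
      exact mul_le_mul_of_nonpos_right (by linarith) this
    have h2 : 4 / (S * (1 + S)) + S ^ 2 * (-(2 * (1 + 2 * S)) / (S ^ 3 * (1 + S) ^ 2)) =
        2 / (S * (1 + S) ^ 2) := by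
      field_simp; ring
    linarith
  have e3 : (1 + c) / (1 + S ^ 2) ^ 2 ≤ 2 / (S * (1 + S) ^ 2) := by
    rw [div_le_div_iff₀ (by positivity) (by positivity)]
    have h1 : (1 + S) ^ 2 ≤ 2 * (1 + S ^ 2) := by nlinarith [sq_nonneg (1 - S)]
    have h2 : 2 * S ≤ 1 + S ^ 2 := by nlinarith [sq_nonneg (1 - S)]
    have h3 : (2 * S) * (1 + S) ^ 2 ≤ (1 + S ^ 2) * (2 * (1 + S ^ 2)) :=
      mul_le_mul h2 h1 (by positivity) (by positivity)
    have h4 : (1 + c) * (S * (1 + S) ^ 2) ≤ 2 * (S * (1 + S) ^ 2) :=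
      mul_le_mul_of_nonneg_right (by linarith) (by positivity)
    nlinarith
  rw [e1]
  have hκ : 0 ≤ 2 / (S * (1 + S) ^ 2) := by positivity
  nlinarith

theorem psi_hasDerivAt {c x : ℝ} (hc : 0 < c) (hx : 0 ≤ x) :
    HasDerivAt (fun x => 8 * Real.log (1 + √(x + c))) (4 / (√(x + c) * (1 + √(x + c)))) x := by
  have hS : 0 < √(x + c) := Real.sqrt_pos.2 (by linarith)
  have h1 : HasDerivAt (fun x => √(x + c)) (1 / (2 * √(x + c))) x := by
    have := ((hasDerivAt_id x).add_const c).sqrt (by simp; linarith)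
    simpa using this
  have h2 := ((h1.const_add 1).log (by positivity)).const_mul 8
  refine h2.congr_deriv ?_
  field_simp; ring

theorem psi'_hasDerivAt {c x : ℝ} (hc : 0 < c) (hx : 0 ≤ x) :
    HasDerivAt (fun x => 4 / (√(x + c) * (1 + √(x + c))))
      (-(2 * (1 + 2 * √(x + c))) / (√(x + c) ^ 3 * (1 + √(x + c)) ^ 2)) x := by
  have hS : 0 < √(x + c) := Real.sqrt_pos.2 (by linarith)
  have h1 : HasDerivAt (fun x => √(x + c)) (1 / (2 * √(x + c))) x := by
    have := ((hasDerivAt_id x).add_const c).sqrt (by simp; linarith)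
    simpa using this
  have h2 := (hasDerivAt_const x (4 : ℝ)).div (h1.mul (h1.const_add 1)) (mul_pos hS (by positivity)).ne'
  refine h2.congr_deriv ?_
  simp only [Pi.mul_apply]
  field_simp; ring

set_option maxHeartbeats 1000000 in
/-- The twisted inequality with explicit weights. -/
theorem twisted_explicit {φ : ℂ → ℝ} {α : ℂ → ℂ} (hφ : ContDiff ℝ 2 φ) (hα : ContDiff ℝ 2 α)
    (hc : HasCompactSupport α)
    (hsub : ∀ z ∈ tsupport α, 0 ≤ (dz (db fun z => (φ z : ℂ)) z).re) (a : ℂ) {c : ℝ} (hc0 : 0 < c)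
    (hc1 : c ≤ 1) :
    ∫ z, c / (‖z - a‖ ^ 2 + c) ^ 2 * ‖α z‖ ^ 2 * Real.exp (φ z) ≤
      ∫ z, (2 + 3 / √(‖z - a‖ ^ 2 + c)) * (2 + ‖z - a‖) ^ 8 * ‖db α z‖ ^ 2 * Real.exp (φ z) := by
  have hx0 : ∀ z : ℂ, 0 ≤ ‖z - a‖ ^ 2 := fun z => by positivity
  have hxc : ∀ z : ℂ, ‖z - a‖ ^ 2 + c ≠ 0 := fun z => by positivity
  have hxc1 : ∀ z : ℂ, ‖z - a‖ ^ 2 + (1 + c) ≠ 0 := fun z => by positivity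
  have hSp : ∀ z : ℂ, 0 < √(‖z - a‖ ^ 2 + c) := fun z => Real.sqrt_pos.2 (by positivity)
  have cx : ContDiff ℝ 2 (fun z : ℂ => ‖z - a‖ ^ 2) := (contDiff_id.sub contDiff_const).norm_sq ℝ
  set w : ℂ → ℝ := fun z => 2 + (Real.log (‖z - a‖ ^ 2 + (1 + c)) - Real.log (‖z - a‖ ^ 2 + c))
    with hw
  set ψ : ℂ → ℝ := fun z => 8 * Real.log (1 + √(‖z - a‖ ^ 2 + c)) with hψ
  have cw : ContDiff ℝ 2 w := contDiff_const.add
    (((cx.add contDiff_const).log hxc1).sub ((cx.add contDiff_const).log hxc))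
  have cψ : ContDiff ℝ 2 ψ := contDiff_const.mul
    ((contDiff_const.add ((cx.add contDiff_const).sqrt hxc)).log fun z => by
      have := hSp z; positivity)
  have hw2 : ∀ z, 2 ≤ w z := fun z => by
    have : Real.log (‖z - a‖ ^ 2 + c) ≤ Real.log (‖z - a‖ ^ 2 + (1 + c)) :=
      Real.log_le_log (by positivity) (by linarith)
    simp only [hw]; linarith
  have hwle : ∀ z, w z ≤ 2 + 2 / √(‖z - a‖ ^ 2 + c) := fun z => by
    have h1 := hSp z
    have h2 : √(‖z - a‖ ^ 2 + c) ^ 2 = ‖z - a‖ ^ 2 + c := Real.sq_sqrt (by positivity)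
    have h3 : Real.log (‖z - a‖ ^ 2 + (1 + c)) - Real.log (‖z - a‖ ^ 2 + c) ≤
        2 / √(‖z - a‖ ^ 2 + c) := by
      set S := √(‖z - a‖ ^ 2 + c)
      rw [← Real.log_div (hxc1 z) (hxc z), ← h2, show ‖z - a‖ ^ 2 + (1 + c) = S ^ 2 + 1 by linarith]
      have h4 : (S ^ 2 + 1) / S ^ 2 ≤ (1 + 1 / S) ^ 2 := by
        rw [div_le_iff₀ (by positivity)]
        have : (1 + 1 / S) ^ 2 * S ^ 2 = (S + 1) ^ 2 := by field_simp
        rw [this]; nlinarith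
      refine (Real.log_le_log (by positivity) h4).trans ?_
      rw [Real.log_pow]
      have := Real.log_le_sub_one_of_pos (x := 1 + 1 / S) (by positivity)
      have e : 2 / S = 2 * (1 / S) := by ring
      rw [e]; push_cast; linarith
    simp only [hw]; linarith
  have hk : Continuous fun z => c / (‖z - a‖ ^ 2 + c) ^ 2 :=
    continuous_const.div₀ (by fun_prop) fun z => pow_ne_zero _ (hxc z)
  have hm : Continuous fun z => 1 / √(‖z - a‖ ^ 2 + c) :=
    continuous_const.div₀ (by fun_prop) fun z => (hSp z).ne'
  have main := twisted_inequality (φ := fun z => φ z + ψ z) (w := w) (hφ.add cψ) cw hα hc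
    (fun z => by linarith [hw2 z]) hk hm ?_
  · have c1α := hα.continuous
    have c2 : Continuous (db α) := hα.db.continuous
    have cφ := hφ.continuous
    have cw' := cw.continuous
    have cψ' := cψ.continuous
    have cS : Continuous fun z => 3 / √(‖z - a‖ ^ 2 + c) :=
      continuous_const.div₀ (by fun_prop) fun z => (hSp z).ne'
    have supp : ∀ {β : ℂ → ℂ} {Z : ℂ → ℝ}, HasCompactSupport β → (∀ p, β p = 0 → Z p = 0) →
        HasCompactSupport Z := fun {β Z} hβ hZ =>
      hβ.mono fun z hz => by
        contrapose! hz
        simp only [Function.mem_support, not_not] at hz ⊢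
        exact hZ z hz
    have hexp : ∀ z, Real.exp (φ z + ψ z) = (1 + √(‖z - a‖ ^ 2 + c)) ^ 8 * Real.exp (φ z) := by
      intro z
      have h1 := hSp z
      rw [Real.exp_add, mul_comm]
      congr 1
      rw [hψ]
      simp only
      rw [show 8 * Real.log (1 + √(‖z - a‖ ^ 2 + c)) =
        Real.log ((1 + √(‖z - a‖ ^ 2 + c)) ^ 8) by rw [Real.log_pow]; norm_num,
        Real.exp_log (by positivity)]
    refine le_trans (integral_mono ?_ ?_ fun z => ?_) (main.trans (integral_mono ?_ ?_ fun z => ?_))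
    · exact Continuous.integrable_of_hasCompactSupport (by fun_prop)
        (supp hc fun p hp => by simp [hp])
    · exact Continuous.integrable_of_hasCompactSupport (by fun_prop)
        (supp hc fun p hp => by simp [hp])
    · simp only
      rw [hexp]
      have h1 := hSp z
      have h2 : 1 ≤ (1 + √(‖z - a‖ ^ 2 + c)) ^ 8 := one_le_pow₀ (by linarith)
      refine mul_le_mul_of_nonneg_left ?_ (by positivity)
      exact le_mul_of_one_le_left (Real.exp_pos _).le h2
    · exact Continuous.integrable_of_hasCompactSupport (by fun_prop)
        (supp hc.db fun p hp => by simp [hp])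
    · exact Continuous.integrable_of_hasCompactSupport (by fun_prop)
        (supp hc.db fun p hp => by simp [hp])
    · simp only
      rw [hexp]
      have h1 := hSp z
      have h3 : √(‖z - a‖ ^ 2 + c) ≤ 1 + ‖z - a‖ := by
        rw [Real.sqrt_le_left (by positivity)]
        nlinarith [norm_nonneg (z - a)]
      have h4 : (1 + √(‖z - a‖ ^ 2 + c)) ^ 8 ≤ (2 + ‖z - a‖) ^ 8 :=
        pow_le_pow_left₀ (by positivity) (by linarith) 8
      have h5 : w z + 1 / √(‖z - a‖ ^ 2 + c) ≤ 2 + 3 / √(‖z - a‖ ^ 2 + c) := by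
        have := hwle z
        have e : 3 / √(‖z - a‖ ^ 2 + c) = 2 / √(‖z - a‖ ^ 2 + c) + 1 / √(‖z - a‖ ^ 2 + c) := by ring
        linarith
      have h6 : 0 ≤ w z + 1 / √(‖z - a‖ ^ 2 + c) := by
        have := hw2 z; positivity
      calc (w z + 1 / √(‖z - a‖ ^ 2 + c)) * ‖db α z‖ ^ 2 *
            ((1 + √(‖z - a‖ ^ 2 + c)) ^ 8 * Real.exp (φ z))
          = ((w z + 1 / √(‖z - a‖ ^ 2 + c)) * (1 + √(‖z - a‖ ^ 2 + c)) ^ 8) *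
            (‖db α z‖ ^ 2 * Real.exp (φ z)) := by ring
        _ ≤ ((2 + 3 / √(‖z - a‖ ^ 2 + c)) * (2 + ‖z - a‖) ^ 8) *
            (‖db α z‖ ^ 2 * Real.exp (φ z)) := by
          refine mul_le_mul_of_nonneg_right ?_ (by positivity)
          exact mul_le_mul h5 h4 (by positivity) (h6.trans h5)
        _ = _ := by ring
  · intro z hz s t hs ht
    have h1 := hSp z
    have h2 : √(‖z - a‖ ^ 2 + c) ^ 2 = ‖z - a‖ ^ 2 + c := Real.sq_sqrt (by positivity)
    have kw : ∀ x : ℝ, 0 ≤ x → HasDerivAt (fun x => 2 + (Real.log (x + (1 + c)) - Real.log (x + c)))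
        (1 / (x + (1 + c)) - 1 / (x + c)) x := fun x hx => by
      have a1 := ((hasDerivAt_id x).add_const (1 + c)).log (by simp; positivity)
      have a2 := ((hasDerivAt_id x).add_const c).log (by simp; positivity)
      exact (a1.sub a2).const_add 2
    have kw1 : ∀ x : ℝ, 0 ≤ x → HasDerivAt (fun x => 1 / (x + (1 + c)) - 1 / (x + c))
        (-1 / (x + (1 + c)) ^ 2 - -1 / (x + c) ^ 2) x := fun x hx => by
      have a1 := ((hasDerivAt_id x).add_const (1 + c)).inv (by simp; positivity)
      have a2 := ((hasDerivAt_id x).add_const c).inv (by simp; positivity)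
      have := a1.sub a2
      simp only [one_div]
      exact this
    have d1 : dz (fun z => (w z : ℂ)) z = _ :=
      dz_radial (k := fun x => 2 + (Real.log (x + (1 + c)) - Real.log (x + c))) (kw _ (hx0 z))
    have d2 : dz (db fun z => (w z : ℂ)) z = _ :=
      dz_db_radial (k := fun x => 2 + (Real.log (x + (1 + c)) - Real.log (x + c))) kw (kw1 _ (hx0 z))
    have d3 : dz (db fun z => (ψ z : ℂ)) z = _ :=
      dz_db_radial (k := fun x => 8 * Real.log (1 + √(x + c))) (fun x hx => psi_hasDerivAt hc0 hx) (psi'_hasDerivAt hc0 (hx0 z))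
    have d4 : dz (db fun z => ((φ z + ψ z : ℝ) : ℂ)) z =
        dz (db fun z => (φ z : ℂ)) z + dz (db fun z => (ψ z : ℂ)) z := by
      have := dz_db_add hφ.ofReal cψ.ofReal z
      simp only [← Complex.ofReal_add] at this
      exact this
    rw [d4, Complex.add_re, d3, d2, d1, Complex.ofReal_re, Complex.ofReal_re]
    have wb := weight_bound h1 hc0 hc1 h2 (hw2 z) (hsub z hz)
    have e4 : √(‖z - a‖ ^ 2 + c) ^ 4 = (‖z - a‖ ^ 2 + c) ^ 2 :=
      (by ring : √(‖z - a‖ ^ 2 + c) ^ 4 = (√(‖z - a‖ ^ 2 + c) ^ 2) ^ 2).trans (by rw [h2])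
    rw [e4] at wb
    have wb2 := mul_le_mul_of_nonneg_right wb (sq_nonneg t)
    have am := two_mul_le_of_sq_le (A := ‖((1 / (‖z - a‖ ^ 2 + (1 + c)) - 1 / (‖z - a‖ ^ 2 + c) : ℝ) : ℂ) *
      starRingEnd ℂ (z - a)‖) (κ := 2 / (√(‖z - a‖ ^ 2 + c) * (1 + √(‖z - a‖ ^ 2 + c)) ^ 2))
      (m := 1 / √(‖z - a‖ ^ 2 + c)) (s := s) (t := t) (by positivity) (by positivity) ?_
    · nlinarith
    · rw [norm_mul, Complex.norm_real, RCLike.norm_conj, mul_pow, Real.norm_eq_abs, sq_abs]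
      have hx : ‖z - a‖ ^ 2 ≤ √(‖z - a‖ ^ 2 + c) ^ 2 := by linarith
      refine (mul_le_mul_of_nonneg_left hx (sq_nonneg _)).trans ?_
      rw [show ‖z - a‖ ^ 2 + (1 + c) = 1 + (‖z - a‖ ^ 2 + c) by ring, ← h2]
      rw [Real.sqrt_sq h1.le]
      generalize √(‖z - a‖ ^ 2 + c) = S at h1
      have e : (1 / (1 + S ^ 2) - 1 / S ^ 2) ^ 2 * S ^ 2 = 1 / (S ^ 2 * (1 + S ^ 2) ^ 2) := by
        field_simp; ring
      rw [e, div_mul_div_comm, div_le_div_iff₀ (by positivity) (by positivity)]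
      have h5 : (1 + S) ^ 2 ≤ 2 * (1 + S ^ 2) ^ 2 := by nlinarith [sq_nonneg (1 - S), sq_nonneg (S)]
      have := mul_le_mul_of_nonneg_left h5 (sq_nonneg S)
      nlinarith

theorem integrableOn_inv_norm (R : ℝ) : IntegrableOn (fun z : ℂ => ‖z‖⁻¹) (ball 0 R) := by
  have h := integrable_fun_norm_addHaar (volume : Measure ℂ) (f := (Iio R).indicator fun y : ℝ => y⁻¹)
  have e : (fun z : ℂ => (Iio R).indicator (fun y : ℝ => y⁻¹) ‖z‖) =
      (ball 0 R).indicator fun z : ℂ => ‖z‖⁻¹ := by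
    ext z
    by_cases hz : ‖z‖ < R
    · rw [indicator_of_mem (by exact hz), indicator_of_mem (by simpa using hz)]
    · rw [indicator_of_notMem (by exact hz), indicator_of_notMem (by simpa using hz)]
  rw [e, integrable_indicator_iff measurableSet_ball] at h
  rw [h, Complex.finrank_real_complex]
  have : IntegrableOn (fun _ : ℝ => (1 : ℝ)) (Ioo 0 R) := by
    simp
  rw [← integrable_indicator_iff measurableSet_Ioo] at this
  rw [← integrable_indicator_iff measurableSet_Ioi]
  refine this.congr (Eventually.of_forall fun y => ?_)
  by_cases h0 : 0 < y
  · by_cases hR : y < R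
    · simp [indicator, h0, hR, h0.ne']
    · simp [indicator, h0, hR]
  · simp [indicator, h0]

theorem locallyIntegrable_inv_norm_sub (a : ℂ) : LocallyIntegrable fun z : ℂ => ‖z - a‖⁻¹ := by
  have h0 : LocallyIntegrable fun z : ℂ => ‖z‖⁻¹ := by
    intro x
    refine ⟨ball 0 (‖x‖ + 1), isOpen_ball.mem_nhds (by simp), integrableOn_inv_norm _⟩
  intro x
  obtain ⟨U, hU, hi⟩ := h0 (x - a)
  have hc : Tendsto (fun z : ℂ => z - a) (nhds x) (nhds (x - a)) :=
    (continuous_id.sub continuous_const).tendsto x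
  refine ⟨_, hc hU, ?_⟩
  have mp := measurePreserving_sub_right (volume : Measure ℂ) a
  have := (mp.integrableOn_comp_preimage (measurableEmbedding_subRight a)
    (f := fun z : ℂ => ‖z‖⁻¹) (s := U)).2 hi
  exact this

/-- The weight in the basic pointwise estimate. -/
noncomputable def otW (a z : ℂ) : ℝ := (2 + 3 * ‖z - a‖⁻¹) * (2 + ‖z - a‖) ^ 8

theorem otW_pos (a z : ℂ) : 0 < otW a z := by unfold otW; positivity

theorem otW_measurable (a : ℂ) : Measurable (otW a) := by
  unfold otW; fun_prop

theorem integrable_otW_mul (a : ℂ) {g : ℂ → ℝ} (hg : Continuous g) (hc : HasCompactSupport g) :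
    Integrable fun z => otW a z * g z := by
  have h1 : Integrable fun z => (2 * (2 + ‖z - a‖) ^ 8) * g z :=
    Continuous.integrable_of_hasCompactSupport (by fun_prop) hc.mul_left
  have h2 : Integrable fun z => (3 * (2 + ‖z - a‖) ^ 8 * g z) • ‖z - a‖⁻¹ :=
    (locallyIntegrable_inv_norm_sub a).integrable_smul_left_of_hasCompactSupport
      (by fun_prop) hc.mul_left
  refine (h1.add h2).congr (Eventually.of_forall fun z => ?_)
  simp only [Pi.add_apply, smul_eq_mul, otW]; ring

theorem basic_estimate_smooth {φ : ℂ → ℝ} {α : ℂ → ℂ} (hφ : ContDiff ℝ 2 φ) (hα : ContDiff ℝ 2 α)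
    (hc : HasCompactSupport α)
    (hsub : ∀ z ∈ tsupport α, 0 ≤ (dz (db fun z => (φ z : ℂ)) z).re) (a : ℂ) :
    Real.pi / 4 * (‖α a‖ ^ 2 * Real.exp (φ a)) ≤
      ∫ z, otW a z * (‖db α z‖ ^ 2 * Real.exp (φ z)) := by
  have cα := hα.continuous
  have cb : Continuous (db α) := hα.db.continuous
  have cφ := hφ.continuous
  have sg : HasCompactSupport fun z => ‖db α z‖ ^ 2 * Real.exp (φ z) := hc.db.mono fun z hz => by
    contrapose! hz
    simp only [Function.mem_support, not_not] at hz ⊢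
    simp [hz]
  have sf : HasCompactSupport fun z => ‖α z‖ ^ 2 * Real.exp (φ z) := hc.mono fun z hz => by
    contrapose! hz
    simp only [Function.mem_support, not_not] at hz ⊢
    simp [hz]
  have ig := integrable_otW_mul a (by fun_prop) sg
  set f : ℂ → ℝ := fun z => ‖α z‖ ^ 2 * Real.exp (φ z) with hf
  have f0 : ∀ z, 0 ≤ f z := fun z => by positivity
  have cf : Continuous f := by fun_prop
  have step : ∀ c : ℝ, 0 < c → c ≤ 1 → ∫ z, c / (‖z - a‖ ^ 2 + c) ^ 2 * f z ≤
      ∫ z, otW a z * (‖db α z‖ ^ 2 * Real.exp (φ z)) := by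
    intro c hc0 hc1
    refine le_trans (le_of_eq ?_) ((twisted_explicit hφ hα hc hsub a hc0 hc1).trans ?_)
    · congr 1; ext z; rw [hf]; ring
    · refine integral_mono_of_nonneg (Eventually.of_forall fun z => by positivity) ig ?_
      have : ∀ᵐ z : ℂ, z ≠ a := by simp [ae_iff]
      filter_upwards [this] with z hz
      have h1 : 0 < ‖z - a‖ := norm_pos_iff.2 (sub_ne_zero.2 hz)
      have h2 : ‖z - a‖ ≤ √(‖z - a‖ ^ 2 + c) := Real.le_sqrt_of_sq_le (by linarith)
      have h3 : 3 / √(‖z - a‖ ^ 2 + c) ≤ 3 * ‖z - a‖⁻¹ := by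
        rw [div_eq_mul_inv]
        exact mul_le_mul_of_nonneg_left (inv_anti₀ h1 h2) (by norm_num)
      simp only [otW]
      rw [mul_assoc _ (‖db α z‖ ^ 2)]
      refine mul_le_mul_of_nonneg_right ?_ (by positivity)
      exact mul_le_mul_of_nonneg_right (by linarith) (by positivity)
  refine le_of_forall_lt fun b hb => ?_
  obtain ⟨b', hb1, hb2⟩ := exists_between hb
  have hb' : b' / (Real.pi / 4) < f a := by
    rw [div_lt_iff₀ (by positivity)]; rw [mul_comm]; exact hb2
  by_cases hb0 : b' < 0
  · refine hb1.trans (hb0.trans_le (integral_nonneg fun z => ?_))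
    exact mul_nonneg (otW_pos a z).le (by positivity)
  push Not at hb0
  obtain ⟨ε, hε, hball⟩ := Metric.mem_nhds_iff.1 (cf.continuousAt.eventually (lt_mem_nhds hb'))
  obtain ⟨δ, hδ0, hδε, hδ1⟩ : ∃ δ : ℝ, 0 < δ ∧ δ ≤ ε ∧ δ ≤ 1 :=
    ⟨min ε 1, by positivity, min_le_left _ _, min_le_right _ _⟩
  refine hb1.trans_le (le_trans ?_ (step (δ ^ 2) (by positivity) (pow_le_one₀ hδ0.le hδ1)))
  have cp : Continuous fun z => δ ^ 2 / (‖z - a‖ ^ 2 + δ ^ 2) ^ 2 :=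
    continuous_const.div₀ (by fun_prop) fun z => by positivity
  have hi : Integrable fun z => δ ^ 2 / (‖z - a‖ ^ 2 + δ ^ 2) ^ 2 * f z :=
    Continuous.integrable_of_hasCompactSupport (by fun_prop) sf.mul_left
  refine le_trans ?_ (setIntegral_le_integral (s := ball a δ) hi
    (Eventually.of_forall fun z => by have := f0 z; positivity))
  have hle : ∀ z ∈ ball a δ, b' / (Real.pi / 4) / (4 * δ ^ 2) ≤
      δ ^ 2 / (‖z - a‖ ^ 2 + δ ^ 2) ^ 2 * f z := by
    intro z hz
    have h1 : b' / (Real.pi / 4) < f z := hball (ball_subset_ball hδε hz)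
    have h2 : ‖z - a‖ < δ := by simpa [dist_eq_norm] using hz
    have h3 : ‖z - a‖ ^ 2 ≤ δ ^ 2 := pow_le_pow_left₀ (norm_nonneg _) h2.le 2
    have h4 : 1 / (4 * δ ^ 2) ≤ δ ^ 2 / (‖z - a‖ ^ 2 + δ ^ 2) ^ 2 := by
      rw [div_le_div_iff₀ (by positivity) (by positivity)]
      have : (‖z - a‖ ^ 2 + δ ^ 2) ^ 2 ≤ (2 * δ ^ 2) ^ 2 :=
        pow_le_pow_left₀ (by positivity) (by linarith) 2
      nlinarith
    rw [div_eq_mul_one_div, mul_comm]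
    exact mul_le_mul h4 h1.le (by positivity) (by positivity)
  have := setIntegral_mono_on (s := ball a δ) (μ := volume)
    (f := fun _ => b' / (Real.pi / 4) / (4 * δ ^ 2)) (integrableOn_const (by
      exact measure_ball_lt_top.ne)) hi.integrableOn measurableSet_ball hle
  refine le_trans (le_of_eq ?_) this
  rw [setIntegral_const, Measure.real, Complex.volume_ball]
  simp only [ENNReal.toReal_mul, ENNReal.toReal_pow, ENNReal.toReal_ofReal hδ0.le, smul_eq_mul]
  have : ((NNReal.pi : ENNReal)).toReal = Real.pi := by simp
  rw [this]
  have := Real.pi_pos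
  field_simp

/-- The basic pointwise estimate for locally bounded subharmonic weights. -/
theorem basic_estimate {φ : ℂ → ℝ} {α : ℂ → ℂ} {D : Set ℂ} (hD : IsOpen D) (hφ : RSub φ D)
    (hα : ContDiff ℝ 2 α) (hc : HasCompactSupport α) (hs : tsupport α ⊆ D) (a : ℂ) :
    Real.pi / 4 * (‖α a‖ ^ 2 * Real.exp (φ a)) ≤
      ∫ z, otW a z * (‖db α z‖ ^ 2 * Real.exp (φ z)) := by
  by_cases ha : a ∈ tsupport α
  swap
  · rw [image_eq_zero_of_notMem_tsupport ha]
    simp only [norm_zero, ne_eq, OfNat.ofNat_ne_zero, not_false_eq_true, zero_pow, zero_mul,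
      mul_zero]
    exact integral_nonneg fun z => mul_nonneg (otW_pos a z).le (by positivity)
  obtain ⟨F, B, hF, hB, hlim, hlap⟩ := hφ.exists_smooth_approx hD hc hs
  have h1 : ∀ n, Real.pi / 4 * (‖α a‖ ^ 2 * Real.exp (F n a)) ≤
      ∫ z, otW a z * (‖db α z‖ ^ 2 * Real.exp (F n z)) := fun n =>
    basic_estimate_smooth (hF n) hα hc (fun z hz => by
      rw [dz_db_ofReal (hF n), Complex.ofReal_re]
      exact mul_nonneg (by norm_num) (hlap n z hz)) a
  have l1 : Tendsto (fun n => Real.pi / 4 * (‖α a‖ ^ 2 * Real.exp (F n a))) atTop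
      (nhds (Real.pi / 4 * (‖α a‖ ^ 2 * Real.exp (φ a)))) :=
    (((Real.continuous_exp.tendsto _).comp (hlim a ha)).const_mul _).const_mul _
  have cb : Continuous (db α) := hα.db.continuous
  have z0 : ∀ z, z ∉ tsupport α → db α z = 0 := fun z hz =>
    image_eq_zero_of_notMem_tsupport fun h => hz (tsupport_db_subset α h)
  have sg : HasCompactSupport fun z => ‖db α z‖ ^ 2 * Real.exp B := hc.db.mono fun z hz => by
    contrapose! hz
    simp only [Function.mem_support, not_not] at hz ⊢
    simp [hz]
  have l2 : Tendsto (fun n => ∫ z, otW a z * (‖db α z‖ ^ 2 * Real.exp (F n z))) atTop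
      (nhds (∫ z, otW a z * (‖db α z‖ ^ 2 * Real.exp (φ z)))) := by
    refine tendsto_integral_of_dominated_convergence
      (fun z => otW a z * (‖db α z‖ ^ 2 * Real.exp B)) (fun n => ?_)
      (integrable_otW_mul a (by fun_prop) sg) (fun n => Eventually.of_forall fun z => ?_)
      (Eventually.of_forall fun z => ?_)
    · have := (hF n).continuous
      have h2 : Continuous fun z => ‖db α z‖ ^ 2 * Real.exp (F n z) := by fun_prop
      exact ((otW_measurable a).mul h2.measurable).aestronglyMeasurable
    · rw [Real.norm_eq_abs, abs_of_nonneg (mul_nonneg (otW_pos a z).le (by positivity))]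
      refine mul_le_mul_of_nonneg_left ?_ (otW_pos a z).le
      by_cases hz : z ∈ tsupport α
      · exact mul_le_mul_of_nonneg_left (Real.exp_le_exp.2 ((le_abs_self _).trans (hB n z hz)))
          (by positivity)
      · simp [z0 z hz]
    · by_cases hz : z ∈ tsupport α
      · exact (((Real.continuous_exp.tendsto _).comp (hlim z hz)).const_mul _).const_mul _
      · simp [z0 z hz]
  exact le_of_tendsto_of_tendsto' l1 l2 h1

theorem conv_assoc_smul {k l : ℂ → ℝ} {f : ℂ → ℂ} (hk : Continuous k) (ck : HasCompactSupport k)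
    (hl : Continuous l) (cl : HasCompactSupport l) (hf : Integrable f) (z : ℂ) :
    convolution (convolution k l (ContinuousLinearMap.lsmul ℝ ℝ) volume) f
      (ContinuousLinearMap.lsmul ℝ ℝ) volume z =
    convolution k (convolution l f (ContinuousLinearMap.lsmul ℝ ℝ) volume)
      (ContinuousLinearMap.lsmul ℝ ℝ) volume z := by
  refine convolution_assoc _ _ _ _ (fun x y z => by simp [mul_smul]) hk.aestronglyMeasurable
    hl.aestronglyMeasurable hf.aestronglyMeasurable ?_ ?_ ?_
  · exact Eventually.of_forall (ck.convolutionExists_left _ hk hl.locallyIntegrable)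
  · exact Eventually.of_forall (cl.norm.convolutionExists_left _ hl.norm hf.norm.locallyIntegrable)
  · refine ck.norm.convolutionExists_left _ hk.norm ?_ z
    exact (cl.norm.continuous_convolution_left _ hl.norm hf.norm.locallyIntegrable).locallyIntegrable

theorem mollify_comm {δ ε : ℝ} (hδ : 0 < δ) (hε : 0 < ε) {f : ℂ → ℂ} (hf : Integrable f) (z : ℂ) :
    mollify ε (mollify δ f) z = mollify δ (mollify ε f) z := by
  simp only [mollify_eq_conv]
  rw [← conv_assoc_smul (mol_continuous ε) (mol_hasCompactSupport hε) (mol_continuous δ)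
    (mol_hasCompactSupport hδ) hf, ← conv_assoc_smul (mol_continuous δ) (mol_hasCompactSupport hδ)
    (mol_continuous ε) (mol_hasCompactSupport hε) hf]
  congr 1
  rw [← convolution_flip]
  congr 1
  ext; simp

theorem hasW_mollify {δ : ℝ} (hδ : 0 < δ) {f : ℂ → ℂ} (hf : LocallyIntegrable f) (z : ℂ) :
    db (mollify δ f) z = ∫ s, f s * db (fun t => (mol δ t : ℂ)) (z - s) := by
  have c1 : ContDiff ℝ 1 (mol δ) := mol_contDiff δ (n := 1)
  have h := (mol_hasCompactSupport hδ).hasFDerivAt_convolution_left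
    (ContinuousLinearMap.lsmul ℝ ℝ : ℝ →L[ℝ] ℂ →L[ℝ] ℂ) c1 hf z
  rw [← mollify_eq_conv] at h
  have hex := (((mol_hasCompactSupport hδ).fderiv ℝ).convolutionExists_left
    ((ContinuousLinearMap.lsmul ℝ ℝ : ℝ →L[ℝ] ℂ →L[ℝ] ℂ).precompL ℂ)
    (c1.continuous_fderiv (by norm_num)) hf z)
  have hv : ∀ v, fderiv ℝ (mollify δ f) z v = ∫ t, (fderiv ℝ (mol δ) t v : ℂ) * f (z - t) := by
    intro v
    rw [h.fderiv, convolution_def, ContinuousLinearMap.integral_apply hex]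
    congr 1
  have hi : ∀ v, Integrable fun t => (fderiv ℝ (mol δ) t v : ℂ) * f (z - t) := by
    intro v
    have := hex.apply_continuousLinearMap v
    exact this
  rw [db, hv, hv, ← integral_const_mul, ← integral_add (hi _) ((hi _).const_mul _),
    ← integral_const_mul, ← integral_sub_left_eq_self _ _ z]
  congr 1
  ext s
  have e : ∀ v, fderiv ℝ (fun t => (mol δ t : ℂ)) (z - s) v = (fderiv ℝ (mol δ) (z - s) v : ℂ) := by
    intro v
    have h3 : HasFDerivAt (fun t => (mol δ t : ℂ)) _ (z - s) :=
      Complex.ofRealCLM.hasFDerivAt.comp (z - s)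
        (c1.differentiable (by norm_num) (z - s)).hasFDerivAt
    rw [h3.fderiv]
    rfl
  rw [db, e, e, sub_sub_cancel]
  ring

theorem mollify_tendsto {g : ℂ → ℂ} (hg : Continuous g) (z : ℂ) :
    Tendsto (fun ε => mollify ε g z) (nhdsWithin 0 (Ioi 0)) (nhds (g z)) := by
  rw [Metric.tendsto_nhds]
  intro η hη
  obtain ⟨d, hd, h⟩ := Metric.continuous_iff.1 hg z (η / 2) (half_pos hη)
  filter_upwards [Ioo_mem_nhdsGT hd] with ε hε
  have hi := mollify_integrable hε.1 hg.locallyIntegrable z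
  have h1 : mollify ε g z - g z = ∫ s, mol ε s • (g (z - s) - g z) := by
    have : ∫ s, mol ε s • g z = g z := by
      rw [integral_smul_const, mol_integral hε.1, one_smul]
    conv_lhs => rw [← this]
    rw [mollify, ← integral_sub hi ((mol_integrable hε.1).smul_const _)]
    simp only [smul_sub]
  rw [dist_eq_norm, h1]
  calc ‖∫ s, mol ε s • (g (z - s) - g z)‖ ≤ ∫ s, mol ε s * (η / 2) := by
        refine norm_integral_le_of_norm_le ((mol_integrable hε.1).mul_const (η / 2))
          (Eventually.of_forall fun s => ?_)
        rcases lt_or_ge ‖s‖ ε with hs | hs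
        · rw [norm_smul, Real.norm_of_nonneg (mol_nonneg ε s), ← dist_eq_norm]
          refine mul_le_mul_of_nonneg_left (h _ ?_).le (mol_nonneg ε s)
          rw [dist_eq_norm]
          simpa using hs.trans hε.2
        · simp [mol_eq_zero hε.1 hs]
    _ = η / 2 := by rw [integral_mul_const, mol_integral hε.1, one_mul]
    _ < η := half_lt_self hη

theorem weyl_local {U : Set ℂ} {f : ℂ → ℂ} (hf : Integrable f)
    (hw : ∀ α : ℂ → ℂ, ContDiff ℝ 2 α → HasCompactSupport α → tsupport α ⊆ U →
      ∫ z, f z * db α z = 0) {z₀ : ℂ} {R : ℝ} (hR : 0 < R) (hU : closedBall z₀ (3 * R) ⊆ U) :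
    ∃ H : ℂ → ℂ, DifferentiableOn ℂ H (ball z₀ R) ∧ ∀ᵐ z, z ∈ ball z₀ R → f z = H z := by
  have hol : ∀ δ, 0 < δ → δ ≤ R → DifferentiableOn ℂ (mollify δ f) (ball z₀ (2 * R)) := by
    intro δ hδ hδR z hz
    have hd : DifferentiableAt ℝ (mollify δ f) z :=
      (mollify_contDiff hδ hf.locallyIntegrable (n := 1)).differentiable (by norm_num) z
    have h0 : db (mollify δ f) z = 0 := by
      rw [hasW_mollify hδ hf.locallyIntegrable]
      have c2 : ContDiff ℝ 2 (fun t => (mol δ t : ℂ)) := (mol_contDiff δ (n := 2)).ofReal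
      have hα : ContDiff ℝ 2 (fun s => (mol δ (z - s) : ℂ)) :=
        c2.comp (contDiff_const.sub contDiff_id)
      have hsupp : tsupport (fun s => (mol δ (z - s) : ℂ)) ⊆ closedBall z δ := by
        refine closure_minimal (fun s hs => ?_) isClosed_closedBall
        by_contra hc
        rw [mem_closedBall, not_le, dist_comm, dist_eq_norm] at hc
        exact hs (by simp [mol_eq_zero hδ hc.le])
      have hα0 := hw _ hα ((isCompact_closedBall z δ).of_isClosed_subset (isClosed_tsupport _) hsupp)
        (hsupp.trans ((closedBall_subset_closedBall' (by
          rw [mem_ball] at hz; linarith)).trans hU))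
      have e : ∀ s, db (fun s => (mol δ (z - s) : ℂ)) s = - db (fun t => (mol δ t : ℂ)) (z - s) := by
        intro s
        have hd : DifferentiableAt ℝ (fun t => (mol δ t : ℂ)) (z - s) :=
          c2.differentiable (by norm_num) _
        have h1 : HasFDerivAt (𝕜 := ℝ) (fun s : ℂ => z - s) (-ContinuousLinearMap.id ℝ ℂ) s :=
          (hasFDerivAt_id s).const_sub z
        have h2 := (hd.hasFDerivAt.comp s h1).fderiv
        have h3 : ((fun t => (mol δ t : ℂ)) ∘ fun s => z - s) = fun s => (mol δ (z - s) : ℂ) := rfl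
        rw [h3] at h2
        rw [db, h2, db]
        simp; ring
      simp only [e, mul_neg, integral_neg, neg_eq_zero] at hα0
      exact hα0
    have := hd.hasW
    rw [h0] at this
    exact this.hasDerivAt.differentiableAt.differentiableWithinAt
  have mean : ∀ δ ε, 0 < δ → δ ≤ R → 0 < ε → ε ≤ R → ∀ z ∈ ball z₀ R,
      mollify ε (mollify δ f) z = mollify δ f z := by
    intro δ ε hδ hδR hε hεR z hz
    refine mollify_eq_of_mean hε
      (mollify_contDiff hδ hf.locallyIntegrable (n := 0)).continuous.locallyIntegrable
      fun r hr hrε => ?_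
    refine circleAverage_of_differentiable_on_off_countable countable_empty ?_ ?_
    · refine (hol δ hδ hδR).continuousOn.mono (closedBall_subset_ball' ?_)
      rw [mem_ball] at hz; rw [abs_of_pos hr]; linarith
    · intro w hw
      refine (hol δ hδ hδR).differentiableAt (isOpen_ball.mem_nhds ?_)
      have := hw.1
      rw [mem_ball] at hz this ⊢
      rw [abs_of_pos hr] at this
      linarith [dist_triangle w z z₀]
  have indep : ∀ ε, 0 < ε → ε ≤ R → ∀ z ∈ ball z₀ R, mollify ε f z = mollify R f z := by
    intro ε hε hεR z hz
    rw [← mean ε R hε hεR hR le_rfl z hz, mollify_comm hε hR hf, mean R ε hR le_rfl hε hεR z hz]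
  refine ⟨mollify R f, (hol R hR le_rfl).mono (ball_subset_ball (by linarith)), ?_⟩
  set H := mollify R f with hH
  have cH : Continuous H := (mollify_contDiff hR hf.locallyIntegrable (n := 0)).continuous
  have := isOpen_ball.ae_eq_zero_of_integral_contDiff_smul_eq_zero (U := ball z₀ R)
    (μ := volume) (f := fun z => f z - H z)
    ((hf.locallyIntegrable.sub cH.locallyIntegrable).locallyIntegrableOn _) ?_
  · filter_upwards [this] with z hz hzb
    exact sub_eq_zero.1 (hz hzb)
  intro τ hτ cτ sτ
  have hτc := hτ.continuous
  set k : ℂ → ℝ := fun z => τ (-z) with hk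
  have ck : Continuous k := hτc.comp continuous_neg
  have sk : HasCompactSupport k := cτ.comp_homeomorph (Homeomorph.neg ℂ)
  have iH : Integrable fun z => τ z • H z :=
    Continuous.integrable_of_hasCompactSupport (by fun_prop) cτ.smul_right
  have if' : Integrable fun z => τ z • f z :=
    hf.locallyIntegrable.integrable_smul_left_of_hasCompactSupport hτc cτ
  simp only [smul_sub]
  rw [integral_sub if' iH, sub_eq_zero]
  set g := convolution k f (ContinuousLinearMap.lsmul ℝ ℝ) volume with hg
  have cg : Continuous g := sk.continuous_convolution_left _ ck hf.locallyIntegrable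
  have ev : ∀ F : ℂ → ℂ, convolution k F (ContinuousLinearMap.lsmul ℝ ℝ) volume 0 =
      ∫ z, τ z • F z := by
    intro F
    rw [convolution_def, ← integral_neg_eq_self]
    simp [hk]
  have h1 : Tendsto (fun ε => mollify ε g 0) (nhdsWithin 0 (Ioi 0)) (nhds (∫ z, τ z • f z)) := by
    rw [← ev f]; exact mollify_tendsto cg 0
  refine tendsto_nhds_unique h1 (tendsto_const_nhds.congr' ?_)
  filter_upwards [Ioo_mem_nhdsGT hR] with ε hε
  rw [mollify_eq_conv, hg, ← conv_assoc_smul (mol_continuous ε) (mol_hasCompactSupport hε.1) ck sk hf]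
  have sw : convolution (mol ε) k (ContinuousLinearMap.lsmul ℝ ℝ) volume =
      convolution k (mol ε) (ContinuousLinearMap.lsmul ℝ ℝ) volume := by
    rw [← convolution_flip]
    congr 1
    ext; simp
  rw [sw, conv_assoc_smul ck sk (mol_continuous ε) (mol_hasCompactSupport hε.1) hf,
    ← mollify_eq_conv, ev]
  congr 1
  ext z
  by_cases hz : z ∈ tsupport τ
  · rw [indep ε hε.1 hε.2.le z (sτ hz)]
  · simp [image_eq_zero_of_notMem_tsupport hz]

/-- Weyl's lemma for `∂̄`. -/
theorem weyl {D : Set ℂ} (hD : IsOpen D) {h : ℂ → ℂ} (hl : LocallyIntegrableOn h D)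
    (hw : ∀ α : ℂ → ℂ, ContDiff ℝ 2 α → HasCompactSupport α → tsupport α ⊆ D →
      ∫ z, h z * db α z = 0) :
    ∃ H : ℂ → ℂ, DifferentiableOn ℂ H D ∧ ∀ᵐ z, z ∈ D → h z = H z := by
  have loc : ∀ z₀ ∈ D, ∃ R > 0, ∃ H : ℂ → ℂ, ball z₀ R ⊆ D ∧ DifferentiableOn ℂ H (ball z₀ R) ∧
      ∀ᵐ z, z ∈ ball z₀ R → h z = H z := by
    intro z₀ hz₀
    obtain ⟨r, hr, hrD⟩ := Metric.isOpen_iff.1 hD z₀ hz₀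
    have hK : closedBall z₀ (r / 2) ⊆ D := (closedBall_subset_ball (half_lt_self hr)).trans hrD
    have hf : Integrable ((closedBall z₀ (r / 2)).indicator h) := by
      rw [integrable_indicator_iff measurableSet_closedBall]
      exact hl.integrableOn_compact_subset hK (isCompact_closedBall _ _)
    have hb : ball z₀ (r / 7) ⊆ closedBall z₀ (r / 2) :=
      (ball_subset_ball (by linarith)).trans ball_subset_closedBall
    have hw' : ∀ α : ℂ → ℂ, ContDiff ℝ 2 α → HasCompactSupport α →
        tsupport α ⊆ closedBall z₀ (r / 2) →
        ∫ z, (closedBall z₀ (r / 2)).indicator h z * db α z = 0 := by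
      intro α h1 h2 h3
      rw [← hw α h1 h2 (h3.trans hK)]
      congr 1
      ext z
      by_cases hz : z ∈ closedBall z₀ (r / 2)
      · rw [indicator_of_mem hz]
      · rw [image_eq_zero_of_notMem_tsupport (f := db α) fun h => hz (h3 (tsupport_db_subset α h))]
        simp
    obtain ⟨H, hH, hae⟩ := weyl_local (U := closedBall z₀ (r / 2)) hf hw'
      (R := r / 7) (by positivity) (z₀ := z₀) (closedBall_subset_closedBall (by linarith))
    refine ⟨r / 7, by positivity, H, hb.trans hK, hH, ?_⟩
    filter_upwards [hae] with z hz hzb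
    rw [← hz hzb, indicator_of_mem (hb hzb)]
  choose! R hR H hb hH hae using loc
  have agree : ∀ z₁ ∈ D, ∀ z₂ ∈ D, EqOn (H z₁) (H z₂) (ball z₁ (R z₁) ∩ ball z₂ (R z₂)) := by
    intro z₁ h1 z₂ h2
    refine Measure.eqOn_open_of_ae_eq (μ := volume) ?_ (isOpen_ball.inter isOpen_ball)
      ((hH z₁ h1).continuousOn.mono inter_subset_left)
      ((hH z₂ h2).continuousOn.mono inter_subset_right)
    rw [EventuallyEq, ae_restrict_iff' (measurableSet_ball.inter measurableSet_ball)]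
    filter_upwards [hae z₁ h1, hae z₂ h2] with z a1 a2 hz
    rw [← a1 hz.1, a2 hz.2]
  have eq : ∀ z₀ ∈ D, EqOn (fun z => H z z) (H z₀) (ball z₀ (R z₀)) := fun z₀ h0 z hz =>
    agree z (hb z₀ h0 hz) z₀ h0 ⟨mem_ball_self (hR z (hb z₀ h0 hz)), hz⟩
  refine ⟨fun z => H z z, fun z hz => ?_, ?_⟩
  · have h1 := (hH z hz).differentiableAt (ball_mem_nhds z (hR z hz))
    refine (h1.congr_of_eventuallyEq ?_).differentiableWithinAt
    filter_upwards [ball_mem_nhds z (hR z hz)] with w hw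
    exact eq z hz hw
  · rw [ae_iff]
    refine measure_null_of_locally_null _ fun z hz => ?_
    simp only [Classical.not_imp] at hz
    refine ⟨_, inter_mem_nhdsWithin _ (ball_mem_nhds z (hR z hz.1)), ?_⟩
    refine measure_mono_null (fun w hw => ?_) (ae_iff.1 (hae z hz.1))
    obtain ⟨hw1, hw2⟩ := hw
    have hw1' : ¬ (w ∈ D → h w = H w w) := hw1
    intro hcon
    exact hw1' fun _ => (hcon hw2).trans (eq z hz.1 hw2).symm

theorem exists_dual_solution {V H : Type*} [AddCommGroup V] [Module ℂ V] [NormedAddCommGroup H]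
    [InnerProductSpace ℂ H] [CompleteSpace H] (T : V →ₗ[ℂ] H) (l : V →ₗ[ℂ] ℂ) {C : ℝ} (hC : 0 ≤ C)
    (h : ∀ x, ‖l x‖ ≤ C * ‖T x‖) : ∃ v : H, ‖v‖ ≤ C ∧ ∀ x, l x = inner ℂ v (T x) := by
  have hk : LinearMap.ker T ≤ LinearMap.ker l := by
    intro x hx
    have := h x
    rw [LinearMap.mem_ker.1 hx, norm_zero, mul_zero] at this
    exact norm_le_zero_iff.1 this
  let g : LinearMap.range T →ₗ[ℂ] ℂ :=
    ((LinearMap.ker T).liftQ l hk).comp T.quotKerEquivRange.symm.toLinearMap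
  have hg : ∀ x, g ⟨T x, x, rfl⟩ = l x := by
    intro x
    have : T.quotKerEquivRange.symm ⟨T x, x, rfl⟩ = (LinearMap.ker T).mkQ x := by
      rw [LinearEquiv.symm_apply_eq]; rfl
    simp only [g, LinearMap.comp_apply, LinearEquiv.coe_coe, this]
    rfl
  let G := g.mkContinuous C (by
    rintro ⟨_, x, rfl⟩
    rw [hg]; exact h x)
  obtain ⟨F, hF, hn⟩ := exists_extension_norm_eq _ G
  refine ⟨(InnerProductSpace.toDual ℂ H).symm F, ?_, fun x => ?_⟩
  · rw [LinearIsometryEquiv.norm_map, hn]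
    exact g.mkContinuous_norm_le hC _
  · rw [InnerProductSpace.toDual_symm_apply]
    have := hF ⟨T x, x, rfl⟩
    exact (hg x).symm.trans this.symm

theorem L2_norm_sq (f : Lp ℂ 2 (volume : Measure ℂ)) : ‖f‖ ^ 2 = ∫ z, ‖f z‖ ^ 2 := by
  rw [← inner_self_eq_norm_sq (𝕜 := ℂ) f, L2.inner_def, ← integral_re (L2.integrable_inner f f)]
  simp only [inner_self_eq_norm_sq]

/-- Compactly supported `C²` functions on `D`. -/
def testSpace (D : Set ℂ) : Submodule ℂ (ℂ → ℂ) where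
  carrier := {α | ContDiff ℝ 2 α ∧ HasCompactSupport α ∧ tsupport α ⊆ D}
  add_mem' := fun {f g} hf hg => ⟨hf.1.add hg.1, hf.2.1.add hg.2.1,
    (tsupport_add f g).trans (union_subset hf.2.2 hg.2.2)⟩
  zero_mem' := ⟨contDiff_const, HasCompactSupport.zero, by simp [tsupport_zero]⟩
  smul_mem' := fun c f hf => ⟨hf.1.const_smul c, hf.2.1.smul_left,
    (closure_mono (Function.support_const_smul_subset c f)).trans hf.2.2⟩

theorem db_add {f g : ℂ → ℂ} (hf : ContDiff ℝ 2 f) (hg : ContDiff ℝ 2 g) (z : ℂ) :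
    db (f + g) z = db f z + db g z :=
  (((hf.differentiable (by norm_num) z).hasW).add ((hg.differentiable (by norm_num) z).hasW)).db_eq

theorem db_smul {f : ℂ → ℂ} (hf : ContDiff ℝ 2 f) (c z : ℂ) :
    db (c • f) z = c • db f z := by
  have h := ((HasW.const c z).mul ((hf.differentiable (by norm_num) z).hasW)).db_eq
  simp only [zero_mul, zero_add] at h
  exact h

theorem memLp_two_weight {W : ℂ → ℝ} {α : ℂ → ℂ} {φ : ℂ → ℝ} {D : Set ℂ}
    (hφ : RSub φ D) (hα : α ∈ testSpace D) (a : ℂ) (hWm : Measurable W)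
    (hW : ∀ z ∈ D, W z ^ 2 = otW a z * Real.exp (φ z)) :
    MemLp (fun z => (W z : ℂ) * db α z) 2 volume := by
  have cdb : Continuous (db α) := (hα.1.of_le (by norm_num)).continuous_db
  have hm : AEStronglyMeasurable (fun z => (W z : ℂ) * db α z) volume :=
    ((Complex.measurable_ofReal.comp hWm).mul cdb.measurable).aestronglyMeasurable
  rw [memLp_two_iff_integrable_sq_norm hm]
  obtain ⟨B, hB⟩ := hφ.bdd _ hα.2.2 hα.2.1
  have sg : HasCompactSupport fun z => ‖db α z‖ ^ 2 * Real.exp B := by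
    have : HasCompactSupport fun z => ‖db α z‖ := (HasCompactSupport.db hα.2.1).norm
    exact (this.comp_left (g := fun x : ℝ => x ^ 2 * Real.exp B) (by simp))
  refine (integrable_otW_mul a (g := fun z => ‖db α z‖ ^ 2 * Real.exp B) (by fun_prop) sg).mono'
    (hm.norm.pow 2) (Eventually.of_forall fun z => ?_)
  rw [Real.norm_of_nonneg (by positivity), norm_mul, mul_pow, Complex.norm_real, Real.norm_eq_abs,
    sq_abs]
  by_cases hz : z ∈ tsupport α
  · rw [hW z (hα.2.2 hz), mul_assoc, mul_comm (Real.exp _)]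
    have := (le_abs_self _).trans (hB z hz)
    have := (otW_pos a z).le
    gcongr
  · rw [image_eq_zero_of_notMem_tsupport fun h => hz (tsupport_db_subset α h)]
    simp

theorem exists_weak_solution {φ : ℂ → ℝ} {D : Set ℂ} (hD : IsOpen D) (hφ : RSub φ D) (a : ℂ) :
    ∃ (v : Lp ℂ 2 (volume : Measure ℂ)) (W : ℂ → ℝ), Measurable W ∧
      (∀ z, 0 < W z) ∧ (∀ z ∈ D, W z ^ 2 = otW a z * Real.exp (φ z)) ∧
      ‖v‖ ^ 2 ≤ 4 / Real.pi * Real.exp (-φ a) ∧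
      ∀ α ∈ testSpace D, ∫ z, (starRingEnd ℂ (v z) * W z) * db α z = α a := by
  set Φ := D.indicator φ with hΦ
  have mΦ : Measurable Φ := measurable_indicator_of_usc hD.measurableSet hφ.usc
  set W : ℂ → ℝ := fun z => √(otW a z) * Real.exp (Φ z / 2) with hWdef
  have mW : Measurable W := ((otW_measurable a).sqrt).mul (mΦ.div_const 2).exp
  have hW : ∀ z ∈ D, W z ^ 2 = otW a z * Real.exp (φ z) := by
    intro z hz
    simp only [hWdef, mul_pow, Real.sq_sqrt (otW_pos a z).le, hΦ, indicator_of_mem hz,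
      ← Real.exp_nat_mul]
    congr 2; push_cast; ring
  have hmem := fun (α : testSpace D) => memLp_two_weight hφ α.2 a mW hW
  let T : testSpace D →ₗ[ℂ] Lp ℂ 2 (volume : Measure ℂ) :=
    { toFun := fun α => (hmem α).toLp _
      map_add' := by
        intro x y
        rw [← MemLp.toLp_add]
        refine MemLp.toLp_congr _ _ (Eventually.of_forall fun z => ?_)
        simp only [Submodule.coe_add, db_add x.2.1 y.2.1, Pi.add_apply, mul_add]
      map_smul' := by
        intro c x
        rw [RingHom.id_apply, ← MemLp.toLp_const_smul]
        refine MemLp.toLp_congr _ _ (Eventually.of_forall fun z => ?_)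
        simp only [Submodule.coe_smul, db_smul x.2.1, Pi.smul_apply, smul_eq_mul]
        ring }
  let l : testSpace D →ₗ[ℂ] ℂ :=
    { toFun := fun α => α.1 a
      map_add' := fun _ _ => rfl
      map_smul' := fun _ _ => rfl }
  have key : ∀ α, ‖l α‖ ≤ √(4 / Real.pi * Real.exp (-φ a)) * ‖T α‖ := by
    intro α
    have h1 := basic_estimate hD hφ α.2.1 α.2.2.1 α.2.2.2 a
    have h2 : ‖T α‖ ^ 2 = ∫ z, otW a z * (‖db α z‖ ^ 2 * Real.exp (φ z)) := by
      rw [L2_norm_sq]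
      refine integral_congr_ae ?_
      filter_upwards [(hmem α).coeFn_toLp] with z hz
      change ‖((hmem α).toLp _ : ℂ → ℂ) z‖ ^ 2 = _
      rw [hz, norm_mul, mul_pow, Complex.norm_real, Real.norm_eq_abs, sq_abs]
      by_cases hzs : z ∈ tsupport α.1
      · rw [hW z (α.2.2.2 hzs)]; ring
      · rw [image_eq_zero_of_notMem_tsupport fun h => hzs (tsupport_db_subset _ h)]
        simp
    rw [← h2] at h1
    have h3 : ‖l α‖ ^ 2 ≤ (4 / Real.pi * Real.exp (-φ a)) * ‖T α‖ ^ 2 := by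
      have : ‖l α‖ ^ 2 = (4 / Real.pi * Real.exp (-φ a)) *
          (Real.pi / 4 * (‖α.1 a‖ ^ 2 * Real.exp (φ a))) := by
        rw [Real.exp_neg]
        have := Real.pi_ne_zero
        have := (Real.exp_pos (φ a)).ne'
        field_simp
        rfl
      rw [this]
      exact mul_le_mul_of_nonneg_left h1 (by positivity)
    refine le_of_sq_le_sq ?_ (by positivity)
    rw [mul_pow, Real.sq_sqrt (by positivity)]
    exact h3
  obtain ⟨v, hv, hvT⟩ := exists_dual_solution T l (Real.sqrt_nonneg _) key
  refine ⟨v, W, mW, fun z => mul_pos (Real.sqrt_pos.2 (otW_pos a z)) (Real.exp_pos _), hW, ?_, ?_⟩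
  · exact (Real.le_sqrt (norm_nonneg _) (by positivity)).1 hv
  · intro α hα
    have := hvT ⟨α, hα⟩
    change α a = _ at this
    rw [this, L2.inner_def]
    refine integral_congr_ae ?_
    filter_upwards [(hmem ⟨α, hα⟩).coeFn_toLp] with z hz
    change _ = inner ℂ (v z) (((hmem ⟨α, hα⟩).toLp _ : ℂ → ℂ) z)
    rw [hz]
    simp only [RCLike.inner_apply]
    ring

theorem otW_mul_le (a z : ℂ) : ‖z - a‖ ^ 2 * otW a z ≤ 5 * (2 + ‖z - a‖) ^ 10 := by
  unfold otW
  set t := ‖z - a‖ with ht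
  have h0 : 0 ≤ t := norm_nonneg _
  have h1 : t ^ 2 * (2 + 3 * t⁻¹) ≤ 5 * (2 + t) ^ 2 := by
    rcases h0.eq_or_lt with h | h
    · rw [← h]; norm_num
    · have : t ^ 2 * (2 + 3 * t⁻¹) = 2 * t ^ 2 + 3 * t := by field_simp
      rw [this]; nlinarith
  calc t ^ 2 * ((2 + 3 * t⁻¹) * (2 + t) ^ 8) = (t ^ 2 * (2 + 3 * t⁻¹)) * (2 + t) ^ 8 := by ring
    _ ≤ (5 * (2 + t) ^ 2) * (2 + t) ^ 8 := by gcongr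
    _ = _ := by ring

theorem integral_deriv_bump_normSq (χ : ContDiffBump (0 : ℝ)) :
    ∫ s : ℂ, deriv χ (‖s‖ ^ 2) = -Real.pi := by
  have hχ : ContDiff ℝ 1 χ := χ.contDiff
  have hc := χ.hasCompactSupport
  have hcd : HasCompactSupport (deriv χ) := hc.deriv
  have cd : Continuous (deriv χ) := hχ.continuous_deriv (by norm_num)
  have h := integral_fun_norm_addHaar (volume : Measure ℂ) (fun y : ℝ => deriv χ (y ^ 2))
  have hsq : Tendsto (fun y : ℝ => y ^ 2) atTop atTop := tendsto_pow_atTop (by norm_num)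
  have hz : ∃ A : ℝ, 0 < A ∧ ∀ y, A ≤ y → χ (y ^ 2) = 0 ∧ deriv χ (y ^ 2) = 0 := by
    refine ⟨χ.rOut + 1, by linarith [χ.rOut_pos], fun y hy => ?_⟩
    have h1 : χ.rOut < y ^ 2 := by nlinarith [χ.rOut_pos]
    have : y ^ 2 ∉ tsupport χ := by
      rw [χ.tsupport_eq, mem_closedBall, Real.dist_eq, sub_zero, abs_of_nonneg (sq_nonneg y)]
      exact not_le.2 h1
    exact ⟨image_eq_zero_of_notMem_tsupport this,
      image_eq_zero_of_notMem_tsupport fun h => this (tsupport_deriv_subset (f := χ) h)⟩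
  obtain ⟨A, hA, hz⟩ := hz
  have hd : ∀ x : ℝ, HasDerivAt (fun y : ℝ => χ (y ^ 2) / 2) (x ^ (2 - 1) • deriv χ (x ^ 2)) x := by
    intro x
    have h1 := (hχ.differentiable (by norm_num) (x ^ 2)).hasDerivAt
    have := (HasDerivAt.comp (h₂ := χ) (h := fun y : ℝ => y ^ 2) x h1 (hasDerivAt_pow 2 x)).div_const 2
    refine HasDerivAt.congr_deriv this ?_
    simp only [smul_eq_mul]; push_cast; ring
  have hi : ∫ y in Ioi (0 : ℝ), y ^ (2 - 1) • deriv χ (y ^ 2) = 0 - χ (0 ^ 2) / 2 := by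
    refine integral_Ioi_of_hasDerivAt_of_tendsto' (f := fun y : ℝ => χ (y ^ 2) / 2)
      (fun x _ => hd x) ?_ ?_
    · refine Integrable.integrableOn (Continuous.integrable_of_hasCompactSupport (by fun_prop) ?_)
      refine HasCompactSupport.of_support_subset_isCompact (isCompact_closedBall (0 : ℝ) A) ?_
      intro y hy
      rw [mem_closedBall, Real.dist_eq, sub_zero]
      by_contra hc
      rw [not_le] at hc
      have := (hz |y| hc.le).2
      rw [sq_abs] at this
      exact hy (by simp [this])
    · refine tendsto_const_nhds.congr' ?_
      filter_upwards [eventually_ge_atTop A] with y hy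
      rw [(hz y hy).1]; simp
  rw [Complex.finrank_real_complex, hi] at h
  rw [h]
  have hb : (volume : Measure ℂ).real (ball 0 1) = Real.pi := by
    simp [Measure.real, Complex.volume_ball]
  have h0 : χ 0 = 1 := χ.one_of_mem_closedBall (by simp [χ.rIn_pos.le])
  rw [hb]
  norm_num [h0]
  ring

/-- Existence of holomorphic functions with prescribed value at `a` and weighted `L²` bounds. -/
theorem exists_holomorphic_weighted {φ : ℂ → ℝ} {D : Set ℂ} (hD : IsOpen D) (hφ : RSub φ D) {a : ℂ}
    (ha : a ∈ D) :
    ∃ h : ℂ → ℂ, DifferentiableOn ℂ h D ∧ h a = 1 ∧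
      IntegrableOn (fun z => ‖h z‖ ^ 2 * Real.exp (-φ z) * ((2 + ‖z - a‖) ^ 10)⁻¹) D ∧
      ∫ z in D, ‖h z‖ ^ 2 * Real.exp (-φ z) * ((2 + ‖z - a‖) ^ 10)⁻¹ ≤
        20 * Real.pi * Real.exp (-φ a) := by
  obtain ⟨v, W, mW, Wpos, hW, hv, hsol⟩ := exists_weak_solution hD hφ a
  set h0 : ℂ → ℂ := fun z => starRingEnd ℂ (v z) * W z * (z - a) with hh0
  have vm : AEStronglyMeasurable v volume := (Lp.aestronglyMeasurable v)
  have hn : ∀ z, ‖h0 z‖ = ‖v z‖ * (W z * ‖z - a‖) := by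
    intro z
    simp only [hh0, norm_mul, RCLike.norm_conj, Complex.norm_real, Real.norm_of_nonneg (Wpos z).le,
      mul_assoc]
  have hm0 : AEStronglyMeasurable h0 volume :=
    ((Complex.continuous_conj.comp_aestronglyMeasurable vm).mul
      (Complex.measurable_ofReal.comp mW).aestronglyMeasurable).mul
      (by fun_prop : Continuous fun z : ℂ => z - a).aestronglyMeasurable
  have hWb : ∀ z ∈ D, (W z * ‖z - a‖) ^ 2 ≤ 5 * (2 + ‖z - a‖) ^ 10 * Real.exp (φ z) := by
    intro z hz
    rw [mul_pow, hW z hz]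
    have := mul_le_mul_of_nonneg_right (otW_mul_le a z) (Real.exp_pos (φ z)).le
    linarith
  have hl : LocallyIntegrableOn h0 D := by
    rw [locallyIntegrableOn_iff hD.isLocallyClosed]
    intro K hK cK
    obtain ⟨B, hB⟩ := hφ.bdd K hK cK
    obtain ⟨A, hA⟩ := cK.exists_bound_of_continuousOn
      (f := fun z : ℂ => 5 * (2 + ‖z - a‖) ^ 10) (by fun_prop)
    have iv : IntegrableOn v K :=
      ((Lp.memLp v).locallyIntegrable (by norm_num)).integrableOn_isCompact cK
    refine (iv.norm.mul_const (√(A * Real.exp B))).mono' hm0.restrict ?_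
    rw [ae_restrict_iff' cK.measurableSet]
    refine Eventually.of_forall fun z hz => ?_
    rw [hn]
    refine mul_le_mul_of_nonneg_left ?_ (norm_nonneg _)
    refine Real.le_sqrt_of_sq_le ((hWb z (hK hz)).trans ?_)
    have h1 := (le_abs_self _).trans (hA z hz)
    have h2 := (le_abs_self _).trans (hB z hz)
    have h3 : 0 ≤ A := (norm_nonneg _).trans (hA z hz)
    gcongr
  obtain ⟨H, hH, hae⟩ := weyl hD hl (fun α h1 h2 h3 => by
    have hα : (fun z => (z - a) * α z) ∈ testSpace D := by
      refine ⟨by fun_prop, h2.mul_left, ?_⟩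
      exact (closure_mono (Function.support_mul_subset_right _ _)).trans h3
    have := hsol _ hα
    simp only [sub_self, zero_mul] at this
    rw [← this]
    congr 1
    ext z
    have hw := (((HasW.id z).sub (HasW.const a z)).mul
      ((h1.differentiable (by norm_num) z).hasW)).db_eq
    rw [hw, hh0]
    ring)
  have hHa : -(Real.pi : ℂ) * H a = 1 := by
    obtain ⟨R, hR, hRD⟩ := Metric.nhds_basis_closedBall.mem_iff.1 (hD.mem_nhds ha)
    let χ : ContDiffBump (0 : ℝ) := ⟨R ^ 2 / 2, R ^ 2, by positivity, half_lt_self (by positivity)⟩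
    have hχ : ContDiff ℝ 2 χ := χ.contDiff
    have hnot : ∀ z, z ∉ closedBall a R → ‖z - a‖ ^ 2 ∉ tsupport χ := by
      intro z hz
      rw [χ.tsupport_eq, mem_closedBall, Real.dist_eq, sub_zero, abs_of_nonneg (sq_nonneg _)]
      rw [mem_closedBall, dist_eq_norm] at hz
      exact fun h => hz (le_of_sq_le_sq h hR.le)
    set α : ℂ → ℂ := fun z => (χ (‖z - a‖ ^ 2) : ℂ) with hα
    set k : ℂ → ℝ := fun s => deriv χ (‖s‖ ^ 2) with hk
    have k0 : ∀ z, z ∉ closedBall a R → k (z - a) = 0 := fun z hz =>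
      image_eq_zero_of_notMem_tsupport (f := deriv χ)
        fun h => hnot z hz (tsupport_deriv_subset (f := χ) h)
    have sα : tsupport α ⊆ closedBall a R := by
      refine closure_minimal (fun z hz => ?_) isClosed_closedBall
      by_contra hc
      exact hz (by simp [hα, image_eq_zero_of_notMem_tsupport (hnot z hc)])
    have tα : α ∈ testSpace D := by
      refine ⟨ContDiff.ofReal ?_, (isCompact_closedBall a R).of_isClosed_subset
        (isClosed_tsupport _) sα, sα.trans hRD⟩
      exact hχ.comp ((contDiff_norm_sq ℝ).comp (contDiff_id.sub contDiff_const))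
    have h1 := hsol α tα
    have hα1 : α a = 1 := by
      have : χ 0 = 1 := χ.one_of_mem_closedBall (by simp [χ.rIn_pos.le])
      simp [hα, this]
    have hdb : ∀ z, db α z = k (z - a) * (z - a) := fun z =>
      (HasW.comp_real ((hχ.differentiable (by norm_num) _).hasDerivAt) (hasW_normSq a z)).db_eq
    have h2 : ∫ s, k s • H (s + a) = 1 := by
      rw [← hα1, ← h1, ← integral_sub_right_eq_self _ a]
      refine integral_congr_ae ?_
      filter_upwards [hae] with z hz
      rw [sub_add_cancel, hdb]
      by_cases hzR : z ∈ closedBall a R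
      · rw [← hz (hRD hzR), hh0, Complex.real_smul]; ring
      · rw [k0 z hzR]; simp
    have h_int : Integrable fun s => k s • H (s + a) := by
      by_contra hc
      rw [integral_undef hc] at h2
      exact zero_ne_one h2
    have hrad := (integral_radial_smul (fun s t hst => by simp only [hk, hst]) h_int).2
    have h3 : ∀ s, k s • Real.circleAverage (fun s => H (s + a)) 0 ‖s‖ = k s • H a := by
      intro s
      by_cases hs : ‖s‖ ≤ R
      · congr 1
        have hdiff : DifferentiableOn ℂ (fun s => H (s + a)) (closedBall 0 R) := by
          refine DifferentiableOn.comp (t := D) hH (by fun_prop) fun s hs => hRD ?_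
          rw [mem_closedBall, dist_eq_norm] at hs ⊢
          simpa using hs
        rw [circleAverage_of_differentiable_on_off_countable countable_empty, zero_add]
        · refine hdiff.continuousOn.mono (closedBall_subset_closedBall ?_)
          rwa [abs_norm]
        · intro w hw
          refine hdiff.differentiableAt (mem_of_superset (isOpen_ball.mem_nhds hw.1) ?_)
          refine ball_subset_closedBall.trans (closedBall_subset_closedBall ?_)
          rwa [abs_norm]
      · have := k0 (s + a) (by rw [mem_closedBall, dist_eq_norm]; simpa using hs)
        rw [add_sub_cancel_right] at this
        rw [this, zero_smul, zero_smul]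
    simp only [h3] at hrad
    rw [h2, integral_smul_const, integral_deriv_bump_normSq, Complex.real_smul] at hrad
    rw [hrad]; push_cast; rfl
  refine ⟨fun z => -(Real.pi : ℂ) * H z, hH.const_mul _, hHa, ?_⟩
  have hdom : ∀ᵐ z ∂(volume.restrict D),
      ‖-(Real.pi : ℂ) * H z‖ ^ 2 * Real.exp (-φ z) * ((2 + ‖z - a‖) ^ 10)⁻¹ ≤
      5 * Real.pi ^ 2 * ‖v z‖ ^ 2 := by
    rw [ae_restrict_iff' hD.measurableSet]
    filter_upwards [hae] with z hz hzD
    rw [← hz hzD, norm_mul, hn, norm_neg, Complex.norm_real, Real.norm_of_nonneg Real.pi_pos.le]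
    have := hWb z hzD
    have he : Real.exp (-φ z) = (Real.exp (φ z))⁻¹ := Real.exp_neg _
    rw [he, ← div_eq_mul_inv, ← div_eq_mul_inv, div_div, div_le_iff₀ (by positivity)]
    calc (Real.pi * (‖v z‖ * (W z * ‖z - a‖))) ^ 2
        = Real.pi ^ 2 * ‖v z‖ ^ 2 * (W z * ‖z - a‖) ^ 2 := by ring
      _ ≤ Real.pi ^ 2 * ‖v z‖ ^ 2 * (5 * (2 + ‖z - a‖) ^ 10 * Real.exp (φ z)) := by gcongr
      _ = _ := by ring
  have iv : Integrable (fun z => ‖v z‖ ^ 2) := (memLp_two_iff_integrable_sq_norm vm).1 (Lp.memLp v)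
  have iv' := iv.const_mul (5 * Real.pi ^ 2)
  have mφ : AEStronglyMeasurable (fun z => Real.exp (-φ z)) (volume.restrict D) := by
    have h1 := (measurable_indicator_of_usc hD.measurableSet hφ.usc).neg.exp
    refine h1.aestronglyMeasurable.congr ?_
    rw [EventuallyEq, ae_restrict_iff' hD.measurableSet]
    exact Eventually.of_forall fun z hz => by simp [indicator_of_mem hz]
  have h_int : IntegrableOn (fun z => ‖-(Real.pi : ℂ) * H z‖ ^ 2 * Real.exp (-φ z) *
      ((2 + ‖z - a‖) ^ 10)⁻¹) D := by
    refine iv'.integrableOn.mono' ?_ ?_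
    · refine ((((hH.const_mul _).continuousOn.norm.pow 2).aestronglyMeasurable
        hD.measurableSet).mul mφ).mul ?_
      exact (by fun_prop : Measurable fun z : ℂ => ((2 + ‖z - a‖) ^ 10)⁻¹).aestronglyMeasurable
    · filter_upwards [hdom] with z hz
      rwa [Real.norm_of_nonneg (by positivity)]
  refine ⟨h_int, (integral_mono_ae h_int iv'.integrableOn hdom).trans ?_⟩
  refine (setIntegral_le_integral iv' (Eventually.of_forall fun z => by positivity)).trans ?_
  rw [integral_const_mul, ← L2_norm_sq]
  calc 5 * Real.pi ^ 2 * ‖v‖ ^ 2 ≤ 5 * Real.pi ^ 2 * (4 / Real.pi * Real.exp (-φ a)) := by gcongr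
    _ = _ := by have := Real.pi_ne_zero; field_simp; ring

/-- Regularized logarithmic kernel. -/
noncomputable def lk (ε : ℝ) (s z : ℂ) : ℝ := (1 / 2) * Real.log (‖z - s‖ ^ 2 + ε)

theorem lk_comm (ε : ℝ) (s z : ℂ) : lk ε s z = lk ε z s := by
  unfold lk; rw [norm_sub_rev]

theorem lk_contDiff {ε : ℝ} (hε : 0 < ε) (s : ℂ) {n : WithTop ℕ∞} : ContDiff ℝ n (lk ε s) := by
  unfold lk
  refine contDiff_const.mul (ContDiff.log ?_ fun z => by positivity)
  exact ((contDiff_norm_sq ℝ).comp (contDiff_id.sub contDiff_const)).add contDiff_const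

theorem log_le_lk {ε : ℝ} (hε : 0 < ε) {s z : ℂ} (h : z ≠ s) : Real.log ‖z - s‖ ≤ lk ε s z := by
  have h1 : 0 < ‖z - s‖ := norm_pos_iff.2 (sub_ne_zero.2 h)
  have : Real.log ‖z - s‖ = 1 / 2 * Real.log (‖z - s‖ ^ 2) := by rw [Real.log_pow]; push_cast; ring
  rw [this, lk]
  gcongr
  linarith

theorem lk_le_log {ε : ℝ} (hε : 0 < ε) (h1 : ε ≤ 1) (s z : ℂ) : lk ε s z ≤ Real.log (‖z - s‖ + 1) := by
  have h0 := norm_nonneg (z - s)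
  have : Real.log (‖z - s‖ + 1) = 1 / 2 * Real.log ((‖z - s‖ + 1) ^ 2) := by
    rw [Real.log_pow]; push_cast; ring
  rw [this, lk]
  gcongr
  nlinarith

theorem abs_lk_le {ε : ℝ} (hε : 0 < ε) (h1 : ε ≤ 1) {s z : ℂ} (h : z ≠ s) :
    |lk ε s z| ≤ ‖z - s‖⁻¹ + ‖z - s‖ := by
  have hp : 0 < ‖z - s‖ := norm_pos_iff.2 (sub_ne_zero.2 h)
  rw [abs_le]
  constructor
  · refine le_trans ?_ (log_le_lk hε h)
    have := Real.log_le_sub_one_of_pos (inv_pos.2 hp)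
    rw [Real.log_inv] at this
    linarith
  · refine (lk_le_log hε h1 s z).trans ?_
    have := Real.log_le_sub_one_of_pos (by linarith : 0 < ‖z - s‖ + 1)
    have := inv_pos.2 hp
    linarith

theorem dz_db_lk {ε : ℝ} (hε : 0 < ε) (s z : ℂ) :
    dz (db fun z => (lk ε s z : ℂ)) z = ((ε / (2 * (‖z - s‖ ^ 2 + ε) ^ 2) : ℝ) : ℂ) := by
  have h := dz_db_radial (k := fun x => (1 / 2) * Real.log (x + ε)) (k1 := fun x => (1 / 2) * (x + ε)⁻¹)
    (k2 := (1 / 2) * (-(1 : ℝ) / (‖z - s‖ ^ 2 + ε) ^ 2)) (a := s) (p := z) (fun x hx => ?_) ?_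
  · refine h.trans ?_
    congr 1
    have : 0 < ‖z - s‖ ^ 2 + ε := by positivity
    field_simp
    ring
  · have h1 : HasDerivAt (fun x : ℝ => x + ε) 1 x := (hasDerivAt_id x).add_const ε
    have := (h1.log (by positivity)).const_mul (1 / 2 : ℝ)
    simpa using this
  · have h1 : HasDerivAt (fun x : ℝ => x + ε) 1 (‖z - s‖ ^ 2) := (hasDerivAt_id _).add_const ε
    exact (h1.fun_inv (by positivity)).const_mul (1 / 2 : ℝ)

/-- Convex combinations of regularized logarithmic kernels with poles in a disc. -/
def lkHull (M : ℝ) : Set (ℂ → ℝ) :=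
  convexHull ℝ {q | ∃ s ∈ closedBall (0 : ℂ) M, ∃ ε ∈ Ioc (0 : ℝ) 1, q = lk ε s}

theorem lkHull_induction {M : ℝ} {P : (ℂ → ℝ) → Prop}
    (base : ∀ s ∈ closedBall (0 : ℂ) M, ∀ ε, 0 < ε → ε ≤ 1 → P (lk ε s))
    (conv : ∀ p q a b, P p → P q → 0 ≤ a → 0 ≤ b → a + b = 1 → P (fun z => a * p z + b * q z))
    {p : ℂ → ℝ} (hp : p ∈ lkHull M) : P p := by
  have : lkHull M ⊆ {p | P p} := by
    refine convexHull_min ?_ ?_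
    · rintro _ ⟨s, hs, ε, hε, rfl⟩
      exact base s hs ε hε.1 hε.2
    · intro p hp q hq a b ha hb hab
      exact conv p q a b hp hq ha hb hab
  exact this hp

theorem lkHull_contDiff {M : ℝ} {p : ℂ → ℝ} (hp : p ∈ lkHull M) : ContDiff ℝ 2 p := by
  refine lkHull_induction (fun s _ ε hε _ => lk_contDiff hε s) (fun p q a b hp hq _ _ _ => ?_) hp
  fun_prop

theorem lkHull_laplacian {M : ℝ} {p : ℂ → ℝ} (hp : p ∈ lkHull M) :
    ∃ t : ℂ → ℝ, (∀ z, 0 ≤ t z) ∧ ∀ z, dz (db fun z => (p z : ℂ)) z = t z := by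
  have : ContDiff ℝ 2 p ∧ ∃ t : ℂ → ℝ, (∀ z, 0 ≤ t z) ∧ ∀ z, dz (db fun z => (p z : ℂ)) z = t z := by
    refine lkHull_induction (P := fun p => ContDiff ℝ 2 p ∧ ∃ t : ℂ → ℝ, (∀ z, 0 ≤ t z) ∧
      ∀ z, dz (db fun z => (p z : ℂ)) z = t z) (fun s _ ε hε _ => ⟨lk_contDiff hε s, ?_⟩) ?_ hp
    · exact ⟨_, fun z => by positivity, dz_db_lk hε s⟩
    · rintro p q a b ⟨hp, t, ht, htp⟩ ⟨hq, t', ht', htq⟩ ha hb -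
      refine ⟨by fun_prop, fun z => a * t z + b * t' z, fun z => ?_, fun z => ?_⟩
      · have := ht z; have := ht' z; positivity
      · have hp' := hp.ofReal
        have hq' := hq.ofReal
        have e : ∀ (c : ℝ) (f : ℂ → ℝ), ContDiff ℝ 2 f → dz (db fun z => (c : ℂ) * (f z : ℂ)) z =
            c * dz (db fun z => (f z : ℂ)) z := by
          intro c f hf
          have h1 : (db fun z => (c : ℂ) * (f z : ℂ)) = fun z => (c : ℂ) * db (fun z => (f z : ℂ)) z := by
            ext w
            exact db_smul hf.ofReal c w
          rw [h1]
          have := ((HasW.const (c : ℂ) z).mul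
            ((hf.ofReal.db.differentiable (by norm_num) z).hasW)).dz_eq
          rw [this]; ring
        push_cast
        rw [dz_db_add (contDiff_const.mul hp') (contDiff_const.mul hq'), e a p hp, e b q hq, htp, htq]
  exact this.2

theorem lkHull_le {M : ℝ} {p : ℂ → ℝ} (hp : p ∈ lkHull M) (z : ℂ) :
    p z ≤ Real.log (‖z‖ + M + 1) := by
  refine lkHull_induction (P := fun p => p z ≤ Real.log (‖z‖ + M + 1))
    (fun s hs ε hε h1 => (lk_le_log hε h1 s z).trans ?_) (fun p q a b hp hq ha hb hab => ?_) hp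
  · have := norm_sub_le z s
    rw [mem_closedBall_zero_iff] at hs
    have := norm_nonneg (z - s)
    gcongr; linarith
  · calc a * p z + b * q z ≤ a * Real.log (‖z‖ + M + 1) + b * Real.log (‖z‖ + M + 1) := by gcongr
      _ = _ := by rw [← add_mul, hab, one_mul]

theorem lkHull_integral_abs_le (M R : ℝ) :
    ∃ C, ∀ p ∈ lkHull M, ∫ z in ball (0 : ℂ) R, |p z| ≤ C := by
  refine ⟨∫ z in ball (0 : ℂ) (R + M), (‖z‖⁻¹ + ‖z‖), fun p hp => ?_⟩
  have hI : IntegrableOn (fun z : ℂ => ‖z‖⁻¹ + ‖z‖) (ball 0 (R + M)) := by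
    refine (integrableOn_inv_norm _).add ?_
    exact (continuous_norm.locallyIntegrable.integrableOn_isCompact
      (isCompact_closedBall (0 : ℂ) (R + M))).mono_set ball_subset_closedBall
  have h_int : ∀ q : ℂ → ℝ, ContDiff ℝ 2 q → IntegrableOn (fun z => |q z|) (ball (0 : ℂ) R) := by
    intro q hq
    exact (hq.continuous.abs.locallyIntegrable.integrableOn_isCompact
      (isCompact_closedBall (0 : ℂ) R)).mono_set ball_subset_closedBall
  refine (lkHull_induction (P := fun p => ContDiff ℝ 2 p ∧ ∫ z in ball (0 : ℂ) R, |p z| ≤ _)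
    (fun s hs ε hε h1 => ⟨lk_contDiff hε s, ?_⟩) ?_ hp).2
  · have htr : ∀ F : ℂ → ℝ, ∫ z in ball (0 : ℂ) R, F (z - s) = ∫ z in ball (-s) R, F z := by
      intro F
      rw [← integral_indicator measurableSet_ball, ← integral_indicator measurableSet_ball,
        ← integral_sub_right_eq_self ((ball (-s) R).indicator F) s]
      congr 1
      ext z
      have : z ∈ ball (0 : ℂ) R ↔ z - s ∈ ball (-s) R := by
        simp [mem_ball, dist_eq_norm]
      by_cases hz : z ∈ ball (0 : ℂ) R
      · rw [indicator_of_mem hz, indicator_of_mem (this.1 hz)]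
      · rw [indicator_of_notMem hz, indicator_of_notMem fun h => hz (this.2 h)]
    have hsub : ball (-s) R ⊆ ball 0 (R + M) := by
      refine ball_subset_ball' ?_
      rw [mem_closedBall_zero_iff] at hs
      simpa using hs
    have e := htr (fun z => |1 / 2 * Real.log (‖z‖ ^ 2 + ε)|)
    change ∫ z in ball (0 : ℂ) R, |lk ε s z| = _ at e
    rw [e]
    refine (integral_mono_ae ?_ (hI.mono_set hsub) ?_).trans
      (setIntegral_mono_set hI ?_ (LE.le.eventuallyLE hsub))
    · have : Continuous fun z : ℂ => |1 / 2 * Real.log (‖z‖ ^ 2 + ε)| := by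
        have h := (lk_contDiff hε 0 (n := 0)).continuous.abs
        simpa [lk] using h
      exact (this.locallyIntegrable.integrableOn_isCompact
        (isCompact_closedBall (-s) R)).mono_set ball_subset_closedBall
    · refine ae_restrict_of_ae ?_
      have : ∀ᵐ z : ℂ, z ≠ 0 := by
        simp [ae_iff]
      filter_upwards [this] with z hz
      have := abs_lk_le hε h1 hz
      simpa [lk] using this
    · exact Eventually.of_forall fun z => by positivity
  · rintro p q a b ⟨cp, hp⟩ ⟨cq, hq⟩ ha hb hab
    refine ⟨by fun_prop, ?_⟩
    calc ∫ z in ball (0 : ℂ) R, |a * p z + b * q z|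
        ≤ ∫ z in ball (0 : ℂ) R, (a * |p z| + b * |q z|) := by
          refine integral_mono (h_int _ (by fun_prop))
            (((h_int p cp).const_mul a).add ((h_int q cq).const_mul b)) fun z => ?_
          refine (abs_add_le _ _).trans ?_
          rw [abs_mul, abs_mul, abs_of_nonneg ha, abs_of_nonneg hb]
      _ = a * (∫ z in ball (0 : ℂ) R, |p z|) + b * ∫ z in ball (0 : ℂ) R, |q z| := by
          rw [integral_add ((h_int p cp).const_mul a) ((h_int q cq).const_mul b), integral_const_mul,
            integral_const_mul]
      _ ≤ _ := by
          refine (add_le_add (mul_le_mul_of_nonneg_left hp ha)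
            (mul_le_mul_of_nonneg_left hq hb)).trans_eq ?_
          rw [← add_mul, hab, one_mul]

/-- Sets on which hull members can be made arbitrarily negative. -/
def CapZero (K : Set ℂ) : Prop := ∃ M, ∀ L : ℝ, ∃ p ∈ lkHull M, ∀ z ∈ K, p z ≤ -L

theorem CapZero.mono {K K' : Set ℂ} (h : CapZero K) (hs : K' ⊆ K) : CapZero K' := by
  obtain ⟨M, hM⟩ := h
  refine ⟨M, fun L => ?_⟩
  obtain ⟨p, hp, h⟩ := hM L
  exact ⟨p, hp, fun z hz => h z (hs hz)⟩

/-- `μ` is a nonzero finite measure carried by `K` with logarithmic potential `≥ -L`. -/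
structure PotMeas (K : Set ℂ) (μ : Measure ℂ) (L : ℝ) : Prop where
  fin : IsFiniteMeasure μ
  supp : μ Kᶜ = 0
  ne : μ ≠ 0
  lb : ∀ s : ℂ, ∀ ε : ℝ, 0 < ε → ε ≤ 1 → -L ≤ ∫ z, lk ε s z ∂μ

open CompactlySupported in
theorem exists_measure_of_positive {X : Type*} [TopologicalSpace X] [T2Space X] [CompactSpace X]
    [MeasurableSpace X] [BorelSpace X] (l : C(X, ℝ) →ₗ[ℝ] ℝ) (hl : ∀ f : C(X, ℝ), 0 ≤ f → 0 ≤ l f) :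
    ∃ μ : Measure X, IsFiniteMeasure μ ∧ ∀ f : C(X, ℝ), l f = ∫ x, f x ∂μ := by
  let T : C_c(X, ℝ) →ₗ[ℝ] ℝ :=
    { toFun := fun f => l f.toContinuousMap
      map_add' := fun f g => by rw [← map_add]; rfl
      map_smul' := fun c f => by rw [RingHom.id_apply, ← map_smul]; rfl }
  let Λ : C_c(X, ℝ) →ₚ[ℝ] ℝ := PositiveLinearMap.mk₀ T fun f hf => hl _ fun x => hf x
  refine ⟨RealRMK.rieszMeasure Λ, inferInstance, fun f => ?_⟩
  have h := RealRMK.integral_rieszMeasure Λ (CompactlySupportedContinuousMap.continuousMapEquiv f)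
  exact h.symm

theorem exists_potMeas {K : Set ℂ} (hK : IsCompact K) (hc : ¬ CapZero K) :
    ∃ μ L, PotMeas K μ L := by
  obtain ⟨M₀, hM₀⟩ := hK.isBounded.subset_closedBall (0 : ℂ)
  set M := max M₀ 0 + 1 with hM
  have hM0 : 0 ≤ M := by positivity
  have hKM : ∀ z ∈ K, ‖z‖ ≤ M - 1 := fun z hz => by
    have := hM₀ hz
    rw [mem_closedBall_zero_iff] at this
    have := le_max_left M₀ 0
    linarith
  simp only [CapZero, not_exists, not_forall] at hc
  obtain ⟨L, hL⟩ := hc M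
  push Not at hL
  have : CompactSpace K := isCompact_iff_compactSpace.1 hK
  set A : Set C(K, ℝ) := {f | ∃ p ∈ lkHull M, ∀ x : K, f x = p x} with hA
  set B : Set C(K, ℝ) := {f | MapsTo f univ (Iio (-L))} with hB
  have hBo : IsOpen B := ContinuousMap.isOpen_setOfPred_mapsTo isCompact_univ isOpen_Iio
  have hBc : Convex ℝ B := by
    intro f hf g hg a b ha hb hab x hx
    have h1 : f x < -L := hf hx
    have h2 : g x < -L := hg hx
    exact (convex_Iio (-L)) h1 h2 ha hb hab
  have hAc : Convex ℝ A := by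
    rintro f ⟨p, hp, hfp⟩ g ⟨q, hq, hgq⟩ a b ha hb hab
    refine ⟨a • p + b • q, (convex_convexHull ℝ _) hp hq ha hb hab, fun x => ?_⟩
    simp [hfp, hgq]
  have hdis : Disjoint B A := by
    rw [Set.disjoint_left]
    rintro f hfB ⟨p, hp, hfp⟩
    obtain ⟨z, hz, hlt⟩ := hL p hp
    have h1 : f ⟨z, hz⟩ < -L := hfB (mem_univ _)
    rw [hfp] at h1
    exact absurd hlt (not_lt.2 h1.le)
  obtain ⟨φ, c, hφB, hφA⟩ := geometric_hahn_banach_open hBc hBo hAc hdis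
  have hcB : ∀ t, t < -L → ContinuousMap.const K t ∈ B := fun t ht x _ => ht
  have hpos : ∀ f : C(K, ℝ), 0 ≤ f → 0 ≤ φ f := by
    intro f hf
    by_contra hneg
    push Not at hneg
    set b := ContinuousMap.const K (-L - 1) with hb
    have key : ∀ t : ℝ, 0 ≤ t → φ b - t * φ f < c := by
      intro t ht
      have : b - t • f ∈ B := by
        intro x _
        have hfx : 0 ≤ f x := hf x
        have : 0 ≤ t * f x := mul_nonneg ht hfx
        change (b - t • f) x < -L
        simp only [hb, ContinuousMap.sub_apply, ContinuousMap.const_apply, ContinuousMap.smul_apply,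
          smul_eq_mul]
        linarith
      have := hφB _ this
      simpa using this
    have h1 := key (|c - φ b| / (-φ f)) (div_nonneg (abs_nonneg _) (by linarith))
    have : |c - φ b| / (-φ f) * φ f = -|c - φ b| := by
      rw [div_neg, neg_mul, div_mul_cancel₀ _ hneg.ne]
    rw [this] at h1
    linarith [le_abs_self (c - φ b)]
  obtain ⟨ν, hν, hrep⟩ := exists_measure_of_positive (φ : C(K, ℝ) →ₗ[ℝ] ℝ) hpos
  have hrep' : ∀ f : C(K, ℝ), φ f = ∫ x, f x ∂ν := hrep
  set m := ν.real univ with hm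
  have hconst : ∀ t, φ (ContinuousMap.const K t) = m * t := by
    intro t
    rw [hrep']
    simp [hm]
  have hlow : ∀ f ∈ A, -(L * m) ≤ φ f := by
    intro f hf
    refine le_trans ?_ (hφA f hf)
    refine le_of_forall_pos_le_add fun η hη => ?_
    have hm0 : 0 ≤ m := measureReal_nonneg
    have h0 : 0 < η / (m + 1) := by positivity
    have h1 := hφB _ (hcB (-L - η / (m + 1)) (by linarith))
    rw [hconst] at h1
    have : m * (η / (m + 1)) ≤ η := by
      rw [← mul_div_assoc, div_le_iff₀ (by positivity)]
      nlinarith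
    nlinarith
  have emb : MeasurableEmbedding (Subtype.val : K → ℂ) :=
    MeasurableEmbedding.subtype_coe hK.measurableSet
  refine ⟨ν.map Subtype.val, max (L * m) 0, ⟨inferInstance, ?_, ?_, ?_⟩⟩
  · rw [emb.map_apply]
    simp
  · intro h0
    have hν0 : ν = 0 := (Measure.map_eq_zero_iff emb.measurable.aemeasurable).1 h0
    have hφ0 : ∀ f, φ f = 0 := fun f => by rw [hrep', hν0]; simp
    have h1 := hφB _ (hcB (-L - 1) (by linarith))
    let f₀ : C(K, ℝ) := ⟨fun x => lk 1 0 x, (lk_contDiff one_pos 0 (n := 0)).continuous.comp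
      continuous_subtype_val⟩
    have h2 := hφA f₀ ⟨lk 1 0, subset_convexHull ℝ _ ⟨0, by simp [hM0], 1, by simp, rfl⟩,
      fun x => rfl⟩
    rw [hφ0] at h1 h2
    linarith
  · intro s ε hε h1
    rw [emb.integral_map]
    by_cases hs : ‖s‖ ≤ M
    · let f₀ : C(K, ℝ) := ⟨fun x => lk ε s x, (lk_contDiff hε s (n := 0)).continuous.comp
        continuous_subtype_val⟩
      have h2 := hlow f₀ ⟨lk ε s, subset_convexHull ℝ _ ⟨s, by simpa using hs, ε, ⟨hε, h1⟩, rfl⟩,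
        fun x => rfl⟩
      rw [hrep'] at h2
      exact (neg_le_neg (le_max_left _ _)).trans h2
    · refine (neg_nonpos.2 (le_max_right _ _)).trans (integral_nonneg fun x => ?_)
      have h2 : 1 ≤ ‖(x : ℂ) - s‖ := by
        have := hKM x x.2
        have := norm_sub_norm_le s (x : ℂ)
        rw [norm_sub_rev] at this
        linarith
      change 0 ≤ 1 / 2 * Real.log _
      have := Real.log_nonneg (x := ‖(x : ℂ) - s‖ ^ 2 + ε) (by nlinarith)
      positivity

theorem lk_radial_le {ε : ℝ} (hε : 0 < ε) (s t₀ z : ℂ) :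
    1 / 2 * Real.log ((‖z - t₀‖ - ‖s - t₀‖) ^ 2 + ε) ≤ lk ε s z := by
  unfold lk
  have h1 : |‖z - t₀‖ - ‖s - t₀‖| ≤ ‖z - s‖ := by
    have := abs_norm_sub_norm_le (z - t₀) (s - t₀)
    simpa using this
  have h2 : (‖z - t₀‖ - ‖s - t₀‖) ^ 2 ≤ ‖z - s‖ ^ 2 := by
    rw [← sq_abs (‖z - t₀‖ - ‖s - t₀‖)]
    gcongr
  have : Real.log ((‖z - t₀‖ - ‖s - t₀‖) ^ 2 + ε) ≤ Real.log (‖z - s‖ ^ 2 + ε) := by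
    apply Real.log_le_log (by positivity)
    linarith
  linarith

theorem lkHull_radial (M : ℝ) (t₀ : ℂ) {r₁ r₂ : ℝ} (hr : r₁ ≤ r₂) :
    ∃ C : ℝ, ∀ p ∈ lkHull M, ∃ q : ℝ → ℝ, Continuous q ∧ (∀ z, q ‖z - t₀‖ ≤ p z) ∧
      -C ≤ ∫ x in r₁..r₂, q x := by
  let F : ℝ → ℝ := fun c => ((r₂ - c) * Real.log (r₂ - c) - (r₂ - c)) -
    ((r₁ - c) * Real.log (r₁ - c) - (r₁ - c))
  have hF : Continuous F := by
    have h := Real.continuous_mul_log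
    exact ((h.comp (continuous_const.sub continuous_id)).sub (continuous_const.sub continuous_id)).sub
      ((h.comp (continuous_const.sub continuous_id)).sub (continuous_const.sub continuous_id))
  obtain ⟨C, hC⟩ := (isCompact_Icc (a := (0:ℝ)) (b := M + ‖t₀‖)).exists_bound_of_continuousOn
    hF.continuousOn
  refine ⟨C, fun p hp => ?_⟩
  refine lkHull_induction (P := fun p => ∃ q : ℝ → ℝ, Continuous q ∧ (∀ z, q ‖z - t₀‖ ≤ p z) ∧
      -C ≤ ∫ x in r₁..r₂, q x) ?_ ?_ hp
  · intro s hs ε hε h1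
    set c := ‖s - t₀‖ with hc
    have hq : Continuous fun x : ℝ => 1 / 2 * Real.log ((x - c) ^ 2 + ε) := by
      refine continuous_const.mul (Continuous.log (by fun_prop) fun x => by positivity)
    refine ⟨_, hq, fun z => lk_radial_le hε s t₀ z, ?_⟩
    have h2 : ∫ x in r₁..r₂, Real.log (x - c) = F c := by
      rw [intervalIntegral.integral_comp_sub_right (fun x => Real.log x) c, integral_log]
      simp only [F]
      ring
    have h3 : ∫ x in r₁..r₂, Real.log (x - c) ≤
        ∫ x in r₁..r₂, 1 / 2 * Real.log ((x - c) ^ 2 + ε) := by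
      refine intervalIntegral.integral_mono_ae hr ?_ (hq.intervalIntegrable _ _) ?_
      · have := (intervalIntegral.intervalIntegrable_log' (a := r₁ - c) (b := r₂ - c)).comp_sub_right c
        simpa using this
      · filter_upwards [compl_mem_ae_iff.2 (measure_singleton c)] with x hx
        have hxc : x - c ≠ 0 := sub_ne_zero.2 hx
        have : Real.log ((x - c) ^ 2) ≤ Real.log ((x - c) ^ 2 + ε) :=
          Real.log_le_log (by positivity) (by linarith)
        rw [Real.log_pow] at this
        push_cast at this
        linarith
    have h4 := hC c ⟨norm_nonneg _, by
      have := norm_sub_le s t₀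
      rw [mem_closedBall_zero_iff] at hs
      linarith⟩
    rw [Real.norm_eq_abs] at h4
    have := neg_abs_le (F c)
    linarith
  · rintro p₁ p₂ a b ⟨q₁, h1, h2, h3⟩ ⟨q₂, g1, g2, g3⟩ ha hb hab
    refine ⟨fun x => a * q₁ x + b * q₂ x, by fun_prop, fun z => ?_, ?_⟩
    · have := mul_le_mul_of_nonneg_left (h2 z) ha
      have := mul_le_mul_of_nonneg_left (g2 z) hb
      linarith
    · rw [intervalIntegral.integral_add ((h1.intervalIntegrable _ _).const_mul _)
        ((g1.intervalIntegrable _ _).const_mul _), intervalIntegral.integral_const_mul,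
        intervalIntegral.integral_const_mul]
      have := mul_le_mul_of_nonneg_left h3 ha
      have := mul_le_mul_of_nonneg_left g3 hb
      have : -C = a * -C + b * -C := by rw [← add_mul, hab, one_mul]
      linarith

theorem CapZero.exists_sphere {K : Set ℂ} (hK : CapZero K) (t₀ : ℂ) {r₁ r₂ : ℝ} (hr : r₁ < r₂) :
    ∃ r ∈ Ioo r₁ r₂, Disjoint (sphere t₀ r) K := by
  obtain ⟨M, hM⟩ := hK
  obtain ⟨C, hC⟩ := lkHull_radial M t₀ hr.le
  by_contra hcon
  push Not at hcon
  obtain ⟨p, hp, hpL⟩ := hM ((C + 1) / (r₂ - r₁))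
  obtain ⟨q, hqc, hqp, hqi⟩ := hC p hp
  have h1 : ∫ x in r₁..r₂, q x ≤ ∫ x in r₁..r₂, -((C + 1) / (r₂ - r₁)) := by
    refine intervalIntegral.integral_mono_on_of_le_Ioo hr.le (hqc.intervalIntegrable _ _)
      (by simp) fun x hx => ?_
    obtain ⟨z, hz, hzK⟩ := Set.not_disjoint_iff.1 (hcon x hx)
    rw [mem_sphere, dist_eq_norm] at hz
    rw [← hz]
    exact (hqp z).trans (hpL z hzK)
  rw [intervalIntegral.integral_const, smul_eq_mul, mul_neg, mul_div_cancel₀] at h1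
  · linarith
  · linarith

theorem log_norm_sub_le_circleAverage (u c : ℂ) {R : ℝ} (hR : 0 < R) (h : c ≠ u) :
    Real.log ‖c - u‖ ≤ Real.circleAverage (fun z => Real.log ‖z - u‖) c R := by
  have h0 : 0 < ‖c - u‖ := norm_pos_iff.2 (sub_ne_zero.2 h)
  rw [circleAverage_log_norm_sub_const_eq_log_radius_add_posLog hR.ne']
  have : Real.log (R⁻¹ * ‖c - u‖) ≤ Real.posLog (R⁻¹ * ‖c - u‖) := le_max_right _ _
  rw [Real.log_mul (by positivity) h0.ne', Real.log_inv] at this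
  linarith

theorem lk_le_circleAverage {ε : ℝ} (hε : 0 < ε) (s c : ℂ) {R : ℝ} (hR : 0 < R) :
    lk ε s c ≤ Real.circleAverage (lk ε s) c R := by
  have hci : CircleIntegrable (lk ε s) c R :=
    ((lk_contDiff hε s (n := 0)).continuous.comp (continuous_circleMap c R)).intervalIntegrable _ _
  by_cases hcs : c = s
  · subst hcs
    rw [← Real.circleAverage_const (lk ε c c) c R]
    refine Real.circleAverage_mono (by simp) hci fun z _ => ?_
    simp only [lk, sub_self, norm_zero]
    gcongr
    simp
  set w := c - s with hw
  have hw0 : w ≠ 0 := sub_ne_zero.2 hcs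
  have hwn : 0 < ‖w‖ := norm_pos_iff.2 hw0
  have hcw : (starRingEnd ℂ) w ≠ 0 := by simpa using hw0
  set u := s - ε / (starRingEnd ℂ) w with hu
  set N2 := ‖w‖ ^ 2 + ε with hN2
  have hN2p : 0 < N2 := by positivity
  have hmul : ∀ z, ‖w‖ * ‖z - u‖ = ‖(starRingEnd ℂ) w * (z - s) + ε‖ := by
    intro z
    rw [← RCLike.norm_conj w, ← norm_mul, hu]
    congr 1
    field_simp
    ring
  have hgc : ‖w‖ * ‖c - u‖ = N2 := by
    rw [hmul, ← hw, Complex.conj_mul', hN2]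
    have : ((‖w‖ : ℂ) ^ 2 + ε) = ((‖w‖ ^ 2 + ε : ℝ) : ℂ) := by push_cast; rfl
    rw [this, Complex.norm_real, Real.norm_of_nonneg (by positivity)]
  have hcu : c ≠ u := by
    rintro h
    rw [← h] at hgc
    simp at hgc
    exact hN2p.ne hgc
  have hpt : ∀ z, z ≠ u → Real.log ‖w‖ + Real.log ‖z - u‖ - 1 / 2 * Real.log N2 ≤ lk ε s z := by
    intro z hz
    have hzu : 0 < ‖z - u‖ := norm_pos_iff.2 (sub_ne_zero.2 hz)
    rw [← Real.log_mul hwn.ne' hzu.ne']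
    have h1 : ‖w‖ * ‖z - u‖ ≤ ‖w‖ * ‖z - s‖ + ε := by
      rw [hmul]
      refine (norm_add_le _ _).trans ?_
      rw [norm_mul, RCLike.norm_conj, Complex.norm_real, Real.norm_of_nonneg hε.le]
    have h2 : (‖w‖ * ‖z - u‖) ^ 2 ≤ N2 * (‖z - s‖ ^ 2 + ε) := by
      calc (‖w‖ * ‖z - u‖) ^ 2 ≤ (‖w‖ * ‖z - s‖ + ε) ^ 2 := by gcongr
        _ ≤ _ := by
          rw [hN2]
          nlinarith [sq_nonneg (‖w‖ - ‖z - s‖)]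
    have h3 := Real.log_le_log (by positivity) h2
    rw [Real.log_pow, Real.log_mul hN2p.ne' (by positivity)] at h3
    push_cast at h3
    unfold lk
    linarith
  have key : Real.circleAverage (fun z => Real.log ‖w‖ + Real.log ‖z - u‖ - 1 / 2 * Real.log N2) c R
      ≤ Real.circleAverage (lk ε s) c R := by
    have hI : CircleIntegrable (fun z => Real.log ‖w‖ + Real.log ‖z - u‖ - 1 / 2 * Real.log N2) c R :=
      ((circleIntegrable_const _ _ _).add (circleIntegrable_log_norm_sub_const R)).sub
        (circleIntegrable_const _ _ _)
    have hcod : {u}ᶜ ∈ codiscreteWithin (sphere c |R|) := compl_singleton_mem_codiscreteWithin u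
    rw [Real.circleAverage_congr_codiscreteWithin (f₂ := fun z => if z = u then lk ε s z else
      Real.log ‖w‖ + Real.log ‖z - u‖ - 1 / 2 * Real.log N2) ?_ hR.ne']
    · refine Real.circleAverage_mono ?_ hci fun z _ => ?_
      · refine hI.congr_codiscreteWithin ?_
        filter_upwards [hcod] with z hz
        simp [show z ≠ u from hz]
      · split_ifs with h
        · exact le_rfl
        · exact hpt z h
    · filter_upwards [hcod] with z hz
      simp [show z ≠ u from hz]
  refine le_trans ?_ key
  have e1 : Real.circleAverage (fun z => Real.log ‖w‖ + Real.log ‖z - u‖ - 1 / 2 * Real.log N2) c R =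
      Real.log ‖w‖ + Real.circleAverage (fun z => Real.log ‖z - u‖) c R - 1 / 2 * Real.log N2 := by
    have a1 := Real.circleAverage_add (circleIntegrable_const (Real.log ‖w‖) c R)
      (circleIntegrable_log_norm_sub_const (a := u) (c := c) R)
    have a2 := Real.circleAverage_sub ((circleIntegrable_const (Real.log ‖w‖) c R).add
      (circleIntegrable_log_norm_sub_const (a := u) (c := c) R))
      (circleIntegrable_const (1 / 2 * Real.log N2) c R)
    rw [a1, Real.circleAverage_const, Real.circleAverage_const] at a2
    exact a2
  rw [e1]
  have h4 := log_norm_sub_le_circleAverage u c hR hcu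
  have h5 : Real.log ‖w‖ + Real.log ‖c - u‖ = Real.log N2 := by
    rw [← hgc, Real.log_mul hwn.ne' (norm_pos_iff.2 (sub_ne_zero.2 hcu)).ne']
  have h6 : lk ε s c = 1 / 2 * Real.log N2 := rfl
  linarith

theorem lkHull_le_circleAverage {M : ℝ} {p : ℂ → ℝ} (hp : p ∈ lkHull M) (c : ℂ) {R : ℝ}
    (hR : 0 < R) : p c ≤ Real.circleAverage p c R := by
  have : Continuous p ∧ p c ≤ Real.circleAverage p c R := by
    refine lkHull_induction (P := fun p => Continuous p ∧ p c ≤ Real.circleAverage p c R)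
      (fun s _ ε hε _ => ⟨(lk_contDiff hε s (n := 0)).continuous, lk_le_circleAverage hε s c hR⟩)
      (fun p q a b hp hq ha hb _ => ⟨by have := hp.1; have := hq.1; fun_prop, ?_⟩) hp
    have ip : CircleIntegrable p c R := (hp.1.comp (continuous_circleMap c R)).intervalIntegrable _ _
    have iq : CircleIntegrable q c R := (hq.1.comp (continuous_circleMap c R)).intervalIntegrable _ _
    have e := Real.circleAverage_add (ip.const_fun_smul (a := a)) (iq.const_fun_smul (a := b))
    have e1 := Real.circleAverage_fun_smul (a := a) (f := p) (c := c) (R := R)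
    have e2 := Real.circleAverage_fun_smul (a := b) (f := q) (c := c) (R := R)
    simp only [smul_eq_mul] at e e1 e2
    change a * p c + b * q c ≤ Real.circleAverage ((fun z => a * p z) + fun z => b * q z) c R
    rw [e, e1, e2]
    have := mul_le_mul_of_nonneg_left hp.2 ha
    have := mul_le_mul_of_nonneg_left hq.2 hb
    linarith
  exact this.2

theorem submeanOn_iInf {Ω : Set ℂ} {S : ℕ → ℂ → ℝ} (hc : ∀ n, Continuous (S n))
    (ha : ∀ z ∈ Ω, Antitone fun n => S n z)
    (hs : ∀ n c R, 0 < R → closedBall c R ⊆ Ω → S n c ≤ Real.circleAverage (S n) c R) :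
    SubmeanOn (fun z => ⨅ n, (S n z : EReal)) Ω := by
  intro c r hr hcr φ hφ hle
  have hmem : ∀ θ : ℝ, circleMap c r θ ∈ Ω := fun θ =>
    hcr (sphere_subset_closedBall (circleMap_mem_sphere c hr.le θ))
  have key : ∀ η : ℝ, 0 < η → (⨅ n, (S n c : EReal)) ≤
      (((2 * Real.pi)⁻¹ * (∫ θ in (0:ℝ)..(2 * Real.pi), φ θ) + η : ℝ) : EReal) := by
    intro η hη
    obtain ⟨n, hn⟩ := (isCompact_Icc (a := (0 : ℝ)) (b := 2 * Real.pi)).elim_directed_cover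
      (fun n => {θ | S n (circleMap c r θ) < φ θ + η})
      (fun n => isOpen_lt ((hc n).comp (continuous_circleMap c r)) (hφ.add continuous_const))
      (fun θ _ => by
        have h1 := hle θ
        have h2 : (⨅ n, (S n (circleMap c r θ) : EReal)) < ((φ θ + η : ℝ) : EReal) :=
          lt_of_le_of_lt h1 (EReal.coe_lt_coe_iff.2 (by linarith))
        obtain ⟨n, hn⟩ := iInf_lt_iff.1 h2
        exact mem_iUnion.2 ⟨n, EReal.coe_lt_coe_iff.1 hn⟩)
      (directed_of_isDirected_le fun m n hmn θ hθ =>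
        lt_of_le_of_lt (ha _ (hmem θ) hmn) hθ)
    refine (iInf_le _ n).trans (EReal.coe_le_coe_iff.2 ((hs n c r hr hcr).trans ?_))
    have hpi : (0 : ℝ) ≤ 2 * Real.pi := by positivity
    rw [Real.circleAverage, smul_eq_mul]
    have : ∫ θ in (0:ℝ)..(2 * Real.pi), S n (circleMap c r θ) ≤
        ∫ θ in (0:ℝ)..(2 * Real.pi), (φ θ + η) :=
      intervalIntegral.integral_mono_on hpi
        (((hc n).comp (continuous_circleMap c r)).intervalIntegrable _ _)
        ((hφ.add continuous_const).intervalIntegrable _ _) fun θ hθ => (hn hθ).le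
    rw [intervalIntegral.integral_add (hφ.intervalIntegrable _ _) (by simp),
      intervalIntegral.integral_const, smul_eq_mul, sub_zero] at this
    calc _ ≤ (2 * Real.pi)⁻¹ * ((∫ θ in (0:ℝ)..(2 * Real.pi), φ θ) + 2 * Real.pi * η) := by gcongr
      _ = _ := by field_simp
  refine EReal.le_of_forall_lt_iff_le.1 fun x hx => ?_
  have hx' := EReal.coe_lt_coe_iff.1 hx
  have := key (x - (2 * Real.pi)⁻¹ * ∫ θ in (0:ℝ)..(2 * Real.pi), φ θ) (by linarith)
  rwa [add_sub_cancel] at this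

theorem exists_summable_abs {Ω : Set ℂ} (hΩ : IsOpen Ω) (hne : Ω.Nonempty) {v : ℕ → ℂ → ℝ}
    {b : ℕ → ℝ} (hc : ∀ k, Continuous (v k)) (hi : ∀ k, IntegrableOn (v k) Ω)
    (hb : ∀ k, ∫ z in Ω, |v k z| ≤ b k) (hs : Summable b) :
    ∃ z ∈ Ω, Summable fun k => |v k z| := by
  have hb0 : ∀ k, 0 ≤ b k := fun k => (integral_nonneg fun z => abs_nonneg _).trans (hb k)
  have h1 : ∫⁻ z in Ω, ∑' k, ENNReal.ofReal |v k z| < ⊤ := by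
    rw [lintegral_tsum fun k => ((hc k).abs.measurable.ennreal_ofReal).aemeasurable]
    refine lt_of_le_of_lt (ENNReal.tsum_le_tsum fun k => ?_)
      (lt_top_iff_ne_top.2 hs.tsum_ofReal_ne_top)
    rw [← ofReal_integral_eq_lintegral_ofReal (hi k).abs (Eventually.of_forall fun z => abs_nonneg _)]
    exact ENNReal.ofReal_le_ofReal (hb k)
  have h2 := ae_lt_top (Measurable.tsum fun k => (hc k).abs.measurable.ennreal_ofReal) h1.ne
  have h3 : (volume.restrict Ω) ≠ 0 := by
    rw [Ne, Measure.restrict_eq_zero]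
    exact (hΩ.measure_pos _ hne).ne'
  have : NeZero (volume.restrict Ω) := ⟨h3⟩
  have h4 := h2.and (ae_restrict_mem hΩ.measurableSet)
  obtain ⟨z, hz, hzΩ⟩ := h4.exists
  refine ⟨z, hzΩ, ?_⟩
  have := ENNReal.summable_toReal hz.ne
  simpa [ENNReal.toReal_ofReal] using this

theorem CapZero.polarSet {K : Set ℂ} (hK : IsCompact K) (hc : CapZero K) : PolarSet K := by
  obtain ⟨M, hM⟩ := hc
  obtain ⟨R₀, hR₀⟩ := hK.isBounded.subset_ball (0 : ℂ)
  set R := max R₀ 1 with hR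
  have hR1 : 1 ≤ R := le_max_right _ _
  have hKR : K ⊆ ball 0 R := hR₀.trans (ball_subset_ball (le_max_left _ _))
  choose p hp hpK using fun k : ℕ => hM (4 ^ k)
  obtain ⟨C, hC⟩ := lkHull_integral_abs_le M R
  set A := max (Real.log (R + |M| + 1)) 0 with hA
  have hA0 : 0 ≤ A := le_max_right _ _
  have hM0 : 0 ≤ M := by
    by_contra h
    have : lkHull M = ∅ := by
      unfold lkHull
      rw [convexHull_eq_empty, closedBall_eq_empty.2 (not_le.1 h)]
      simp
    have h2 := hp 0
    rw [this] at h2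
    exact h2
  have hpA : ∀ k, ∀ z ∈ ball (0 : ℂ) R, p k z ≤ A := by
    intro k z hz
    refine (lkHull_le (hp k) z).trans (le_trans ?_ (le_max_left _ _))
    rw [mem_ball_zero_iff] at hz
    have := norm_nonneg z
    apply Real.log_le_log (by linarith)
    linarith [le_abs_self M]
  have hpc : ∀ k, Continuous (p k) := fun k => (lkHull_contDiff (hp k)).continuous
  let v : ℕ → ℂ → ℝ := fun k z => (1 / 2) ^ k * (p k z - A)
  have hvc : ∀ k, Continuous (v k) := fun k => continuous_const.mul ((hpc k).sub continuous_const)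
  have hv0 : ∀ k, ∀ z ∈ ball (0 : ℂ) R, v k z ≤ 0 := fun k z hz =>
    mul_nonpos_of_nonneg_of_nonpos (by positivity) (sub_nonpos.2 (hpA k z hz))
  let S : ℕ → ℂ → ℝ := fun n z => ∑ k ∈ Finset.range n, v k z
  have hSc : ∀ n, Continuous (S n) := fun n => continuous_finsetSum _ fun k _ => hvc k
  have hSa : ∀ z ∈ ball (0 : ℂ) R, Antitone fun n => S n z := by
    intro z hz
    refine antitone_nat_of_succ_le fun n => ?_
    simp only [S, Finset.sum_range_succ]
    linarith [hv0 n z hz]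
  have hci : ∀ (f : ℂ → ℝ) (c : ℂ) (r : ℝ), Continuous f → CircleIntegrable f c r := fun f c r hf =>
    (hf.comp (continuous_circleMap c r)).intervalIntegrable _ _
  have hvs : ∀ k c r, 0 < r → v k c ≤ Real.circleAverage (v k) c r := by
    intro k c r hr
    have e1 := Real.circleAverage_fun_smul (a := (1 / 2 : ℝ) ^ k) (f := fun z => p k z - A) (c := c) (R := r)
    have e2 := Real.circleAverage_sub (hci _ c r (hpc k)) (circleIntegrable_const A c r)
    rw [Real.circleAverage_const] at e2
    have e3 : Real.circleAverage (v k) c r = (1 / 2) ^ k * (Real.circleAverage (p k) c r - A) := by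
      rw [← e2]; exact e1
    rw [e3]
    have := lkHull_le_circleAverage (hp k) c hr
    simp only [v]
    gcongr
  have hSs : ∀ n c r, 0 < r → S n c ≤ Real.circleAverage (S n) c r := by
    intro n c r hr
    have : Real.circleAverage (S n) c r = ∑ k ∈ Finset.range n, Real.circleAverage (v k) c r := by
      rw [← Real.circleAverage_sum fun k _ => hci _ c r (hvc k)]
      congr 1
      ext z
      simp [S]
    rw [this]
    exact Finset.sum_le_sum fun k _ => hvs k c r hr
  have hiO : ∀ f : ℂ → ℝ, Continuous f → IntegrableOn f (ball (0 : ℂ) R) := fun f hf =>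
    (hf.locallyIntegrable.integrableOn_isCompact
      (isCompact_closedBall (0 : ℂ) R)).mono_set ball_subset_closedBall
  obtain ⟨w, hw, hws⟩ := exists_summable_abs isOpen_ball ⟨0, mem_ball_self (by linarith : 0 < R)⟩
    (b := fun k => (1 / 2) ^ k * (C + ∫ z in ball (0 : ℂ) R, A)) hvc (fun k => hiO _ (hvc k))
    (fun k => by
      have : ∀ z, |v k z| ≤ (1 / 2) ^ k * (|p k z| + A) := by
        intro z
        simp only [v]
        rw [abs_mul, abs_of_nonneg (by positivity : (0 : ℝ) ≤ (1 / 2) ^ k)]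
        gcongr
        refine (abs_sub _ _).trans ?_
        rw [abs_of_nonneg hA0]
      refine (integral_mono (hiO _ (hvc k).abs) (hiO (fun z => (1 / 2) ^ k * (|p k z| + A))
        (by have := hpc k; fun_prop)) this).trans ?_
      rw [integral_const_mul, integral_add (hiO _ (hpc k).abs) (hiO _ continuous_const)]
      gcongr
      exact hC _ (hp k))
    ((summable_geometric_two).mul_right _)
  refine ⟨ball 0 R, hKR, fun z => ⨅ n, (S n z : EReal), ⟨isOpen_ball, ?_, ?_, ?_, ?_⟩, ?_⟩
  · intro z hz
    exact upperSemicontinuousWithinAt_iInf fun n =>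
      (continuous_coe_real_ereal.comp (hSc n)).upperSemicontinuous.upperSemicontinuousOn (ball 0 R) z hz
  · intro z _
    exact ne_of_lt (lt_of_le_of_lt (iInf_le _ 0) (EReal.coe_lt_top _))
  · intro z hz
    refine ⟨w, ?_, ?_⟩
    · rw [(convex_ball (0 : ℂ) R).isPreconnected.connectedComponentIn hz]
      exact hw
    · refine ne_of_gt (lt_of_lt_of_le (EReal.bot_lt_coe (-∑' k, |v k w|)) (le_iInf fun n => ?_))
      refine EReal.coe_le_coe_iff.2 ?_
      have h1 : -S n w ≤ ∑ k ∈ Finset.range n, |v k w| := by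
        simp only [S]
        rw [← Finset.sum_neg_distrib]
        exact Finset.sum_le_sum fun k _ => neg_le_abs _
      have h2 := hws.sum_le_tsum (Finset.range n) fun k _ => abs_nonneg _
      linarith
  · exact submeanOn_iInf hSc hSa fun n c r hr _ => hSs n c r hr
  · intro z hz
    have hle : ∀ n : ℕ, S n z ≤ -n := by
      intro n
      induction n with
      | zero => simp [S]
      | succ n ih =>
        simp only [S, Finset.sum_range_succ] at ih ⊢
        have h1 := hpK n z hz
        have h2 : v n z ≤ -1 := by
          have : v n z ≤ (1 / 2) ^ n * (-4 ^ n) := by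
            simp only [v]
            gcongr
            linarith
          refine this.trans ?_
          rw [mul_neg, ← mul_pow]
          norm_num
          exact one_le_pow₀ (by norm_num)
        push_cast
        linarith
    refine (EReal.eq_bot_iff_forall_lt _).2 fun y => ?_
    obtain ⟨n, hn⟩ := exists_nat_gt (-y)
    exact lt_of_le_of_lt (iInf_le _ n) (EReal.coe_lt_coe_iff.2 (by linarith [hle n]))

/-- Logarithmic potential of a measure. -/
noncomputable def logPot (μ : Measure ℂ) (z : ℂ) : ℝ := ∫ s, Real.log ‖z - s‖ ∂μ

theorem exists_log_bound {Z K : Set ℂ} (hZ : IsCompact Z) (hK : IsCompact K) (hd : Z ⊆ Kᶜ) :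
    ∃ B, ∀ z ∈ Z, ∀ s ∈ K, |Real.log ‖z - s‖| ≤ B := by
  obtain ⟨B, hB⟩ := (hZ.prod hK).exists_bound_of_continuousOn
    (f := fun p : ℂ × ℂ => Real.log ‖p.1 - p.2‖) (by
      refine ContinuousOn.log (by fun_prop) fun p hp => ?_
      rw [norm_ne_zero_iff, sub_ne_zero]
      intro h
      exact hd hp.1 (h ▸ hp.2))
  exact ⟨B, fun z hz s hs => hB (z, s) ⟨hz, hs⟩⟩

theorem measurable_log_norm_sub : Measurable fun p : ℂ × ℂ => Real.log ‖p.1 - p.2‖ :=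
  Real.measurable_log.comp (by fun_prop)

section LogPot

variable {K : Set ℂ} {μ : Measure ℂ} [IsFiniteMeasure μ]

theorem logPot_integrable (hK : IsCompact K) (hμ : μ Kᶜ = 0) {z : ℂ} (hz : z ∉ K) :
    Integrable (fun s => Real.log ‖z - s‖) μ := by
  obtain ⟨B, hB⟩ := exists_log_bound (isCompact_singleton (x := z)) hK (by simpa using hz)
  refine Integrable.of_bound (measurable_log_norm_sub.comp measurable_prodMk_left).aestronglyMeasurable
    B ?_
  have : ∀ᵐ s ∂μ, s ∈ K := by rwa [ae_iff]
  filter_upwards [this] with s hs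
  exact hB z rfl s hs

theorem logPot_continuousAt (hK : IsCompact K) (hμ : μ Kᶜ = 0) {z : ℂ} (hz : z ∉ K) :
    ContinuousAt (logPot μ) z := by
  obtain ⟨d, hd, hdK⟩ := nhds_basis_closedBall.mem_iff.1 (hK.isClosed.isOpen_compl.mem_nhds hz)
  obtain ⟨B, hB⟩ := exists_log_bound (isCompact_closedBall z d) hK hdK
  have hae : ∀ᵐ s ∂μ, s ∈ K := by rwa [ae_iff]
  refine continuousAt_of_dominated (bound := fun _ => B) (Eventually.of_forall fun w =>
    (measurable_log_norm_sub.comp measurable_prodMk_left).aestronglyMeasurable) ?_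
    (integrable_const B) ?_
  · filter_upwards [closedBall_mem_nhds z hd] with w hw
    filter_upwards [hae] with s hs
    exact hB w hw s hs
  · filter_upwards [hae] with s hs
    refine ContinuousAt.log (by fun_prop) ?_
    rw [norm_ne_zero_iff, sub_ne_zero]
    rintro rfl
    exact hz hs

theorem logPot_circleAverage (hK : IsCompact K) (hμ : μ Kᶜ = 0) {c : ℂ} {R : ℝ} (hR : 0 < R)
    (hc : closedBall c R ⊆ Kᶜ) : Real.circleAverage (logPot μ) c R = logPot μ c := by
  obtain ⟨B, hB⟩ := exists_log_bound (isCompact_closedBall c R) hK hc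
  have hae : ∀ᵐ s ∂μ, s ∈ K := by rwa [ae_iff]
  have hm : Measurable fun p : ℝ × ℂ => Real.log ‖circleMap c R p.1 - p.2‖ :=
    Real.measurable_log.comp (by
      have := (continuous_circleMap c R).measurable
      fun_prop)
  unfold Real.circleAverage logPot
  rw [intervalIntegral.integral_of_le (by positivity), integral_integral_swap]
  · rw [← integral_smul]
    refine integral_congr_ae ?_
    filter_upwards [hae] with s hs
    have h1 := circleAverage_log_norm_sub_const_eq_log_radius_add_posLog (a := s) (c := c) hR.ne'
    have h2 : R < ‖c - s‖ := by
      by_contra h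
      push Not at h
      exact hc (mem_closedBall'.2 (by rwa [dist_eq_norm])) hs
    rw [Real.posLog_eq_log, Real.log_mul (by positivity) (by linarith), Real.log_inv,
      add_neg_cancel_left] at h1
    · rw [← h1, Real.circleAverage, intervalIntegral.integral_of_le (by positivity)]
    · rw [abs_of_nonneg (by positivity), ← div_eq_inv_mul, one_le_div hR]
      exact h2.le
  · refine Integrable.of_bound hm.aestronglyMeasurable B ?_
    have : ∀ᵐ p : ℝ × ℂ ∂((volume.restrict (Ioc 0 (2 * Real.pi))).prod μ), p.2 ∈ K :=
      Measure.quasiMeasurePreserving_snd.ae hae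
    filter_upwards [this] with p hp
    exact hB _ (circleMap_mem_closedBall c hR.le p.1) _ hp

end LogPot

theorem log_ge_lk_sub {ε : ℝ} (hε : 0 < ε) {d : ℝ} (hd : 0 < d) {s z : ℂ} (h : d ≤ ‖z - s‖) :
    lk ε s z - ε / (2 * d ^ 2) ≤ Real.log ‖z - s‖ := by
  have h0 : 0 < ‖z - s‖ := hd.trans_le h
  have h1 : Real.log (‖z - s‖ ^ 2 + ε) = 2 * Real.log ‖z - s‖ + Real.log (1 + ε / ‖z - s‖ ^ 2) := by
    have : ‖z - s‖ ^ 2 + ε = ‖z - s‖ ^ 2 * (1 + ε / ‖z - s‖ ^ 2) := by field_simp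
    rw [this, Real.log_mul (by positivity) (by positivity), Real.log_pow]
    push_cast; rfl
  have h2 := Real.log_le_sub_one_of_pos (by positivity : 0 < 1 + ε / ‖z - s‖ ^ 2)
  have h3 : ε / ‖z - s‖ ^ 2 ≤ ε / d ^ 2 := by gcongr
  have h4 : ε / (2 * d ^ 2) = ε / d ^ 2 / 2 := by field_simp
  unfold lk
  rw [h1, h4]
  linarith

/-- Restrictions of measures with bounded potential have potential locally bounded below. -/
theorem PotMeas.logPot_restrict_ge {K : Set ℂ} {μ : Measure ℂ} {L : ℝ} (hK : IsCompact K)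
    (h : PotMeas K μ L) {A : Set ℂ} (hA : MeasurableSet A) (M : ℝ) :
    ∃ L', ∀ z ∉ K, ‖z‖ ≤ M → -L' ≤ logPot (μ.restrict A) z := by
  have := h.fin
  obtain ⟨R, hR⟩ := hK.isBounded.exists_norm_le
  have hae : ∀ᵐ s ∂μ, s ∈ K := by rw [ae_iff]; exact h.supp
  refine ⟨L + |M| + |R| + (|M| + |R|) * μ.real univ, fun z hz hzM => ?_⟩
  obtain ⟨d, hd, hdK⟩ := Metric.isOpen_iff.1 hK.isClosed.isOpen_compl z hz
  have hds : ∀ s ∈ K, d ≤ ‖z - s‖ := by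
    intro s hs
    by_contra hlt
    push Not at hlt
    exact hdK (by rwa [mem_ball', dist_eq_norm]) hs
  have hm : 0 ≤ μ.real univ := measureReal_nonneg
  have h_int := logPot_integrable hK h.supp hz
  have hilk : ∀ ε, 0 < ε → Integrable (fun s => lk ε z s) μ := by
    intro ε hε
    obtain ⟨B, hB⟩ := hK.exists_bound_of_continuousOn
      (lk_contDiff hε z (n := 0)).continuous.continuousOn
    refine Integrable.of_bound (lk_contDiff hε z (n := 0)).continuous.aestronglyMeasurable B ?_
    filter_upwards [hae] with s hs using hB s hs
  have hup : ∀ᵐ s ∂μ, Real.log ‖z - s‖ ≤ |M| + |R| := by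
    filter_upwards [hae] with s hs
    have h1 := Real.log_le_sub_one_of_pos (hd.trans_le (hds s hs))
    have h2 := norm_sub_le z s
    have := hR s hs
    linarith [le_abs_self M, le_abs_self R]
  have htot : -L ≤ logPot μ z := by
    refine le_of_forall_pos_le_add fun η hη => ?_
    set ε := min 1 (2 * d ^ 2 * (η / (μ.real univ + 1))) with hε
    have hε0 : 0 < ε := by positivity
    have h1 := h.lb z ε hε0 (min_le_left _ _)
    have h2 : ∫ s, lk ε z s ∂μ ≤ ∫ s, (Real.log ‖z - s‖ + ε / (2 * d ^ 2)) ∂μ := by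
      refine integral_mono_ae (hilk ε hε0) (h_int.add (integrable_const _)) ?_
      filter_upwards [hae] with s hs
      have := log_ge_lk_sub hε0 hd (hds s hs)
      rw [lk_comm]
      linarith
    rw [integral_add h_int (integrable_const _), integral_const, smul_eq_mul] at h2
    have h3 : ε / (2 * d ^ 2) ≤ η / (μ.real univ + 1) := by
      rw [div_le_iff₀' (by positivity)]
      exact min_le_right _ _
    have h4 : μ.real univ * (ε / (2 * d ^ 2)) ≤ η := by
      calc μ.real univ * (ε / (2 * d ^ 2)) ≤ μ.real univ * (η / (μ.real univ + 1)) := by gcongr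
        _ ≤ η := by
          rw [← mul_div_assoc, div_le_iff₀ (by positivity)]
          nlinarith
    unfold logPot
    linarith
  have hsplit := integral_add_compl hA h_int
  have hc : ∫ s in Aᶜ, Real.log ‖z - s‖ ∂μ ≤ (|M| + |R|) * μ.real univ := by
    calc ∫ s in Aᶜ, Real.log ‖z - s‖ ∂μ ≤ ∫ s in Aᶜ, (|M| + |R|) ∂μ :=
          integral_mono_ae h_int.integrableOn (integrable_const _) (ae_restrict_of_ae hup)
      _ = μ.real Aᶜ * (|M| + |R|) := by
          rw [integral_const, smul_eq_mul, measureReal_restrict_apply_univ]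
      _ ≤ μ.real univ * (|M| + |R|) := by
          gcongr
          · exact measure_ne_top _ _
          · exact subset_univ _
      _ = _ := mul_comm _ _
  unfold logPot at htot ⊢
  have := abs_nonneg M
  have := abs_nonneg R
  linarith

theorem exists_real_bound {u : ℂ → EReal} {S : Set ℂ} (hS : IsCompact S)
    (hu : UpperSemicontinuousOn u S) (ht : ∀ z ∈ S, u z ≠ ⊤) : ∃ B : ℝ, ∀ z ∈ S, u z ≤ B := by
  rcases S.eq_empty_or_nonempty with rfl | hne
  · exact ⟨0, by simp⟩
  obtain ⟨m, hm, hmax⟩ := hu.exists_isMaxOn hne hS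
  refine ⟨(u m).toReal, fun z hz => (hmax hz).trans ?_⟩
  exact EReal.le_coe_toReal (ht m hm)

theorem circleAverage_pos_of_continuous {ψ : ℂ → ℝ} (hψ : Continuous ψ) (h0 : ∀ z, 0 ≤ ψ z) {c w : ℂ}
    {r : ℝ} (hr : 0 ≤ r) (hw : w ∈ sphere c r) (hpos : 0 < ψ w) :
    0 < Real.circleAverage ψ c r := by
  obtain ⟨θ, hθ, rfl⟩ : ∃ θ ∈ Ioc 0 (2 * Real.pi), circleMap c r θ = w := by
    have := image_circleMap_Ioc c r
    rw [abs_of_nonneg hr] at this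
    rw [← this] at hw
    exact hw
  rw [Real.circleAverage, smul_eq_mul]
  refine mul_pos (by positivity) ?_
  exact intervalIntegral.integral_pos (by positivity)
    (hψ.comp (continuous_circleMap c r)).continuousOn (fun _ _ => h0 _) ⟨θ, ⟨hθ.1.le, hθ.2⟩, hpos⟩

theorem SubharmonicOn.exists_ne_bot {u : ℂ → EReal} {Ω : Set ℂ} (hu : SubharmonicOn u Ω) {z : ℂ}
    (hz : z ∈ Ω) {V : Set ℂ} (hV : IsOpen V) (hzV : z ∈ V) : ∃ w ∈ V ∩ Ω, u w ≠ ⊥ := by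
  obtain ⟨hΩ, husc, htop, hcomp, hsub⟩ := hu
  by_contra hcon
  push Not at hcon
  set W : Set ℂ := {z | ∀ᶠ w in nhds z, u w = ⊥} with hW
  have hWo : IsOpen W := isOpen_setOfPred_eventually_nhds
  have hzW : z ∈ W := by
    filter_upwards [(hV.inter hΩ).mem_nhds ⟨hzV, hz⟩] with w hw using hcon w hw
  have hcl : ∀ z ∈ closure W, z ∈ Ω → z ∈ W := by
    intro z hzc hzΩ
    obtain ⟨δ, hδ, hball⟩ := Metric.isOpen_iff.1 hΩ z hzΩ
    obtain ⟨w, hwW, hwz⟩ := Metric.mem_closure_iff.1 hzc (δ / 4) (by linarith)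
    obtain ⟨η, hη, hηw⟩ := Metric.eventually_nhds_iff_ball.1 hwW
    filter_upwards [ball_mem_nhds z (by linarith : 0 < δ / 4)] with c hc
    by_cases hcw : c = w
    · subst hcw
      exact hηw c (mem_ball_self hη)
    set r := dist w c with hr
    have hr0 : 0 < r := dist_pos.2 (Ne.symm hcw)
    have hrc : closedBall c r ⊆ Ω := by
      refine Subset.trans (fun y hy => ?_) hball
      rw [mem_closedBall] at hy
      rw [mem_ball] at hc ⊢
      have h1 := dist_triangle y c z
      have h2 := dist_triangle w z c
      rw [dist_comm z c] at h2
      rw [dist_comm] at hwz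
      linarith
    obtain ⟨B, hB⟩ := exists_real_bound (isCompact_closedBall c r) (husc.mono hrc)
      fun z hz => htop z (hrc hz)
    let ψ : ℂ → ℝ := fun z => max 0 (η - dist z w)
    have hψ : Continuous ψ := by fun_prop
    have hψc : Continuous fun θ => ψ (circleMap c r θ) := hψ.comp (continuous_circleMap c r)
    have hκ : 0 < Real.circleAverage ψ c r :=
      circleAverage_pos_of_continuous hψ (fun _ => le_max_left _ _) hr0.le (mem_sphere.2 hr.symm)
        (by simp [ψ, hη])
    set κ := Real.circleAverage ψ c r with hκd
    have key : ∀ N : ℝ, 0 ≤ N → u c ≤ ((B - N * κ : ℝ) : EReal) := by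
      intro N hN
      have h := hsub c r hr0 hrc (fun θ => B - N * ψ (circleMap c r θ))
        (continuous_const.sub (continuous_const.mul (hψ.comp (continuous_circleMap c r)))) ?_
      · refine h.trans_eq ?_
        congr 1
        rw [hκd, Real.circleAverage, smul_eq_mul, intervalIntegral.integral_sub
          (continuous_const.intervalIntegrable _ _)
          ((hψc.intervalIntegrable _ _).const_mul N), intervalIntegral.integral_const_mul, intervalIntegral.integral_const, smul_eq_mul]
        field_simp
        ring
      · intro θ
        change u (circleMap c r θ) ≤ _
        by_cases hd : dist (circleMap c r θ) w < η
        · rw [hηw _ hd]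
          exact bot_le
        · have : ψ (circleMap c r θ) = 0 := max_eq_left (by linarith)
          rw [this, mul_zero, sub_zero]
          exact hB _ (circleMap_mem_closedBall c hr0.le θ)
    refine (EReal.eq_bot_iff_forall_lt _).2 fun y => ?_
    obtain ⟨N, hN0, hN⟩ : ∃ N : ℝ, 0 ≤ N ∧ B - N * κ < y := by
      refine ⟨(|B - y| + 1) / κ, by positivity, ?_⟩
      rw [div_mul_cancel₀ _ hκ.ne']
      linarith [le_abs_self (B - y)]
    exact lt_of_le_of_lt (key N hN0) (EReal.coe_lt_coe_iff.2 hN)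
  obtain ⟨w, hw, hwb⟩ := hcomp z hz
  have := isPreconnected_connectedComponentIn.subset_of_closure_inter_subset hWo
    ⟨z, mem_connectedComponentIn hz, hzW⟩
    (fun y hy => hcl y hy.1 (connectedComponentIn_subset _ _ hy.2))
  exact hwb (this hw).self_of_nhds

theorem upperSemicontinuousOn_trunc {u : ℂ → EReal} {S : Set ℂ} (hu : UpperSemicontinuousOn u S)
    (ht : ∀ z ∈ S, u z ≠ ⊤) (N : ℝ) :
    UpperSemicontinuousOn (fun z => (max (u z) ((-N : ℝ) : EReal)).toReal) S := by
  have hco : ∀ z ∈ S, (((max (u z) ((-N : ℝ) : EReal)).toReal : ℝ) : EReal) =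
      max (u z) ((-N : ℝ) : EReal) := by
    intro z hz
    refine EReal.coe_toReal ?_ ?_
    · exact ne_of_lt (max_lt (lt_top_iff_ne_top.2 (ht z hz)) (EReal.coe_lt_top _))
    · exact ne_of_gt (lt_max_of_lt_right (EReal.bot_lt_coe _))
  intro z hz y hy
  have h1 : max (u z) ((-N : ℝ) : EReal) < y := by
    rw [← hco z hz]
    exact EReal.coe_lt_coe_iff.2 hy
  filter_upwards [hu z hz y (max_lt_iff.1 h1).1, self_mem_nhdsWithin] with w hw hwS
  refine EReal.coe_lt_coe_iff.1 ?_
  rw [hco w hwS]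
  exact max_lt hw (max_lt_iff.1 h1).2

theorem circleAverage_norm_sub_sq (a c : ℂ) {R : ℝ} (hR : 0 ≤ R) :
    Real.circleAverage (fun z => ‖z - a‖ ^ 2) c R = ‖c - a‖ ^ 2 + R ^ 2 := by
  have h := circleAverage_re (h := fun z => ((‖c - a‖ ^ 2 + R ^ 2 : ℝ) : ℂ) +
    2 * ((starRingEnd ℂ) (c - a) * (z - c))) (by fun_prop) c R
  simp only [sub_self, mul_zero, add_zero, Complex.ofReal_re] at h
  rw [← h]
  refine Real.circleAverage_congr_sphere fun z hz => ?_
  rw [abs_of_nonneg hR, mem_sphere, dist_eq_norm] at hz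
  have : z - a = (c - a) + (z - c) := by ring
  rw [this, ← Complex.normSq_eq_norm_sq, Complex.normSq_add, Complex.normSq_eq_norm_sq,
    Complex.normSq_eq_norm_sq, hz]
  simp only [Complex.add_re, Complex.ofReal_re, Complex.mul_re, Complex.mul_im, Complex.conj_re,
    Complex.conj_im, Complex.sub_re, Complex.sub_im, Complex.re_ofNat, Complex.im_ofNat, map_sub]
  ring

theorem PotMeas.exists_mem_support {K : Set ℂ} {μ : Measure ℂ} {L : ℝ} (h : PotMeas K μ L) :
    ∃ x ∈ K, ∀ r > 0, 0 < μ (ball x r) := by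
  by_contra hcon
  push Not at hcon
  apply h.ne
  have : μ K = 0 := by
    refine measure_null_of_locally_null K fun x hx => ?_
    obtain ⟨r, hr, h0⟩ := hcon x hx
    exact ⟨ball x r, mem_nhdsWithin_of_mem_nhds (ball_mem_nhds x hr), nonpos_iff_eq_zero.1 h0⟩
  rw [← Measure.measure_univ_eq_zero, ← union_compl_self K]
  exact measure_union_null this h.supp

theorem PotMeas.not_polarSet {K : Set ℂ} {μ : Measure ℂ} {L : ℝ} (hK : IsCompact K)
    (h : PotMeas K μ L) : ¬ PolarSet K := by
  rintro ⟨Ω, hKΩ, u, hu, hbot⟩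
  have hfin := h.fin
  have hae : ∀ᵐ s ∂μ, s ∈ K := by rw [ae_iff]; exact h.supp
  obtain ⟨x, hxK, hx⟩ := h.exists_mem_support
  obtain ⟨r₀, hr₀, hr₀Ω⟩ := nhds_basis_closedBall.mem_iff.1 (hu.1.mem_nhds (hKΩ hxK))
  set r := r₀ / 2 with hrdef
  have hr : 0 < r := by positivity
  obtain ⟨z₀, ⟨hz₀x, hz₀Ω⟩, hz₀⟩ := hu.exists_ne_bot (hKΩ hxK) isOpen_ball
    (mem_ball_self (by positivity : 0 < r / 8))
  have hz₀K : z₀ ∉ K := fun hk => hz₀ (hbot z₀ hk)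
  set S := closedBall z₀ r with hS
  have hSΩ : S ⊆ Ω := by
    refine (closedBall_subset_closedBall' ?_).trans hr₀Ω
    rw [mem_ball] at hz₀x
    linarith
  set A := closedBall z₀ (r / 4) with hA
  set ν := μ.restrict A with hν
  have hνK : ν Kᶜ = 0 := nonpos_iff_eq_zero.1 ((Measure.restrict_apply_le _ _).trans h.supp.le)
  have haeν : ∀ᵐ s ∂ν, s ∈ K := ae_restrict_of_ae hae
  have haeA : ∀ᵐ s ∂ν, s ∈ A := ae_restrict_mem measurableSet_closedBall
  set m := ν.real univ with hm
  have hm0 : 0 < m := by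
    rw [hm, hν, measureReal_restrict_apply_univ, measureReal_def, ENNReal.toReal_pos_iff]
    refine ⟨lt_of_lt_of_le (hx (r / 8) (by positivity)) (measure_mono fun y hy => ?_),
      measure_lt_top _ _⟩
    rw [hA, mem_closedBall]
    rw [mem_ball] at hy hz₀x
    have := dist_triangle_right y z₀ x
    linarith
  obtain ⟨L', hL'⟩ := h.logPot_restrict_ge hK (A := A) measurableSet_closedBall (‖z₀‖ + r)
  have hL'S : ∀ z ∈ S, z ∉ K → -logPot ν z ≤ L' := by
    intro z hz hzK
    have h1 : ‖z‖ ≤ ‖z₀‖ + r := by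
      rw [hS, mem_closedBall, dist_eq_norm] at hz
      have := norm_sub_norm_le z z₀
      linarith
    linarith [hL' z hzK h1]
  obtain ⟨B, hB⟩ := exists_real_bound (isCompact_closedBall z₀ r) (hu.2.1.mono hSΩ)
    fun z hz => hu.2.2.1 z (hSΩ hz)
  set a := (u z₀).toReal with ha
  have hua : u z₀ = a := (EReal.coe_toReal (hu.2.2.1 z₀ hz₀Ω) hz₀).symm
  have hlog3 : 0 < Real.log 3 := Real.log_pos (by norm_num)
  set η := m * Real.log 3 / (4 * r ^ 2) with hη
  set ε := m * Real.log 3 / (4 * (|B - a| + 1)) with hε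
  have hη0 : 0 < η := by positivity
  have hε0 : 0 < ε := by positivity
  set N := |B| + (|logPot ν z₀| + |a| * ε + |L'| + η * r ^ 2 + 1) / ε with hN
  set uN : ℂ → ℝ := fun z => (max (u z) ((-N : ℝ) : EReal)).toReal with huN
  have hco : ∀ z ∈ S, ((uN z : ℝ) : EReal) = max (u z) ((-N : ℝ) : EReal) := by
    intro z hz
    refine EReal.coe_toReal ?_ ?_
    · exact ne_of_lt (max_lt (lt_top_iff_ne_top.2 (hu.2.2.1 z (hSΩ hz))) (EReal.coe_lt_top _))
    · exact ne_of_gt (lt_max_of_lt_right (EReal.bot_lt_coe _))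
  classical
  set v : ℂ → ℝ := fun z => if z ∈ K then L' else -logPot ν z with hv
  have hvusc : UpperSemicontinuousOn v S := by
    intro z hz y hy
    by_cases hzK : z ∈ K
    · filter_upwards [self_mem_nhdsWithin] with w hw
      simp only [hv, hzK, if_true] at hy
      simp only [hv]
      split_ifs with h
      · exact hy
      · exact lt_of_le_of_lt (hL'S w hw h) hy
    · refine nhdsWithin_le_nhds ?_
      simp only [hv, hzK, if_false] at hy
      filter_upwards [(logPot_continuousAt hK hνK hzK).neg.eventually_lt continuousAt_const hy,
        hK.isClosed.isOpen_compl.mem_nhds hzK] with w hw hwK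
      simp only [hv, show w ∉ K from hwK, if_false]
      exact hw
  set F : ℂ → ℝ := fun z => v z + η * ‖z - z₀‖ ^ 2 + ε * uN z with hF
  have huNusc : UpperSemicontinuousOn uN S :=
    upperSemicontinuousOn_trunc (hu.2.1.mono hSΩ) (fun z hz => hu.2.2.1 z (hSΩ hz)) N
  have hFusc : UpperSemicontinuousOn F S := by
    refine (hvusc.add ?_).add ?_
    · have : Continuous fun z : ℂ => η * ‖z - z₀‖ ^ 2 := by fun_prop
      exact this.upperSemicontinuous.upperSemicontinuousOn S
    · intro z hz y hy
      have h1 : uN z < y / ε := by rw [lt_div_iff₀ hε0]; linarith [mul_comm (uN z) ε]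
      filter_upwards [huNusc z hz _ h1] with w hw
      rw [lt_div_iff₀ hε0] at hw
      linarith [mul_comm (uN w) ε]
  obtain ⟨ζ, hζS, hmax⟩ := hFusc.exists_isMaxOn ⟨z₀, mem_closedBall_self hr.le⟩
    (isCompact_closedBall z₀ r)
  have hz₀S : z₀ ∈ S := mem_closedBall_self hr.le
  have hFz₀ : -logPot ν z₀ + ε * a ≤ F ζ := by
    refine le_trans ?_ (hmax hz₀S)
    have : a ≤ uN z₀ := by
      refine EReal.coe_le_coe_iff.1 ?_
      rw [hco z₀ hz₀S, ← hua]
      exact le_max_left _ _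
    simp only [hF, hv, hz₀K, if_false, sub_self, norm_zero]
    have := mul_le_mul_of_nonneg_left this hε0.le
    linarith
  have hnorm : ‖ζ - z₀‖ ≤ r := by rw [← dist_eq_norm]; exact hζS
  have hsq : η * ‖ζ - z₀‖ ^ 2 ≤ η * r ^ 2 := by gcongr
  have hζK : ζ ∉ K := by
    intro hζ
    have h1 : uN ζ = -N := by
      simp only [huN, hbot ζ hζ]
      rw [max_eq_right bot_le, EReal.toReal_coe]
    have h2 : F ζ ≤ L' + η * r ^ 2 - ε * N := by
      simp only [hF, hv, hζ, if_true, h1]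
      linarith
    have h3 : ε * N = ε * |B| + (|logPot ν z₀| + |a| * ε + |L'| + η * r ^ 2 + 1) := by
      rw [hN]; field_simp
    have h4 : 0 ≤ ε * |B| := by positivity
    have h5 : -(|a| * ε) ≤ ε * a := by
      have := mul_le_mul_of_nonneg_left (neg_abs_le a) hε0.le
      linarith
    linarith [le_abs_self (logPot ν z₀), le_abs_self L']
  have hFζ : F ζ = -logPot ν ζ + η * ‖ζ - z₀‖ ^ 2 + ε * uN ζ := by
    simp only [hF, hv, hζK, if_false]
  rcases hnorm.lt_or_eq with hlt | heq
  · have hopen : IsOpen (ball z₀ r ∩ Kᶜ) := isOpen_ball.inter hK.isClosed.isOpen_compl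
    obtain ⟨R, hR, hRsub⟩ := nhds_basis_closedBall.mem_iff.1
      (hopen.mem_nhds ⟨by rwa [mem_ball, dist_eq_norm], hζK⟩)
    have hcm : ∀ θ, circleMap ζ R θ ∈ ball z₀ r ∩ Kᶜ := fun θ =>
      hRsub (circleMap_mem_closedBall ζ hR.le θ)
    let Φ : ℂ → ℝ := fun z => (F ζ + logPot ν z - η * ‖z - z₀‖ ^ 2) / ε
    have hle : ∀ θ, uN (circleMap ζ R θ) ≤ Φ (circleMap ζ R θ) := by
      intro θ
      have h1 := hmax (ball_subset_closedBall (hcm θ).1 : circleMap ζ R θ ∈ S)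
      simp only [hF, hv, show circleMap ζ R θ ∉ K from (hcm θ).2, if_false, mem_ofPred_eq] at h1
      rw [le_div_iff₀ hε0, mul_comm]
      simp only [hF, hv]
      linarith
    have hlc : Continuous fun θ => logPot ν (circleMap ζ R θ) := continuous_iff_continuousAt.2 fun θ =>
      (logPot_continuousAt hK hνK (hcm θ).2).comp (continuous_circleMap ζ R).continuousAt
    have hΦc : Continuous fun θ => Φ (circleMap ζ R θ) := by
      have := continuous_circleMap ζ R
      simp only [Φ]
      fun_prop
    have hsub := hu.2.2.2.2 ζ R hR (fun z hz => hSΩ (ball_subset_closedBall (hRsub hz).1)) _ hΦc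
      (fun θ => by
        refine le_trans ?_ (EReal.coe_le_coe_iff.2 (hle θ))
        rw [hco _ (ball_subset_closedBall (hcm θ).1)]
        exact le_max_left _ _)
    have havg : Real.circleAverage Φ ζ R = uN ζ - η * R ^ 2 / ε := by
      have i1 : CircleIntegrable (logPot ν) ζ R := hlc.intervalIntegrable _ _
      have i2 : CircleIntegrable (fun z => η * ‖z - z₀‖ ^ 2) ζ R := by
        have : Continuous fun z : ℂ => η * ‖z - z₀‖ ^ 2 := by fun_prop
        exact (this.comp (continuous_circleMap ζ R)).intervalIntegrable _ _
      have e1 := Real.circleAverage_fun_smul (a := ε⁻¹)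
        (f := fun z => F ζ + logPot ν z - η * ‖z - z₀‖ ^ 2) (c := ζ) (R := R)
      have e2 := Real.circleAverage_sub ((circleIntegrable_const (F ζ) ζ R).add i1) i2
      rw [Real.circleAverage_add (circleIntegrable_const (F ζ) ζ R) i1, Real.circleAverage_const,
        logPot_circleAverage hK hνK hR (fun z hz => (hRsub hz).2)] at e2
      have e3 := Real.circleAverage_fun_smul (a := η) (f := fun z => ‖z - z₀‖ ^ 2) (c := ζ) (R := R)
      simp only [smul_eq_mul] at e1 e3
      rw [e3, circleAverage_norm_sub_sq z₀ ζ hR.le] at e2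
      have e4 : Φ = fun z => ε⁻¹ * (F ζ + logPot ν z - η * ‖z - z₀‖ ^ 2) := by
        ext z
        simp only [Φ]
        rw [div_eq_inv_mul]
      rw [e4, e1]
      change Real.circleAverage (fun z => F ζ + logPot ν z - η * ‖z - z₀‖ ^ 2) ζ R = _ at e2
      rw [e2, hFζ]
      field_simp
      ring
    have hNle : -N ≤ Real.circleAverage Φ ζ R := by
      rw [← Real.circleAverage_const (-N) ζ R, Real.circleAverage, Real.circleAverage, smul_eq_mul,
        smul_eq_mul]
      have : ∫ θ in (0:ℝ)..(2 * Real.pi), -N ≤ ∫ θ in (0:ℝ)..(2 * Real.pi), Φ (circleMap ζ R θ) := by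
        refine intervalIntegral.integral_mono_on (by positivity) (by simp)
          (hΦc.intervalIntegrable _ _) fun θ _ => le_trans ?_ (hle θ)
        refine EReal.coe_le_coe_iff.1 ?_
        rw [hco _ (ball_subset_closedBall (hcm θ).1)]
        exact le_max_right _ _
      gcongr
    have hfin : uN ζ ≤ Real.circleAverage Φ ζ R := by
      refine EReal.coe_le_coe_iff.1 ?_
      rw [hco ζ hζS]
      exact max_le hsub (EReal.coe_le_coe_iff.2 hNle)
    rw [havg] at hfin
    have : 0 < η * R ^ 2 / ε := by positivity
    linarith
  · have hup : m * Real.log (3 * r / 4) ≤ logPot ν ζ := by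
      have : ∫ s, Real.log (3 * r / 4) ∂ν ≤ logPot ν ζ := by
        refine integral_mono_ae (integrable_const _) (logPot_integrable hK hνK hζK) ?_
        filter_upwards [haeA] with s hs
        apply Real.log_le_log (by positivity)
        rw [hA, mem_closedBall, dist_eq_norm] at hs
        have := norm_sub_le_norm_sub_add_norm_sub ζ s z₀
        linarith
      rwa [integral_const, smul_eq_mul] at this
    have hlow : logPot ν z₀ ≤ m * Real.log (r / 4) := by
      have : logPot ν z₀ ≤ ∫ s, Real.log (r / 4) ∂ν := by
        refine integral_mono_ae (logPot_integrable hK hνK hz₀K) (integrable_const _) ?_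
        filter_upwards [haeA, haeν] with s hs hsK
        have h0 : 0 < ‖z₀ - s‖ := norm_pos_iff.2 (sub_ne_zero.2 fun h => hz₀K (h ▸ hsK))
        apply Real.log_le_log h0
        rw [hA, mem_closedBall, dist_eq_norm, norm_sub_rev] at hs
        exact hs
      rwa [integral_const, smul_eq_mul] at this
    have hBN : uN ζ ≤ B := by
      refine EReal.coe_le_coe_iff.1 ?_
      rw [hco ζ hζS]
      refine max_le (hB ζ hζS) (EReal.coe_le_coe_iff.2 ?_)
      have : 0 ≤ (|logPot ν z₀| + |a| * ε + |L'| + η * r ^ 2 + 1) / ε := by positivity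
      linarith [neg_abs_le B]
    have h1 : Real.log (3 * r / 4) = Real.log 3 + Real.log (r / 4) := by
      rw [← Real.log_mul (by norm_num) (by positivity)]
      congr 1; ring
    have h2 : η * r ^ 2 = m * Real.log 3 / 4 := by rw [hη]; field_simp
    have h3 : ε * (B - a) ≤ m * Real.log 3 / 4 := by
      have : ε * (|B - a| + 1) = m * Real.log 3 / 4 := by rw [hε]; field_simp
      rw [← this]
      gcongr
      linarith [le_abs_self (B - a)]
    have h4 := mul_le_mul_of_nonneg_left hBN hε0.le
    have h5 : 0 < m * Real.log 3 := by positivity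
    rw [h1] at hup
    nlinarith

theorem PolarSet.mono {E F : Set ℂ} (h : PolarSet F) (hs : E ⊆ F) : PolarSet E := by
  obtain ⟨Ω, hΩ, u, hu, hb⟩ := h
  exact ⟨Ω, hs.trans hΩ, u, hu, fun z hz => hb z (hs hz)⟩

theorem PolarSet.capZero {K : Set ℂ} (hK : IsCompact K) (h : PolarSet K) : CapZero K := by
  by_contra hc
  obtain ⟨μ, L, hμ⟩ := exists_potMeas hK hc
  exact hμ.not_polarSet hK h

theorem CapZero.exists_cutoff_weight {K : Set ℂ} (hK : CapZero K) (R : ℝ) {ε : ℝ} (hε : 0 < ε) :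
    ∃ g s : ℂ → ℝ, ContDiff ℝ 2 g ∧ (∀ z, 0 < g z) ∧ (∀ z ∈ K, g z < 1 / 2) ∧
      ∫ z in ball (0 : ℂ) R, |g z - 1| ≤ ε ∧ (∀ z, dz (db fun z => (g z : ℂ)) z = s z) ∧
      ∀ z, ‖db (fun z => (g z : ℂ)) z‖ ^ 2 ≤ g z * s z := by
  obtain ⟨M, hM⟩ := hK
  obtain ⟨C, hC⟩ := lkHull_integral_abs_le M R
  set B := |Real.log (R + M + 1)| + |Real.log (M + 1)| with hB
  obtain ⟨L, hL1, hL⟩ : ∃ L : ℝ, 1 ≤ L ∧ Real.exp |R + M| * C / L ≤ ε := by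
    refine ⟨max 1 (Real.exp |R + M| * C / ε), le_max_left _ _, ?_⟩
    rw [div_le_iff₀ (lt_of_lt_of_le one_pos (le_max_left _ _))]
    have := le_max_right 1 (Real.exp |R + M| * C / ε)
    rw [div_le_iff₀ hε] at this
    linarith
  have hL0 : 0 < L := by linarith
  obtain ⟨p, hp, hpK⟩ := hM L
  have hpc := lkHull_contDiff hp
  obtain ⟨t, ht, hpt⟩ := lkHull_laplacian hp
  set g : ℂ → ℝ := fun z => Real.exp (L⁻¹ * p z) with hg
  have hgc : ContDiff ℝ 2 g := by fun_prop
  have hpw : ∀ z, HasW (fun z => (p z : ℂ)) (dz (fun z => (p z : ℂ)) z)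
      (db (fun z => (p z : ℂ)) z) z := fun z =>
    (hpc.ofReal.differentiable (by norm_num) z).hasW
  have hgw : ∀ z, HasW (fun z => (g z : ℂ)) ((g z * L⁻¹ : ℝ) * dz (fun z => (p z : ℂ)) z)
      ((g z * L⁻¹ : ℝ) * db (fun z => (p z : ℂ)) z) z := by
    intro z
    refine HasW.comp_real (k := fun x => Real.exp (L⁻¹ * x)) ?_ (hpw z)
    simpa using ((hasDerivAt_id (p z)).const_mul L⁻¹).exp
  have hdb : db (fun z => (g z : ℂ)) = fun z => ((g z : ℂ) * (L⁻¹ : ℝ)) * db (fun z => (p z : ℂ)) z := by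
    ext z
    rw [(hgw z).db_eq]; push_cast; ring
  have hconj : ∀ z, db (fun z => (p z : ℂ)) z = starRingEnd ℂ (dz (fun z => (p z : ℂ)) z) := fun z =>
    db_ofReal (hpc.ofReal.differentiable (by norm_num) z)
  refine ⟨g, fun z => g z * (L⁻¹ ^ 2 * ‖dz (fun z => (p z : ℂ)) z‖ ^ 2 + L⁻¹ * t z), hgc,
    fun z => Real.exp_pos _, fun z hz => ?_, ?_, fun z => ?_, fun z => ?_⟩
  · have h1 : L⁻¹ * p z ≤ -1 := by
      have := mul_le_mul_of_nonneg_left (hpK z hz) (inv_nonneg.2 hL0.le)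
      rwa [mul_neg, inv_mul_cancel₀ hL0.ne'] at this
    calc g z ≤ Real.exp (-1) := Real.exp_le_exp.2 h1
      _ < 1 / 2 := by
        have := Real.exp_neg_one_lt_half
        linarith
  · have hpt : ∀ z ∈ ball (0 : ℂ) R, |g z - 1| ≤ Real.exp |R + M| / L * |p z| := by
      intro z hz
      rw [mem_ball_zero_iff] at hz
      have h1 : L⁻¹ * p z ≤ |R + M| := by
        have h2 : p z ≤ |R + M| := by
          refine (lkHull_le hp z).trans ?_
          by_cases h : 0 < ‖z‖ + M + 1
          · have := Real.log_le_sub_one_of_pos h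
            have := le_abs_self (R + M)
            linarith
          · have hM0 : 0 ≤ M := by
              by_contra hneg
              have hemp : lkHull M = ∅ := by
                unfold lkHull
                rw [convexHull_eq_empty]
                ext q
                simp only [mem_ofPred_eq, mem_empty_iff_false, iff_false]
                rintro ⟨s, hs, -⟩
                rw [closedBall_eq_empty.2 (not_le.1 hneg)] at hs
                exact hs
              rw [hemp] at hp
              exact hp
            have := norm_nonneg z
            exact absurd (by linarith) h
        rcases le_total 0 (p z) with h | h
        · calc L⁻¹ * p z ≤ 1 * p z := by gcongr; exact inv_le_one_of_one_le₀ hL1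
            _ ≤ _ := by linarith
        · have := mul_nonpos_of_nonneg_of_nonpos (inv_nonneg.2 hL0.le) h
          have := abs_nonneg (R + M)
          linarith
      have h3 : ∀ x b : ℝ, x ≤ b → 0 ≤ b → |Real.exp x - 1| ≤ Real.exp b * |x| := by
        intro x b hx hb
        rcases le_total 0 x with h | h
        · rw [abs_of_nonneg h, abs_of_nonneg (by have := Real.one_le_exp h; linarith)]
          have h4 := Real.add_one_le_exp (-x)
          have h5 : Real.exp x - 1 ≤ Real.exp x * x := by
            have h6 : Real.exp x * Real.exp (-x) = 1 := by rw [← Real.exp_add]; simp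
            nlinarith [Real.exp_pos x]
          exact h5.trans (by gcongr)
        · rw [abs_of_nonpos h, abs_of_nonpos (by have := Real.exp_le_one_iff.2 h; linarith)]
          have h4 := Real.add_one_le_exp x
          have h5 := Real.one_le_exp hb
          nlinarith
      have h7 := h3 _ _ h1 (abs_nonneg _)
      rw [abs_mul, abs_of_pos (inv_pos.2 hL0)] at h7
      calc |g z - 1| ≤ _ := h7
        _ = _ := by ring
    have hi : ∀ q : ℂ → ℝ, Continuous q → IntegrableOn q (ball (0 : ℂ) R) := fun q hq =>
      (hq.locallyIntegrable.integrableOn_isCompact (isCompact_closedBall (0 : ℂ) R)).mono_set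
        ball_subset_closedBall
    have hpc' := hpc.continuous
    calc ∫ z in ball (0 : ℂ) R, |g z - 1| ≤ ∫ z in ball (0 : ℂ) R, Real.exp |R + M| / L * |p z| := by
          refine setIntegral_mono_on (hi _ ?_) (hi _ (by fun_prop)) measurableSet_ball hpt
          have := hgc.continuous
          fun_prop
      _ = Real.exp |R + M| / L * ∫ z in ball (0 : ℂ) R, |p z| := by rw [integral_const_mul]
      _ ≤ Real.exp |R + M| / L * C := by gcongr; exact hC p hp
      _ ≤ ε := by rw [div_mul_eq_mul_div]; exact hL
  · rw [hdb]
    have h1 := (((hgw z).mul (HasW.const ((L⁻¹ : ℝ) : ℂ) z)).mul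
      (hpc.ofReal.db.differentiable (by norm_num) z).hasW).dz_eq
    rw [h1, hpt, hconj]
    have h2 : dz (fun z => (p z : ℂ)) z * starRingEnd ℂ (dz (fun z => (p z : ℂ)) z) =
        ((‖dz (fun z => (p z : ℂ)) z‖ ^ 2 : ℝ) : ℂ) := by
      rw [Complex.mul_conj, Complex.normSq_eq_norm_sq]
    push_cast at h2 ⊢
    rw [← h2]; ring
  · rw [(hgw z).db_eq, hconj, norm_mul, Complex.norm_real, RCLike.norm_conj, Real.norm_of_nonneg
      (by have := Real.exp_pos (L⁻¹ * p z); positivity)]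
    have h1 : 0 ≤ g z ^ 2 * (L⁻¹ * t z) := by have := ht z; positivity
    nlinarith

theorem integral_mul_dz_db {κ g : ℂ → ℂ} (hκ : ContDiff ℝ 2 κ) (hc : HasCompactSupport κ)
    (hg : ContDiff ℝ 2 g) :
    ∫ z, κ z * dz (db g) z = ∫ z, db (dz κ) z * (g z - 1) := by
  have hκ1 : ContDiff ℝ 1 κ := hκ.of_le (by norm_num)
  have hg1 : ContDiff ℝ 1 g := hg.of_le (by norm_num)
  have h1 := integral_dz_eq_zero (hκ1.mul hg.db) (hc.mul_right (f' := db g))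
  have h2 := integral_db_eq_zero (hκ.dz.mul (hg1.sub contDiff_const))
    (hc.dz.mul_right (f' := fun z => g z - 1))
  have e1 : ∀ z, dz (fun z => κ z * db g z) z = dz κ z * db g z + κ z * dz (db g) z := fun z =>
    ((hκ1.differentiable (by norm_num) z).hasW.mul
      (hg.db.differentiable (by norm_num) z).hasW).dz_eq
  have e2 : ∀ z, db (fun z => dz κ z * (g z - 1)) z = db (dz κ) z * (g z - 1) + dz κ z * db g z := by
    intro z
    refine (((hκ.dz.differentiable (by norm_num) z).hasW.mul
      ((hg1.differentiable (by norm_num) z).hasW.sub (HasW.const 1 z))).db_eq).trans ?_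
    rw [sub_zero]
  have c1 := hκ1.continuous
  have c2 := hκ1.continuous_dz
  have c3 := hg1.continuous_db
  have c4 := hg.db.continuous_dz
  have c5 := hκ.dz.continuous_db
  have c6 := hg1.continuous
  have i1 : Integrable fun z => dz κ z * db g z :=
    (c2.mul c3).integrable_of_hasCompactSupport (hc.dz.mul_right (f' := db g))
  have i2 : Integrable fun z => κ z * dz (db g) z :=
    (c1.mul c4).integrable_of_hasCompactSupport (hc.mul_right (f' := dz (db g)))
  have i3 : Integrable fun z => db (dz κ) z * (g z - 1) :=
    (c5.mul (c6.sub continuous_const)).integrable_of_hasCompactSupport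
      (hc.dz.db.mul_right (f' := fun z => g z - 1))
  simp only [e1] at h1
  simp only [e2] at h2
  rw [integral_add i1 i2] at h1
  rw [integral_add i3 i1] at h2
  linear_combination h1 - h2

theorem exists_smooth_step : ∃ (Θ : ℝ → ℝ) (C : ℝ), ContDiff ℝ 2 Θ ∧ (∀ x ≤ 1 / 2, Θ x = 0) ∧
    (∀ x, 3 / 4 ≤ x → Θ x = 1) ∧ (∀ x, 0 ≤ Θ x) ∧ (∀ x, Θ x ≤ 1) ∧ 0 ≤ C ∧
    ∀ x, 0 < x → deriv Θ x ^ 2 * x ≤ C := by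
  set Θ : ℝ → ℝ := fun x => Real.smoothTransition (4 * x - 2) with hΘ
  have hc : ContDiff ℝ 2 Θ := Real.smoothTransition.contDiff.comp (by fun_prop)
  have hd : Continuous (deriv Θ) := hc.continuous_deriv (by norm_num)
  obtain ⟨C, hC⟩ := (isCompact_Icc (a := (0 : ℝ)) (b := 1)).exists_bound_of_continuousOn
    (f := fun x => deriv Θ x ^ 2 * x) (by fun_prop)
  have hC0 : 0 ≤ C := (norm_nonneg _).trans (hC 0 (by simp))
  refine ⟨Θ, C, hc, fun x hx => Real.smoothTransition.zero_of_nonpos (by linarith),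
    fun x hx => Real.smoothTransition.one_of_one_le (by linarith),
    fun x => Real.smoothTransition.nonneg _, fun x => Real.smoothTransition.le_one _, hC0,
    fun x hx => ?_⟩
  by_cases h : x ≤ 1
  · exact (le_abs_self _).trans (hC x ⟨hx.le, h⟩)
  · have : Θ =ᶠ[nhds x] fun _ => 1 := by
      filter_upwards [lt_mem_nhds (not_le.1 h)] with y hy
      exact Real.smoothTransition.one_of_one_le (by linarith)
    rw [this.deriv_eq]
    simpa using hC0

theorem HasCompactSupport.exists_norm_le {u : ℂ → ℂ} (hc : HasCompactSupport u)
    (hu : Continuous u) : ∃ A, 0 ≤ A ∧ ∀ z, ‖u z‖ ≤ A := by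
  obtain ⟨A, hA⟩ := hu.bounded_above_of_compact_support hc
  exact ⟨A, (norm_nonneg _).trans (hA 0), hA⟩

/-- Quantitative form of the vanishing of the weak `∂̄`-derivative across a set of capacity zero. -/
theorem norm_integral_mul_db_le {W : Set ℂ} (hW : IsOpen W) {f : ℂ → ℂ}
    (hf : DifferentiableOn ℂ f W) (hf2 : IntegrableOn (fun z => ‖f z‖ ^ 2) W) {α : ℂ → ℂ}
    (hα : ContDiff ℝ 2 α) (hc : HasCompactSupport α) (hcap : CapZero (tsupport α \ W)) :
    ∃ C, ∀ δ > 0, ∀ ε > 0, ‖∫ z, W.indicator f z * db α z‖ ≤ δ * C + C * ε / δ := by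
  set h := W.indicator f with hh
  have hα1 : ContDiff ℝ 1 α := hα.of_le (by norm_num)
  have hmeas : AEStronglyMeasurable h volume :=
    (aestronglyMeasurable_indicator_iff hW.measurableSet).2
      (hf.continuousOn.aestronglyMeasurable hW.measurableSet)
  have hsq : Integrable fun z => ‖h z‖ ^ 2 := by
    refine (hf2.integrable_indicator hW.measurableSet).congr (ae_of_all _ fun z => ?_)
    by_cases hz : z ∈ W <;> simp [hh, hz]
  have hL2 : MemLp h 2 volume := (memLp_two_iff_integrable_sq_norm hmeas).2 hsq
  have hloc : LocallyIntegrable h := hL2.locallyIntegrable (by norm_num)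
  obtain ⟨R, hR⟩ := hc.isCompact.isBounded.subset_ball (0 : ℂ)
  obtain ⟨A₁, hA₁, hb1⟩ := hc.db.exists_norm_le hα1.continuous_db
  set κ : ℂ → ℂ := fun z => α z * starRingEnd ℂ (α z) with hκ
  have hκc : ContDiff ℝ 2 κ := hα.mul hα.conj
  have hκs : HasCompactSupport κ := hc.mul_right (f' := fun z => starRingEnd ℂ (α z))
  have hκα : ∀ z, κ z = ((‖α z‖ ^ 2 : ℝ) : ℂ) := fun z => by
    simp only [hκ]; rw [Complex.mul_conj, Complex.normSq_eq_norm_sq]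
  obtain ⟨A₂, hA₂, hb2⟩ := hκs.dz.db.exists_norm_le hκc.dz.continuous_db
  obtain ⟨Θ, CΘ, hΘc, hΘ0, hΘ1, hΘn, hΘl, hCΘ, hΘd⟩ := exists_smooth_step
  set A := ∫ z, ‖h z‖ ^ 2 with hA
  have hA0 : 0 ≤ A := integral_nonneg fun z => by positivity
  refine ⟨A + (8 * A₁ ^ 2 + 2 * CΘ * A₂), fun δ hδ ε hε => ?_⟩
  obtain ⟨g, s, hg, hg0, hgK, hgint, hgs, hgb⟩ := hcap.exists_cutoff_weight R hε
  have hg' := hg.ofReal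
  have hgcont := hg.continuous
  have hs0 : ∀ z, 0 ≤ s z := fun z => by
    have := (sq_nonneg _).trans (hgb z)
    exact nonneg_of_mul_nonneg_right this (hg0 z)
  have hscont : Continuous s := by
    have : s = fun z => (dz (db fun z => (g z : ℂ)) z).re := by ext z; rw [hgs]; simp
    rw [this]
    exact Complex.continuous_re.comp hg'.db.continuous_dz
  set β : ℂ → ℂ := fun z => (Θ (g z) : ℂ) * α z with hβ
  have hβc : ContDiff ℝ 2 β := (hΘc.comp hg).ofReal.mul hα
  have hβs : HasCompactSupport β := hc.mul_left (f := fun z => (Θ (g z) : ℂ))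
  have hβW : tsupport β ⊆ W := by
    have h1 : tsupport β ⊆ {z | 1 / 2 ≤ g z} := by
      refine closure_minimal (fun z hz => ?_) (isClosed_le continuous_const hgcont)
      by_contra hlt
      simp only [mem_ofPred_eq, not_le] at hlt
      exact hz (by simp [hβ, hΘ0 _ hlt.le])
    have h2 : tsupport β ⊆ tsupport α := tsupport_mul_subset_right
    intro z hz
    by_contra hzW
    have := hgK z ⟨h2 hz, hzW⟩
    exact absurd (h1 hz) (by simpa using this)
  set G : ℂ → ℂ := fun z => db (fun z => (g z : ℂ)) z with hG
  have hGc : Continuous G := hg'.db.continuous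
  have hΘ' : Continuous (deriv Θ) := hΘc.continuous_deriv (by norm_num)
  have hΘcont := hΘc.continuous
  have hαcont := hα.continuous
  have hdbα : Continuous (db α) := hα1.continuous_db
  have hdbβ : ∀ z, db β z = Θ (g z) * db α z + deriv Θ (g z) * G z * α z := by
    intro z
    have h1 := HasW.comp_real (k := Θ) ((hΘc.differentiable (by norm_num) (g z)).hasDerivAt)
      (hg'.differentiable (by norm_num) z).hasW
    rw [(h1.mul (hα1.differentiable (by norm_num) z).hasW).db_eq]
    ring
  -- integration by parts away from the exceptional set
  have hzero : ∫ z, h z * db β z = 0 := by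
    have hcd : ContDiff ℝ 1 fun z => h z * β z := by
      rw [contDiff_iff_contDiffAt]
      intro z
      by_cases hz : z ∈ W
      · have h1 : ContDiffAt ℝ 1 f z :=
          ((hf.analyticAt (hW.mem_nhds hz)).contDiffAt (n := 1)).restrict_scalars ℝ
        have h2 : ContDiffAt ℝ 1 h z := h1.congr_of_eventuallyEq (by
          filter_upwards [hW.mem_nhds hz] with w hw
          simp [hh, hw])
        exact h2.mul (hβc.of_le (by norm_num)).contDiffAt
      · have h1 : (fun z => h z * β z) =ᶠ[nhds z] fun _ => 0 := by
          filter_upwards [(isClosed_tsupport β).isOpen_compl.mem_nhds fun h => hz (hβW h)] with w hw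
          rw [image_eq_zero_of_notMem_tsupport hw, mul_zero]
        exact contDiffAt_const.congr_of_eventuallyEq h1
    rw [← integral_db_eq_zero hcd (hβs.mul_left (f := h))]
    refine integral_congr_ae (ae_of_all _ fun z => ?_)
    by_cases hz : z ∈ W
    · have h1 : HasW h (deriv f z) 0 z :=
        (HasW.of_hasDerivAt (hf.differentiableAt (hW.mem_nhds hz)).hasDerivAt).congr_of_eventuallyEq
          (by filter_upwards [hW.mem_nhds hz] with w hw; simp [hh, hw])
      have h2 := (h1.mul (hβc.differentiable (by norm_num) z).hasW).db_eq
      simp only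
      rw [h2]; ring
    · have h1 : (fun z => h z * β z) =ᶠ[nhds z] fun _ => 0 := by
        filter_upwards [(isClosed_tsupport β).isOpen_compl.mem_nhds fun h => hz (hβW h)] with w hw
        rw [image_eq_zero_of_notMem_tsupport hw, mul_zero]
      simp only
      rw [((HasW.const 0 z).congr_of_eventuallyEq h1).db_eq]
      simp [hh, hz]
  have h_int : ∀ u : ℂ → ℂ, Continuous u → HasCompactSupport u → Integrable fun z => h z * u z := by
    intro u hu huc
    have := hloc.integrable_smul_right_of_hasCompactSupport hu huc
    simpa [smul_eq_mul] using this
  set u : ℂ → ℂ := fun z => db α z - db β z with hu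
  have hucont : Continuous u := hdbα.sub (hβc.of_le (by norm_num : (1 : WithTop ℕ∞) ≤ 2)).continuous_db
  have husupp : HasCompactSupport u := hc.db.sub hβs.db
  have hI : ∫ z, h z * db α z = ∫ z, h z * u z := by
    have h1 : ∀ z, h z * u z = h z * db α z - h z * db β z := fun z => by simp only [hu]; ring
    simp only [h1]
    rw [integral_sub (h_int _ hdbα hc.db)
      (h_int _ (hβc.of_le (by norm_num : (1 : WithTop ℕ∞) ≤ 2)).continuous_db hβs.db), hzero, sub_zero]
  set V : ℂ → ℝ := fun z => 8 * A₁ ^ 2 * (ball (0 : ℂ) R).indicator (fun z => |g z - 1|) z +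
    2 * CΘ * (‖α z‖ ^ 2 * s z) with hV
  have hdb0 : ∀ z, z ∉ ball (0 : ℂ) R → db α z = 0 := fun z hz =>
    image_eq_zero_of_notMem_tsupport fun h => hz (hR (tsupport_db_subset α h))
  have huV : ∀ z, ‖u z‖ ^ 2 ≤ V z := by
    intro z
    have e : u z = ((1 - Θ (g z) : ℝ) : ℂ) * db α z - ((deriv Θ (g z) : ℝ) : ℂ) * G z * α z := by
      simp only [hu]; rw [hdbβ]; push_cast; ring
    have n1 : ‖((1 - Θ (g z) : ℝ) : ℂ) * db α z‖ ^ 2 ≤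
        4 * A₁ ^ 2 * (ball (0 : ℂ) R).indicator (fun z => |g z - 1|) z := by
      by_cases hz : z ∈ ball (0 : ℂ) R
      · rw [indicator_of_mem hz, norm_mul, mul_pow, Complex.norm_real, Real.norm_eq_abs, sq_abs]
        have h1 : (1 - Θ (g z)) ^ 2 ≤ 4 * |g z - 1| := by
          by_cases h34 : 3 / 4 ≤ g z
          · rw [hΘ1 _ h34]; simp
          · have h2 := neg_abs_le (g z - 1)
            have h3 := hΘn (g z)
            have h4 := hΘl (g z)
            nlinarith
        have h2 : ‖db α z‖ ^ 2 ≤ A₁ ^ 2 := by gcongr; exact hb1 z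
        calc (1 - Θ (g z)) ^ 2 * ‖db α z‖ ^ 2 ≤ 4 * |g z - 1| * A₁ ^ 2 := by gcongr
          _ = _ := by ring
      · rw [indicator_of_notMem hz, hdb0 z hz]; simp
    have n2 : ‖((deriv Θ (g z) : ℝ) : ℂ) * G z * α z‖ ^ 2 ≤ CΘ * (‖α z‖ ^ 2 * s z) := by
      rw [norm_mul, norm_mul, Complex.norm_real, Real.norm_eq_abs, mul_pow, mul_pow, sq_abs]
      calc deriv Θ (g z) ^ 2 * ‖G z‖ ^ 2 * ‖α z‖ ^ 2
          ≤ deriv Θ (g z) ^ 2 * (g z * s z) * ‖α z‖ ^ 2 := by gcongr; exact hgb z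
        _ = (deriv Θ (g z) ^ 2 * g z) * (‖α z‖ ^ 2 * s z) := by ring
        _ ≤ _ := by
          have := hs0 z
          gcongr; exact hΘd _ (hg0 z)
    have n3 := norm_sub_le (((1 - Θ (g z) : ℝ) : ℂ) * db α z) (((deriv Θ (g z) : ℝ) : ℂ) * G z * α z)
    rw [← e] at n3
    have n4 : ‖u z‖ ^ 2 ≤ (‖((1 - Θ (g z) : ℝ) : ℂ) * db α z‖ + ‖((deriv Θ (g z) : ℝ) : ℂ) * G z * α z‖) ^ 2 := by
      gcongr
    simp only [hV]
    nlinarith [sq_nonneg (‖((1 - Θ (g z) : ℝ) : ℂ) * db α z‖ - ‖((deriv Θ (g z) : ℝ) : ℂ) * G z * α z‖)]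
  have hgB : IntegrableOn (fun z => |g z - 1|) (ball (0 : ℂ) R) := by
    have : Continuous fun z => |g z - 1| := by fun_prop
    exact (this.locallyIntegrable.integrableOn_isCompact (isCompact_closedBall (0 : ℂ) R)).mono_set
        ball_subset_closedBall
  have hi1 : Integrable ((ball (0 : ℂ) R).indicator fun z => |g z - 1|) :=
    hgB.integrable_indicator measurableSet_ball
  have hi2 : Integrable fun z => ‖α z‖ ^ 2 * s z := by
    refine Continuous.integrable_of_hasCompactSupport (by fun_prop) ?_
    have : HasCompactSupport fun z => ‖α z‖ ^ 2 := hc.comp_left (g := fun w => ‖w‖ ^ 2) (by simp)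
    exact this.mul_right (f' := s)
  have hVint : Integrable V := (hi1.const_mul _).add (hi2.const_mul _)
  have hκint : ∫ z, ‖α z‖ ^ 2 * s z ≤ A₂ * ε := by
    have h1 := integral_mul_dz_db hκc hκs hg'
    have h2 : ∀ z, κ z * dz (db fun z => (g z : ℂ)) z = ((‖α z‖ ^ 2 * s z : ℝ) : ℂ) := fun z => by
      rw [hgs, hκα]; push_cast; ring
    simp only [h2] at h1
    rw [integral_complex_ofReal] at h1
    calc ∫ z, ‖α z‖ ^ 2 * s z ≤ ‖((∫ z, ‖α z‖ ^ 2 * s z : ℝ) : ℂ)‖ := by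
          rw [Complex.norm_real]; exact le_abs_self _
      _ ≤ ∫ z, A₂ * (ball (0 : ℂ) R).indicator (fun z => |g z - 1|) z := by
          rw [h1]
          refine norm_integral_le_of_norm_le (hi1.const_mul _) (ae_of_all _ fun z => ?_)
          by_cases hz : z ∈ ball (0 : ℂ) R
          · rw [indicator_of_mem hz, norm_mul]
            have : ‖(g z : ℂ) - 1‖ = |g z - 1| := by
              rw [← Complex.ofReal_one, ← Complex.ofReal_sub, Complex.norm_real]; rfl
            rw [this]
            gcongr; exact hb2 z
          · have : db (dz κ) z = 0 := image_eq_zero_of_notMem_tsupport fun h => hz (hR ?_)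
            · rw [this, indicator_of_notMem hz]; simp
            · have h3 := tsupport_dz_subset κ (tsupport_db_subset (dz κ) h)
              exact tsupport_mul_subset_left h3
      _ = A₂ * ∫ z in ball (0 : ℂ) R, |g z - 1| := by
          rw [integral_const_mul, integral_indicator measurableSet_ball]
      _ ≤ A₂ * ε := by gcongr
  have hVle : ∫ z, V z ≤ (8 * A₁ ^ 2 + 2 * CΘ * A₂) * ε := by
    simp only [hV]
    rw [integral_add (hi1.const_mul _) (hi2.const_mul _), integral_const_mul, integral_const_mul,
      integral_indicator measurableSet_ball]
    have h1 : 8 * A₁ ^ 2 * ∫ z in ball (0 : ℂ) R, |g z - 1| ≤ 8 * A₁ ^ 2 * ε := by gcongr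
    have h2 : 2 * CΘ * ∫ z, ‖α z‖ ^ 2 * s z ≤ 2 * CΘ * (A₂ * ε) := by gcongr
    linarith
  rw [hI]
  calc ‖∫ z, h z * u z‖ ≤ ∫ z, (δ * ‖h z‖ ^ 2 + V z / δ) := by
        refine norm_integral_le_of_norm_le ((hsq.const_mul δ).add (hVint.div_const δ))
          (ae_of_all _ fun z => ?_)
        rw [norm_mul]
        have h1 : ‖h z‖ * ‖u z‖ ≤ δ * ‖h z‖ ^ 2 + ‖u z‖ ^ 2 / δ := by
          have h2 : δ * ‖h z‖ ^ 2 + ‖u z‖ ^ 2 / δ - ‖h z‖ * ‖u z‖ =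
              (‖u z‖ ^ 2 + (δ * ‖h z‖ - ‖u z‖) ^ 2 + (δ * ‖h z‖) ^ 2) / (2 * δ) := by
            field_simp; ring
          have h3 : 0 ≤ (‖u z‖ ^ 2 + (δ * ‖h z‖ - ‖u z‖) ^ 2 + (δ * ‖h z‖) ^ 2) / (2 * δ) := by
            positivity
          linarith
        refine h1.trans ?_
        gcongr; exact huV z
    _ = δ * A + (∫ z, V z) / δ := by
        rw [integral_add (hsq.const_mul δ) (hVint.div_const δ), integral_const_mul, integral_div]
    _ ≤ δ * A + (8 * A₁ ^ 2 + 2 * CΘ * A₂) * ε / δ := by gcongr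
    _ ≤ _ := by
        have h1 : 0 ≤ δ * (8 * A₁ ^ 2 + 2 * CΘ * A₂) := by positivity
        have h2 : 0 ≤ A * ε / δ := by positivity
        have h3 : (A + (8 * A₁ ^ 2 + 2 * CΘ * A₂)) * ε / δ =
            A * ε / δ + (8 * A₁ ^ 2 + 2 * CΘ * A₂) * ε / δ := by ring
        rw [h3, mul_add]
        linarith

/-- Closed sets of capacity zero are removable for square-integrable holomorphic functions. -/
theorem exists_extension_of_capZero {U W : Set ℂ} (hU : IsOpen U) (hW : IsOpen W) (hWU : W ⊆ U)
    (hcap : ∀ K, IsCompact K → K ⊆ U \ W → CapZero K) {f : ℂ → ℂ} (hf : DifferentiableOn ℂ f W)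
    (hf2 : IntegrableOn (fun z => ‖f z‖ ^ 2) W) :
    ∃ F : ℂ → ℂ, DifferentiableOn ℂ F U ∧ EqOn F f W := by
  have hmeas : AEStronglyMeasurable (W.indicator f) volume :=
    (aestronglyMeasurable_indicator_iff hW.measurableSet).2
      (hf.continuousOn.aestronglyMeasurable hW.measurableSet)
  have hsq : Integrable fun z => ‖W.indicator f z‖ ^ 2 := by
    refine (hf2.integrable_indicator hW.measurableSet).congr (ae_of_all _ fun z => ?_)
    by_cases hz : z ∈ W <;> simp [hz]
  have hL2 : MemLp (W.indicator f) 2 volume := (memLp_two_iff_integrable_sq_norm hmeas).2 hsq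
  have hloc : LocallyIntegrable (W.indicator f) := hL2.locallyIntegrable (by norm_num)
  obtain ⟨F, hF, hFe⟩ := weyl hU (hloc.locallyIntegrableOn U) fun α hα hc hs => by
    have hK : IsCompact (tsupport α \ W) := hc.isCompact.diff hW
    obtain ⟨C, hC⟩ := norm_integral_mul_db_le hW hf hf2 hα hc
      (hcap _ hK (sdiff_subset_sdiff_left hs))
    by_contra hne
    have hpos := norm_pos_iff.2 hne
    have h1 := hC 1 one_pos 1 one_pos
    have hC0 : 0 < C := by linarith
    set N := ‖∫ z, W.indicator f z * db α z‖
    have hδ : 0 < N / (3 * C) := by positivity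
    have h2 := hC _ hδ _ (pow_pos hδ 2)
    have h3 : N / (3 * C) * C + C * (N / (3 * C)) ^ 2 / (N / (3 * C)) = 2 / 3 * N := by
      field_simp; ring
    linarith
  refine ⟨F, hF, ?_⟩
  have h1 : F =ᵐ[volume.restrict W] f := by
    rw [EventuallyEq, ae_restrict_iff' hW.measurableSet]
    filter_upwards [hFe] with z hz hzW
    rw [← hz (hWU hzW), indicator_of_mem hzW]
  exact Measure.eqOn_open_of_ae_eq h1 hW (hF.continuousOn.mono hWU) hf.continuousOn

theorem isPreconnected_of_capZero {U W : Set ℂ} (hU : IsOpen U) (hUc : IsPreconnected U)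
    (hUb : volume U ≠ ⊤)
    (hW : IsOpen W) (hWU : W ⊆ U) (hcap : ∀ K, IsCompact K → K ⊆ U \ W → CapZero K) :
    IsPreconnected W := by
  classical
  rw [isPreconnected_iff_subset_of_disjoint]
  intro A B hA hB hAB hdis
  by_contra hcon
  push Not at hcon
  obtain ⟨⟨b, hbW, hbA⟩, ⟨a, haW, haB⟩⟩ := And.intro (not_subset.1 hcon.1) (not_subset.1 hcon.2)
  have haA : a ∈ A := (hAB haW).resolve_right haB
  have hbB : b ∈ B := (hAB hbW).resolve_left hbA
  set f : ℂ → ℂ := A.indicator fun _ => 1 with hf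
  have hfd : DifferentiableOn ℂ f W := by
    intro z hz
    rcases hAB hz with h | h
    · refine DifferentiableAt.differentiableWithinAt ?_
      refine (differentiableAt_const (1 : ℂ)).congr_of_eventuallyEq ?_
      filter_upwards [hA.mem_nhds h] with w hw
      simp [hf, hw]
    · refine DifferentiableAt.differentiableWithinAt ?_
      refine (differentiableAt_const (0 : ℂ)).congr_of_eventuallyEq ?_
      filter_upwards [(hB.inter hW).mem_nhds ⟨h, hz⟩] with w hw
      have : w ∉ A := fun hwA => by
        have : w ∈ W ∩ (A ∩ B) := ⟨hw.2, hwA, hw.1⟩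
        rw [hdis] at this; exact this
      simp [hf, this]
  have hfi : IntegrableOn (fun z => ‖f z‖ ^ 2) W := by
    have h1 : IntegrableOn (fun _ : ℂ => (1 : ℝ)) W :=
      integrableOn_const (measure_ne_top_of_subset hWU hUb)
    refine Integrable.mono' h1 ?_ (ae_of_all _ fun z => ?_)
    · have : ContinuousOn (fun z => ‖f z‖ ^ 2) W := hfd.continuousOn.norm.pow 2
      exact this.aestronglyMeasurable hW.measurableSet
    · by_cases h : z ∈ A <;> simp [hf, h]
  obtain ⟨F, hF, hFf⟩ := exists_extension_of_capZero hU hW hWU hcap hfd hfi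
  have h1 : EqOn F (fun _ => 1) U := by
    refine (hF.analyticOnNhd hU).eqOn_of_preconnected_of_eventuallyEq analyticOnNhd_const hUc
      (hWU haW) ?_
    filter_upwards [(hA.inter hW).mem_nhds ⟨haA, haW⟩] with w hw
    rw [hFf hw.2]; simp [hf, hw.1]
  have h2 := hFf hbW
  rw [h1 (hWU hbW)] at h2
  simp [hf, hbA] at h2

theorem measurable_phase {u : ℂ → ℂ} (hu : Measurable u) :
    Measurable fun s => starRingEnd ℂ (u s) / (‖u s‖ : ℂ) := by
  have : Measurable fun s => starRingEnd ℂ (u s) := Complex.continuous_conj.measurable.comp hu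
  fun_prop

theorem phase_norm_le (w : ℂ) : ‖starRingEnd ℂ w / (‖w‖ : ℂ)‖ ≤ 1 := by
  rw [norm_div, RCLike.norm_conj, Complex.norm_real, norm_norm]
  exact div_self_le_one _

theorem phase_mul (w : ℂ) : starRingEnd ℂ w / (‖w‖ : ℂ) * w = ‖w‖ := by
  by_cases h : w = 0
  · simp [h]
  have h1 : (‖w‖ : ℂ) ≠ 0 := by simpa using h
  rw [div_mul_eq_mul_div, mul_comm, Complex.mul_conj, Complex.normSq_eq_norm_sq, div_eq_iff h1]
  push_cast; ring

theorem integral_norm_sub_average_le {μ : Measure ℂ} [IsFiniteMeasure μ] (hμ : μ ≠ 0) {k : ℂ → ℂ}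
    (hk : Measurable k) (hki : Integrable k μ) {C : ℝ}
    (H : ∀ h : ℂ → ℂ, Measurable h → (∀ s, ‖h s‖ ≤ 2) → ∫ s, h s ∂μ = 0 →
      ‖∫ s, h s * k s ∂μ‖ ≤ C) :
    ∫ s, ‖k s - ⨍ s, k s ∂μ‖ ∂μ ≤ C := by
  set m := ⨍ s, k s ∂μ with hm
  have : NeZero μ := ⟨hμ⟩
  have hu : Measurable fun s => k s - m := hk.sub_const m
  set h₀ : ℂ → ℂ := fun s => starRingEnd ℂ (k s - m) / (‖k s - m‖ : ℂ) with hh₀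
  have hh₀m : Measurable h₀ := measurable_phase hu
  have hh₀b : ∀ s, ‖h₀ s‖ ≤ 1 := fun s => phase_norm_le _
  have hh₀i : Integrable h₀ μ := (integrable_const (1 : ℝ)).mono' hh₀m.aestronglyMeasurable
    (ae_of_all _ hh₀b)
  set c := ⨍ s, h₀ s ∂μ with hc
  have hcb : ‖c‖ ≤ 1 := by
    rw [hc, average_eq, norm_smul, norm_inv, Real.norm_of_nonneg measureReal_nonneg]
    have h1 : 0 < μ.real univ := by
      simp only [Measure.real]; exact ENNReal.toReal_pos (by simpa using hμ) (measure_ne_top _ _)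
    rw [inv_mul_le_iff₀ h1, mul_one]
    have := norm_integral_le_of_norm_le_const (μ := μ) (ae_of_all _ hh₀b)
    simpa using this
  have hz : ∀ {f : ℂ → ℂ}, Integrable f μ → ∫ s, (f s - ⨍ s, f s ∂μ) ∂μ = 0 := by
    intro f hf
    exact integral_sub_average μ f
  have h1 := H (fun s => h₀ s - c) (hh₀m.sub_const c)
    (fun s => (norm_sub_le _ _).trans (by have := hh₀b s; linarith)) (hz hh₀i)
  have hi1 : Integrable (fun s => k s - m) μ := hki.sub (integrable_const m)
  have e : ∀ s, (h₀ s - c) * k s = ((‖k s - m‖ : ℝ) : ℂ) - c * (k s - m) + m * (h₀ s - c) := by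
    intro s
    have := phase_mul (k s - m)
    rw [← this]; simp only [hh₀]; ring
  have hi2 : Integrable (fun s => h₀ s - c) μ := hh₀i.sub (integrable_const c)
  have h2 : ∫ s, (h₀ s - c) * k s ∂μ = ((∫ s, ‖k s - m‖ ∂μ : ℝ) : ℂ) := by
    simp only [e]
    rw [integral_add (f := fun s => ((‖k s - m‖ : ℝ) : ℂ) - c * (k s - m))
        (hi1.norm.ofReal.sub (hi1.const_mul c)) (hi2.const_mul m),
      integral_sub (f := fun s => ((‖k s - m‖ : ℝ) : ℂ)) hi1.norm.ofReal (hi1.const_mul c),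
      integral_const_mul, integral_const_mul, hz hh₀i, hz hki, integral_complex_ofReal]
    simp
  rw [h2, Complex.norm_real] at h1
  exact (le_abs_self _).trans h1

/-- A function of modulus at least two whose powers have bounded moments against all mean-zero
functions is almost everywhere constant. -/
theorem ae_const_of_moments {μ : Measure ℂ} [IsFiniteMeasure μ] (hμ : μ ≠ 0) {y : ℂ → ℂ}
    (hy : Measurable y) {Y : ℝ} (h2 : ∀ᵐ s ∂μ, 2 ≤ ‖y s‖) (hY : ∀ᵐ s ∂μ, ‖y s‖ ≤ Y) {C : ℝ}
    (H : ∀ n : ℕ, ∀ h : ℂ → ℂ, Measurable h → (∀ s, ‖h s‖ ≤ 2) → ∫ s, h s ∂μ = 0 →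
      ‖∫ s, h s * y s ^ n ∂μ‖ ≤ C) :
    ∃ q, ∀ᵐ s ∂μ, y s = q := by
  have : NeZero μ := ⟨hμ⟩
  set m : ℕ → ℂ := fun n => ⨍ s, y s ^ n ∂μ with hm
  set v := μ.real univ with hv
  have hv0 : 0 < v := by
    simp only [hv, Measure.real]
    exact ENNReal.toReal_pos (by simpa using hμ) (measure_ne_top _ _)
  have hyi : ∀ n, Integrable (fun s => y s ^ n) μ := fun n =>
    (integrable_const (Y ^ n)).mono' (hy.pow_const n).aestronglyMeasurable
      (hY.mono fun s hs => by rw [norm_pow]; gcongr)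
  have hC : ∀ n, ∫ s, ‖y s ^ n - m n‖ ∂μ ≤ C := fun n =>
    integral_norm_sub_average_le hμ (hy.pow_const n) (hyi n) (H n)
  have hdi : ∀ n, Integrable (fun s => y s ^ n - m n) μ := fun n => (hyi n).sub (integrable_const _)
  have hY0 : 0 ≤ Y := by
    obtain ⟨s, hs⟩ := hY.exists
    exact (norm_nonneg _).trans hs
  have hmn : ∀ n, 2 ^ n * v - C ≤ ‖m n‖ * v := by
    intro n
    have h3 : ∫ _, (2 : ℝ) ^ n ∂μ ≤ ∫ s, (‖y s ^ n - m n‖ + ‖m n‖) ∂μ := by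
      refine integral_mono_ae (integrable_const _) ((hdi n).norm.add (integrable_const _)) ?_
      filter_upwards [h2] with s hs
      calc (2 : ℝ) ^ n ≤ ‖y s‖ ^ n := by gcongr
        _ = ‖y s ^ n‖ := (norm_pow _ _).symm
        _ = ‖(y s ^ n - m n) + m n‖ := by rw [sub_add_cancel]
        _ ≤ _ := norm_add_le _ _
    rw [integral_add (hdi n).norm (integrable_const _), integral_const, integral_const, smul_eq_mul,
      smul_eq_mul] at h3
    have := hC n
    linarith
  have hstep : ∀ n, m n ≠ 0 → ∫ s, ‖y s - m (n + 1) / m n‖ ∂μ ≤ (1 + Y) * C / ‖m n‖ := by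
    intro n hn
    have hn' := norm_pos_iff.2 hn
    have h3 : ∫ s, ‖y s - m (n + 1) / m n‖ ∂μ ≤
        ∫ s, (‖y s ^ (n + 1) - m (n + 1)‖ + Y * ‖y s ^ n - m n‖) / ‖m n‖ ∂μ := by
      have hyi1 : Integrable y μ := by simpa using hyi 1
      refine integral_mono_ae (hyi1.sub (integrable_const _)).norm
        (((hdi (n + 1)).norm.add ((hdi n).norm.const_mul Y)).div_const _) ?_
      filter_upwards [hY] with s hs
      have e : y s - m (n + 1) / m n = ((y s ^ (n + 1) - m (n + 1)) - y s * (y s ^ n - m n)) / m n := by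
        field_simp; ring
      rw [e, norm_div]
      have h4 := norm_sub_le (y s ^ (n + 1) - m (n + 1)) (y s * (y s ^ n - m n))
      rw [norm_mul] at h4
      gcongr
      refine h4.trans ?_
      gcongr
    refine h3.trans ?_
    rw [integral_div, integral_add (hdi (n + 1)).norm ((hdi n).norm.const_mul Y), integral_const_mul]
    have := hC (n + 1)
    have := mul_le_mul_of_nonneg_left (hC n) hY0
    gcongr
    linarith
  refine ⟨⨍ s, y s ∂μ, ?_⟩
  have hyi1 : Integrable y μ := by simpa using hyi 1
  have hA : ∀ q : ℂ, ∫ s, ‖y s - ⨍ s, y s ∂μ‖ ∂μ ≤ 2 * ∫ s, ‖y s - q‖ ∂μ := by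
    intro q
    have hq : Integrable (fun s => y s - q) μ := hyi1.sub (integrable_const _)
    have e : (⨍ s, y s ∂μ) - q = v⁻¹ • ∫ s, (y s - q) ∂μ := by
      rw [integral_sub hyi1 (integrable_const _), smul_sub, integral_const, smul_smul,
        inv_mul_cancel₀ hv0.ne', one_smul, average_eq]
    have h5 : ‖q - ⨍ s, y s ∂μ‖ * v ≤ ∫ s, ‖y s - q‖ ∂μ := by
      rw [norm_sub_rev, e, norm_smul, norm_inv, Real.norm_of_nonneg hv0.le]
      have := norm_integral_le_integral_norm (μ := μ) (fun s => y s - q)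
      calc v⁻¹ * ‖∫ s, (y s - q) ∂μ‖ * v = ‖∫ s, (y s - q) ∂μ‖ := by field_simp
        _ ≤ _ := this
    calc ∫ s, ‖y s - ⨍ s, y s ∂μ‖ ∂μ ≤ ∫ s, (‖y s - q‖ + ‖q - ⨍ s, y s ∂μ‖) ∂μ := by
          refine integral_mono (hyi1.sub (integrable_const _)).norm (hq.norm.add (integrable_const _))
            fun s => ?_
          have := norm_add_le (y s - q) (q - ⨍ s, y s ∂μ)
          rwa [sub_add_sub_cancel] at this
      _ = ∫ s, ‖y s - q‖ ∂μ + ‖q - ⨍ s, y s ∂μ‖ * v := by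
          rw [integral_add hq.norm (integrable_const _), integral_const, smul_eq_mul, mul_comm]
      _ ≤ _ := by linarith
  have hle : ∫ s, ‖y s - ⨍ s, y s ∂μ‖ ∂μ ≤ 0 := by
    have hC0 : 0 ≤ C := (integral_nonneg fun s => norm_nonneg _).trans (hC 0)
    refine le_of_forall_pos_le_add fun δ hδ => ?_
    rw [zero_add]
    obtain ⟨n, hn⟩ := pow_unbounded_of_one_lt ((C / v) + 2 * (1 + Y) * C / δ + 1) one_lt_two
    have h6 := hmn n
    have h7 : C / v * v = C := div_mul_cancel₀ _ hv0.ne'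
    have h8 : 2 * (1 + Y) * C / δ < ‖m n‖ := by
      by_contra hcon
      push Not at hcon
      have := mul_le_mul_of_nonneg_right hcon hv0.le
      nlinarith
    have h9 : 0 ≤ 2 * (1 + Y) * C / δ := by positivity
    have h10 : 0 < ‖m n‖ := by linarith
    refine (hA (m (n + 1) / m n)).trans ?_
    have h11 := hstep n (norm_pos_iff.1 h10)
    rw [div_lt_iff₀ hδ] at h8
    have h12 : 2 * ((1 + Y) * C / ‖m n‖) ≤ δ := by
      rw [← mul_div_assoc, div_le_iff₀ h10]
      linarith
    linarith
  have hz := (integral_eq_zero_iff_of_nonneg (fun s => norm_nonneg _)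
    (hyi1.sub (integrable_const (⨍ s, y s ∂μ))).norm).1
    (le_antisymm hle (integral_nonneg fun s => norm_nonneg _))
  filter_upwards [hz] with s hs
  exact sub_eq_zero.1 (norm_eq_zero.1 hs)

theorem PotMeas.not_ae_const {K : Set ℂ} {μ : Measure ℂ} {L : ℝ} (h : PotMeas K μ L) (s₀ : ℂ) :
    ¬ ∀ᵐ s ∂μ, s = s₀ := by
  intro hs
  have := h.fin
  have hv0 : 0 < μ.real univ := by
    simp only [Measure.real]
    exact ENNReal.toReal_pos (by simpa using h.ne) (measure_ne_top _ _)
  set v := μ.real univ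
  have key : ∀ ε, 0 < ε → ε ≤ 1 → -L ≤ v * (1 / 2 * Real.log ε) := by
    intro ε hε h1
    have h2 := h.lb s₀ ε hε h1
    rw [integral_congr_ae (g := fun _ => 1 / 2 * Real.log ε) (by
      filter_upwards [hs] with s hs
      simp [lk, hs])] at h2
    simpa using h2
  have h3 := key (Real.exp (-(2 * (|L| + 1) / v))) (Real.exp_pos _) (by
    rw [Real.exp_le_one_iff]
    have : 0 ≤ 2 * (|L| + 1) / v := by positivity
    linarith)
  rw [Real.log_exp] at h3
  have h4 : v * (1 / 2 * -(2 * (|L| + 1) / v)) = -(|L| + 1) := by field_simp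
  rw [h4] at h3
  have := le_abs_self L
  linarith

theorem integrable_radial_kernel {d : ℝ} (hd : 0 < d) :
    Integrable (fun z : ℂ => (Iio (3 : ℝ)).indicator (fun x => x⁻¹ * (2 / (d / 2 + x))) ‖z‖) ∧
    ∫ z : ℂ, (Iio (3 : ℝ)).indicator (fun x => x⁻¹ * (2 / (d / 2 + x))) ‖z‖ =
      4 * Real.pi * (Real.log (d / 2 + 3) - Real.log (d / 2)) := by
  have hc : ContinuousOn (fun x : ℝ => 2 / (d / 2 + x)) (Icc 0 3) := by
    refine continuousOn_const.div (by fun_prop) fun x hx => ?_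
    have := hx.1
    positivity
  have he : ∀ x : ℝ, x ∈ Ioi (0 : ℝ) → x ^ (Module.finrank ℝ ℂ - 1) •
      (Iio (3 : ℝ)).indicator (fun x => x⁻¹ * (2 / (d / 2 + x))) x =
      (Ioo (0 : ℝ) 3).indicator (fun x => 2 / (d / 2 + x)) x := by
    intro x hx
    have hx0 : x ≠ 0 := (mem_Ioi.1 hx).ne'
    rw [Complex.finrank_real_complex]
    by_cases h : x < 3
    · rw [indicator_of_mem (by exact h), indicator_of_mem (by exact ⟨hx, h⟩)]
      simp only [smul_eq_mul]
      field_simp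
      norm_num
    · rw [indicator_of_notMem (by exact h), indicator_of_notMem (by exact fun h' => h h'.2), smul_zero]
  constructor
  · rw [integrable_fun_norm_addHaar, integrableOn_congr_fun he measurableSet_Ioi]
    refine Integrable.integrableOn ?_
    rw [integrable_indicator_iff measurableSet_Ioo]
    exact (hc.integrableOn_Icc).mono_set Ioo_subset_Icc_self
  · rw [integral_fun_norm_addHaar, setIntegral_congr_fun measurableSet_Ioi he,
      setIntegral_indicator measurableSet_Ioo, Ioi_inter_Ioo, sup_eq_right.2 le_rfl,
      ← integral_Ioc_eq_integral_Ioo, ← intervalIntegral.integral_of_le (by norm_num),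
      Complex.finrank_real_complex, Measure.real, Complex.volume_ball]
    have h1 : ∫ x in (0 : ℝ)..3, 2 / (d / 2 + x) =
        2 * Real.log (d / 2 + 3) - 2 * Real.log (d / 2 + 0) := by
      refine intervalIntegral.integral_eq_sub_of_hasDerivAt (f := fun x => 2 * Real.log (d / 2 + x))
        (fun x hx => ?_) ?_
      · rw [uIcc_of_le (by norm_num)] at hx
        have hx' : d / 2 + x ≠ 0 := by have := hx.1; positivity
        have := (((hasDerivAt_id x).const_add (d / 2)).log hx').const_mul 2
        simpa [div_eq_mul_inv] using this
      · refine ContinuousOn.intervalIntegrable ?_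
        rwa [uIcc_of_le (by norm_num)]
    rw [h1]
    simp
    ring

theorem lintegral_cauchy_kernel_le {t s s' : ℂ} (hs : s ∈ closedBall t 1) (hs' : s' ∈ closedBall t 1)
    (hne : s ≠ s') :
    ∫⁻ z in ball t 2, ENNReal.ofReal ‖z - s‖⁻¹ * ENNReal.ofReal ‖z - s'‖⁻¹ ≤
      ENNReal.ofReal (8 * Real.pi * (Real.log 8 - Real.log ‖s - s'‖)) := by
  set d := ‖s - s'‖ with hd
  have hd0 : 0 < d := norm_pos_iff.2 (sub_ne_zero.2 hne)
  rw [mem_closedBall, dist_eq_norm] at hs hs'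
  have hd2 : d ≤ 2 := by
    have := norm_sub_le (s - t) (s' - t)
    rw [sub_sub_sub_cancel_right] at this
    linarith
  obtain ⟨hi, h_int⟩ := integrable_radial_kernel hd0
  set q : ℂ → ℝ := fun z => (Iio (3 : ℝ)).indicator (fun x => x⁻¹ * (2 / (d / 2 + x))) ‖z‖ with hq
  have hq0 : ∀ z, 0 ≤ q z := fun z => indicator_apply_nonneg fun _ => by positivity
  have hqv : ∀ z, ‖z‖ < 3 → q z = ‖z‖⁻¹ * (2 / (d / 2 + ‖z‖)) := fun z hz =>
    indicator_of_mem (by exact hz) _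
  have aux : ∀ a b : ℝ, 0 ≤ b → b ≤ a → d ≤ a + b → a⁻¹ * b⁻¹ ≤ b⁻¹ * (2 / (d / 2 + b)) := by
    intro a b hb hab hdab
    rw [mul_comm]
    gcongr
    rw [inv_eq_one_div, div_le_div_iff₀ (by linarith) (by positivity)]
    linarith
  have hpt : ∀ z ∈ ball t 2, ENNReal.ofReal ‖z - s‖⁻¹ * ENNReal.ofReal ‖z - s'‖⁻¹ ≤
      ENNReal.ofReal (q (z - s) + q (z - s')) := by
    intro z hz
    rw [mem_ball, dist_eq_norm] at hz
    rw [← ENNReal.ofReal_mul (by positivity)]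
    refine ENNReal.ofReal_le_ofReal ?_
    have h1 : ‖z - s‖ < 3 := by
      have := norm_sub_le (z - t) (s - t)
      rw [sub_sub_sub_cancel_right] at this
      linarith
    have h2 : ‖z - s'‖ < 3 := by
      have := norm_sub_le (z - t) (s' - t)
      rw [sub_sub_sub_cancel_right] at this
      linarith
    have h3 : d ≤ ‖z - s‖ + ‖z - s'‖ := by
      have := norm_sub_le (z - s') (z - s)
      rw [sub_sub_sub_cancel_left] at this
      linarith
    rcases le_total ‖z - s‖ ‖z - s'‖ with h | h
    · have h4 := aux _ _ (norm_nonneg _) h (by linarith)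
      have := hq0 (z - s')
      rw [hqv _ h1, mul_comm]
      linarith
    · have h4 := aux _ _ (norm_nonneg _) h h3
      have := hq0 (z - s)
      rw [hqv _ h2]
      linarith
  calc ∫⁻ z in ball t 2, ENNReal.ofReal ‖z - s‖⁻¹ * ENNReal.ofReal ‖z - s'‖⁻¹
      ≤ ∫⁻ z in ball t 2, ENNReal.ofReal (q (z - s) + q (z - s')) :=
        setLIntegral_mono' measurableSet_ball hpt
    _ ≤ ∫⁻ z, ENNReal.ofReal (q (z - s) + q (z - s')) := setLIntegral_le_lintegral _ _
    _ = ENNReal.ofReal (∫ z, (q (z - s) + q (z - s'))) := by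
        exact (ofReal_integral_eq_lintegral_ofReal ((hi.comp_sub_right s).add (hi.comp_sub_right s'))
          (ae_of_all _ fun z => add_nonneg (hq0 _) (hq0 _))).symm
    _ ≤ _ := by
        refine ENNReal.ofReal_le_ofReal ?_
        rw [integral_add (hi.comp_sub_right s) (hi.comp_sub_right s'), integral_sub_right_eq_self q,
          integral_sub_right_eq_self q, h_int]
        have h5 : Real.log (d / 2 + 3) - Real.log (d / 2) ≤ Real.log 8 - Real.log d := by
          rw [← Real.log_div (by positivity) (by positivity), ← Real.log_div (by norm_num) hd0.ne']
          refine Real.log_le_log (by positivity) ?_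
          rw [div_le_div_iff₀ (by positivity) hd0]
          nlinarith
        have := Real.pi_pos
        nlinarith

theorem PotMeas.lintegral_cauchy_sq_lt_top {K : Set ℂ} {μ : Measure ℂ} {L : ℝ} (h : PotMeas K μ L)
    {t : ℂ} (hK : K ⊆ closedBall t 1) :
    ∫⁻ z in ball t 2, (∫⁻ s, ENNReal.ofReal ‖z - s‖⁻¹ ∂μ) ^ 2 < ⊤ := by
  have := h.fin
  have hae : ∀ᵐ s ∂μ, s ∈ K := h.supp
  set k : ℂ → ℂ → ENNReal := fun z s => ENNReal.ofReal ‖z - s‖⁻¹ with hk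
  have hkm : Measurable (Function.uncurry k) := by
    simp only [hk, Function.uncurry_def]; fun_prop
  have hkz : ∀ z, Measurable (k z) := fun z => hkm.comp measurable_prodMk_left
  have h1 : ∀ z, (∫⁻ s, ENNReal.ofReal ‖z - s‖⁻¹ ∂μ) ^ 2 = ∫⁻ p, k z p.1 * k z p.2 ∂(μ.prod μ) := fun z => by
    rw [lintegral_prod_mul (hkz z).aemeasurable (hkz z).aemeasurable, sq]
  simp only [h1]
  rw [lintegral_lintegral_swap (by
    refine Measurable.aemeasurable ?_
    have e1 : Measurable fun q : ℂ × ℂ × ℂ => k q.1 q.2.1 :=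
      hkm.comp (measurable_fst.prodMk (measurable_fst.comp measurable_snd))
    have e2 : Measurable fun q : ℂ × ℂ × ℂ => k q.1 q.2.2 :=
      hkm.comp (measurable_fst.prodMk (measurable_snd.comp measurable_snd))
    exact e1.mul e2)]
  set F : ℕ → ℂ → ℂ → ENNReal := fun n s s' =>
    ENNReal.ofReal (8 * Real.pi * (Real.log 8 - lk (1 / (n + 1)) s s')) with hF
  have hnpos : ∀ n : ℕ, (0 : ℝ) < 1 / (n + 1) := fun n => by positivity
  have hn1 : ∀ n : ℕ, (1 : ℝ) / (n + 1) ≤ 1 := fun n => by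
    rw [div_le_one (by positivity)]
    have : (0 : ℝ) ≤ n := by positivity
    linarith
  have hFm : ∀ n s, Measurable (F n s) := fun n s => by
    have := (lk_contDiff (n := 0) (hnpos n) s).continuous
    simp only [hF]; fun_prop
  have hd2 : ∀ s ∈ K, ∀ s' ∈ K, ‖s' - s‖ ≤ 2 := by
    intro s hs s' hs'
    have a1 := hK hs
    have a2 := hK hs'
    rw [mem_closedBall] at a1 a2
    rw [← dist_eq_norm]
    linarith [dist_triangle_right s' s t]
  have hlim0 : Tendsto (fun n : ℕ => (1 : ℝ) / (n + 1)) atTop (nhds 0) :=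
    tendsto_one_div_add_atTop_nhds_zero_nat
  have key : ∀ s ∈ K, ∀ s' ∈ K, ∫⁻ z in ball t 2, k z s * k z s' ≤ liminf (fun n => F n s s') atTop := by
    intro s hs s' hs'
    by_cases hss : s = s'
    · subst hss
      have h2 : Tendsto (fun n => F n s s) atTop (nhds ⊤) := by
        simp only [hF]
        refine ENNReal.tendsto_ofReal_nhds_top.2 ?_
        refine Tendsto.const_mul_atTop (by have := Real.pi_pos; positivity) ?_
        refine tendsto_atTop_add_const_left _ _ ?_
        rw [tendsto_neg_atTop_iff]
        have : ∀ n : ℕ, lk (1 / (n + 1)) s s = 1 / 2 * Real.log (1 / (n + 1)) := fun n => by simp [lk]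
        simp only [this]
        refine Tendsto.const_mul_atBot (by norm_num) ?_
        refine Real.tendsto_log_nhdsGT_zero.comp ?_
        exact tendsto_nhdsWithin_iff.2 ⟨hlim0, Eventually.of_forall fun n => hnpos n⟩
      rw [h2.liminf_eq]
      exact le_top
    · have h2 : Tendsto (fun n => F n s s') atTop
          (nhds (ENNReal.ofReal (8 * Real.pi * (Real.log 8 - Real.log ‖s - s'‖)))) := by
        simp only [hF]
        refine ENNReal.tendsto_ofReal (Tendsto.const_mul _ (Tendsto.const_sub _ ?_))
        simp only [lk]
        have h3 : 0 < ‖s' - s‖ := norm_pos_iff.2 (sub_ne_zero.2 (Ne.symm hss))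
        have h4 : Real.log ‖s - s'‖ = 1 / 2 * Real.log (‖s' - s‖ ^ 2 + 0) := by
          rw [add_zero, Real.log_pow, norm_sub_rev]; push_cast; ring
        rw [h4]
        refine Tendsto.const_mul _ ?_
        exact (Real.continuousAt_log (by positivity)).tendsto.comp (hlim0.const_add _)
      rw [h2.liminf_eq]
      exact lintegral_cauchy_kernel_le (hK hs) (hK hs') hss
  set c := ENNReal.ofReal (8 * Real.pi * (Real.log 8 * μ.real univ + L)) with hc
  have hinner : ∀ s ∈ K, ∫⁻ s', liminf (fun n => F n s s') atTop ∂μ ≤ c := by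
    intro s hs
    refine (lintegral_liminf_le fun n => hFm n s).trans ?_
    refine (liminf_le_liminf (Eventually.of_forall fun n => ?_)).trans (liminf_const c).le
    have hli : Integrable (fun s' => lk (1 / (n + 1)) s s') μ := by
      have hcl := (lk_contDiff (n := 0) (hnpos n) s).continuous
      obtain ⟨B, hB⟩ := (isCompact_closedBall t 1).exists_bound_of_continuousOn hcl.continuousOn
      exact (integrable_const B).mono' hcl.measurable.aestronglyMeasurable
        (hae.mono fun s' hs' => hB s' (hK hs'))
    simp only [hF]
    have hli2 : Integrable (fun s' => Real.log 8 - lk (1 / (n + 1)) s s') μ :=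
      (integrable_const _).sub hli
    rw [← ofReal_integral_eq_lintegral_ofReal (hli2.const_mul _)]
    · rw [integral_const_mul, integral_sub (integrable_const _) hli, integral_const]
      refine ENNReal.ofReal_le_ofReal ?_
      have := h.lb s _ (hnpos n) (hn1 n)
      have := Real.pi_pos
      simp only [smul_eq_mul]
      gcongr
      linarith [mul_comm (μ.real univ) (Real.log 8)]
    · filter_upwards [hae] with s' hs'
      have h3 : lk (1 / (n + 1)) s s' ≤ Real.log 8 := by
        refine (lk_le_log (hnpos n) (hn1 n) s s').trans (Real.log_le_log (by positivity) ?_)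
        linarith [hd2 s hs s' hs']
      have := Real.pi_pos
      have : 0 ≤ Real.log 8 - lk (1 / (n + 1)) s s' := by linarith
      positivity
  have hprod : ∀ᵐ p ∂(μ.prod μ), p.1 ∈ K ∧ p.2 ∈ K :=
    (Measure.quasiMeasurePreserving_fst.ae hae).and (Measure.quasiMeasurePreserving_snd.ae hae)
  have hFm2 : Measurable fun p : ℂ × ℂ => liminf (fun n => F n p.1 p.2) atTop := by
    refine Measurable.liminf fun n => ?_
    simp only [hF, lk]
    fun_prop
  calc ∫⁻ p, (∫⁻ z in ball t 2, k z p.1 * k z p.2) ∂(μ.prod μ)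
      ≤ ∫⁻ p, liminf (fun n => F n p.1 p.2) atTop ∂(μ.prod μ) :=
        lintegral_mono_ae (hprod.mono fun p hp => key _ hp.1 _ hp.2)
    _ = ∫⁻ s, ∫⁻ s', liminf (fun n => F n s s') atTop ∂μ ∂μ := lintegral_prod _ hFm2.aemeasurable
    _ ≤ ∫⁻ _, c ∂μ := lintegral_mono_ae (hae.mono fun s hs => hinner s hs)
    _ < ⊤ := by
        rw [lintegral_const]
        exact ENNReal.mul_lt_top ENNReal.ofReal_lt_top (measure_lt_top _ _)

/-- The Cauchy-type integral of order `n + 1` of the density `h` against `μ`. -/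
noncomputable def cauchyT (μ : Measure ℂ) (h : ℂ → ℂ) (n : ℕ) (z : ℂ) : ℂ :=
  ∫ s, h s * ((s - z)⁻¹) ^ (n + 1) ∂μ

theorem hasDerivAt_cauchyT {μ : Measure ℂ} [IsFiniteMeasure μ] {K : Set ℂ} (hK : IsCompact K)
    (hμ : μ Kᶜ = 0) {h : ℂ → ℂ} (hm : Measurable h) (hb : ∀ s, ‖h s‖ ≤ 2) (n : ℕ) {z : ℂ}
    (hz : z ∉ K) : HasDerivAt (cauchyT μ h n) ((n + 1) * cauchyT μ h (n + 1) z) z := by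
  obtain ⟨δ, hδ, hball⟩ := Metric.isOpen_iff.1 hK.isClosed.isOpen_compl z hz
  have hae : ∀ᵐ s ∂μ, s ∈ K := by rwa [ae_iff]
  have hfar : ∀ s ∈ K, ∀ x ∈ ball z (δ / 2), δ / 2 ≤ ‖s - x‖ := by
    intro s hs x hx
    by_contra hcon
    push Not at hcon
    have h1 : s ∈ ball z δ := by
      rw [mem_ball] at hx ⊢
      rw [← dist_eq_norm] at hcon
      linarith [dist_triangle s x z]
    exact hball h1 hs
  have hinv : ∀ s ∈ K, ∀ x ∈ ball z (δ / 2), ‖(s - x)⁻¹‖ ≤ (δ / 2)⁻¹ := by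
    intro s hs x hx
    rw [norm_inv]
    exact inv_anti₀ (by positivity) (hfar s hs x hx)
  have hmeas : ∀ (k : ℕ) (x : ℂ), Measurable fun s => h s * ((s - x)⁻¹) ^ k := fun k x =>
    hm.mul (((measurable_id.sub_const x).inv).pow_const k)
  have hbd : ∀ k : ℕ, ∀ s ∈ K, ∀ x ∈ ball z (δ / 2), ‖h s * ((s - x)⁻¹) ^ k‖ ≤ 2 * (δ / 2)⁻¹ ^ k := by
    intro k s hs x hx
    rw [norm_mul, norm_pow]
    gcongr
    · exact hb s
    · exact hinv s hs x hx
  have hz' : z ∈ ball z (δ / 2) := mem_ball_self (by positivity)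
  have key := (hasDerivAt_integral_of_dominated_loc_of_deriv_le (μ := μ) (𝕜 := ℂ)
    (F := fun x s => h s * ((s - x)⁻¹) ^ (n + 1))
    (F' := fun x s => (n + 1) * (h s * ((s - x)⁻¹) ^ (n + 1 + 1))) (x₀ := z)
    (s := ball z (δ / 2)) (bound := fun _ => (n + 1) * (2 * (δ / 2)⁻¹ ^ (n + 1 + 1)))
    (ball_mem_nhds _ (by positivity))
    (Eventually.of_forall fun x => (hmeas _ x).aestronglyMeasurable)
    ((integrable_const _).mono' (hmeas _ z).aestronglyMeasurable
      (hae.mono fun s hs => hbd _ s hs z hz'))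
    ((hmeas _ z).const_mul _).aestronglyMeasurable
    (hae.mono fun s hs x hx => by
      rw [norm_mul]
      have h1 : ‖(n + 1 : ℂ)‖ = n + 1 := by
        rw [← Nat.cast_succ, Complex.norm_natCast]; push_cast; rfl
      rw [h1]
      exact mul_le_mul_of_nonneg_left (hbd _ s hs x hx) (by positivity))
    (integrable_const _)
    (hae.mono fun s hs x hx => by
      have hne : s - x ≠ 0 := by
        have := hfar s hs x hx
        intro h0
        rw [h0, norm_zero] at this
        linarith
      have h1 : HasDerivAt (fun x => (s - x)⁻¹) (((s - x) ^ 2)⁻¹) x := by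
        have := ((hasDerivAt_id x).const_sub s).fun_inv hne
        simpa [neg_div] using this
      have h2 := (h1.fun_pow (n + 1)).const_mul (h s)
      refine h2.congr_deriv ?_
      push_cast
      rw [← inv_pow]
      ring)).2
  rw [integral_const_mul] at key
  exact key

theorem iteratedDeriv_cauchyT {μ : Measure ℂ} [IsFiniteMeasure μ] {K : Set ℂ} (hK : IsCompact K)
    (hμ : μ Kᶜ = 0) {h : ℂ → ℂ} (hm : Measurable h) (hb : ∀ s, ‖h s‖ ≤ 2) (n : ℕ) {z : ℂ}
    (hz : z ∉ K) : iteratedDeriv n (cauchyT μ h 0) z = n.factorial * cauchyT μ h n z := by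
  induction n generalizing z with
  | zero => simp
  | succ n ih =>
    rw [iteratedDeriv_succ]
    have h1 : iteratedDeriv n (cauchyT μ h 0) =ᶠ[nhds z] fun x => n.factorial * cauchyT μ h n x := by
      filter_upwards [hK.isClosed.isOpen_compl.mem_nhds hz] with x hx using ih hx
    rw [h1.deriv_eq, ((hasDerivAt_cauchyT hK hμ hm hb n hz).const_mul _).deriv, Nat.factorial_succ]
    push_cast
    ring

/-- Cauchy transforms of mean-zero densities cannot all extend holomorphically, with uniform bounds,
to a disc that engulfs the support of the measure. -/
theorem PotMeas.cauchyT_not_extendable {K : Set ℂ} {μ : Measure ℂ} {L : ℝ} (h : PotMeas K μ L)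
    (hK : IsCompact K) {z₁ : ℂ} (hz : z₁ ∉ K) {R C : ℝ} (hR : 0 < R)
    (hKR : K ⊆ closedBall z₁ (R / 2))
    (H : ∀ k : ℂ → ℂ, Measurable k → (∀ s, ‖k s‖ ≤ 2) → ∫ s, k s ∂μ = 0 →
      ∃ g : ℂ → ℂ, DiffContOnCl ℂ g (ball z₁ R) ∧ (∀ z ∈ sphere z₁ R, ‖g z‖ ≤ C) ∧
        g =ᶠ[nhds z₁] cauchyT μ k 0) : False := by
  have := h.fin
  have hae : ∀ᵐ s ∂μ, s ∈ K := by have := h.supp; rwa [ae_iff]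
  obtain ⟨δ, hδ, hball⟩ := Metric.isOpen_iff.1 hK.isClosed.isOpen_compl z₁ hz
  have hfar : ∀ s ∈ K, δ ≤ ‖s - z₁‖ := by
    intro s hs
    by_contra hcon
    push Not at hcon
    exact hball (by rwa [mem_ball, dist_eq_norm]) hs
  have hC : 0 ≤ C := by
    obtain ⟨g, -, hg, -⟩ := H (fun _ => 0) measurable_const (by simp) (by simp)
    have hz2 : z₁ + R ∈ sphere z₁ R := by simp [abs_of_pos hR]
    exact (norm_nonneg _).trans (hg _ hz2)
  have hmy : Measurable fun s : ℂ => (R : ℂ) * (s - z₁)⁻¹ :=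
    ((measurable_id.sub_const z₁).inv).const_mul _
  obtain ⟨q, hq⟩ := ae_const_of_moments (μ := μ) (Y := R * δ⁻¹) (C := R * C) h.ne hmy
    (hae.mono fun s hs => by
      have h1 := hKR hs
      have h2 := hfar s hs
      rw [mem_closedBall, dist_eq_norm] at h1
      have h3 : 0 < ‖s - z₁‖ := hδ.trans_le h2
      rw [norm_mul, norm_inv, Complex.norm_real, Real.norm_of_nonneg hR.le, ← div_eq_mul_inv,
        le_div_iff₀ h3]
      linarith)
    (hae.mono fun s hs => by
      rw [norm_mul, norm_inv, Complex.norm_real, Real.norm_of_nonneg hR.le]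
      exact mul_le_mul_of_nonneg_left (inv_anti₀ hδ (hfar s hs)) hR.le)
    (fun n k hkm hkb hk0 => by
      cases n with
      | zero => simp [hk0]; positivity
      | succ n =>
        have h1 : ∫ s, k s * ((R : ℂ) * (s - z₁)⁻¹) ^ (n + 1) ∂μ = R ^ (n + 1) * cauchyT μ k n z₁ := by
          rw [cauchyT, ← integral_const_mul]
          congr 1
          ext s
          rw [mul_pow]
          ring
        obtain ⟨g, hgd, hgb, hge⟩ := H k hkm hkb hk0
        have h2 := Complex.norm_iteratedDeriv_le_of_forall_mem_sphere_norm_le n hR hgd hgb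
        rw [hge.iteratedDeriv_eq, iteratedDeriv_cauchyT hK h.supp hkm hkb n hz, norm_mul,
          Complex.norm_natCast, mul_div_assoc] at h2
        have h3 := le_of_mul_le_mul_left h2 (by exact_mod_cast n.factorial_pos)
        rw [h1, norm_mul, norm_pow, Complex.norm_real, Real.norm_of_nonneg hR.le, pow_succ]
        rw [le_div_iff₀ (by positivity)] at h3
        nlinarith)
  refine h.not_ae_const (z₁ + R / q) ?_
  filter_upwards [hq, hae] with s hs hsK
  have h2 := hfar s hsK
  have hne : s - z₁ ≠ 0 := by
    intro h0
    rw [h0, norm_zero] at h2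
    linarith
  have hR' : (R : ℂ) ≠ 0 := by exact_mod_cast hR.ne'
  rw [← hs]
  field_simp
  ring

theorem PotMeas.exists_cauchyT_bound {K : Set ℂ} {μ : Measure ℂ} {L : ℝ} (h : PotMeas K μ L)
    {t : ℂ} (hK : K ⊆ closedBall t 1) : ∃ A : ENNReal, A < ⊤ ∧
      ∀ k : ℂ → ℂ, Measurable k → (∀ s, ‖k s‖ ≤ 2) → ∫ s, k s ∂μ = 0 →
        ∫⁻ z, ENNReal.ofReal (‖cauchyT μ k 0 z‖ ^ 2) ≤ A := by
  have := h.fin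
  have hae : ∀ᵐ s ∂μ, s ∈ K := by have := h.supp; rwa [ae_iff]
  set m := μ.real univ with hm
  set B : ENNReal := ∫⁻ z, ENNReal.ofReal (256 * m ^ 2 * (1 + ‖z - t‖) ^ (-(4 : ℝ))) with hB
  have hBfin : B < ⊤ := by
    have hi : Integrable (fun z : ℂ => (1 + ‖z‖) ^ (-(4 : ℝ))) := by
      refine integrable_one_add_norm ?_
      rw [Complex.finrank_real_complex]
      norm_num
    have hi2 := (hi.comp_sub_right t).const_mul (256 * m ^ 2)
    exact hi2.lintegral_lt_top
  refine ⟨4 * (∫⁻ z in ball t 2, (∫⁻ s, ENNReal.ofReal ‖z - s‖⁻¹ ∂μ) ^ 2) + B, ?_, ?_⟩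
  · exact ENNReal.add_lt_top.2 ⟨ENNReal.mul_lt_top (by norm_num) (h.lintegral_cauchy_sq_lt_top hK), hBfin⟩
  intro k hkm hkb hk0
  have h_int : Integrable k μ :=
    (integrable_const (2 : ℝ)).mono' hkm.aestronglyMeasurable (Eventually.of_forall hkb)
  rw [← lintegral_add_compl _ (measurableSet_ball (x := t) (ε := 2))]
  refine add_le_add ?_ ?_
  · rw [← lintegral_const_mul' _ _ (by norm_num)]
    refine lintegral_mono fun z => ?_
    have h1 : ‖cauchyT μ k 0 z‖ₑ ≤ 2 * ∫⁻ s, ENNReal.ofReal ‖z - s‖⁻¹ ∂μ := by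
      rw [← lintegral_const_mul' _ _ (by norm_num)]
      refine (enorm_integral_le_lintegral_enorm _).trans (lintegral_mono fun s => ?_)
      rw [← ofReal_norm, norm_mul, zero_add, pow_one, norm_inv, norm_sub_rev,
        ENNReal.ofReal_mul (norm_nonneg _)]
      gcongr
      rw [← ENNReal.ofReal_ofNat]
      exact ENNReal.ofReal_le_ofReal (hkb s)
    rw [ENNReal.ofReal_pow (norm_nonneg _), ofReal_norm]
    refine (pow_le_pow_left' h1 2).trans_eq ?_
    rw [mul_pow]
    norm_num
  · refine (setLIntegral_mono' measurableSet_ball.compl ?_).trans (setLIntegral_le_lintegral _ _)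
    intro z hz
    rw [mem_compl_iff, mem_ball, not_lt, dist_eq_norm] at hz
    refine ENNReal.ofReal_le_ofReal ?_
    have hx0 : 0 < ‖z - t‖ := by linarith
    have hfar : ∀ s ∈ K, ‖z - t‖ / 2 ≤ ‖s - z‖ := by
      intro s hs
      have h1 := hK hs
      rw [mem_closedBall, dist_eq_norm] at h1
      have h2 := norm_sub_norm_le (z - t) (s - t)
      rw [show z - t - (s - t) = -(s - z) by ring, norm_neg] at h2
      linarith
    have hT : cauchyT μ k 0 z = ∫ s, k s * ((s - z)⁻¹ - (t - z)⁻¹) ∂μ := by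
      have hi1 : Integrable (fun s => k s * (s - z)⁻¹) μ := by
        refine (integrable_const (2 * (‖z - t‖ / 2)⁻¹)).mono'
          (hkm.mul (measurable_id.sub_const z).inv).aestronglyMeasurable (hae.mono fun s hs => ?_)
        rw [norm_mul, norm_inv]
        exact mul_le_mul (hkb s) (inv_anti₀ (by positivity) (hfar s hs)) (by positivity) (by norm_num)
      simp only [mul_sub]
      rw [integral_sub hi1 (h_int.mul_const _), integral_mul_const, hk0, zero_mul, sub_zero]
      simp [cauchyT]
    have hT2 : ‖cauchyT μ k 0 z‖ ≤ 4 / ‖z - t‖ ^ 2 * m := by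
      rw [hT]
      refine norm_integral_le_of_norm_le_const (hae.mono fun s hs => ?_)
      have h1 := hK hs
      rw [mem_closedBall, dist_eq_norm, norm_sub_rev] at h1
      have h2 := hfar s hs
      have h3 : s - z ≠ 0 := norm_pos_iff.1 (by linarith)
      have h4 : t - z ≠ 0 := norm_pos_iff.1 (by rw [norm_sub_rev]; exact hx0)
      have h5 : (s - z)⁻¹ - (t - z)⁻¹ = (t - s) * ((s - z)⁻¹ * (t - z)⁻¹) := by
        field_simp
        ring
      rw [h5, norm_mul, norm_mul, norm_mul, norm_inv, norm_inv, norm_sub_rev t z]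
      have h6 : ‖s - z‖⁻¹ ≤ (‖z - t‖ / 2)⁻¹ := inv_anti₀ (by positivity) h2
      calc ‖k s‖ * (‖t - s‖ * (‖s - z‖⁻¹ * ‖z - t‖⁻¹))
          ≤ 2 * (1 * ((‖z - t‖ / 2)⁻¹ * ‖z - t‖⁻¹)) := by
            gcongr
            exact hkb s
        _ = 4 / ‖z - t‖ ^ 2 := by field_simp; norm_num
    have hm0 : 0 ≤ m := measureReal_nonneg
    calc ‖cauchyT μ k 0 z‖ ^ 2 ≤ (4 / ‖z - t‖ ^ 2 * m) ^ 2 := by gcongr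
      _ = 256 * m ^ 2 * ((2 * ‖z - t‖) ^ 4)⁻¹ := by field_simp; ring
      _ ≤ 256 * m ^ 2 * ((1 + ‖z - t‖) ^ 4)⁻¹ := by
        gcongr
        linarith
      _ = 256 * m ^ 2 * (1 + ‖z - t‖) ^ (-(4 : ℝ)) := by
        rw [Real.rpow_neg (by positivity)]
        norm_cast

theorem RSub.volume_superlevel_ne_zero {D : Set ℂ} {r : ℂ → ℝ} (hr : RSub r D) {c : ℂ} {s N : ℝ}
    (hs : 0 < s) (hD : closedBall c s ⊆ D) (hN : N < r c) :
    volume {z ∈ closedBall c s | N ≤ r z} ≠ 0 := by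
  intro h0
  set f := (closedBall c s).indicator r with hf
  have hm : Measurable f := measurable_indicator_of_usc measurableSet_closedBall (hr.usc.mono hD)
  obtain ⟨B, hB⟩ := hr.bdd _ hD (isCompact_closedBall c s)
  have hi : Integrable f := by
    have hc : Integrable ((closedBall c s).indicator fun _ => B) :=
      (integrable_indicator_iff measurableSet_closedBall).2
        (integrableOn_const (isCompact_closedBall c s).measure_lt_top.ne)
    refine hc.mono' hm.aestronglyMeasurable (Eventually.of_forall fun z => ?_)
    rw [hf, norm_indicator_eq_indicator_norm]
    exact indicator_le_indicator' fun hz => hB z hz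
  have h1 : f c ≤ mollify s f c := by
    refine le_mollify_of_submean hs hi.locallyIntegrable fun ρ h0 h1 => ?_
    have hsub : closedBall c ρ ⊆ closedBall c s := closedBall_subset_closedBall h1.le
    have hc : f c = r c := indicator_of_mem (mem_closedBall_self hs.le) r
    rw [hc]
    refine (hr.submean c ρ h0 (hsub.trans hD)).trans_eq ?_
    refine Real.circleAverage_congr_sphere fun z hz => ?_
    rw [abs_of_pos h0] at hz
    exact (indicator_of_mem (hsub (sphere_subset_closedBall hz)) r).symm
  have h2 : mollify s f c ≤ N := by
    have : ∫ z, mol s z • N = N := by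
      rw [integral_smul_const, mol_integral hs, one_smul]
    rw [← this]
    refine integral_mono_ae (mollify_integrable hs hi.locallyIntegrable c)
      ((mol_integrable hs).smul_const N) ?_
    have hae : ∀ᵐ z : ℂ, z ∉ {z ∈ closedBall c s | N ≤ r z} := measure_eq_zero_iff_ae_notMem.1 h0
    filter_upwards [(Measure.measurePreserving_sub_left volume c).quasiMeasurePreserving.ae hae]
      with z hz
    by_cases hzs : ‖z‖ < s
    · refine mul_le_mul_of_nonneg_left ?_ (mol_nonneg s z)
      have hmem : c - z ∈ closedBall c s := by simpa using hzs.le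
      simp only [hf]
      rw [indicator_of_mem hmem]
      by_contra hcon
      push Not at hcon
      exact hz ⟨hmem, hcon.le⟩
    · simp [mol_eq_zero hs (not_lt.1 hzs)]
  have hc : f c = r c := indicator_of_mem (mem_closedBall_self hs.le) r
  linarith

theorem exists_potMeas_of_volume {K : Set ℂ} (hK : IsCompact K) (h0 : volume K ≠ 0) :
    ∃ L, PotMeas K (volume.restrict K) L := by
  have hfin : IsFiniteMeasure (volume.restrict K) := ⟨by
    rw [Measure.restrict_apply_univ]; exact hK.measure_lt_top⟩
  refine ⟨∫ z in ball (0 : ℂ) 1, ‖z‖⁻¹, hfin, ?_, ?_, fun s ε hε h1 => ?_⟩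
  · rw [Measure.restrict_apply hK.measurableSet.compl]
    simp
  · rwa [Ne, Measure.restrict_eq_zero]
  have hi : Integrable ((ball (0 : ℂ) 1).indicator fun z => ‖z‖⁻¹) :=
    (integrable_indicator_iff measurableSet_ball).2 (integrableOn_inv_norm 1)
  have hi2 := hi.comp_sub_right s
  have hli : Integrable (fun z => lk ε s z) (volume.restrict K) :=
    ((lk_contDiff hε s (n := 0)).continuous.continuousOn).integrableOn_compact hK
  have hlow : ∀ z, z ≠ s → -((ball (0 : ℂ) 1).indicator (fun z => ‖z‖⁻¹) (z - s)) ≤ lk ε s z := by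
    intro z hz
    have hp : 0 < ‖z - s‖ := norm_pos_iff.2 (sub_ne_zero.2 hz)
    refine le_trans ?_ (log_le_lk hε hz)
    by_cases hb : z - s ∈ ball (0 : ℂ) 1
    · rw [indicator_of_mem hb]
      have := Real.one_sub_inv_le_log_of_pos hp
      linarith
    · rw [indicator_of_notMem hb, neg_zero]
      exact Real.log_nonneg (by simpa using hb)
  calc -∫ z in ball (0 : ℂ) 1, ‖z‖⁻¹
      = -∫ z, (ball (0 : ℂ) 1).indicator (fun z => ‖z‖⁻¹) (z - s) := by
        rw [integral_sub_right_eq_self (fun z => (ball (0 : ℂ) 1).indicator (fun z => ‖z‖⁻¹) z) s,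
          integral_indicator measurableSet_ball]
    _ ≤ -∫ z in K, (ball (0 : ℂ) 1).indicator (fun z => ‖z‖⁻¹) (z - s) := by
        refine neg_le_neg (setIntegral_le_integral hi2 (Eventually.of_forall fun z => ?_))
        exact indicator_nonneg (fun z _ => by positivity) _
    _ = ∫ z in K, -(ball (0 : ℂ) 1).indicator (fun z => ‖z‖⁻¹) (z - s) := (integral_neg _).symm
    _ ≤ ∫ z in K, lk ε s z := by
        refine integral_mono_ae hi2.neg.restrict hli ?_
        have hs : ∀ᵐ z : ℂ, z ∉ ({s} : Set ℂ) := measure_eq_zero_iff_ae_notMem.1 (measure_singleton s)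
        filter_upwards [ae_restrict_of_ae hs] with z hz using hlow z hz

theorem PotMeas.exists_logPot_ge {K : Set ℂ} {μ : Measure ℂ} {L : ℝ} (h : PotMeas K μ L)
    (hKc : IsCompact K) {t : ℂ} (hK : K ⊆ closedBall t 1) :
    ∃ C, ∀ z ∉ K, μ.real univ * Real.log (1 + ‖z‖) - C ≤ logPot μ z := by
  have := h.fin
  have hae : ∀ᵐ s ∂μ, s ∈ K := by have := h.supp; rwa [ae_iff]
  obtain ⟨L', hL'⟩ := h.logPot_restrict_ge hKc MeasurableSet.univ (2 + ‖t‖)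
  rw [Measure.restrict_univ] at hL'
  set m := μ.real univ with hm
  have hm0 : 0 ≤ m := measureReal_nonneg
  refine ⟨max (m * Real.log (3 + ‖t‖) + L') (m * Real.log (3 * (1 + ‖t‖))), fun z hz => ?_⟩
  rcases le_or_gt ‖z‖ (2 + ‖t‖) with hzt | hzt
  · have h1 := hL' z hz hzt
    have h2 : Real.log (1 + ‖z‖) ≤ Real.log (3 + ‖t‖) :=
      Real.log_le_log (by positivity) (by linarith)
    have h3 := mul_le_mul_of_nonneg_left h2 hm0
    have h4 := le_max_left (m * Real.log (3 + ‖t‖) + L') (m * Real.log (3 * (1 + ‖t‖)))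
    linarith
  · have h4 := le_max_right (m * Real.log (3 + ‖t‖) + L') (m * Real.log (3 * (1 + ‖t‖)))
    have h5 : m * (Real.log (1 + ‖z‖) - Real.log (3 * (1 + ‖t‖))) ≤ logPot μ z := by
      have h6 : ∫ _, (Real.log (1 + ‖z‖) - Real.log (3 * (1 + ‖t‖))) ∂μ ≤ logPot μ z := by
        refine integral_mono_ae (integrable_const _) (logPot_integrable hKc h.supp hz) ?_
        filter_upwards [hae] with s hs
        have h7 := hK hs
        rw [mem_closedBall, dist_eq_norm] at h7
        have ht0 := norm_nonneg t
        rw [← Real.log_div (by positivity) (by positivity)]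
        refine Real.log_le_log (by positivity) ?_
        rw [div_le_iff₀ (by positivity)]
        have h8 : ‖z‖ ≤ ‖z - s‖ + ‖s - t‖ + ‖t‖ := by
          calc ‖z‖ = ‖(z - s) + (s - t) + t‖ := by ring_nf
            _ ≤ _ := norm_add₃_le
        nlinarith [norm_nonneg (z - s)]
      rwa [integral_const, smul_eq_mul] at h6
    linarith

open Classical in
/-- A harmonic function with a pole set `P` inside a disc can be glued to a subharmonic function which
dominates it near `P`. -/
theorem RSub.glue {D P : Set ℂ} (hD : IsOpen D) (hP : IsClosed P) {t : ℂ} {R G : ℝ}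
    (hPR : P ⊆ ball t R) {l g : ℂ → ℝ} (hl : RSub l D)
    (hgc : ContinuousOn g Pᶜ)
    (hgm : ∀ c s, 0 < s → closedBall c s ⊆ Pᶜ → Real.circleAverage g c s = g c)
    (hgG : ∀ z ∉ P, g z ≤ G) (hlG : ∀ z ∈ P, G ≤ l z) (hΓ : ∀ z ∈ sphere t R, z ∈ D → l z < g z) :
    RSub (fun z => if z ∈ P then l z else if z ∈ closedBall t R then max (g z) (l z) else g z) D := by
  set v : ℂ → ℝ := fun z => if z ∈ P then l z else if z ∈ closedBall t R then max (g z) (l z) else g z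
    with hv
  have vP : ∀ z ∈ P, v z = l z := fun z hz => if_pos hz
  have vB : ∀ z ∉ P, z ∈ closedBall t R → v z = max (g z) (l z) := fun z hz hz' => by
    simp only [hv, if_neg hz, if_pos hz']
  have vO : ∀ z ∉ P, z ∉ closedBall t R → v z = g z := fun z hz hz' => by
    simp only [hv, if_neg hz, if_neg hz']
  have g_le : ∀ z ∉ P, g z ≤ v z := by
    intro z hz
    by_cases hz' : z ∈ closedBall t R
    · rw [vB z hz hz']; exact le_max_left _ _
    · rw [vO z hz hz']
  have l_le : ∀ z ∈ closedBall t R, l z ≤ v z := by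
    intro z hz'
    by_cases hz : z ∈ P
    · rw [vP z hz]
    · rw [vB z hz hz']; exact le_max_right _ _
  have v_le : ∀ z ∉ P, v z ≤ max (g z) (l z) := by
    intro z hz
    by_cases hz' : z ∈ closedBall t R
    · rw [vB z hz hz']
    · rw [vO z hz hz']; exact le_max_left _ _
  have v_le' : ∀ z, v z ≤ max G (l z) := by
    intro z
    by_cases hz : z ∈ P
    · rw [vP z hz]; exact le_max_right _ _
    · exact (v_le z hz).trans (max_le_max_right _ (hgG z hz))
  have hgat : ∀ z ∉ P, ContinuousAt g z := fun z hz => hgc.continuousAt (hP.isOpen_compl.mem_nhds hz)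
  have husc : UpperSemicontinuousOn v D := by
    intro m hm c hc
    have hlm : l m < c → ∀ᶠ z in nhdsWithin m D, l z < c := fun h => hl.usc m hm c h
    by_cases hmP : m ∈ P
    · simp only [vP m hmP] at hc
      filter_upwards [hlm hc] with z hz
      exact (v_le' z).trans_lt (max_lt ((hlG m hmP).trans_lt hc) hz)
    · have hgc' : ∀ᶠ z in nhdsWithin m D, g z < c :=
        mem_nhdsWithin_of_mem_nhds ((hgat m hmP).eventually_lt_const ((g_le m hmP).trans_lt hc))
      by_cases hmB : m ∈ closedBall t R
      · filter_upwards [hlm ((l_le m hmB).trans_lt hc), hgc',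
          mem_nhdsWithin_of_mem_nhds (hP.isOpen_compl.mem_nhds hmP)] with z h1 h2 h3
        exact (v_le z h3).trans_lt (max_lt h2 h1)
      · filter_upwards [hgc', mem_nhdsWithin_of_mem_nhds (hP.isOpen_compl.mem_nhds hmP),
          mem_nhdsWithin_of_mem_nhds (isClosed_closedBall.isOpen_compl.mem_nhds hmB)] with z h1 h2 h3
        rw [vO z h2 h3]
        exact h1
  have hbdd : ∀ K ⊆ D, IsCompact K → ∃ B, ∀ z ∈ K, |v z| ≤ B := by
    intro K hK hKc
    obtain ⟨B, hB⟩ := hl.bdd K hK hKc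
    obtain ⟨B', hB'⟩ := (hKc.diff isOpen_ball (t := ball t R)).exists_bound_of_continuousOn
      (hgc.mono fun z hz hzP => hz.2 (hPR hzP))
    refine ⟨max |G| (max B B'), fun z hz => abs_le.2 ⟨?_, (v_le' z).trans ?_⟩⟩
    · by_cases hz' : z ∈ closedBall t R
      · have h1 := l_le z hz'
        have h2 := (abs_le.1 (hB z hz)).1
        have h3 : B ≤ max |G| (max B B') := le_max_of_le_right (le_max_left _ _)
        linarith
      · have hzb : z ∉ ball t R := fun h => hz' (ball_subset_closedBall h)
        have h1 := g_le z fun h => hzb (hPR h)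
        have h2 := (abs_le.1 (hB' z ⟨hz, hzb⟩)).1
        have h3 : B' ≤ max |G| (max B B') := le_max_of_le_right (le_max_right _ _)
        linarith
    · refine max_le (le_max_of_le_left (le_abs_self G)) ?_
      exact (abs_le.1 (hB z hz)).2.trans (le_max_of_le_right (le_max_left _ _))
  refine RSub.of_local husc hbdd fun m hm => ?_
  obtain ⟨d, hd, hdD⟩ := nhds_basis_closedBall.mem_iff.1 (hD.mem_nhds hm)
  have hvi : ∀ s, 0 < s → s < d → CircleIntegrable v m s := by
    intro s h0 h1
    have hs : sphere m s ⊆ D :=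
      (sphere_subset_closedBall.trans (closedBall_subset_closedBall h1.le)).trans hdD
    obtain ⟨B, hB⟩ := hbdd _ hs (isCompact_sphere m s)
    exact circleIntegrable_of_usc h0.le (husc.mono hs) hB
  have caseg : m ∉ P → v m = g m → ∃ r₀ > 0, ∀ r, 0 < r → r < r₀ → v m ≤ Real.circleAverage v m r := by
    intro hmP hvm
    obtain ⟨e, he, heP⟩ := nhds_basis_closedBall.mem_iff.1 (hP.isOpen_compl.mem_nhds hmP)
    refine ⟨min d e, lt_min hd he, fun s h0 h1 => ?_⟩
    have hsub : closedBall m s ⊆ Pᶜ :=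
      (closedBall_subset_closedBall (h1.le.trans (min_le_right _ _))).trans heP
    rw [hvm, ← hgm m s h0 hsub]
    refine Real.circleAverage_mono ?_ (hvi s h0 (h1.trans_le (min_le_left _ _))) fun z hz => ?_
    · exact ((hgc.mono (sphere_subset_closedBall.trans hsub))).circleIntegrable h0.le
    · rw [abs_of_pos h0] at hz
      exact g_le z (hsub (sphere_subset_closedBall hz))
  have casel : m ∈ ball t R → v m = l m → ∃ r₀ > 0, ∀ r, 0 < r → r < r₀ → v m ≤ Real.circleAverage v m r := by
    intro hmB hvm
    obtain ⟨e, he, heP⟩ := nhds_basis_closedBall.mem_iff.1 (isOpen_ball.mem_nhds hmB)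
    refine ⟨min d e, lt_min hd he, fun s h0 h1 => ?_⟩
    have hsub : closedBall m s ⊆ ball t R :=
      (closedBall_subset_closedBall (h1.le.trans (min_le_right _ _))).trans heP
    have hsubD : closedBall m s ⊆ D :=
      (closedBall_subset_closedBall (h1.le.trans (min_le_left _ _))).trans hdD
    rw [hvm]
    refine (hl.submean m s h0 hsubD).trans ?_
    refine Real.circleAverage_mono (hl.circleIntegrable h0.le (sphere_subset_closedBall.trans hsubD))
      (hvi s h0 (h1.trans_le (min_le_left _ _))) fun z hz => ?_
    rw [abs_of_pos h0] at hz
    exact l_le z (ball_subset_closedBall (hsub (sphere_subset_closedBall hz)))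
  by_cases hmP : m ∈ P
  · exact casel (hPR hmP) (vP m hmP)
  by_cases hmB : m ∈ closedBall t R
  · rcases le_or_gt (l m) (g m) with hlg | hlg
    · exact caseg hmP ((vB m hmP hmB).trans (max_eq_left hlg))
    · refine casel ?_ ((vB m hmP hmB).trans (max_eq_right hlg.le))
      by_contra hmb
      have hms : m ∈ sphere t R := by
        rw [mem_sphere]
        rw [mem_ball, not_lt] at hmb
        exact le_antisymm hmB hmb
      exact absurd (hΓ m hms hm) (not_lt.2 hlg.le)
  · exact caseg hmP (vO m hmP hmB)

theorem PotMeas.exists_harmonic {K : Set ℂ} {μ : Measure ℂ} {L : ℝ} (h : PotMeas K μ L)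
    (hKc : IsCompact K) {t : ℂ} (hK : K ⊆ closedBall t 1) :
    ∃ g : ℂ → ℝ, ∃ G : ℝ, ContinuousOn g Kᶜ ∧
      (∀ c s, 0 < s → closedBall c s ⊆ Kᶜ → Real.circleAverage g c s = g c) ∧
      ∀ z ∉ K, g z ≤ G - 10 * Real.log (1 + ‖z‖) := by
  have := h.fin
  have hm : 0 < μ.real univ :=
    ENNReal.toReal_pos (by simpa using h.ne) (measure_ne_top _ _)
  obtain ⟨C, hC⟩ := h.exists_logPot_ge hKc hK
  set m := μ.real univ
  refine ⟨fun z => -(10 / m) * logPot μ z, 10 / m * C, ?_, fun c s hs hcs => ?_, fun z hz => ?_⟩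
  · exact continuousOn_const.mul fun z hz =>
      (logPot_continuousAt hKc h.supp hz).continuousWithinAt
  · have := Real.circleAverage_fun_smul (a := -(10 / m)) (f := logPot μ) (c := c) (R := s)
    simp only [smul_eq_mul] at this
    rw [this, logPot_circleAverage hKc h.supp hs hcs]
  · have h1 := mul_le_mul_of_nonneg_left (hC z hz) (a := 10 / m) (by positivity)
    have h2 : 10 / m * (m * Real.log (1 + ‖z‖) - C) = 10 * Real.log (1 + ‖z‖) - 10 / m * C := by
      field_simp
    linarith

theorem RSub.exists_weight {D : Set ℂ} (hD : IsOpen D) (hDc : IsConnected D) (hDne : D ≠ univ)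
    {r : ℂ → ℝ} (hr : RSub r D) {M : ℝ} (hM : ∀ z ∈ D, M ≤ r z)
    (hlim : ∀ t ∈ polarS D, ∀ N : ℝ, ∃ᶠ z in nhdsWithin t D, N < r z) :
    ∃ k : ℕ, ∃ φ : ℂ → ℝ, ∃ C : ℝ, RSub φ D ∧
      ∀ z ∈ D, φ z ≤ 2 * k * r z - 10 * Real.log (1 + ‖z‖) + C := by
  obtain ⟨t, ht⟩ : (frontier D).Nonempty := nonempty_frontier_iff.2 ⟨hDc.nonempty, hDne⟩
  set K := closedBall t 1 \ D with hK
  have hKc : IsCompact K := (isCompact_closedBall t 1).diff hD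
  by_cases hcap : CapZero K
  swap
  · obtain ⟨μ, L, hμ⟩ := exists_potMeas hKc hcap
    obtain ⟨g, G, hgc, hgm, hgG⟩ := hμ.exists_harmonic hKc sdiff_subset
    have hDK : D ⊆ Kᶜ := fun z hz hzK => hzK.2 hz
    refine ⟨0, g, G, ⟨(hgc.mono hDK).upperSemicontinuousOn, fun A hA hAc => ?_, fun c s hs hcs => ?_⟩,
      fun z hz => ?_⟩
    · exact hAc.exists_bound_of_continuousOn (hgc.mono (hA.trans hDK))
    · exact (hgm c s hs (hcs.trans hDK)).ge
    · have := hgG z (hDK hz)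
      push_cast
      linarith
  have htS : t ∈ polarS D :=
    ⟨ht, ball t 1, isOpen_ball, mem_ball_self one_pos, (hcap.polarSet hKc).mono
      (sdiff_subset_sdiff_left ball_subset_closedBall)⟩
  obtain ⟨R, ⟨hR0, hR1⟩, hdisj⟩ := hcap.exists_sphere t one_pos
  have hΓD : sphere t R ⊆ D := by
    intro z hz
    by_contra hzD
    exact Set.disjoint_left.1 hdisj hz
      ⟨closedBall_subset_closedBall hR1.le (sphere_subset_closedBall hz), hzD⟩
  obtain ⟨B, hB⟩ := hr.bdd _ hΓD (isCompact_sphere t R)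
  set N := B + 1 with hN
  obtain ⟨z₂, hz₂N, hz₂D, hz₂R⟩ : ∃ z, N < r z ∧ z ∈ D ∧ z ∈ ball t R := by
    have h1 : ∀ᶠ z in nhdsWithin t D, z ∈ D ∧ z ∈ ball t R :=
      (eventually_mem_nhdsWithin).and (mem_nhdsWithin_of_mem_nhds (ball_mem_nhds t hR0))
    exact ((hlim t htS N).and_eventually h1).exists
  obtain ⟨s, hs, hsD⟩ := nhds_basis_closedBall.mem_iff.1 ((hD.inter isOpen_ball).mem_nhds ⟨hz₂D, hz₂R⟩)
  have hsD' : closedBall z₂ s ⊆ D := hsD.trans inter_subset_left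
  set P := {z ∈ closedBall z₂ s | N ≤ r z} with hP
  have hPc : IsCompact P :=
    (hr.usc.mono hsD').isCompact_inter_preimage_Ici (isCompact_closedBall z₂ s) N
  have hPcl : IsClosed P := hPc.isClosed
  have hPR : P ⊆ ball t R := (sep_subset _ _).trans (hsD.trans inter_subset_right)
  obtain ⟨L, hμ⟩ := exists_potMeas_of_volume hPc (hr.volume_superlevel_ne_zero hs hsD' hz₂N)
  obtain ⟨g, G, hgc, hgm, hgG⟩ := hμ.exists_harmonic hPc
    (hPR.trans (ball_subset_closedBall.trans (closedBall_subset_closedBall hR1.le)))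
  have hΓP : sphere t R ⊆ Pᶜ := fun z hz hzP => (hPR hzP).ne hz
  obtain ⟨B', hB'⟩ := (isCompact_sphere t R).exists_bound_of_continuousOn (hgc.mono hΓP)
  obtain ⟨k, hk⟩ := exists_nat_gt (|G| + |B'|)
  set C := 2 * k * N - G with hC
  set l : ℂ → ℝ := fun z => 2 * k * r z - C with hl
  have hlr : RSub l D := by
    have := (hr.const_mul (k := 2 * k) (by positivity)).add_const (-C)
    simpa only [← sub_eq_add_neg] using this
  have hlog : ∀ z : ℂ, 0 ≤ Real.log (1 + ‖z‖) := fun z =>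
    Real.log_nonneg (by linarith [norm_nonneg z])
  have hv := RSub.glue (G := G) hD hPcl hPR hlr hgc hgm
    (fun z hz => (hgG z hz).trans (by linarith [hlog z]))
    (fun z hz => by
      have h1 : 2 * (k : ℝ) * N ≤ 2 * k * r z := mul_le_mul_of_nonneg_left hz.2 (by positivity)
      simp only [hl, hC]
      linarith)
    (fun z hz _ => by
      have h1 := (abs_le.1 (hB z hz)).2
      have h2 := (abs_le.1 (hB' z hz)).1
      have h3 : 2 * (k : ℝ) * r z ≤ 2 * k * B := mul_le_mul_of_nonneg_left h1 (by positivity)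
      simp only [hl, hC, hN]
      have h4 := le_abs_self G
      have h5 := le_abs_self B'
      have h6 := abs_nonneg G
      have h7 := abs_nonneg B'
      linarith)
  refine ⟨k, _, max (10 * Real.log (2 + ‖t‖) - C) (G - 2 * k * M), hv, fun z hz => ?_⟩
  have hg' : z ∉ P → g z ≤ 2 * k * r z - 10 * Real.log (1 + ‖z‖) +
      max (10 * Real.log (2 + ‖t‖) - C) (G - 2 * k * M) := by
    intro hzP
    have h1 := hgG z hzP
    have h2 : 2 * (k : ℝ) * M ≤ 2 * k * r z := mul_le_mul_of_nonneg_left (hM z hz) (by positivity)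
    have h3 := le_max_right (10 * Real.log (2 + ‖t‖) - C) (G - 2 * k * M)
    linarith
  have hl' : z ∈ closedBall t R → l z ≤ 2 * k * r z - 10 * Real.log (1 + ‖z‖) +
      max (10 * Real.log (2 + ‖t‖) - C) (G - 2 * k * M) := by
    intro hzR
    have h1 : Real.log (1 + ‖z‖) ≤ Real.log (2 + ‖t‖) := by
      refine Real.log_le_log (by positivity) ?_
      have h2 := norm_le_norm_add_norm_sub' z t
      rw [mem_closedBall, dist_eq_norm] at hzR
      linarith
    have h3 := le_max_left (10 * Real.log (2 + ‖t‖) - C) (G - 2 * k * M)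
    simp only [hl]
    linarith
  split_ifs with h1 h2
  · exact hl' (ball_subset_closedBall (hPR h1))
  · exact max_le (hg' h1) (hl' h2)
  · exact hg' h1

theorem RSub.aemeasurable {D : Set ℂ} (hD : IsOpen D) {r : ℂ → ℝ} (hr : RSub r D) :
    AEMeasurable r (volume.restrict D) :=
  ⟨D.indicator r, measurable_indicator_of_usc hD.measurableSet hr.usc,
    (ae_restrict_iff' hD.measurableSet).2
      (Eventually.of_forall fun _ hz => (indicator_of_mem hz r).symm)⟩

theorem RSub.exists_holomorphic_decay {D : Set ℂ} (hD : IsOpen D) (hDc : IsConnected D)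
    (hDne : D ≠ univ) {r : ℂ → ℝ} (hr : RSub r D) {M : ℝ} (hM : ∀ z ∈ D, M ≤ r z)
    (hlim : ∀ t ∈ polarS D, ∀ N : ℝ, ∃ᶠ z in nhdsWithin t D, N < r z) :
    ∃ k : ℕ, ∀ a ∈ D, ∃ C, ∀ j ≥ k, ∃ h : ℂ → ℂ, DifferentiableOn ℂ h D ∧ h a = 1 ∧
      IntegrableOn (fun z => ‖h z‖ ^ 2 * Real.exp (-r z) ^ (2 * j + 2)) D ∧
      ∫ z in D, ‖h z‖ ^ 2 * Real.exp (-r z) ^ (2 * j + 2) ≤ C * Real.exp (-r a) ^ (2 * j) := by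
  obtain ⟨k, φ, C, hφ, hφle⟩ := hr.exists_weight hD hDc hDne hM hlim
  refine ⟨k, fun a ha => ?_⟩
  set c := Real.exp C * (2 + ‖a‖) ^ 10 with hc
  have hc0 : 0 < c := by positivity
  refine ⟨c * (20 * Real.pi * Real.exp (2 * (k - 1) * r a - φ a)), fun j hj => ?_⟩
  have hj' : (k : ℝ) ≤ j := by exact_mod_cast hj
  have hψ : RSub (fun z => 2 * (j + 1 - k) * r z + φ z) D :=
    (hr.const_mul (k := 2 * (j + 1 - k)) (by linarith)).add hφ
  obtain ⟨h, hh, ha1, h_int, hle⟩ := exists_holomorphic_weighted hD hψ ha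
  have hpt : ∀ z ∈ D, ‖h z‖ ^ 2 * Real.exp (-r z) ^ (2 * j + 2) ≤
      c * (‖h z‖ ^ 2 * Real.exp (-(2 * (j + 1 - k) * r z + φ z)) * ((2 + ‖z - a‖) ^ 10)⁻¹) := by
    intro z hz
    have h1 : Real.exp (-r z) ^ (2 * j + 2) * (1 + ‖z‖) ^ 10 ≤
        Real.exp C * Real.exp (-(2 * (j + 1 - k) * r z + φ z)) := by
      have h2 : (1 + ‖z‖) ^ 10 = Real.exp (10 * Real.log (1 + ‖z‖)) := by
        rw [show (10 : ℝ) = (10 : ℕ) by norm_num, Real.exp_nat_mul, Real.exp_log (by positivity)]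
      rw [h2, ← Real.exp_nat_mul, ← Real.exp_add, ← Real.exp_add]
      refine Real.exp_le_exp.2 ?_
      have := hφle z hz
      push_cast
      linarith
    have h3 : (2 + ‖z - a‖) ^ 10 ≤ ((2 + ‖a‖) * (1 + ‖z‖)) ^ 10 := by
      refine pow_le_pow_left₀ (by positivity) ?_ 10
      nlinarith [norm_sub_le z a, norm_nonneg z, norm_nonneg a, mul_nonneg (norm_nonneg a) (norm_nonneg z)]
    have h4 : Real.exp (-r z) ^ (2 * j + 2) * (2 + ‖z - a‖) ^ 10 ≤
        c * Real.exp (-(2 * (j + 1 - k) * r z + φ z)) := by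
      calc Real.exp (-r z) ^ (2 * j + 2) * (2 + ‖z - a‖) ^ 10
          ≤ Real.exp (-r z) ^ (2 * j + 2) * ((2 + ‖a‖) * (1 + ‖z‖)) ^ 10 := by gcongr
        _ = (2 + ‖a‖) ^ 10 * (Real.exp (-r z) ^ (2 * j + 2) * (1 + ‖z‖) ^ 10) := by
          rw [mul_pow]; ring
        _ ≤ (2 + ‖a‖) ^ 10 * (Real.exp C * Real.exp (-(2 * (j + 1 - k) * r z + φ z))) := by gcongr
        _ = _ := by rw [hc]; ring
    rw [← le_div_iff₀ (by positivity)] at h4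
    calc ‖h z‖ ^ 2 * Real.exp (-r z) ^ (2 * j + 2)
        ≤ ‖h z‖ ^ 2 * (c * Real.exp (-(2 * (j + 1 - k) * r z + φ z)) / (2 + ‖z - a‖) ^ 10) := by gcongr
      _ = _ := by rw [div_eq_mul_inv]; ring
  have hmeas : AEStronglyMeasurable (fun z => ‖h z‖ ^ 2 * Real.exp (-r z) ^ (2 * j + 2))
      (volume.restrict D) := by
    have h1 : AEMeasurable h (volume.restrict D) :=
      (hh.continuousOn.aestronglyMeasurable hD.measurableSet).aemeasurable
    exact ((h1.norm.pow_const 2).mul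
      ((Real.measurable_exp.comp_aemeasurable (hr.aemeasurable hD).neg).pow_const _)).aestronglyMeasurable
  have h_int' : IntegrableOn (fun z => ‖h z‖ ^ 2 * Real.exp (-r z) ^ (2 * j + 2)) D := by
    refine (h_int.const_mul c).mono' hmeas ?_
    refine (ae_restrict_iff' hD.measurableSet).2 (Eventually.of_forall fun z hz => ?_)
    rw [Real.norm_of_nonneg (by positivity)]
    exact hpt z hz
  refine ⟨h, hh, ha1, h_int', ?_⟩
  calc ∫ z in D, ‖h z‖ ^ 2 * Real.exp (-r z) ^ (2 * j + 2)
      ≤ ∫ z in D, c * (‖h z‖ ^ 2 * Real.exp (-(2 * (j + 1 - k) * r z + φ z)) * ((2 + ‖z - a‖) ^ 10)⁻¹) :=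
        setIntegral_mono_on h_int' (h_int.const_mul c) hD.measurableSet hpt
    _ ≤ c * (20 * Real.pi * Real.exp (-(2 * (j + 1 - k) * r a + φ a))) := by
        rw [integral_const_mul]
        exact mul_le_mul_of_nonneg_left hle hc0.le
    _ = _ := by
        have : Real.exp (-(2 * (j + 1 - k) * r a + φ a)) =
            Real.exp (2 * (k - 1) * r a - φ a) * Real.exp (-r a) ^ (2 * j) := by
          rw [← Real.exp_nat_mul, ← Real.exp_add]
          congr 1
          push_cast
          ring
        rw [this]
        ring

/-- Holomorphy along complex lines. -/
def LineHol (f : ℂ × ℂ → ℂ) (U : Set (ℂ × ℂ)) : Prop :=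
  ∀ q v : ℂ × ℂ, DifferentiableOn ℂ (fun t : ℂ => f (q + t • v)) {t | q + t • v ∈ U}

theorem DifferentiableOn.lineHol {f : ℂ × ℂ → ℂ} {U : Set (ℂ × ℂ)} (hf : DifferentiableOn ℂ f U) :
    LineHol f U := fun q v =>
  hf.comp (t := U) (by fun_prop) fun _ ht => ht

theorem LineHol.mono {f : ℂ × ℂ → ℂ} {U V : Set (ℂ × ℂ)} (hf : LineHol f U) (hV : V ⊆ U) :
    LineHol f V := fun q v => (hf q v).mono fun _ ht => hV ht

theorem isOpen_line {U : Set (ℂ × ℂ)} (hU : IsOpen U) (q v : ℂ × ℂ) :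
    IsOpen {t : ℂ | q + t • v ∈ U} :=
  hU.preimage (by fun_prop)

theorem LineHol.of_tendsto {F : ℕ → ℂ × ℂ → ℂ} {f : ℂ × ℂ → ℂ} {U : Set (ℂ × ℂ)} (hU : IsOpen U)
    (hF : ∀ n, LineHol (F n) U) (h : TendstoUniformlyOn F f atTop U) : LineHol f U := by
  intro q v
  have h1 : TendstoUniformlyOn (fun n (t : ℂ) => F n (q + t • v)) (fun t => f (q + t • v)) atTop
      {t | q + t • v ∈ U} := h.comp fun t : ℂ => q + t • v
  exact h1.tendstoLocallyUniformlyOn.differentiableOn (Eventually.of_forall fun n => hF n q v)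
    (isOpen_line hU q v)

theorem LineHol.eqOn_ball {f g : ℂ × ℂ → ℂ} {p : ℂ × ℂ} {ε : ℝ} (hf : LineHol f (ball p ε))
    (hg : LineHol g (ball p ε)) {q : ℂ × ℂ} (hq : q ∈ ball p ε) (h : f =ᶠ[nhds q] g) :
    EqOn f g (ball p ε) := by
  intro x hx
  set S := {t : ℂ | q + t • (x - q) ∈ ball p ε} with hS
  have hSo : IsOpen S := isOpen_line isOpen_ball q (x - q)
  have hSc : Convex ℝ S := by
    intro s hs t ht a b ha hb hab
    have h1 := convex_ball p ε hs ht ha hb hab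
    have h2 : a • (q + s • (x - q)) + b • (q + t • (x - q)) = q + (a • s + b • t) • (x - q) := by
      rw [smul_add, smul_add, add_smul, smul_assoc, smul_assoc, add_add_add_comm, ← add_smul, hab,
        one_smul]
    rw [h2] at h1
    exact h1
  have h0 : (0 : ℂ) ∈ S := by simpa [hS] using hq
  have h1 : (1 : ℂ) ∈ S := by simpa [hS] using hx
  have hev : (fun t : ℂ => f (q + t • (x - q))) =ᶠ[nhds 0] fun t => g (q + t • (x - q)) := by
    have hc : Tendsto (fun t : ℂ => q + t • (x - q)) (nhds 0) (nhds q) := by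
      have : Continuous fun t : ℂ => q + t • (x - q) := by fun_prop
      simpa using this.tendsto 0
    exact hc.eventually h
  have := ((hf q (x - q)).analyticOnNhd hSo).eqOn_of_preconnected_of_eventuallyEq
    ((hg q (x - q)).analyticOnNhd hSo) hSc.isPreconnected h0 hev h1
  simpa using this

theorem LineHol.eqOn_of_isPreconnected {f g : ℂ × ℂ → ℂ} {U V : Set (ℂ × ℂ)} (hU : IsOpen U)
    (hUc : IsPreconnected U) (hf : LineHol f U) (hg : LineHol g U) (hV : IsOpen V)
    (hVU : V ⊆ U) (hVn : V.Nonempty) (h : EqOn f g V) : EqOn f g U := by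
  set W := {q | f =ᶠ[nhds q] g} with hW
  have hWo : IsOpen W := isOpen_setOfPred_eventually_nhds
  have hsub : U ⊆ W := by
    refine hUc.subset_of_closure_inter_subset hWo ?_ ?_
    · obtain ⟨x, hx⟩ := hVn
      exact ⟨x, hVU hx, h.eventuallyEq_of_mem (hV.mem_nhds hx)⟩
    · rintro q ⟨hq, hqU⟩
      obtain ⟨ε, hε, hb⟩ := Metric.isOpen_iff.1 hU q hqU
      obtain ⟨w, hw, hwq⟩ := Metric.mem_closure_iff.1 hq ε hε
      have := LineHol.eqOn_ball (hf.mono hb) (hg.mono hb) (mem_ball'.2 hwq) hw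
      exact this.eventuallyEq_of_mem (ball_mem_nhds q hε)
  exact fun q hq => (hsub hq).self_of_nhds

theorem norm_fderiv_le_of_norm_le {f : ℂ × ℂ → ℂ} {p : ℂ × ℂ} {R C : ℝ} (hR : 0 < R)
    (hf : DifferentiableOn ℂ f (ball p R)) (hC : ∀ q ∈ ball p R, ‖f q‖ ≤ C) :
    ‖fderiv ℂ f p‖ ≤ 2 * C / R := by
  refine Complex.norm_fderiv_le_div_of_mapsTo_ball hf (fun q hq => ?_) hR
  rw [mem_closedBall, dist_eq_norm]
  linarith [norm_sub_le (f q) (f p), hC q hq, hC p (mem_ball_self hR)]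

/-- The Hartogs domain with real-valued weight `r`. -/
def hset (D : Set ℂ) (r : ℂ → ℝ) : Set (ℂ × ℂ) := {p | p.1 ∈ D ∧ ‖p.2‖ < Real.exp (-r p.1)}

theorem hartogs_eq_hset {D : Set ℂ} {ρ : ℂ → EReal} {r : ℂ → ℝ}
    (h : ∀ z ∈ D, ((r z : ℝ) : EReal) = ρ z) : hartogs D ρ = hset D r := by
  ext p
  simp only [hartogs, hset, mem_ofPred_eq]
  refine and_congr_right fun hp => ?_
  rw [← h _ hp, ← EReal.coe_neg, elog]
  split_ifs with h0
  · simp only [EReal.bot_lt_coe, true_iff]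
    exact h0.trans_lt (Real.exp_pos _)
  · rw [EReal.coe_lt_coe_iff, Real.log_lt_iff_lt_exp (not_le.1 h0)]

theorem isOpen_hset {D : Set ℂ} {r : ℂ → ℝ} (hD : IsOpen D) (hr : UpperSemicontinuousOn r D) :
    IsOpen (hset D r) := by
  rw [isOpen_iff_mem_nhds]
  rintro ⟨z, w⟩ ⟨hz, hw⟩
  obtain ⟨b, hb1, hb2⟩ := exists_between hw
  have hb0 : 0 < b := (norm_nonneg _).trans_lt hb1
  have h1 : r z < -Real.log b := by
    have := (Real.log_lt_iff_lt_exp hb0).2 hb2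
    linarith
  have h2 := hr z hz _ h1
  rw [hD.nhdsWithin_eq hz] at h2
  have h3 : ∀ᶠ w' : ℂ in nhds w, ‖w'‖ < b := (continuous_norm.tendsto w).eventually_lt_const hb1
  filter_upwards [(h2.and (hD.mem_nhds hz)).prod_nhds h3] with p hp
  obtain ⟨⟨hp1, hpD⟩, hp2⟩ := hp
  refine ⟨hpD, lt_of_lt_of_le hp2 ?_⟩
  rw [← Real.log_le_iff_le_exp hb0]
  linarith

theorem lintegral_hset {D : Set ℂ} {r : ℂ → ℝ} (hD : IsOpen D) (hr : UpperSemicontinuousOn r D)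
    {F : ℂ × ℂ → ENNReal} (hF : AEMeasurable F (volume.restrict (hset D r))) :
    ∫⁻ p in hset D r, F p = ∫⁻ z in D, ∫⁻ w in ball 0 (Real.exp (-r z)), F (z, w) := by
  have ho := isOpen_hset hD hr
  rw [← lintegral_indicator ho.measurableSet, Measure.volume_eq_prod,
    lintegral_prod _ ((aemeasurable_indicator_iff ho.measurableSet).2 hF),
    ← lintegral_indicator hD.measurableSet]
  refine lintegral_congr fun z => ?_
  by_cases hz : z ∈ D
  · rw [indicator_of_mem hz, ← lintegral_indicator measurableSet_ball]
    refine lintegral_congr fun w => ?_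
    by_cases hw : ‖w‖ < Real.exp (-r z)
    · rw [indicator_of_mem (show (z, w) ∈ hset D r from ⟨hz, hw⟩),
        indicator_of_mem (mem_ball_zero_iff.2 hw)]
    · rw [indicator_of_notMem (fun h : (z, w) ∈ hset D r => hw h.2),
        indicator_of_notMem (fun h => hw (mem_ball_zero_iff.1 h))]
  · rw [indicator_of_notMem hz]
    simp [hset, hz]

theorem mem_L2h_monomial {D : Set ℂ} {r : ℂ → ℝ} (hD : IsOpen D) (hr : UpperSemicontinuousOn r D)
    {h : ℂ → ℂ} (hh : DifferentiableOn ℂ h D) (j : ℕ)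
    (hi : IntegrableOn (fun z => ‖h z‖ ^ 2 * Real.exp (-r z) ^ (2 * j + 2)) D) :
    (fun p : ℂ × ℂ => h p.1 * p.2 ^ j) ∈ L2h (hset D r) ∧
      ∫ p in hset D r, ‖h p.1 * p.2 ^ j‖ ^ 2 ≤
        Real.pi * ∫ z in D, ‖h z‖ ^ 2 * Real.exp (-r z) ^ (2 * j + 2) := by
  have ho := isOpen_hset hD hr
  have hd : DifferentiableOn ℂ (fun p : ℂ × ℂ => h p.1 * p.2 ^ j) (hset D r) := by
    refine DifferentiableOn.mul (hh.comp (t := D) differentiable_fst.differentiableOn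
      fun p hp => hp.1) ?_
    fun_prop
  have hc : ContinuousOn (fun p : ℂ × ℂ => ‖h p.1 * p.2 ^ j‖ ^ 2) (hset D r) :=
    hd.continuousOn.norm.pow 2
  have hm := hc.aestronglyMeasurable ho.measurableSet (μ := volume)
  have hle : ∫⁻ p in hset D r, ENNReal.ofReal (‖h p.1 * p.2 ^ j‖ ^ 2) ≤
      ENNReal.ofReal (Real.pi * ∫ z in D, ‖h z‖ ^ 2 * Real.exp (-r z) ^ (2 * j + 2)) := by
    rw [lintegral_hset hD hr (F := fun p => ENNReal.ofReal (‖h p.1 * p.2 ^ j‖ ^ 2))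
      hm.aemeasurable.ennreal_ofReal, ← integral_const_mul,
      ofReal_integral_eq_lintegral_ofReal (hi.const_mul _)
        (Eventually.of_forall fun z => by positivity)]
    refine lintegral_mono fun z => ?_
    calc ∫⁻ w in ball (0 : ℂ) (Real.exp (-r z)), ENNReal.ofReal (‖h z * w ^ j‖ ^ 2)
        ≤ ∫⁻ w in ball (0 : ℂ) (Real.exp (-r z)),
            ENNReal.ofReal (‖h z‖ ^ 2 * Real.exp (-r z) ^ (2 * j)) := by
          refine setLIntegral_mono measurable_const fun w hw => ENNReal.ofReal_le_ofReal ?_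
          rw [norm_mul, norm_pow, mul_pow, ← pow_mul, mul_comm j 2]
          have := (mem_ball_zero_iff.1 hw).le
          gcongr
      _ = _ := by
          rw [setLIntegral_const, Complex.volume_ball, ← ENNReal.ofReal_pow (Real.exp_pos _).le,
            ← ENNReal.ofReal_coe_nnreal, ← ENNReal.ofReal_mul (by positivity),
            ← ENNReal.ofReal_mul (by positivity)]
          congr 1
          simp only [NNReal.coe_real_pi]
          ring
  have h_int : IntegrableOn (fun p : ℂ × ℂ => ‖h p.1 * p.2 ^ j‖ ^ 2) (hset D r) := by
    refine ⟨hm, ?_⟩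
    rw [hasFiniteIntegral_iff_ofReal (Eventually.of_forall fun p => by positivity)]
    exact hle.trans_lt ENNReal.ofReal_lt_top
  refine ⟨⟨hd, h_int⟩, ?_⟩
  rw [integral_eq_lintegral_of_nonneg_ae (Eventually.of_forall fun p => by positivity) hm]
  refine ENNReal.toReal_le_of_le_ofReal ?_ hle
  exact mul_nonneg Real.pi_pos.le (integral_nonneg fun z => by positivity)

theorem exists_enorm_sq_le_lintegral {δ : ℝ} (hδ : 0 < δ) :
    ∃ B : NNReal, ∀ (g : ℂ → ℂ) (c : ℂ), DiffContOnCl ℂ g (ball c δ) →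
      ‖g c‖ₑ ^ 2 ≤ B * ∫⁻ w in closedBall c δ, ‖g w‖ₑ ^ 2 := by
  obtain ⟨B, hB⟩ := (mol_continuous δ).bounded_above_of_compact_support (mol_hasCompactSupport hδ)
  refine ⟨B.toNNReal, fun g c hg => ?_⟩
  set F : ℂ → ℂ := (closedBall c δ).indicator fun w => g w * g w with hF
  have hgc : ContinuousOn g (closedBall c δ) := by
    rw [← closure_ball c hδ.ne']
    exact hg.continuousOn
  have hFi : Integrable F := by
    rw [hF, integrable_indicator_iff measurableSet_closedBall]
    exact (hgc.mul hgc).integrableOn_compact (isCompact_closedBall c δ)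
  have hmean : ∀ r, 0 < r → r < δ → Real.circleAverage F c r = F c := by
    intro r hr hrδ
    have h1 : Real.circleAverage F c r = Real.circleAverage (fun w => g w * g w) c r := by
      refine Real.circleAverage_congr_sphere fun w hw => ?_
      rw [abs_of_pos hr] at hw
      exact indicator_of_mem (closedBall_subset_closedBall hrδ.le (sphere_subset_closedBall hw)) _
    have h2 : DiffContOnCl ℂ (fun w => g w * g w) (ball c |r|) := by
      rw [abs_of_pos hr]
      exact (hg.smul hg).mono (ball_subset_ball hrδ.le)
    rw [h1, h2.circleAverage, hF, indicator_of_mem (mem_closedBall_self hδ.le)]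
  have h3 := mollify_eq_of_mean hδ hFi.locallyIntegrable hmean
  have h4 : ‖g c‖ₑ ^ 2 = ‖mollify δ F c‖ₑ := by
    rw [h3, hF, indicator_of_mem (mem_closedBall_self hδ.le), enorm_mul, sq]
  rw [h4, mollify]
  calc ‖∫ s, mol δ s • F (c - s)‖ₑ ≤ ∫⁻ s, ‖mol δ s • F (c - s)‖ₑ := enorm_integral_le_lintegral_enorm _
    _ ≤ ∫⁻ s, B.toNNReal * ‖F (c - s)‖ₑ := by
        refine lintegral_mono fun s => ?_
        rw [enorm_smul]
        gcongr
        rw [← ofReal_norm]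
        exact ENNReal.ofReal_le_ofReal (hB s)
    _ = B.toNNReal * ∫⁻ s, ‖F s‖ₑ := by
        rw [lintegral_const_mul' _ _ ENNReal.coe_ne_top]
        congr 1
        exact lintegral_sub_left_eq_self (fun s => ‖F s‖ₑ) c
    _ = _ := by
        rw [← lintegral_indicator measurableSet_closedBall]
        congr 1
        refine lintegral_congr fun w => ?_
        by_cases hw : w ∈ closedBall c δ
        · rw [hF, indicator_of_mem hw, indicator_of_mem hw, enorm_mul, sq]
        · rw [hF, indicator_of_notMem hw, indicator_of_notMem hw, enorm_zero]

theorem exists_enorm_sq_le_lintegral_prod {δ : ℝ} (hδ : 0 < δ) :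
    ∃ B : NNReal, ∀ (f : ℂ × ℂ → ℂ) (q : ℂ × ℂ) (G : Set (ℂ × ℂ)), IsOpen G →
      DifferentiableOn ℂ f G → closedBall q δ ⊆ G → ‖f q‖ₑ ^ 2 ≤ B * ∫⁻ p in G, ‖f p‖ₑ ^ 2 := by
  obtain ⟨B, hB⟩ := exists_enorm_sq_le_lintegral hδ
  refine ⟨B * B, fun f q G hG hf hq => ?_⟩
  rw [← Prod.mk.eta (p := q), ← closedBall_prod_same] at hq
  have hd1 : DiffContOnCl ℂ (fun z => f (z, q.2)) (ball q.1 δ) := by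
    refine (DifferentiableOn.comp (t := G) hf (by fun_prop) fun z hz => ?_).diffContOnCl
    exact hq ⟨closure_ball_subset_closedBall hz, mem_closedBall_self hδ.le⟩
  have hd2 : ∀ z ∈ closedBall q.1 δ, DiffContOnCl ℂ (fun w => f (z, w)) (ball q.2 δ) := by
    intro z hz
    refine (DifferentiableOn.comp (t := G) hf (by fun_prop) fun w hw => ?_).diffContOnCl
    exact hq ⟨hz, closure_ball_subset_closedBall hw⟩
  have hm : AEMeasurable (fun p => ‖f p‖ₑ ^ 2)
      ((volume : Measure (ℂ × ℂ)).restrict (closedBall q.1 δ ×ˢ closedBall q.2 δ)) :=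
    (((hf.continuousOn.mono hq).aestronglyMeasurable
      (measurableSet_closedBall.prod measurableSet_closedBall)).enorm).pow_const 2
  calc ‖f q‖ₑ ^ 2 ≤ B * ∫⁻ z in closedBall q.1 δ, ‖f (z, q.2)‖ₑ ^ 2 := hB _ _ hd1
    _ ≤ B * ∫⁻ z in closedBall q.1 δ, B * ∫⁻ w in closedBall q.2 δ, ‖f (z, w)‖ₑ ^ 2 := by
        refine mul_le_mul' le_rfl ?_
        exact setLIntegral_mono' measurableSet_closedBall fun z hz => hB _ _ (hd2 z hz)
    _ = (B * B : NNReal) * ∫⁻ p in closedBall q.1 δ ×ˢ closedBall q.2 δ, ‖f p‖ₑ ^ 2 := by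
        rw [lintegral_const_mul' _ _ ENNReal.coe_ne_top, ← mul_assoc, ← ENNReal.coe_mul]
        congr 1
        rw [Measure.volume_eq_prod, ← Measure.prod_restrict] at hm ⊢
        rw [lintegral_prod _ hm]
    _ ≤ _ := by gcongr

theorem lp_one_hasSum_norm (c : lp (fun _ : ℕ => ℂ) 1) : HasSum (fun n => ‖c n‖) ‖c‖ := by
  have := lp.hasSum_norm (p := 1) (by norm_num) c
  simpa using this

theorem exists_local_bound {f : ℕ → ℂ × ℂ → ℂ} {G : Set (ℂ × ℂ)} (hG : IsOpen G)
    (hf : ∀ n, DifferentiableOn ℂ (f n) G) (hl : ∀ n, ∫⁻ p in G, ‖f n p‖ₑ ^ 2 ≤ 1) {p : ℂ × ℂ}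
    (hp : p ∈ G) : ∃ δ > 0, ball p δ ⊆ G ∧ ∃ C, 0 ≤ C ∧ ∀ n, ∀ q ∈ ball p δ, ‖f n q‖ ≤ C := by
  obtain ⟨ε, hε, hb⟩ := Metric.isOpen_iff.1 hG p hp
  obtain ⟨B, hB⟩ := exists_enorm_sq_le_lintegral_prod (half_pos (half_pos hε))
  refine ⟨ε / 2, half_pos hε, (ball_subset_ball (half_le_self hε.le)).trans hb, B + 1,
    by positivity, fun n q hq => ?_⟩
  have h1 : closedBall q (ε / 2 / 2) ⊆ G := by
    refine Subset.trans (fun x hx => ?_) hb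
    rw [mem_closedBall] at hx
    rw [mem_ball] at hq ⊢
    linarith [dist_triangle x q p]
  have h2 := (hB (f n) q G hG (hf n) h1).trans (mul_le_mul' le_rfl (hl n))
  rw [mul_one, ← ofReal_norm, ← ENNReal.ofReal_pow (norm_nonneg _),
    ← ENNReal.ofReal_coe_nnreal, ENNReal.ofReal_le_ofReal_iff B.coe_nonneg] at h2
  have := B.coe_nonneg
  nlinarith [sq_nonneg (‖f n q‖ - 1)]

theorem summable_lp_one_mul {f : ℕ → ℂ} {C : ℝ} (hC : ∀ n, ‖f n‖ ≤ C)
    (c : lp (fun _ : ℕ => ℂ) 1) : Summable fun n => c n * f n := by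
  refine Summable.of_norm_bounded ((lp_one_hasSum_norm c).summable.mul_right C) fun n => ?_
  rw [norm_mul]
  exact mul_le_mul_of_nonneg_left (hC n) (norm_nonneg _)

theorem norm_tsum_lp_one_mul_le {f : ℕ → ℂ} {C : ℝ} (hC : ∀ n, ‖f n‖ ≤ C)
    (c : lp (fun _ : ℕ => ℂ) 1) : ‖∑' n, c n * f n‖ ≤ ‖c‖ * C := by
  refine tsum_of_norm_bounded ((lp_one_hasSum_norm c).mul_right C) fun n => ?_
  rw [norm_mul]
  exact mul_le_mul_of_nonneg_left (hC n) (norm_nonneg _)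

theorem tsum_mul_mem_L2h {f : ℕ → ℂ × ℂ → ℂ} {G : Set (ℂ × ℂ)} (hG : IsOpen G)
    (hf : ∀ n, DifferentiableOn ℂ (f n) G) (hl : ∀ n, ∫⁻ p in G, ‖f n p‖ₑ ^ 2 ≤ 1)
    (c : lp (fun _ : ℕ => ℂ) 1) : (fun p => ∑' n, c n * f n p) ∈ L2h G := by
  have hsum : ∀ p ∈ G, Summable fun n => c n * f n p := by
    intro p hp
    obtain ⟨δ, hδ, -, C, -, hC⟩ := exists_local_bound hG hf hl hp
    exact summable_lp_one_mul (fun n => hC n p (mem_ball_self hδ)) c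
  have hd : DifferentiableOn ℂ (fun p => ∑' n, c n * f n p) G := by
    intro p hp
    obtain ⟨δ, hδ, hδG, C, hC0, hC⟩ := exists_local_bound hG hf hl hp
    have h1 : ∀ n, ∀ q ∈ ball p (δ / 2),
        HasFDerivAt (fun q => c n * f n q) (c n • fderiv ℂ (f n) q) q := fun n q hq =>
      ((hf n).differentiableAt (hG.mem_nhds (hδG (ball_subset_ball (half_le_self hδ.le) hq)))
        ).hasFDerivAt.const_mul (c n)
    have h2 : ∀ n, ∀ q ∈ ball p (δ / 2),
        ‖c n • fderiv ℂ (f n) q‖ ≤ ‖c n‖ * (2 * C / (δ / 2)) := by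
      intro n q hq
      have hsub : ball q (δ / 2) ⊆ ball p δ := by
        intro x hx
        rw [mem_ball] at hx hq ⊢
        linarith [dist_triangle x q p]
      rw [norm_smul]
      exact mul_le_mul_of_nonneg_left (norm_fderiv_le_of_norm_le (half_pos hδ)
        ((hf n).mono (hsub.trans hδG)) fun x hx => hC n x (hsub hx)) (norm_nonneg _)
    exact (hasFDerivAt_tsum_of_isPreconnected ((lp_one_hasSum_norm c).summable.mul_right _)
      isOpen_ball (convex_ball p (δ / 2)).isPreconnected h1 h2 (mem_ball_self (half_pos hδ))
      (hsum p hp) (mem_ball_self (half_pos hδ))).differentiableAt.differentiableWithinAt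
  have hm : ∀ n, AEStronglyMeasurable (f n) (volume.restrict G) := fun n =>
    (hf n).continuousOn.aestronglyMeasurable hG.measurableSet
  have hdm := hd.continuousOn.aestronglyMeasurable hG.measurableSet (μ := volume)
  have hnorm : ∀ n, eLpNorm (f n) 2 (volume.restrict G) ≤ 1 := by
    intro n
    have h1 := eLpNorm_nnreal_pow_eq_lintegral (f := f n) (μ := volume.restrict G)
      (p := 2) two_ne_zero
    have h2 : eLpNorm (f n) 2 (volume.restrict G) ^ (2 : ℝ) ≤ 1 := by
      have h3 := hl n
      simp only [NNReal.coe_ofNat, ENNReal.coe_ofNat, ENNReal.rpow_ofNat] at h1 ⊢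
      rw [h1]
      exact h3
    rw [← ENNReal.one_rpow 2] at h2
    exact (ENNReal.rpow_le_rpow_iff two_pos).1 h2
  have hlp : eLpNorm (fun p => ∑' n, c n * f n p) 2 (volume.restrict G) ≤ ‖c‖ₑ := by
    refine (Lp.eLpNorm_lim_le_liminf_eLpNorm (f := fun N => ∑ n ∈ Finset.range N, c n • f n)
      (fun N => Finset.aestronglyMeasurable_sum _ fun n _ => (hm n).const_smul _) _
      ((ae_restrict_mem hG.measurableSet).mono fun p hp => ?_)).trans ?_
    · simpa using (hsum p hp).hasSum.tendsto_sum_nat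
    · refine liminf_le_of_le (by isBoundedDefault) fun b hb => ?_
      obtain ⟨N, hN⟩ := hb.exists
      refine hN.trans ((eLpNorm_sum_le (fun n _ => (hm n).const_smul _) one_le_two).trans ?_)
      calc ∑ n ∈ Finset.range N, eLpNorm (c n • f n) 2 (volume.restrict G)
          ≤ ∑ n ∈ Finset.range N, ENNReal.ofReal ‖c n‖ := by
            refine Finset.sum_le_sum fun n _ => ?_
            rw [eLpNorm_const_smul, ofReal_norm]
            exact mul_le_of_le_one_right' (hnorm n)
        _ ≤ _ := by
            rw [← ENNReal.ofReal_sum_of_nonneg fun n _ => norm_nonneg _, ← ofReal_norm]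
            exact ENNReal.ofReal_le_ofReal
              (sum_le_hasSum _ (fun n _ => norm_nonneg _) (lp_one_hasSum_norm c))
  exact ⟨hd, (memLp_two_iff_integrable_sq_norm hdm).1 ⟨hdm, hlp.trans_lt enorm_lt_top⟩⟩

theorem LineHol.eqOn_closedBall {f g : ℂ × ℂ → ℂ} {p : ℂ × ℂ} {ε : ℝ} (hε : 0 < ε)
    (hf : LineHol f (ball p ε)) (hg : LineHol g (ball p ε)) (hfc : ContinuousOn f (closedBall p ε))
    (hgc : ContinuousOn g (closedBall p ε)) {V : Set (ℂ × ℂ)} (hV : IsOpen V) (hVn : V.Nonempty)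
    (hVb : V ⊆ ball p ε) (h : EqOn f g V) : EqOn f g (closedBall p ε) := by
  obtain ⟨q, hq⟩ := hVn
  have h1 := hf.eqOn_ball hg (hVb hq) (h.eventuallyEq_of_mem (hV.mem_nhds hq))
  exact h1.of_subset_closure hfc hgc ball_subset_closedBall (closure_ball p hε.ne').ge

theorem exists_extension_bound {G U V : Set (ℂ × ℂ)} (hG : IsOpen G) {p : ℂ × ℂ}
    {ε : ℝ} (hε : 0 < ε) (hbU : closedBall p ε ⊆ U) (hV : IsOpen V) (hVn : V.Nonempty)
    (hVb : V ⊆ ball p ε) (hVG : V ⊆ G)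
    (hext : ∀ f ∈ L2h G, ∃ g : ℂ × ℂ → ℂ, DifferentiableOn ℂ g U ∧ EqOn g f V) :
    ∃ C : ℝ, 0 ≤ C ∧ ∀ f g : ℂ × ℂ → ℂ, ∀ A : ℝ, 0 < A → DifferentiableOn ℂ f G →
      ∫⁻ q in G, ‖f q‖ₑ ^ 2 ≤ ENNReal.ofReal (A ^ 2) → DifferentiableOn ℂ g U → EqOn g f V →
      ∀ q ∈ closedBall p ε, ‖g q‖ ≤ C * A := by
  set K := closedBall p ε with hK
  have hbK : ball p ε ⊆ U := ball_subset_closedBall.trans hbU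
  have huniq : ∀ {g₁ g₂ : ℂ × ℂ → ℂ}, DifferentiableOn ℂ g₁ U → DifferentiableOn ℂ g₂ U →
      EqOn g₁ g₂ V → EqOn g₁ g₂ K := fun h₁ h₂ h =>
    LineHol.eqOn_closedBall hε (h₁.mono hbK).lineHol (h₂.mono hbK).lineHol
      (h₁.continuousOn.mono hbU) (h₂.continuousOn.mono hbU) hV hVn hVb h
  suffices H : ∃ C : ℝ, ∀ f g : ℂ × ℂ → ℂ, DifferentiableOn ℂ f G →
      ∫⁻ q in G, ‖f q‖ₑ ^ 2 ≤ 1 → DifferentiableOn ℂ g U → EqOn g f V → ∀ q ∈ K, ‖g q‖ ≤ C by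
    obtain ⟨C, hC⟩ := H
    refine ⟨max C 0, le_max_right _ _, fun f g A hA hf hfA hg hgf q hq => ?_⟩
    have h1 := hC (fun q => (A : ℂ)⁻¹ * f q) (fun q => (A : ℂ)⁻¹ * g q) (hf.const_mul _) ?_
      (hg.const_mul _) (fun x hx => by simp only [hgf hx]) q hq
    · rw [norm_mul, norm_inv, Complex.norm_real, Real.norm_of_nonneg hA.le,
        inv_mul_le_iff₀ hA] at h1
      calc ‖g q‖ ≤ A * C := h1
        _ ≤ max C 0 * A := by rw [mul_comm]; gcongr; exact le_max_left _ _
    · have h2 : ∀ q, ‖(A : ℂ)⁻¹ * f q‖ₑ ^ 2 = ENNReal.ofReal ((A ^ 2)⁻¹) * ‖f q‖ₑ ^ 2 := by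
        intro q
        rw [enorm_mul, mul_pow, ← ofReal_norm (A : ℂ)⁻¹, ← ENNReal.ofReal_pow (norm_nonneg _),
          norm_inv, Complex.norm_real, Real.norm_of_nonneg hA.le, inv_pow]
      simp only [h2]
      rw [lintegral_const_mul' _ _ ENNReal.ofReal_ne_top]
      refine (mul_le_mul' le_rfl hfA).trans ?_
      rw [← ENNReal.ofReal_mul (by positivity), inv_mul_cancel₀ (by positivity)]
      simp
  by_contra! H
  have H' := fun n : ℕ => H n
  choose f g hf hfl hg hgf q hq hgq using H'
  choose E hE hEf using fun c : lp (fun _ : ℕ => ℂ) 1 => hext _ (tsum_mul_mem_L2h hG hf hfl c)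
  have hsum : ∀ x ∈ V, ∀ c : lp (fun _ : ℕ => ℂ) 1, Summable fun n => c n * f n x := by
    intro x hx c
    obtain ⟨δ, hδ, -, C, -, hC⟩ := exists_local_bound hG hf hfl (hVG hx)
    exact summable_lp_one_mul (fun n => hC n x (mem_ball_self hδ)) c
  have hKc : CompactSpace K := isCompact_iff_compactSpace.1 (isCompact_closedBall p ε)
  let T : lp (fun _ : ℕ => ℂ) 1 →ₗ[ℂ] C(K, ℂ) :=
    { toFun := fun c => ⟨fun x => E c x, ((hE c).continuousOn.mono hbU).domRestrict⟩
      map_add' := by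
        intro a b
        ext x
        refine huniq (hE _) ((hE a).add (hE b)) (fun y hy => ?_) x.2
        simp only [Pi.add_apply]
        rw [hEf _ hy, hEf _ hy, hEf _ hy, ← (hsum y hy a).tsum_add (hsum y hy b)]
        refine tsum_congr fun n => ?_
        simp [add_mul]
      map_smul' := by
        intro a b
        ext x
        refine huniq (hE _) ((hE b).const_mul a) (fun y hy => ?_) x.2
        have h1 : a * E b y = ∑' n, a * (b n * f n y) := by rw [hEf b hy, tsum_mul_left]
        refine (hEf (a • b) hy).trans (Eq.trans (tsum_congr fun n => ?_) h1.symm)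
        simp [mul_assoc] }
  have hT : Continuous T := by
    refine T.continuous_of_seq_closed_graph fun u c y hu hy => ?_
    set Y : ℂ × ℂ → ℂ := Function.extend Subtype.val y 0 with hY
    have hYy : ∀ x : K, Y x = y x := fun x => Subtype.val_injective.extend_apply y 0 x
    have hunif : TendstoUniformlyOn (fun n x => E (u n) x) Y atTop K := by
      rw [ContinuousMap.tendsto_iff_tendstoUniformly] at hy
      intro s hs
      filter_upwards [hy s hs] with n hn x hx
      have := hn ⟨x, hx⟩
      rwa [← hYy] at this
    have hcont : ContinuousOn Y K :=
      hunif.continuousOn (Frequently.of_forall fun n => (hE _).continuousOn.mono hbU)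
    have hline := LineHol.of_tendsto isOpen_ball (fun n => ((hE (u n)).mono hbK).lineHol)
      (hunif.mono ball_subset_closedBall)
    have heq := hline.eqOn_closedBall hε ((hE c).mono hbK).lineHol hcont
      ((hE c).continuousOn.mono hbU) hV hVn hVb ?_
    · ext x
      exact (hYy x).symm.trans (heq x.2)
    · intro x hx
      refine tendsto_nhds_unique (hunif.tendsto_at (ball_subset_closedBall (hVb hx))) ?_
      obtain ⟨δ, hδ, -, C, -, hC⟩ := exists_local_bound hG hf hfl (hVG hx)
      rw [tendsto_iff_norm_sub_tendsto_zero]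
      have h0 : Tendsto (fun n => ‖u n - c‖ * C) atTop (nhds 0) := by
        simpa using (tendsto_iff_norm_sub_tendsto_zero.1 hu).mul_const C
      refine squeeze_zero (fun n => norm_nonneg _) (fun n => ?_) h0
      rw [hEf _ hx, hEf _ hx, ← (hsum x hx _).tsum_sub (hsum x hx _)]
      simp only [← sub_mul]
      exact norm_tsum_lp_one_mul_le (fun n => hC n x (mem_ball_self hδ)) (u n - c)
  obtain ⟨C, hC0, hC⟩ := (⟨T, hT⟩ : lp (fun _ : ℕ => ℂ) 1 →L[ℂ] C(K, ℂ)).bound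
  obtain ⟨n, hn⟩ := exists_nat_gt C
  have h1 := hC (lp.single 1 n 1)
  rw [lp.norm_single one_pos, norm_one, mul_one] at h1
  have h2 : EqOn (E (lp.single 1 n 1)) (g n) K := by
    refine huniq (hE _) (hg n) fun x hx => ?_
    refine (hEf _ hx).trans ((tsum_eq_single n ?_).trans ?_)
    rotate_left
    · simp [hgf n hx]
    · intro m hm
      simp [lp.single_apply, hm]
  have h3 := (ContinuousMap.norm_coe_le_norm (T (lp.single 1 n 1)) ⟨q n, hq n⟩).trans h1
  have h4 : T (lp.single 1 n 1) ⟨q n, hq n⟩ = g n (q n) := h2 (hq n)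
  rw [h4] at h3
  linarith [hgq n]

theorem aestronglyMeasurable_fderiv_param {F : ℂ × ℂ → ℝ → ℂ} {a b : ℝ} {x₀ : ℂ × ℂ} {η : ℝ}
    (hη : 0 < η) (hc : ∀ x ∈ closedBall x₀ η, Continuous (F x))
    (hF : ∀ θ, DifferentiableAt ℂ (fun x => F x θ) x₀) :
    AEStronglyMeasurable (fun θ => fderiv ℂ (fun x => F x θ) x₀) (volume.restrict (uIoc a b)) := by
  have h1 : ∀ v : ℂ × ℂ, AEStronglyMeasurable (fun θ => fderiv ℂ (fun x => F x θ) x₀ v)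
      (volume.restrict (uIoc a b)) := by
    intro v
    set c : ℕ → ℂ := fun n => (((n + 1) * ((‖v‖ + 1) / η) : ℝ) : ℂ) with hcdef
    have hpos : ∀ n : ℕ, 0 < ((n : ℝ) + 1) * ((‖v‖ + 1) / η) := fun n => by positivity
    have hcn : ∀ n, ‖c n‖ = (n + 1) * ((‖v‖ + 1) / η) := fun n => by
      rw [hcdef, Complex.norm_real, Real.norm_of_nonneg (hpos n).le]
    have hct : Tendsto (fun n => ‖c n‖) atTop atTop := by
      simp only [hcn]
      exact (tendsto_natCast_atTop_atTop.atTop_add tendsto_const_nhds).atTop_mul_const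
        (by positivity)
    have hmem : ∀ n, x₀ + (c n)⁻¹ • v ∈ closedBall x₀ η := by
      intro n
      rw [mem_closedBall_iff_norm, add_sub_cancel_left, norm_smul, norm_inv, hcn,
        inv_mul_le_iff₀ (hpos n)]
      have h2 : ((n : ℝ) + 1) * ((‖v‖ + 1) / η) * η = (n + 1) * (‖v‖ + 1) := by
        field_simp
      rw [h2]
      nlinarith [norm_nonneg v, Nat.cast_nonneg (α := ℝ) n]
    refine aestronglyMeasurable_of_tendsto_ae atTop
      (f := fun n θ => c n • (F (x₀ + (c n)⁻¹ • v) θ - F x₀ θ)) (fun n => ?_)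
      (ae_of_all _ fun θ => (hF θ).hasFDerivAt.lim v hct)
    exact (((hc _ (hmem n)).sub (hc _ (mem_closedBall_self hη.le))).const_smul
      (c n)).aestronglyMeasurable
  have h2 : (fun θ => fderiv ℂ (fun x => F x θ) x₀) = fun θ =>
      (fderiv ℂ (fun x => F x θ) x₀ (1, 0)) • ContinuousLinearMap.fst ℂ ℂ ℂ +
        (fderiv ℂ (fun x => F x θ) x₀ (0, 1)) • ContinuousLinearMap.snd ℂ ℂ ℂ := by
    funext θ
    ext <;> simp
  rw [h2]
  exact ((h1 _).smul_const _).add ((h1 _).smul_const _)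

theorem differentiableOn_intervalIntegral_param {F : ℂ × ℂ → ℝ → ℂ} {a b : ℝ} {U : Set (ℂ × ℂ)}
    (hU : IsOpen U) (hF : ∀ θ, DifferentiableOn ℂ (fun x => F x θ) U)
    (hc : ContinuousOn (fun p : (ℂ × ℂ) × ℝ => F p.1 p.2) (U ×ˢ univ)) :
    DifferentiableOn ℂ (fun x => ∫ θ in a..b, F x θ) U := by
  intro x₀ hx₀
  obtain ⟨ε, hε, hb⟩ := Metric.isOpen_iff.1 hU x₀ hx₀
  set η := ε / 4 with hη
  have hη0 : 0 < η := by positivity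
  have hK : closedBall x₀ (2 * η) ⊆ U := (closedBall_subset_ball (by linarith)).trans hb
  have hcx : ∀ x ∈ U, Continuous (F x) := by
    intro x hx
    rw [← continuousOn_univ]
    exact hc.comp (f := fun θ : ℝ => (x, θ)) (by fun_prop) fun θ _ => ⟨hx, mem_univ _⟩
  obtain ⟨C, hC⟩ := ((isCompact_closedBall x₀ (2 * η)).prod (isCompact_uIcc (a := a) (b := b))
    ).exists_bound_of_continuousOn (hc.mono (prod_mono hK (subset_univ _)))
  refine (intervalIntegral.hasFDerivAt_integral_of_dominated_of_fderiv_le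
    (s := ball x₀ η) (F' := fun x θ => fderiv ℂ (fun x => F x θ) x) (bound := fun _ => 2 * C / η)
    (ball_mem_nhds _ hη0) ?_ ?_ ?_ ?_ ?_ ?_).differentiableAt.differentiableWithinAt
  · filter_upwards [hU.mem_nhds hx₀] with x hx
    exact (hcx x hx).aestronglyMeasurable
  · exact (hcx x₀ hx₀).intervalIntegrable _ _
  · exact aestronglyMeasurable_fderiv_param hη0
      (fun x hx => hcx x (hK (closedBall_subset_closedBall (by linarith) hx)))
      fun θ => (hF θ).differentiableAt (hU.mem_nhds hx₀)
  · refine ae_of_all _ fun θ hθ x hx => ?_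
    have hsub : ball x η ⊆ closedBall x₀ (2 * η) := by
      intro y hy
      rw [mem_ball] at hy hx
      rw [mem_closedBall]
      linarith [dist_triangle y x x₀]
    exact norm_fderiv_le_of_norm_le hη0 ((hF θ).mono (hsub.trans hK)) fun q hq =>
      hC (q, θ) ⟨hsub hq, uIoc_subset_uIcc hθ⟩
  · exact intervalIntegrable_const
  · refine ae_of_all _ fun θ hθ x hx => ?_
    exact ((hF θ).differentiableAt (hU.mem_nhds
      (hK (ball_subset_closedBall.trans (closedBall_subset_closedBall (by linarith)) hx)))).hasFDerivAt

theorem differentiableOn_cauchyIntegral {f : ℂ × ℂ → ℂ} {G : Set (ℂ × ℂ)}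
    (hf : DifferentiableOn ℂ f G) {t : ℂ} {R s : ℝ} (hR : 0 < R)
    (hsub : sphere t R ×ˢ ball (0 : ℂ) s ⊆ G) :
    DifferentiableOn ℂ (fun p : ℂ × ℂ => (2 * Real.pi * Complex.I)⁻¹ •
      ∮ ζ in C(t, R), (ζ - p.1)⁻¹ • f (ζ, p.2)) (ball t R ×ˢ ball 0 s) := by
  suffices h : DifferentiableOn ℂ (fun p : ℂ × ℂ => ∮ ζ in C(t, R), (ζ - p.1)⁻¹ • f (ζ, p.2))
      (ball t R ×ˢ ball 0 s) from
    h.fun_const_smul (2 * Real.pi * Complex.I : ℂ)⁻¹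
  have hcm : ∀ θ, circleMap t R θ ∈ sphere t R := fun θ => circleMap_mem_sphere t hR.le θ
  have hne : ∀ θ, ∀ p ∈ ball t R ×ˢ ball (0 : ℂ) s, circleMap t R θ - p.1 ≠ 0 := by
    intro θ p hp h
    rw [sub_eq_zero] at h
    have h1 := hcm θ
    rw [h, mem_sphere] at h1
    exact absurd (mem_ball.1 hp.1) (not_lt.2 h1.ge)
  refine differentiableOn_intervalIntegral_param (isOpen_ball.prod isOpen_ball) (fun θ => ?_) ?_
  · have h1 : DifferentiableOn ℂ (fun p : ℂ × ℂ => circleMap t R θ - p.1)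
        (ball t R ×ˢ ball 0 s) := by
      generalize circleMap t R θ = c
      fun_prop
    refine DifferentiableOn.fun_const_smul (DifferentiableOn.smul (h1.fun_inv (hne θ)) ?_) _
    exact hf.comp (t := G) (f := fun p : ℂ × ℂ => (circleMap t R θ, p.2)) (by fun_prop)
      fun p hp => hsub ⟨hcm θ, hp.2⟩
  · have hcc : Continuous fun p : (ℂ × ℂ) × ℝ => circleMap t R p.2 :=
      (continuous_circleMap t R).comp continuous_snd
    have hdc : Continuous fun p : (ℂ × ℂ) × ℝ => deriv (circleMap t R) p.2 := by
      simp only [deriv_circleMap]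
      exact ((continuous_circleMap 0 R).comp continuous_snd).mul continuous_const
    refine hdc.continuousOn.smul (ContinuousOn.smul (ContinuousOn.inv₀ (by fun_prop)
      fun p hp => hne _ _ hp.1) ?_)
    exact hf.continuousOn.comp (t := G) (f := fun p : (ℂ × ℂ) × ℝ => (circleMap t R p.2, p.1.2))
      (by fun_prop) fun p hp => hsub ⟨hcm _, hp.1.2⟩

theorem not_isL2hDomainOfHolomorphy_hset {D : Set ℂ} {r : ℂ → ℝ} (hD : IsOpen D)
    (hr : UpperSemicontinuousOn r D) {t : ℂ} (ht : t ∈ polarS D) {N : ℝ}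
    (hN : ∀ᶠ z in nhdsWithin t D, r z ≤ N) : ¬ IsL2hDomainOfHolomorphy (hset D r) := by
  obtain ⟨htf, U₀, hU₀, htU₀, hpol⟩ := ht
  rw [eventually_nhdsWithin_iff] at hN
  obtain ⟨δ, hδ, hδb⟩ := Metric.mem_nhds_iff.1 (inter_mem (hU₀.mem_nhds htU₀) hN)
  have hG := isOpen_hset hD hr
  set K := closedBall t (δ / 2) \ D with hK
  have hKc : IsCompact K := (isCompact_closedBall _ _).diff hD
  have hball : closedBall t (δ / 2) ⊆ ball t δ := closedBall_subset_ball (by linarith)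
  have hcapK : CapZero K :=
    PolarSet.capZero hKc (hpol.mono (sdiff_subset_sdiff_left fun x hx => (hδb (hball hx)).1))
  obtain ⟨R, hR, hRK⟩ := hcapK.exists_sphere t (r₁ := 0) (r₂ := δ / 2) (by linarith)
  have hRD : sphere t R ⊆ D := by
    intro x hx
    by_contra hxD
    exact hRK.le_bot ⟨hx, closedBall_subset_closedBall hR.2.le (sphere_subset_closedBall hx), hxD⟩
  set s := Real.exp (-N) with hs
  set U := ball t (δ / 2) with hU
  have hprod : ∀ z ∈ closedBall t (δ / 2), z ∈ D → ∀ w ∈ ball (0 : ℂ) s, (z, w) ∈ hset D r := by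
    intro z hz hzD w hw
    refine ⟨hzD, (mem_ball_zero_iff.1 hw).trans_le (Real.exp_le_exp.2 (neg_le_neg ?_))⟩
    exact (hδb (hball hz)).2 hzD
  have hRU : ball t R ⊆ U := ball_subset_ball hR.2.le
  obtain ⟨z₁, hz₁, hz₁D⟩ := mem_closure_iff_nhds.1 htf.1 _ (ball_mem_nhds t hR.1)
  obtain ⟨η, hη, hηb⟩ := Metric.isOpen_iff.1 (isOpen_ball.inter hD) z₁ ⟨hz₁, hz₁D⟩
  have hs0 : 0 < s := Real.exp_pos _
  refine not_not.2 ⟨ball z₁ η ×ˢ ball 0 s, ball t R ×ˢ ball 0 s, isOpen_ball.prod isOpen_ball,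
    ((convex_ball _ _).isConnected (nonempty_ball.2 hη)).prod
      ((convex_ball _ _).isConnected (nonempty_ball.2 hs0)),
    isOpen_ball.prod isOpen_ball, ((convex_ball _ _).isConnected (nonempty_ball.2 hR.1)).prod
      ((convex_ball _ _).isConnected (nonempty_ball.2 hs0)), ?_, ?_, ?_⟩
  · rintro ⟨z, w⟩ ⟨hz, hw⟩
    exact ⟨⟨(hηb hz).1, hw⟩,
      hprod z (ball_subset_closedBall (hRU (hηb hz).1)) (hηb hz).2 w hw⟩
  · intro hsub
    have h1 := (hsub (a := (t, 0)) ⟨mem_ball_self hR.1, mem_ball_self hs0⟩).1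
    exact htf.2 (by rwa [hD.interior_eq])
  · rintro f ⟨hfd, hfi⟩
    have hSG : sphere t R ×ˢ ball (0 : ℂ) s ⊆ hset D r := fun p hp =>
      hprod p.1 (closedBall_subset_closedBall hR.2.le (sphere_subset_closedBall hp.1)) (hRD hp.1)
        p.2 hp.2
    refine ⟨_, differentiableOn_cauchyIntegral hfd hR.1 hSG, ?_⟩
    set W := U ∩ D with hW
    have hWo : IsOpen W := isOpen_ball.inter hD
    have hWG : W ×ˢ ball (0 : ℂ) s ⊆ hset D r := fun p hp =>
      hprod p.1 (ball_subset_closedBall hp.1.1) hp.1.2 p.2 hp.2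
    have h_int := hfi.mono_set hWG
    rw [IntegrableOn, Measure.volume_eq_prod, ← Measure.prod_restrict] at h_int
    have hae := h_int.prod_left_ae
    rintro ⟨z, w⟩ ⟨hz, hw⟩
    have hzW : z ∈ W := ⟨hRU (hηb hz).1, (hηb hz).2⟩
    have hzR : z ∈ ball t R := (hηb hz).1
    have key : (fun w => (2 * Real.pi * Complex.I : ℂ)⁻¹ • ∮ ζ in C(t, R), (ζ - z)⁻¹ • f (ζ, w))
        =ᵐ[volume.restrict (ball 0 s)] fun w => f (z, w) := by
      filter_upwards [hae, ae_restrict_mem measurableSet_ball] with w hw1 hw2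
      have hfw : DifferentiableOn ℂ (fun z => f (z, w)) W :=
        hfd.comp (t := hset D r) (f := fun z => (z, w)) (by fun_prop) fun z hz => hWG ⟨hz, hw2⟩
      obtain ⟨F, hF, hFf⟩ := exists_extension_of_capZero isOpen_ball hWo inter_subset_left
        (fun K' _ hK'2 => hcapK.mono fun x hx =>
          ⟨ball_subset_closedBall (hK'2 hx).1, fun h => (hK'2 hx).2 ⟨(hK'2 hx).1, h⟩⟩) hfw hw1
      have h1 : ∮ ζ in C(t, R), (ζ - z)⁻¹ • f (ζ, w) = ∮ ζ in C(t, R), (ζ - z)⁻¹ • F ζ := by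
        refine circleIntegral.integral_congr hR.1.le fun ζ hζ => ?_
        have hζW : ζ ∈ W := ⟨closedBall_subset_ball hR.2 (sphere_subset_closedBall hζ), hRD hζ⟩
        rw [hFf hζW]
      have h2 : DiffContOnCl ℂ F (ball t R) := by
        refine (hF.mono ?_).diffContOnCl
        exact closure_ball_subset_closedBall.trans (closedBall_subset_ball hR.2)
      rw [h1, h2.two_pi_i_inv_smul_circleIntegral_sub_inv_smul hzR, hFf hzW]
    refine Measure.eqOn_open_of_ae_eq key isOpen_ball ?_ ?_ hw
    · exact (differentiableOn_cauchyIntegral hfd hR.1 hSG).continuousOn.comp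
        (f := fun w : ℂ => (z, w)) (by fun_prop) fun w hw => ⟨hzR, hw⟩
    · exact hfd.continuousOn.comp (f := fun w : ℂ => (z, w)) (by fun_prop)
        fun w hw => hWG ⟨hzW, hw⟩

theorem mem_connectedComponentIn_of_mem_closure {E : Type*} [NormedAddCommGroup E]
    [NormedSpace ℝ E] {U : Set E} (hU : IsOpen U) {x t : E} (ht : t ∈ U)
    (hc : t ∈ closure (connectedComponentIn U x)) : t ∈ connectedComponentIn U x := by
  obtain ⟨ε, hε, hb⟩ := Metric.isOpen_iff.1 hU t ht
  obtain ⟨y, hy, hyt⟩ := Metric.mem_closure_iff.1 hc ε hε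
  rw [connectedComponentIn_eq hy]
  exact (convex_ball t ε).isPreconnected.subset_connectedComponentIn (mem_ball'.2 hyt) hb
    (mem_ball_self hε)

theorem exists_mem_closure_connectedComponentIn {E : Type*} [NormedAddCommGroup E]
    [NormedSpace ℝ E] {U B : Set E} (hU : IsOpen U) (hB : IsPreconnected B) {x : E} (hx : x ∈ U)
    (hxB : x ∈ B) (hBU : ¬ B ⊆ connectedComponentIn (B ∩ U) x) (hBo : IsOpen B) :
    ∃ t ∈ B, t ∈ closure (connectedComponentIn (B ∩ U) x) ∧ t ∉ U := by
  by_contra! H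
  refine hBU (hB.subset_of_closure_inter_subset (hBo.inter hU).connectedComponentIn
    ⟨x, hxB, mem_connectedComponentIn ⟨hxB, hx⟩⟩ ?_)
  rintro t ⟨ht, htB⟩
  exact mem_connectedComponentIn_of_mem_closure (hBo.inter hU) ⟨htB, H t htB ht⟩ ht

theorem lintegral_enorm_sq_le {f : ℂ × ℂ → ℂ} {G : Set (ℂ × ℂ)} (hf : f ∈ L2h G) {B : ℝ}
    (h : ∫ p in G, ‖f p‖ ^ 2 ≤ B) : ∫⁻ p in G, ‖f p‖ₑ ^ 2 ≤ ENNReal.ofReal B := by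
  refine le_trans (le_of_eq ?_) (ENNReal.ofReal_le_ofReal h)
  rw [ofReal_integral_eq_lintegral_ofReal hf.2 (Eventually.of_forall fun p => by positivity)]
  refine lintegral_congr fun p => ?_
  rw [ENNReal.ofReal_pow (norm_nonneg _), ofReal_norm]

theorem le_of_pow_le_const_mul_pow {x y C : ℝ} (hy : 0 < y) {k : ℕ}
    (h : ∀ j ≥ k, x ^ j ≤ C * y ^ j) : x ≤ y := by
  by_contra! hxy
  have h1 := tendsto_pow_atTop_atTop_of_one_lt ((one_lt_div hy).2 hxy)
  obtain ⟨j, hj, hjk⟩ := ((h1.eventually_gt_atTop C).and (eventually_ge_atTop k)).exists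
  rw [div_pow, lt_div_iff₀ (pow_pos hy j)] at hj
  exact absurd (h j hjk) (not_le.2 hj)

theorem PotMeas.exists_cauchyT_L2h {K : Set ℂ} {μ : Measure ℂ} {L : ℝ} (h : PotMeas K μ L)
    (hK : IsCompact K) {t : ℂ} (hKt : K ⊆ closedBall t 1) {D : Set ℂ} {r : ℂ → ℝ}
    (hD : IsOpen D) (hr : RSub r D) {M : ℝ} (hM : ∀ z ∈ D, M ≤ r z) (hKD : Disjoint K D) :
    ∃ A : ℝ, 0 < A ∧ ∀ k : ℂ → ℂ, Measurable k → (∀ s, ‖k s‖ ≤ 2) → ∫ s, k s ∂μ = 0 →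
      DifferentiableOn ℂ (cauchyT μ k 0) D ∧
      (fun p : ℂ × ℂ => cauchyT μ k 0 p.1 * p.2 ^ 0) ∈ L2h (hset D r) ∧
      ∫⁻ p in hset D r, ‖cauchyT μ k 0 p.1 * p.2 ^ 0‖ₑ ^ 2 ≤ ENNReal.ofReal (A ^ 2) := by
  obtain ⟨A, hA, hAk⟩ := h.exists_cauchyT_bound hKt
  have := h.fin
  set B := Real.pi * (Real.exp (-M) ^ 2 * A.toReal) with hB
  have hB0 : 0 ≤ B := by positivity
  refine ⟨Real.sqrt B + 1, by positivity, fun k hk hk2 hk0 => ?_⟩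
  have hd : DifferentiableOn ℂ (cauchyT μ k 0) D := fun z hz =>
    (hasDerivAt_cauchyT hK h.supp hk hk2 0 fun hzK =>
      hKD.le_bot ⟨hzK, hz⟩).differentiableAt.differentiableWithinAt
  have hm : AEStronglyMeasurable (fun z => ‖cauchyT μ k 0 z‖ ^ 2) (volume.restrict D) :=
    (hd.continuousOn.norm.pow 2).aestronglyMeasurable hD.measurableSet
  have hci : IntegrableOn (fun z => ‖cauchyT μ k 0 z‖ ^ 2) D := by
    refine ⟨hm, ?_⟩
    rw [hasFiniteIntegral_iff_ofReal (Eventually.of_forall fun p => by positivity)]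
    exact ((setLIntegral_le_lintegral _ _).trans (hAk k hk hk2 hk0)).trans_lt hA
  have hcb : ∫ z in D, ‖cauchyT μ k 0 z‖ ^ 2 ≤ A.toReal := by
    rw [integral_eq_lintegral_of_nonneg_ae (Eventually.of_forall fun p => by positivity) hm]
    exact ENNReal.toReal_mono hA.ne ((setLIntegral_le_lintegral _ _).trans (hAk k hk hk2 hk0))
  have hle : ∀ z ∈ D, ‖cauchyT μ k 0 z‖ ^ 2 * Real.exp (-r z) ^ (2 * 0 + 2) ≤
      Real.exp (-M) ^ 2 * ‖cauchyT μ k 0 z‖ ^ 2 := by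
    intro z hz
    have := hM z hz
    rw [mul_comm, mul_zero, zero_add]
    gcongr
  have hi : IntegrableOn (fun z => ‖cauchyT μ k 0 z‖ ^ 2 * Real.exp (-r z) ^ (2 * 0 + 2)) D := by
    refine (hci.const_mul (Real.exp (-M) ^ 2)).mono' ?_ ?_
    · exact hm.mul ((Real.measurable_exp.comp_aemeasurable
        (hr.aemeasurable hD).neg).pow_const _).aestronglyMeasurable
    · filter_upwards [ae_restrict_mem hD.measurableSet] with z hz
      rw [Real.norm_of_nonneg (by positivity)]
      exact hle z hz
  obtain ⟨h1, h2⟩ := mem_L2h_monomial hD hr.usc hd 0 hi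
  refine ⟨hd, h1, lintegral_enorm_sq_le h1 (h2.trans ?_)⟩
  have h3 : ∫ z in D, ‖cauchyT μ k 0 z‖ ^ 2 * Real.exp (-r z) ^ (2 * 0 + 2) ≤
      Real.exp (-M) ^ 2 * A.toReal := by
    refine (setIntegral_mono_on hi (hci.const_mul _) hD.measurableSet hle).trans ?_
    rw [integral_const_mul]
    gcongr
  calc _ ≤ B := mul_le_mul_of_nonneg_left h3 Real.pi_pos.le
    _ = Real.sqrt B ^ 2 := (Real.sq_sqrt hB0).symm
    _ ≤ _ := by gcongr; linarith

/-- Data of a point of non-extendability: every `L²ₕ` function on `G` continues to a fixed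
neighbourhood of a closed ball centred outside `G`, with norm control. -/
theorem exists_ball_of_not_isL2h {G : Set (ℂ × ℂ)} (hG : IsOpen G)
    (h : ¬ IsL2hDomainOfHolomorphy G) : ∃ (p : ℂ × ℂ) (ε C : ℝ) (V : Set (ℂ × ℂ)), 0 < ε ∧ p ∉ G ∧
      IsOpen V ∧ V.Nonempty ∧ V ⊆ ball p ε ∧ V ⊆ G ∧ ∀ f ∈ L2h G, ∃ g : ℂ × ℂ → ℂ,
        (∃ U, closedBall p ε ⊆ U ∧ DifferentiableOn ℂ g U) ∧ EqOn g f V ∧ ∀ A, 0 < A →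
          ∫⁻ q in G, ‖f q‖ₑ ^ 2 ≤ ENNReal.ofReal (A ^ 2) → ∀ q ∈ closedBall p ε, ‖g q‖ ≤ C * A := by
  obtain ⟨D₀, D₁, hD₀, hD₀c, hD₁, hD₁c, hsub, hn, hext⟩ := not_not.1 h
  obtain ⟨x, hx⟩ := hD₀c.nonempty
  set V' := connectedComponentIn (D₁ ∩ G) x with hV'
  have hV'o : IsOpen V' := (hD₁.inter hG).connectedComponentIn
  have hV's : V' ⊆ D₁ ∩ G := connectedComponentIn_subset _ _
  have hD₀V' : D₀ ⊆ V' := hD₀c.isPreconnected.subset_connectedComponentIn hx hsub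
  obtain ⟨p, hpD₁, hpc, hpG⟩ := exists_mem_closure_connectedComponentIn hG hD₁c.isPreconnected
    (hsub hx).2 (hsub hx).1 (fun hc => hn (hc.trans (hV's.trans inter_subset_right))) hD₁
  obtain ⟨ε', hε', hb⟩ := Metric.isOpen_iff.1 hD₁ p hpD₁
  have hbU : closedBall p (ε' / 2) ⊆ D₁ := (closedBall_subset_ball (by linarith)).trans hb
  have hε : 0 < ε' / 2 := half_pos hε'
  have hext' : ∀ f ∈ L2h G, ∃ g : ℂ × ℂ → ℂ, DifferentiableOn ℂ g D₁ ∧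
      EqOn g f (V' ∩ ball p (ε' / 2)) := by
    intro f hf
    obtain ⟨g, hg, hgf⟩ := hext f hf
    refine ⟨g, hg, EqOn.mono inter_subset_left (LineHol.eqOn_of_isPreconnected hV'o
      isPreconnected_connectedComponentIn (hg.mono (hV's.trans inter_subset_left)).lineHol
      (hf.1.mono (hV's.trans inter_subset_right)).lineHol hD₀ hD₀V' ⟨x, hx⟩ hgf)⟩
  have hVo : IsOpen (V' ∩ ball p (ε' / 2)) := hV'o.inter isOpen_ball
  have hVn : (V' ∩ ball p (ε' / 2)).Nonempty := by
    obtain ⟨y, hy, hyp⟩ := Metric.mem_closure_iff.1 hpc _ hε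
    exact ⟨y, hy, mem_ball'.2 hyp⟩
  have hVG : V' ∩ ball p (ε' / 2) ⊆ G := inter_subset_left.trans (hV's.trans inter_subset_right)
  obtain ⟨C, -, hC⟩ := exists_extension_bound hG hε hbU hVo hVn inter_subset_right hVG hext'
  refine ⟨p, ε' / 2, C, _, hε, hpG, hVo, hVn, inter_subset_right, hVG, fun f hf => ?_⟩
  obtain ⟨g, hg, hgf⟩ := hext' f hf
  exact ⟨g, ⟨D₁, hbU, hg⟩, hgf, fun A hA hfA => hC f g A hA hf.1 hfA hg hgf⟩

theorem norm_le_exp_of_extension {D : Set ℂ} {r : ℂ → ℝ} (hD : IsOpen D) (hr : RSub r D)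
    {k : ℕ} {a w : ℂ} {C C' : ℝ}
    (hdec : ∀ j ≥ k, ∃ h : ℂ → ℂ, DifferentiableOn ℂ h D ∧ h a = 1 ∧
      IntegrableOn (fun z => ‖h z‖ ^ 2 * Real.exp (-r z) ^ (2 * j + 2)) D ∧
      ∫ z in D, ‖h z‖ ^ 2 * Real.exp (-r z) ^ (2 * j + 2) ≤ C' * Real.exp (-r a) ^ (2 * j))
    (hbd : ∀ (h : ℂ → ℂ) (j : ℕ), DifferentiableOn ℂ h D →
      (fun p : ℂ × ℂ => h p.1 * p.2 ^ j) ∈ L2h (hset D r) → ∀ A, 0 < A →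
      ∫⁻ p in hset D r, ‖h p.1 * p.2 ^ j‖ₑ ^ 2 ≤ ENNReal.ofReal (A ^ 2) →
      ‖h a * w ^ j‖ ≤ C * A) : ‖w‖ ≤ Real.exp (-r a) := by
  set B := Real.pi * max C' 1 with hB
  have hB0 : 0 < B := mul_pos Real.pi_pos (lt_max_of_lt_right one_pos)
  have he : 0 < Real.exp (-r a) := Real.exp_pos _
  refine le_of_pow_le_const_mul_pow (C := C * Real.sqrt B) (k := k) he fun j hj => ?_
  obtain ⟨h, hd, ha, hi, hle⟩ := hdec j hj
  obtain ⟨h1, h2⟩ := mem_L2h_monomial hD hr.usc hd j hi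
  have h3 : ∫ p in hset D r, ‖h p.1 * p.2 ^ j‖ ^ 2 ≤
      (Real.sqrt B * Real.exp (-r a) ^ j) ^ 2 := by
    rw [mul_pow, Real.sq_sqrt hB0.le, hB, mul_assoc, ← pow_mul, mul_comm j 2]
    refine h2.trans (mul_le_mul_of_nonneg_left (hle.trans ?_) Real.pi_pos.le)
    gcongr
    exact le_max_left _ _
  have h4 := hbd h j hd h1 _ (by positivity) (lintegral_enorm_sq_le h1 h3)
  rwa [ha, one_mul, norm_pow, ← mul_assoc] at h4

theorem isL2hDomainOfHolomorphy_hset {D : Set ℂ} {r : ℂ → ℝ} (hD : IsOpen D)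
    (hDc : IsConnected D) (hDne : D ≠ univ) (hr : RSub r D) {M : ℝ} (hM : ∀ z ∈ D, M ≤ r z)
    (hlim : ∀ t ∈ polarS D, ∀ N : ℝ, ∃ᶠ z in nhdsWithin t D, N < r z) :
    IsL2hDomainOfHolomorphy (hset D r) := by
  have hG := isOpen_hset hD hr.usc
  by_contra hcon
  obtain ⟨p, ε, C, V, hε, hpG, hV, ⟨⟨z₁, w₁⟩, hv⟩, hVb, hVG, hext⟩ :=
    exists_ball_of_not_isL2h hG hcon
  set Bz := ball p.1 ε with hBz
  set Bw := ball p.2 ε with hBw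
  have hbp : ball p ε = Bz ×ˢ Bw := (ball_prod_same p.1 p.2 ε).symm
  have hz₁ : z₁ ∈ Bz := by have := hVb hv; rw [hbp] at this; exact this.1
  have hw₁ : w₁ ∈ Bw := by have := hVb hv; rw [hbp] at this; exact this.2
  have hz₁D : z₁ ∈ D := (hVG hv).1
  have hUo : IsOpen (Bz ∩ D) := isOpen_ball.inter hD
  set Ω := connectedComponentIn (Bz ∩ D) z₁ with hΩ
  have hΩo : IsOpen Ω := hUo.connectedComponentIn
  have hΩs : Ω ⊆ Bz ∩ D := connectedComponentIn_subset _ _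
  have hz₁Ω : z₁ ∈ Ω := mem_connectedComponentIn ⟨hz₁, hz₁D⟩
  have hext' : ∀ (h : ℂ → ℂ) (j : ℕ), DifferentiableOn ℂ h D →
      (fun p : ℂ × ℂ => h p.1 * p.2 ^ j) ∈ L2h (hset D r) → ∃ g : ℂ × ℂ → ℂ,
        (∃ U, closedBall p ε ⊆ U ∧ DifferentiableOn ℂ g U) ∧
        (∀ a ∈ Ω, ∀ w ∈ Bw, g (a, w) = h a * w ^ j) ∧ ∀ A, 0 < A →
        ∫⁻ p in hset D r, ‖h p.1 * p.2 ^ j‖ₑ ^ 2 ≤ ENNReal.ofReal (A ^ 2) →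
        ∀ q ∈ closedBall p ε, ‖g q‖ ≤ C * A := by
    intro h j hd hL
    obtain ⟨g, ⟨U, hU, hg⟩, hgf, hgb⟩ := hext _ hL
    refine ⟨g, ⟨U, hU, hg⟩, fun a ha w hw => ?_, hgb⟩
    have hsub : Ω ×ˢ Bw ⊆ ball p ε := by
      rw [hbp]
      exact prod_mono (hΩs.trans inter_subset_left) Subset.rfl
    have hφ : DifferentiableOn ℂ (fun p : ℂ × ℂ => h p.1 * p.2 ^ j) (Ω ×ˢ Bw) := by
      refine DifferentiableOn.mul (hd.comp (t := D) differentiable_fst.differentiableOn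
        fun p hp => (hΩs hp.1).2) ?_
      fun_prop
    exact LineHol.eqOn_of_isPreconnected (hΩo.prod isOpen_ball)
      (isPreconnected_connectedComponentIn.prod (convex_ball _ _).isPreconnected)
      (hg.mono (hsub.trans (ball_subset_closedBall.trans hU))).lineHol hφ.lineHol
      (hV.inter (hΩo.prod isOpen_ball)) inter_subset_right ⟨_, hv, hz₁Ω, hw₁⟩
      (hgf.mono inter_subset_left) (show (a, w) ∈ Ω ×ˢ Bw from ⟨ha, hw⟩)
  have hΩb : ∀ a ∈ Ω, ∀ w ∈ Bw, ‖w‖ ≤ Real.exp (-r a) := by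
    obtain ⟨k, hk⟩ := hr.exists_holomorphic_decay hD hDc hDne hM hlim
    intro a ha w hw
    obtain ⟨C', hC'⟩ := hk a (hΩs ha).2
    refine norm_le_exp_of_extension hD hr (C := C) hC' fun h j hd hL A hA hfA => ?_
    obtain ⟨g, -, hgeq, hgb⟩ := hext' h j hd hL
    rw [← hgeq a ha w hw]
    refine hgb A hA hfA _ (ball_subset_closedBall ?_)
    rw [hbp]
    exact ⟨(hΩs ha).1, hw⟩
  have hΩG : ∀ a ∈ Ω, ∀ w ∈ Bw, (a, w) ∈ hset D r := by
    intro a ha w hw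
    refine ⟨(hΩs ha).2, ?_⟩
    have h1 : Bw ⊆ interior (closedBall 0 (Real.exp (-r a))) :=
      interior_maximal (fun w hw => mem_closedBall_zero_iff.2 (hΩb a ha w hw)) isOpen_ball
    rw [interior_closedBall _ (Real.exp_pos _).ne'] at h1
    exact mem_ball_zero_iff.1 (h1 hw)
  have hpw : p.2 ∈ Bw := mem_ball_self hε
  obtain ⟨w₂, hw₂, hw₂0⟩ : ∃ w ∈ Bw, w ≠ 0 := by
    by_cases h0 : p.2 = 0
    · refine ⟨((ε / 2 : ℝ) : ℂ), ?_, ?_⟩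
      · rw [hBw, h0, mem_ball_zero_iff, Complex.norm_real, Real.norm_of_nonneg (by positivity)]
        linarith
      · exact_mod_cast (half_pos hε).ne'
    · exact ⟨p.2, hpw, h0⟩
  have hrb : ∀ a ∈ Ω, r a ≤ -Real.log ‖w₂‖ := by
    intro a ha
    have := (Real.log_le_iff_le_exp (norm_pos_iff.2 hw₂0)).2 (hΩb a ha w₂ hw₂)
    linarith
  have hnsub : ¬ Bz ⊆ Ω := fun hc => hpG (hΩG p.1 (hc (mem_ball_self hε)) p.2 hpw)
  obtain ⟨t, htB, htc, htD⟩ := exists_mem_closure_connectedComponentIn hD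
    (convex_ball _ _).isPreconnected hz₁D hz₁ hnsub isOpen_ball
  have htf : t ∈ frontier D :=
    ⟨closure_mono (hΩs.trans inter_subset_right) htc, by rwa [hD.interior_eq]⟩
  by_cases htS : t ∈ polarS D
  · obtain ⟨-, U₀, hU₀, htU₀, hpol⟩ := id htS
    obtain ⟨δ, hδ, hδb⟩ := Metric.isOpen_iff.1 (hU₀.inter isOpen_ball) t ⟨htU₀, htB⟩
    have hWpre : IsPreconnected (ball t δ ∩ D) := by
      refine isPreconnected_of_capZero isOpen_ball (convex_ball _ _).isPreconnected
        measure_ball_lt_top.ne (isOpen_ball.inter hD) inter_subset_left fun K hK hKs => ?_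
      exact PolarSet.capZero hK (hpol.mono fun x hx =>
        ⟨(hδb (hKs hx).1).1, fun hxD => (hKs hx).2 ⟨(hKs hx).1, hxD⟩⟩)
    obtain ⟨y, hy, hyt⟩ := Metric.mem_closure_iff.1 htc δ hδ
    have hWΩ : ball t δ ∩ D ⊆ Ω := by
      rw [hΩ, connectedComponentIn_eq hy]
      exact hWpre.subset_connectedComponentIn ⟨mem_ball'.2 hyt, (hΩs hy).2⟩
        fun x hx => ⟨(hδb hx.1).2, hx.2⟩
    have hev : ∀ᶠ z in nhdsWithin t D, z ∈ ball t δ ∩ D :=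
      inter_mem (mem_nhdsWithin_of_mem_nhds (ball_mem_nhds t hδ)) self_mem_nhdsWithin
    obtain ⟨z, hz, hzW⟩ := ((hlim t htS (-Real.log ‖w₂‖)).and_eventually hev).exists
    exact absurd (hrb z (hWΩ hzW)) (not_le.2 hz)
  · obtain ⟨η, hη, hηb⟩ := Metric.isOpen_iff.1 isOpen_ball t htB
    set δ := min 1 (η / 8) with hδ
    have hδ0 : 0 < δ := by positivity
    have hδ1 : δ ≤ 1 := min_le_left _ _
    have hδη : δ ≤ η / 8 := min_le_right _ _
    set K := closedBall t δ \ D with hK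
    have hKc : IsCompact K := (isCompact_closedBall _ _).diff hD
    have hncap : ¬ CapZero K := fun hc => htS ⟨htf, ball t δ, isOpen_ball, mem_ball_self hδ0,
      (hc.polarSet hKc).mono (sdiff_subset_sdiff_left ball_subset_closedBall)⟩
    obtain ⟨μ, L, hμ⟩ := exists_potMeas hKc hncap
    obtain ⟨A, hA, hAk⟩ := hμ.exists_cauchyT_L2h hKc
      (fun x hx => closedBall_subset_closedBall hδ1 hx.1) hD hr hM disjoint_sdiff_left
    obtain ⟨y, hy, hyt⟩ := Metric.mem_closure_iff.1 htc δ hδ0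
    have hyK : y ∉ K := fun h => h.2 (hΩs hy).2
    have hsubB : closedBall y (4 * δ) ⊆ Bz := by
      refine Subset.trans (fun x hx => ?_) hηb
      rw [mem_closedBall] at hx
      rw [mem_ball]
      linarith [dist_triangle x y t, dist_comm y t]
    have hmem : ∀ z ∈ Bz, (z, p.2) ∈ closedBall p ε := by
      intro z hz
      refine ball_subset_closedBall ?_
      rw [hbp]
      exact ⟨hz, hpw⟩
    refine hμ.cauchyT_not_extendable hKc hyK (R := 4 * δ) (C := C * A) (by positivity) ?_ ?_
    · intro x hx
      have := mem_closedBall.1 hx.1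
      rw [mem_closedBall]
      linarith [dist_triangle x t y]
    · intro k hk hk2 hk0
      obtain ⟨hd, hL, hLA⟩ := hAk k hk hk2 hk0
      obtain ⟨g, ⟨U, hU, hg⟩, hgeq, hgb⟩ := hext' _ 0 hd hL
      refine ⟨fun z => g (z, p.2), ?_, ?_, ?_⟩
      · refine (DifferentiableOn.comp (t := U) hg (by fun_prop) fun z hz => ?_).diffContOnCl
        exact hU (hmem z (hsubB (closure_ball_subset_closedBall hz)))
      · exact fun z hz => hgb A hA hLA _ (hmem z (hsubB (sphere_subset_closedBall hz)))
      · filter_upwards [hΩo.mem_nhds hy] with z hz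
        rw [hgeq z hz p.2 hpw, pow_zero, mul_one]

/-- For a domain `D ⊊ ℂ` and a subharmonic `ρ` bounded from below,
`G_{D,ρ}` is an `L²ₕ`-domain of holomorphy iff `limsup_{D ∋ z → z₀} ρ(z) = ∞` for
every `z₀ ∈ S(D)`. -/
theorem hartogs_L2h_domain_iff_of_ne_univ (D : Set ℂ) (hDopen : IsOpen D)
    (hDconn : IsConnected D) (hDne : D ≠ Set.univ)
    (ρ : ℂ → EReal) (hρ : SubharmonicOn ρ D) (hbd : ∃ M : ℝ, ∀ z ∈ D, (M : EReal) ≤ ρ z) :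
    IsL2hDomainOfHolomorphy (hartogs D ρ) ↔
      ∀ z₀ ∈ polarS D, Filter.limsup ρ (nhdsWithin z₀ D) = ⊤ := by
  obtain ⟨M, hM⟩ := hbd
  have hcoe : ∀ z ∈ D, (((ρ z).toReal : ℝ) : EReal) = ρ z :=
    fun z hz => coe_toReal_of_subharmonicOn hρ hM hz
  have hr := RSub.of_subharmonicOn hρ hM
  rw [hartogs_eq_hset hcoe]
  constructor
  · intro h t ht
    by_contra hne
    obtain ⟨N, hN, -⟩ := EReal.lt_iff_exists_real_btwn.1 (lt_top_iff_ne_top.2 hne)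
    refine not_isL2hDomainOfHolomorphy_hset hDopen hr.usc ht (N := N) ?_ h
    filter_upwards [Filter.eventually_lt_of_limsup_lt hN, self_mem_nhdsWithin] with z hz hzD
    rw [← hcoe z hzD] at hz
    exact (EReal.coe_lt_coe_iff.1 hz).le
  · intro h
    refine isL2hDomainOfHolomorphy_hset hDopen hDconn hDne hr (M := M) (fun z hz => ?_)
      fun t ht N => ?_
    · have := hM z hz
      rw [← hcoe z hz] at this
      exact EReal.coe_le_coe_iff.1 this
    · have hlt : (N : EReal) < Filter.limsup ρ (nhdsWithin t D) := by
        rw [h t ht]; exact EReal.coe_lt_top N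
      refine ((Filter.frequently_lt_of_lt_limsup (by isBoundedDefault) hlt).and_eventually
        self_mem_nhdsWithin).mono fun z hz => ?_
      rw [← hcoe z hz.2] at hz
      exact EReal.coe_lt_coe_iff.1 hz.1
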